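/- Suppose that t > 1, and that A ⊆ ℝ³ is H^t-measurable with 0 < H^t(A) < ∞. Then there is a set E ⊆ I with dim E ≤ (3−t)/2, such that for every θ ∈ I ∖ E, the set {y ∈ span γ(θ) : dim(ρ_θ^{−1}(y) ∩ A) = t − 1} has positive H¹ measure. -/

import Mathlib

open MeasureTheory Metric Set
open scoped ENNReal RealInnerProductSpace

noncomputable section

abbrev E3 : Type := EuclideanSpace ℝ (Fin 3)

/-- Orthogonal projection onto the line spanned by `γ θ`:  `ρ_θ x = ⟨x, γ θ⟩ γ θ`. -/
def lineProj (γ : ℝ → E3) (θ : ℝ) (x : E3) : E3 := ⟪x, γ θ⟫ • γ θ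

set_option linter.unusedSectionVars false

/-- Normalised average of a function on a finite type. -/
def avg {X 𝕜 : Type*} [Fintype X] [RCLike 𝕜] (f : X → 𝕜) : 𝕜 :=
  (Fintype.card X : 𝕜)⁻¹ * ∑ x, f x

section avg
variable {X Y 𝕜 ι : Type*} [Fintype X] [Fintype Y] [RCLike 𝕜]

lemma avg_add (f g : X → 𝕜) : avg (fun x => f x + g x) = avg f + avg g := by
  simp [avg, Finset.sum_add_distrib, mul_add]

lemma avg_sum (s : Finset ι) (f : ι → X → 𝕜) :
    avg (fun x => ∑ i ∈ s, f i x) = ∑ i ∈ s, avg (f i) := by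
  simp only [avg]; rw [Finset.sum_comm, Finset.mul_sum]

lemma avg_const_mul (a : 𝕜) (f : X → 𝕜) : avg (fun x => a * f x) = a * avg f := by
  simp only [avg, ← Finset.mul_sum]; ring

lemma avg_mul_const (a : 𝕜) (f : X → 𝕜) : avg (fun x => f x * a) = avg f * a := by
  simp only [avg, ← Finset.sum_mul]; ring

lemma avg_const [Nonempty X] (a : 𝕜) : avg (fun _ : X => a) = a := by
  have : (Fintype.card X : 𝕜) ≠ 0 := by simp
  simp only [avg, Finset.sum_const, Finset.card_univ, nsmul_eq_mul]
  field_simp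

lemma avg_comm (f : X → Y → 𝕜) :
    avg (fun x => avg (fun y => f x y)) = avg (fun y => avg (fun x => f x y)) := by
  simp only [avg, ← Finset.mul_sum]; rw [Finset.sum_comm]; ring

lemma avg_ofReal (f : X → ℝ) : avg (fun x => (f x : ℂ)) = ((avg f : ℝ) : ℂ) := by
  simp [avg]

lemma avg_mono {f g : X → ℝ} (h : ∀ x, f x ≤ g x) : avg f ≤ avg g := by
  unfold avg; gcongr with x; exact h x

lemma avg_nonneg {f : X → ℝ} (h : ∀ x, 0 ≤ f x) : 0 ≤ avg f := by
  unfold avg; have := Finset.sum_nonneg (fun x (_ : x ∈ Finset.univ) => h x); positivity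

lemma norm_avg_le (f : X → ℂ) : ‖avg f‖ ≤ avg (fun x => ‖f x‖) := by
  simp only [avg, norm_mul, norm_inv, RCLike.norm_natCast]
  gcongr; exact norm_sum_le _ _

lemma avg_re (f : X → ℂ) : (avg f).re = avg (fun x => (f x).re) := by
  unfold avg
  rw [show ((Fintype.card X : ℂ)⁻¹) = (((Fintype.card X : ℝ)⁻¹ : ℝ) : ℂ) by simp, Complex.re_ofReal_mul]
  simp

end avg

/-- A multiplicative system of functions on a finite set, whose averages vanish for the nonzero
indices in `B`. -/
structure IsCharSystem {Γ X : Type*} [AddCommGroup Γ] [Fintype X] (e : Γ → X → ℂ) (B : Set Γ) :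
    Prop where
  nonempty : Nonempty X
  zero : ∀ x, e 0 x = 1
  add : ∀ a b x, e (a + b) x = e a x * e b x
  neg : ∀ a x, e (-a) x = (starRingEnd ℂ) (e a x)
  avg_eq_zero : ∀ a ∈ B, a ≠ 0 → avg (e a) = 0

/-- Functions with spectrum in `S`. -/
def spec {Γ X : Type*} (e : Γ → X → ℂ) (S : Set Γ) : Submodule ℂ (X → ℂ) :=
  Submodule.span ℂ (e '' S)

section spec
variable {Γ X ι : Type*} [AddCommGroup Γ] [Fintype X] {e : Γ → X → ℂ} {B : Set Γ}

lemma mem_spec {S : Set Γ} {a : Γ} (h : a ∈ S) : e a ∈ spec e S :=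
  Submodule.subset_span ⟨a, h, rfl⟩

lemma spec_mono {S T : Set Γ} (h : S ⊆ T) : spec e S ≤ spec e T :=
  Submodule.span_mono (image_mono h)

lemma spec_mul (he : IsCharSystem e B) {S T U : Set Γ} (hU : ∀ a ∈ S, ∀ b ∈ T, a + b ∈ U)
    {f g : X → ℂ} (hf : f ∈ spec e S) (hg : g ∈ spec e T) :
    (fun x => f x * g x) ∈ spec e U := by
  have h1 : f * g ∈ spec e S * spec e T := Submodule.mul_mem_mul hf hg
  unfold spec at h1
  rw [Submodule.span_mul_span] at h1
  refine Submodule.span_le.2 ?_ h1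
  rintro _ ⟨_, ⟨a, ha, rfl⟩, _, ⟨b, hb, rfl⟩, rfl⟩
  have : e a * e b = e (a + b) := by ext x; simp [he.add]
  simp only [this]
  exact mem_spec (hU a ha b hb)

lemma spec_conj (he : IsCharSystem e B) {S U : Set Γ} (hU : ∀ a ∈ S, -a ∈ U)
    {f : X → ℂ} (hf : f ∈ spec e S) : (fun x => (starRingEnd ℂ) (f x)) ∈ spec e U := by
  induction hf using Submodule.span_induction with
  | mem f hf =>
    obtain ⟨a, ha, rfl⟩ := hf
    have : (fun x => (starRingEnd ℂ) (e a x)) = e (-a) := by ext x; rw [he.neg]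
    rw [this]; exact mem_spec (hU a ha)
  | zero => simp only [Pi.zero_apply, map_zero]; exact (spec e U).zero_mem
  | add f g _ _ h1 h2 =>
    simp only [Pi.add_apply, map_add]; exact (spec e U).add_mem h1 h2
  | smul c f _ h1 =>
    simp only [Pi.smul_apply, smul_eq_mul, map_mul]
    exact (spec e U).smul_mem ((starRingEnd ℂ) c) h1

lemma avg_eq_zero_of_spec (he : IsCharSystem e B) {S : Set Γ} (hS : ∀ a ∈ S, a ∈ B ∧ a ≠ 0)
    {f : X → ℂ} (hf : f ∈ spec e S) : avg f = 0 := by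
  induction hf using Submodule.span_induction with
  | mem f hf => obtain ⟨a, ha, rfl⟩ := hf; exact he.avg_eq_zero a (hS a ha).1 (hS a ha).2
  | zero => simp [avg]
  | add f g _ _ h1 h2 => rw [show f + g = fun x => f x + g x from rfl, avg_add, h1, h2, add_zero]
  | smul c f _ h1 => rw [show c • f = fun x => c * f x from rfl, avg_const_mul, h1, mul_zero]

lemma avg_char (he : IsCharSystem e B) (a b : Γ) (h : a - b ∈ B) [Decidable (a = b)] :
    avg (fun x => e a x * (starRingEnd ℂ) (e b x)) = if a = b then 1 else 0 := by
  have h1 : (fun x => e a x * (starRingEnd ℂ) (e b x)) = e (a - b) := by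
    ext x; rw [sub_eq_add_neg, he.add, he.neg]
  rw [h1]
  split_ifs with hab
  · have := he.nonempty
    rw [hab, sub_self, show e 0 = fun _ => 1 from funext he.zero, avg_const]
  · exact he.avg_eq_zero _ h (sub_ne_zero.2 hab)

/-- Fourier coefficient. -/
def fc (e : Γ → X → ℂ) (f : X → ℂ) (a : Γ) : ℂ := avg (fun x => f x * (starRingEnd ℂ) (e a x))

lemma fc_sum (s : Finset ι) (f : ι → X → ℂ) (a : Γ) :
    fc e (fun x => ∑ i ∈ s, f i x) a = ∑ i ∈ s, fc e (f i) a := by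
  simp only [fc, Finset.sum_mul, avg_sum]

lemma fc_eq_zero (he : IsCharSystem e B) {S : Set Γ} {a : Γ} (ha : a ∉ S)
    (hB : ∀ b ∈ S, b - a ∈ B) {f : X → ℂ} (hf : f ∈ spec e S) : fc e f a = 0 := by
  refine avg_eq_zero_of_spec he (S := {c | ∃ b ∈ S, b - a = c}) ?_ ?_
  · rintro _ ⟨b, hb, rfl⟩
    exact ⟨hB b hb, fun h => ha (by rwa [← sub_eq_zero.1 h])⟩
  · have h1 : (fun x => (starRingEnd ℂ) (e a x)) ∈ spec e {-a} :=
      spec_conj he (S := {a}) (by simp) (mem_spec rfl)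
    refine spec_mul he ?_ hf h1
    rintro b hb c rfl
    exact ⟨b, hb, by abel⟩

lemma eq_sum_fc (he : IsCharSystem e B) (T : Finset Γ)
    (hB : ∀ a ∈ T, ∀ b ∈ T, a - b ∈ B) {f : X → ℂ} (hf : f ∈ spec e (T : Set Γ)) :
    f = fun x => ∑ a ∈ T, fc e f a * e a x := by
  classical
  induction hf using Submodule.span_induction with
  | mem f hf =>
    obtain ⟨a, ha, rfl⟩ := hf
    ext x
    have : ∀ b ∈ T, fc e (e a) b * e b x = if a = b then e b x else 0 := by
      intro b hb
      rw [fc, avg_char he a b (hB a ha b hb)]; split_ifs <;> simp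
    rw [Finset.sum_congr rfl this]; simp [Finset.mem_coe.1 ha]
  | zero => ext x; simp [fc, avg]
  | add f g _ _ h1 h2 =>
    ext x
    have : ∀ a, fc e (f + g) a = fc e f a + fc e g a := by
      intro a; simp only [fc, Pi.add_apply, add_mul, avg_add]
    simp only [this, add_mul, Finset.sum_add_distrib]
    simp only [Pi.add_apply]; rw [congrFun h1 x, congrFun h2 x]
  | smul c f _ h1 =>
    ext x
    have : ∀ a, fc e (c • f) a = c * fc e f a := by
      intro a; simp only [fc, Pi.smul_apply, smul_eq_mul, mul_assoc, avg_const_mul]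
    simp only [this, mul_assoc, ← Finset.mul_sum, Pi.smul_apply, smul_eq_mul]
    rw [← congrFun h1 x]

lemma avg_sum_mul_conj (he : IsCharSystem e B) (T : Finset Γ)
    (hB : ∀ a ∈ T, ∀ b ∈ T, a - b ∈ B) (c : Γ → ℂ) :
    avg (fun x => ‖∑ a ∈ T, c a * e a x‖ ^ 2) = ∑ a ∈ T, ‖c a‖ ^ 2 := by
  classical
  have h : ((avg (fun x => ‖∑ a ∈ T, c a * e a x‖ ^ 2) : ℝ) : ℂ) = ((∑ a ∈ T, ‖c a‖ ^ 2 : ℝ) : ℂ) := by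
    rw [← avg_ofReal]
    have : ∀ x, (((‖∑ a ∈ T, c a * e a x‖ ^ 2 : ℝ)) : ℂ) =
        ∑ a ∈ T, ∑ b ∈ T, (c a * (starRingEnd ℂ) (c b)) * (e a x * (starRingEnd ℂ) (e b x)) := by
      intro x
      push_cast
      rw [← Complex.mul_conj', map_sum, Finset.sum_mul_sum]
      refine Finset.sum_congr rfl fun a _ => Finset.sum_congr rfl fun b _ => ?_
      rw [map_mul]; ring
    simp only [this, avg_sum, avg_const_mul]
    push_cast
    refine Finset.sum_congr rfl fun a ha => ?_
    rw [Finset.sum_congr rfl fun b hb => by rw [avg_char he a b (hB a ha b hb)]]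
    simp [ha, Complex.mul_conj']
  exact_mod_cast h

lemma parseval (he : IsCharSystem e B) (T : Finset Γ)
    (hB : ∀ a ∈ T, ∀ b ∈ T, a - b ∈ B) {f : X → ℂ} (hf : f ∈ spec e (T : Set Γ)) :
    avg (fun x => ‖f x‖ ^ 2) = ∑ a ∈ T, ‖fc e f a‖ ^ 2 := by
  rw [← avg_sum_mul_conj he T hB]
  conv_lhs => rw [eq_sum_fc he T hB hf]

/-- Almost orthogonality for a nonnegative weight. -/
lemma schur_avg (s : Finset ι) (h : ι → X → ℂ) (V : X → ℝ) (hV : ∀ x, 0 ≤ V x)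
    (r : ι → ι → Prop) (hsymm : ∀ p q, r p q → r q p) [∀ p, DecidablePred (r p)] (K : ℕ)
    (hcard : ∀ p ∈ s, (s.filter (r p)).card ≤ K)
    (horth : ∀ p ∈ s, ∀ q ∈ s, ¬ r p q →
      avg (fun x => h p x * (starRingEnd ℂ) (h q x) * V x) = 0) :
    avg (fun x => ‖∑ p ∈ s, h p x‖ ^ 2 * V x) ≤ K * ∑ p ∈ s, avg (fun x => ‖h p x‖ ^ 2 * V x) := by
  have h0 : ((avg (fun x => ‖∑ p ∈ s, h p x‖ ^ 2 * V x) : ℝ) : ℂ) =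
      ∑ p ∈ s, ∑ q ∈ s.filter (r p), avg (fun x => h p x * (starRingEnd ℂ) (h q x) * V x) := by
    rw [← avg_ofReal]
    have : ∀ x, (((‖∑ p ∈ s, h p x‖ ^ 2 * V x : ℝ)) : ℂ) =
        ∑ p ∈ s, ∑ q ∈ s, h p x * (starRingEnd ℂ) (h q x) * V x := by
      intro x
      push_cast
      rw [← Complex.mul_conj', map_sum, Finset.sum_mul_sum, Finset.sum_mul]
      simp only [Finset.sum_mul]
    simp only [this, avg_sum]
    refine Finset.sum_congr rfl fun p hp => ?_
    rw [Finset.sum_filter]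
    refine Finset.sum_congr rfl fun q hq => ?_
    split_ifs with hr
    · rfl
    · exact horth p hp q hq hr
  set a : ι → ℝ := fun p => avg (fun x => ‖h p x‖ ^ 2 * V x)
  have ha : ∀ p, 0 ≤ a p := fun p => avg_nonneg fun x => mul_nonneg (sq_nonneg _) (hV x)
  have hb : ∀ p q, ‖avg (fun x => h p x * (starRingEnd ℂ) (h q x) * V x)‖ ≤ a p / 2 + a q / 2 := by
    intro p q
    refine (norm_avg_le _).trans ?_
    have : a p / 2 + a q / 2 = avg (fun x => (‖h p x‖ ^ 2 * V x) * (1/2) + (‖h q x‖ ^ 2 * V x) * (1/2)) := by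
      rw [avg_add, avg_mul_const, avg_mul_const]; simp only [a]; ring
    rw [this]
    refine avg_mono fun x => ?_
    rw [norm_mul, norm_mul, RCLike.norm_conj, Complex.norm_real, Real.norm_of_nonneg (hV x)]
    nlinarith [mul_nonneg (sq_nonneg (‖h p x‖ - ‖h q x‖)) (hV x)]
  have h1 : avg (fun x => ‖∑ p ∈ s, h p x‖ ^ 2 * V x) ≤
      ∑ p ∈ s, ∑ q ∈ s.filter (r p), (a p / 2 + a q / 2) := by
    calc avg (fun x => ‖∑ p ∈ s, h p x‖ ^ 2 * V x)
        ≤ ‖((avg (fun x => ‖∑ p ∈ s, h p x‖ ^ 2 * V x) : ℝ) : ℂ)‖ := by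
          rw [Complex.norm_real]; exact le_abs_self _
      _ ≤ _ := by
          rw [h0]
          refine (norm_sum_le _ _).trans (Finset.sum_le_sum fun p _ => ?_)
          exact (norm_sum_le _ _).trans (Finset.sum_le_sum fun q _ => hb p q)
  have h2 : ∑ p ∈ s, ∑ q ∈ s.filter (r p), a p / 2 ≤ K * ∑ p ∈ s, a p / 2 := by
    rw [Finset.mul_sum]
    refine Finset.sum_le_sum fun p hp => ?_
    rw [Finset.sum_const, nsmul_eq_mul]
    have := ha p
    gcongr; exact_mod_cast hcard p hp
  have h3 : ∑ p ∈ s, ∑ q ∈ s.filter (r p), a q / 2 = ∑ p ∈ s, ∑ q ∈ s.filter (r p), a p / 2 := by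
    simp only [Finset.sum_filter]
    rw [Finset.sum_comm]
    refine Finset.sum_congr rfl fun p _ => Finset.sum_congr rfl fun q _ => ?_
    simp only [show r q p ↔ r p q from ⟨hsymm q p, hsymm p q⟩]
  simp only [Finset.sum_add_distrib] at h1
  rw [h3] at h1
  have : ∑ p ∈ s, a p / 2 = (∑ p ∈ s, a p) / 2 := by rw [Finset.sum_div]
  rw [this] at h2
  linarith

end spec

/-- The character `t ↦ exp (2 π i t)`. -/
def eR (t : ℝ) : ℂ := Complex.exp ((2 * Real.pi * t : ℝ) * Complex.I)

lemma eR_zero : eR 0 = 1 := by simp [eR]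

lemma eR_add (s t : ℝ) : eR (s + t) = eR s * eR t := by
  rw [eR, eR, eR, ← Complex.exp_add]; congr 1; push_cast; ring

lemma eR_neg (t : ℝ) : eR (-t) = (starRingEnd ℂ) (eR t) := by
  rw [eR, eR, ← Complex.exp_conj, map_mul, Complex.conj_ofReal, Complex.conj_I]; congr 1
  push_cast; ring

lemma norm_eR (t : ℝ) : ‖eR t‖ = 1 := by rw [eR, Complex.norm_exp_ofReal_mul_I]

lemma eR_nat_mul (m : ℕ) (t : ℝ) : eR (m * t) = eR t ^ m := by
  rw [eR, eR, ← Complex.exp_nat_mul]; congr 1; push_cast; ring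

lemma eR_int (a : ℤ) : eR a = 1 := by
  rw [eR]; convert Complex.exp_int_mul_two_pi_mul_I a using 2; push_cast; ring

lemma eR_eq_one_iff (t : ℝ) : eR t = 1 ↔ ∃ a : ℤ, t = a := by
  constructor
  · intro h
    rw [eR, Complex.exp_eq_one_iff] at h
    obtain ⟨a, ha⟩ := h
    refine ⟨a, ?_⟩
    have h2 : ((2 * Real.pi * t : ℝ) : ℂ) = ((a * (2 * Real.pi) : ℝ) : ℂ) := by
      have := Complex.I_ne_zero
      apply mul_right_cancel₀ this
      rw [ha]; push_cast; ring
    have h3 : 2 * Real.pi * t = a * (2 * Real.pi) := by exact_mod_cast h2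
    have := Real.pi_pos
    field_simp at h3
    linarith
  · rintro ⟨a, rfl⟩; exact eR_int a

lemma continuous_eR : Continuous eR := by unfold eR; fun_prop

lemma sum_eR_eq_zero (N : ℕ) (a : ℤ) (h : ¬ (N : ℤ) ∣ a) :
    ∑ x : Fin N, eR (a * ((x : ℕ) / N : ℝ)) = 0 := by
  rcases Nat.eq_zero_or_pos N with rfl | hN
  · simp
  have hN' : (N : ℝ) ≠ 0 := by positivity
  have h1 : ∀ x : Fin N, eR (a * ((x : ℕ) / N : ℝ)) = eR (a / N) ^ (x : ℕ) := by
    intro x; rw [← eR_nat_mul]; congr 1; field_simp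
  simp only [h1]
  rw [Fin.sum_univ_eq_sum_range (fun m => eR (a / N) ^ m) N]
  have h2 : eR (a / N) ≠ 1 := by
    rw [Ne, eR_eq_one_iff]
    rintro ⟨b, hb⟩
    apply h
    refine ⟨b, ?_⟩
    field_simp at hb
    exact_mod_cast hb
  rw [geom_sum_eq h2, ← eR_nat_mul]
  rw [show (N : ℝ) * (a / N) = a by field_simp, eR_int]; simp

/-- Characters on the discrete circle. -/
def ech1 (N : ℕ) (a : ℤ) (x : Fin N) : ℂ := eR (a * ((x : ℕ) / N : ℝ))

lemma isCharSystem_ech1 (N : ℕ) (hN : 0 < N) : IsCharSystem (ech1 N) {a | |a| < (N : ℤ)} where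
  nonempty := ⟨⟨0, hN⟩⟩
  zero x := by simp [ech1, eR_zero]
  add a b x := by simp only [ech1]; rw [← eR_add]; congr 1; push_cast; ring
  neg a x := by simp only [ech1]; rw [← eR_neg]; congr 1; push_cast; ring
  avg_eq_zero a ha h0 := by
    simp only [avg, ech1]
    rw [sum_eR_eq_zero, mul_zero]
    intro hd
    exact h0 (Int.eq_zero_of_abs_lt_dvd hd ha)

/-- Frequencies. -/
abbrev Freq : Type := ℤ × ℤ × ℤ

/-- The ambient space for the model problem. -/
abbrev Pt : Type := ℝ × ℝ × ℝ

/-- A discrete torus. -/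
abbrev Grid (N : ℕ) : Type := Fin N × Fin N × Fin N

/-- The exponential with integer frequency on `ℝ³`. -/
def eP (ξ : Freq) (x : Pt) : ℂ := eR (ξ.1 * x.1 + ξ.2.1 * x.2.1 + ξ.2.2 * x.2.2)

/-- The position of a grid point. -/
def gpt {N : ℕ} (x : Grid N) : Pt := ((x.1 : ℕ) / N, (x.2.1 : ℕ) / N, (x.2.2 : ℕ) / N)

/-- Characters on the discrete torus. -/
def ech (N : ℕ) (ξ : Freq) (x : Grid N) : ℂ := eP ξ (gpt x)

/-- The box of frequencies `|ξᵢ| < N`. -/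
def fbox (N : ℕ) : Set Freq := {ξ | |ξ.1| < (N : ℤ) ∧ |ξ.2.1| < (N : ℤ) ∧ |ξ.2.2| < (N : ℤ)}

lemma isCharSystem_ech (N : ℕ) (hN : 0 < N) : IsCharSystem (ech N) (fbox N) where
  nonempty := ⟨(⟨0, hN⟩, ⟨0, hN⟩, ⟨0, hN⟩)⟩
  zero x := by simp [ech, eP, eR_zero]
  add a b x := by simp only [ech, eP]; rw [← eR_add]; congr 1; push_cast [Prod.fst_add, Prod.snd_add]; ring
  neg a x := by
    simp only [ech, eP]; rw [← eR_neg]; congr 1; push_cast [Prod.fst_neg, Prod.snd_neg]; ring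
  avg_eq_zero a ha h0 := by
    obtain ⟨h1, h2, h3⟩ := ha
    simp only [avg, ech, eP, gpt, eR_add, Fintype.sum_prod_type]
    simp only [← Finset.mul_sum, ← Finset.sum_mul]
    rw [mul_eq_zero]; right
    by_contra hne
    apply h0
    have key : ∀ b : ℤ, |b| < N → ∑ x : Fin N, eR (b * ((x : ℕ) / N : ℝ)) ≠ 0 → b = 0 := by
      intro b hb hb2
      by_contra hb0
      exact hb2 (sum_eR_eq_zero N b fun hd => hb0 (Int.eq_zero_of_abs_lt_dvd hd hb))
    have e1 := key _ h1 (by rintro h; simp [h] at hne)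
    have e2 := key _ h2 (by rintro h; simp [h] at hne)
    have e3 := key _ h3 (by rintro h; simp [h] at hne)
    ext <;> simp [e1, e2, e3]

section
variable {Γ X ι : Type*} [AddCommGroup Γ] [Fintype X] {e : Γ → X → ℂ} {B : Set Γ}

lemma IsCharSystem.mul_conj (he : IsCharSystem e B) (a b : Γ) (x : X) :
    e a x * (starRingEnd ℂ) (e b x) = e (a - b) x := by
  rw [sub_eq_add_neg, he.add, he.neg]

lemma IsCharSystem.norm_eq (he : IsCharSystem e B) (a : Γ) (x : X) : ‖e a x‖ = 1 := by
  have h := he.mul_conj a a x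
  rw [sub_self, he.zero, Complex.mul_conj, Complex.normSq_eq_norm_sq] at h
  have h2 : ‖e a x‖ ^ 2 = 1 := by exact_mod_cast h
  have := norm_nonneg (e a x)
  nlinarith

/-- Bessel's inequality. -/
lemma bessel (he : IsCharSystem e B) (U : Finset Γ) (hB : ∀ a ∈ U, ∀ b ∈ U, a - b ∈ B) (f : X → ℂ) :
    ∑ a ∈ U, ‖fc e f a‖ ^ 2 ≤ avg (fun x => ‖f x‖ ^ 2) := by
  set P : X → ℂ := fun x => ∑ a ∈ U, fc e f a * e a x with hP
  have h1 : avg (fun x => ‖P x‖ ^ 2) = ∑ a ∈ U, ‖fc e f a‖ ^ 2 := avg_sum_mul_conj he U hB _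
  have h2 : avg (fun x => f x * (starRingEnd ℂ) (P x)) = ((∑ a ∈ U, ‖fc e f a‖ ^ 2 : ℝ) : ℂ) := by
    have : ∀ x, f x * (starRingEnd ℂ) (P x) =
        ∑ a ∈ U, (starRingEnd ℂ) (fc e f a) * (f x * (starRingEnd ℂ) (e a x)) := by
      intro x; simp only [hP, map_sum, map_mul, Finset.mul_sum]
      refine Finset.sum_congr rfl fun a _ => by ring
    simp only [this, avg_sum, avg_const_mul]
    push_cast
    refine Finset.sum_congr rfl fun a _ => ?_
    rw [← fc.eq_1, mul_comm, Complex.mul_conj, Complex.normSq_eq_norm_sq]; push_cast; rfl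
  have h3 : ∀ x, ‖f x - P x‖ ^ 2 = ‖f x‖ ^ 2 + (-2) * (f x * (starRingEnd ℂ) (P x)).re + ‖P x‖ ^ 2 := by
    intro x
    rw [← Complex.normSq_eq_norm_sq, ← Complex.normSq_eq_norm_sq, ← Complex.normSq_eq_norm_sq,
      Complex.normSq_sub]; ring
  have h4 : 0 ≤ avg (fun x => ‖f x - P x‖ ^ 2) := avg_nonneg fun _ => sq_nonneg _
  simp only [h3] at h4
  rw [avg_add, avg_add, avg_const_mul, ← avg_re, h1, h2, Complex.ofReal_re] at h4
  linarith

/-- The Fejér type weight attached to a finite set of frequencies. -/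
def wgt (e : Γ → X → ℂ) (Q : Finset Γ) (x y : X) : ℝ :=
  (Q.card : ℝ)⁻¹ * ‖∑ q ∈ Q, (starRingEnd ℂ) (e q x) * e q y‖ ^ 2

variable {Q : Finset Γ}

lemma wgt_nonneg (x y : X) : 0 ≤ wgt e Q x y := by unfold wgt; positivity

lemma wgt_symm (x y : X) : wgt e Q x y = wgt e Q y x := by
  unfold wgt
  rw [← Complex.norm_conj]
  simp only [map_sum, map_mul, Complex.conj_conj]
  congr 3
  exact Finset.sum_congr rfl fun _ _ => mul_comm _ _

lemma avg_wgt (he : IsCharSystem e B) (hB : ∀ a ∈ Q, ∀ b ∈ Q, a - b ∈ B) (hQ : Q.Nonempty) (x : X) :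
    avg (fun y => wgt e Q x y) = 1 := by
  unfold wgt
  rw [avg_const_mul, avg_sum_mul_conj he Q hB]
  simp only [RCLike.norm_conj, he.norm_eq]
  have : (Q.card : ℝ) ≠ 0 := by simpa using hQ.ne_empty
  simp [this]

lemma avg_wgt' (he : IsCharSystem e B) (hB : ∀ a ∈ Q, ∀ b ∈ Q, a - b ∈ B) (hQ : Q.Nonempty) (y : X) :
    avg (fun x => wgt e Q x y) = 1 := by
  simp only [wgt_symm _ y]; exact avg_wgt he hB hQ y

lemma wgt_eq (he : IsCharSystem e B) (x y : X) : (wgt e Q x y : ℂ) =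
    (Q.card : ℂ)⁻¹ * ∑ q ∈ Q, ∑ q' ∈ Q, e (q - q') x * (starRingEnd ℂ) (e (q - q') y) := by
  unfold wgt
  push_cast
  congr 1
  have : ((‖∑ q ∈ Q, (starRingEnd ℂ) (e q x) * e q y‖ : ℂ)) ^ 2 =
      (starRingEnd ℂ) (∑ q ∈ Q, (starRingEnd ℂ) (e q x) * e q y) *
        (∑ q ∈ Q, (starRingEnd ℂ) (e q x) * e q y) := by
    rw [mul_comm, Complex.mul_conj, Complex.normSq_eq_norm_sq]; push_cast; rfl
  rw [this, map_sum, Finset.sum_mul_sum]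
  refine Finset.sum_congr rfl fun q _ => Finset.sum_congr rfl fun q' _ => ?_
  rw [← he.mul_conj, ← he.mul_conj]
  simp only [map_mul, Complex.conj_conj]; ring

lemma wgt_spec (he : IsCharSystem e B) (x : X) :
    (fun y => (wgt e Q x y : ℂ)) ∈ spec e {ω | ∃ q ∈ Q, ∃ q' ∈ Q, ω = q - q'} := by
  have h : (fun y => (wgt e Q x y : ℂ)) = (Q.card : ℂ)⁻¹ • ∑ q ∈ Q, ∑ q' ∈ Q, e (q - q') x • e (q' - q) := by
    ext y
    rw [wgt_eq he]
    simp only [Pi.smul_apply, Finset.sum_apply, smul_eq_mul, ← he.neg, neg_sub]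
  rw [h]
  refine Submodule.smul_mem _ _ (Submodule.sum_mem _ fun q hq => Submodule.sum_mem _ fun q' hq' =>
    Submodule.smul_mem _ _ (mem_spec ⟨q', hq', q, hq, rfl⟩))

/-- Averaging against the weight. -/
def wavg (e : Γ → X → ℂ) (Q : Finset Γ) (g : X → ℝ) (x : X) : ℝ := avg (fun y => g y * wgt e Q x y)

lemma wavg_nonneg {g : X → ℝ} (hg : ∀ x, 0 ≤ g x) (x : X) : 0 ≤ wavg e Q g x :=
  avg_nonneg fun y => mul_nonneg (hg y) (wgt_nonneg x y)

lemma wavg_eq (he : IsCharSystem e B) (g : X → ℝ) (x : X) : (wavg e Q g x : ℂ) =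
    (Q.card : ℂ)⁻¹ * ∑ q ∈ Q, ∑ q' ∈ Q, fc e (fun y => (g y : ℂ)) (q - q') * e (q - q') x := by
  unfold wavg
  rw [← avg_ofReal]
  push_cast
  simp only [wgt_eq he, fc, ← avg_mul_const, ← avg_sum, ← avg_const_mul]
  congr 1; ext y
  rw [mul_left_comm, Finset.mul_sum]
  congr 1
  refine Finset.sum_congr rfl fun q _ => ?_
  rw [Finset.mul_sum]
  refine Finset.sum_congr rfl fun q' _ => by ring

lemma fc_wavg [DecidableEq Γ] (he : IsCharSystem e B) (g : X → ℝ) (ω : Γ)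
    (hB : ∀ a ∈ Q, ∀ b ∈ Q, a - b - ω ∈ B) : fc e (fun x => (wavg e Q g x : ℂ)) ω =
    ((Q.card : ℂ)⁻¹ * ((Q ×ˢ Q).filter (fun p => p.1 - p.2 = ω)).card) * fc e (fun y => (g y : ℂ)) ω := by
  have h1 : fc e (fun x => (wavg e Q g x : ℂ)) ω = avg (fun x => (Q.card : ℂ)⁻¹ *
      ∑ p ∈ Q ×ˢ Q, fc e (fun y => (g y : ℂ)) (p.1 - p.2) *
        (e (p.1 - p.2) x * (starRingEnd ℂ) (e ω x))) := by
    unfold fc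
    congr 1; ext x
    beta_reduce
    rw [wavg_eq he, ← Finset.sum_product', mul_assoc, Finset.sum_mul]
    congr 1
    exact Finset.sum_congr rfl fun _ _ => by unfold fc; ring
  rw [h1, avg_const_mul, avg_sum, mul_assoc]
  congr 1
  simp only [avg_const_mul]
  rw [Finset.card_filter]
  push_cast
  rw [Finset.sum_mul]
  refine Finset.sum_congr rfl fun p hp => ?_
  rw [Finset.mem_product] at hp
  rw [avg_char he _ _ (hB _ hp.1 _ hp.2)]
  split_ifs with h
  · rw [h, mul_one, one_mul]
  · simp

lemma wavg_sq_le (he : IsCharSystem e B) (hB : ∀ a ∈ Q, ∀ b ∈ Q, a - b ∈ B) (hQ : Q.Nonempty)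
    (g : X → ℝ) (x : X) : wavg e Q g x ^ 2 ≤ avg (fun y => g y ^ 2 * wgt e Q x y) := by
  have h : 0 ≤ avg (fun y => (g y - wavg e Q g x) ^ 2 * wgt e Q x y) :=
    avg_nonneg fun y => mul_nonneg (sq_nonneg _) (wgt_nonneg x y)
  have e1 : ∀ y, (g y - wavg e Q g x) ^ 2 * wgt e Q x y = g y ^ 2 * wgt e Q x y +
      (-2 * wavg e Q g x) * (g y * wgt e Q x y) + wavg e Q g x ^ 2 * wgt e Q x y := by intro y; ring
  simp only [e1] at h
  rw [avg_add, avg_add, avg_const_mul, avg_const_mul, avg_wgt he hB hQ] at h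
  have e2 : avg (fun y => g y * wgt e Q x y) = wavg e Q g x := rfl
  rw [e2] at h
  linarith

lemma avg_mul_wgt (he : IsCharSystem e B) (hB : ∀ a ∈ Q, ∀ b ∈ Q, a - b ∈ B) (hQ : Q.Nonempty)
    (g : X → ℝ) : avg (fun x => avg (fun y => g y * wgt e Q x y)) = avg g := by
  rw [avg_comm]
  simp only [avg_const_mul, avg_wgt' he hB hQ, mul_one]

lemma avg_wavg (he : IsCharSystem e B) (hB : ∀ a ∈ Q, ∀ b ∈ Q, a - b ∈ B) (hQ : Q.Nonempty)
    (g : X → ℝ) : avg (fun x => wavg e Q g x) = avg g := avg_mul_wgt he hB hQ g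

lemma avg_wavg_sq_le (he : IsCharSystem e B) (hB : ∀ a ∈ Q, ∀ b ∈ Q, a - b ∈ B) (hQ : Q.Nonempty)
    (g : X → ℝ) : avg (fun x => wavg e Q g x ^ 2) ≤ avg (fun x => g x ^ 2) :=
  (avg_mono fun x => wavg_sq_le he hB hQ g x).trans (avg_mul_wgt he hB hQ _).le

/-- Lower bound for the weighted averages in terms of Fourier coefficients. -/
lemma sum_fc_le_wavg (he : IsCharSystem e B) (U : Finset Γ) (c : ℝ) (hc : 0 ≤ c)
    (hUU : ∀ a ∈ U, ∀ b ∈ U, a - b ∈ B) (hQU : ∀ a ∈ Q, ∀ b ∈ Q, ∀ ω ∈ U, a - b - ω ∈ B)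
    (hUQ : U ⊆ Q) (hadd : ∀ a ∈ U, ∀ b ∈ U, a + b ∈ Q) (hcard : (Q.card : ℝ) ≤ c * U.card) (g : X → ℝ) :
    ∑ ω ∈ U, ‖fc e (fun y => (g y : ℂ)) ω‖ ^ 2 ≤ c ^ 2 * avg (fun x => wavg e Q g x ^ 2) := by
  classical
  have h1 := bessel he U hUU (fun x => (wavg e Q g x : ℂ))
  have h2 : avg (fun x => ‖(wavg e Q g x : ℂ)‖ ^ 2) = avg (fun x => wavg e Q g x ^ 2) := by
    simp
  rw [h2] at h1
  refine le_trans ?_ (mul_le_mul_of_nonneg_left h1 (sq_nonneg c))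
  rw [Finset.mul_sum]
  refine Finset.sum_le_sum fun ω hω => ?_
  rw [fc_wavg he g ω (fun a ha b hb => hQU a ha b hb ω hω), norm_mul, mul_pow, ← mul_assoc, ← mul_pow]
  refine le_mul_of_one_le_left (sq_nonneg _) (one_le_pow₀ ?_)
  have hle : U.card ≤ ((Q ×ˢ Q).filter (fun p => p.1 - p.2 = ω)).card := by
    refine Finset.card_le_card_of_injOn (fun q => (q + ω, q)) ?_ ?_
    · intro q hq
      simp only [Finset.coe_filter, Finset.mem_product, mem_ofPred_eq]
      exact ⟨⟨hadd q hq ω hω, hUQ hq⟩, by abel⟩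
    · intro a _ b _ h; exact (Prod.mk.inj h).2
  have hUpos : 0 < U.card := Finset.card_pos.2 ⟨ω, hω⟩
  have hQpos : 0 < Q.card := lt_of_lt_of_le hUpos (Finset.card_le_card hUQ)
  have hQ' : (0 : ℝ) < Q.card := by exact_mod_cast hQpos
  rw [norm_mul, norm_inv, Complex.norm_natCast, Complex.norm_natCast]
  rw [← mul_assoc, mul_comm c, mul_assoc, ← div_eq_inv_mul, le_div_iff₀ hQ', one_mul]
  refine hcard.trans ?_
  gcongr

end

/-- The coordinate `ω₁ - v ω₀`. -/
def bco (v : ℝ) (ω : Freq) : ℝ := ω.2.1 - v * ω.1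

/-- The coordinate `ω₂ - φ(v) ω₀ - ψ(v) (ω₁ - v ω₀)`. -/
def cco (φ ψ : ℝ → ℝ) (v : ℝ) (ω : Freq) : ℝ := ω.2.2 - φ v * ω.1 - ψ v * bco v ω

lemma bco_sub (v : ℝ) (ω ω' : Freq) : bco v (ω - ω') = bco v ω - bco v ω' := by
  simp only [bco, Prod.fst_sub, Prod.snd_sub]; push_cast; ring

lemma bco_add (v : ℝ) (ω ω' : Freq) : bco v (ω + ω') = bco v ω + bco v ω' := by
  simp only [bco, Prod.fst_add, Prod.snd_add]; push_cast; ring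

lemma cco_sub (φ ψ : ℝ → ℝ) (v : ℝ) (ω ω' : Freq) :
    cco φ ψ v (ω - ω') = cco φ ψ v ω - cco φ ψ v ω' := by
  simp only [cco, bco_sub, Prod.fst_sub, Prod.snd_sub]; push_cast; ring

lemma cco_add (φ ψ : ℝ → ℝ) (v : ℝ) (ω ω' : Freq) :
    cco φ ψ v (ω + ω') = cco φ ψ v ω + cco φ ψ v ω' := by
  simp only [cco, bco_add, Prod.fst_add, Prod.snd_add]; push_cast; ring

/-- Quantitative convexity of `φ`, with subgradients `ψ`, on the set `Λ`. -/
structure Convx (K : ℝ) (φ ψ : ℝ → ℝ) (Λ : Set ℝ) : Prop where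
  one_le : 1 ≤ K
  lower : ∀ u ∈ Λ, ∀ v ∈ Λ, (u - v) ^ 2 ≤ K * (φ u - φ v - ψ v * (u - v))
  upper : ∀ u ∈ Λ, ∀ v ∈ Λ, φ u - φ v - ψ v * (u - v) ≤ K * (u - v) ^ 2
  phi_le : ∀ u ∈ Λ, |φ u| ≤ K
  psi_le : ∀ u ∈ Λ, |ψ u| ≤ K
  mem : ∀ u ∈ Λ, 0 ≤ u ∧ u < 1

section
variable {K : ℝ} {φ ψ : ℝ → ℝ} {Λ : Set ℝ}

lemma Convx.pos (h : Convx K φ ψ Λ) : 0 < K := by linarith [h.one_le]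

lemma Convx.gap_nonneg (h : Convx K φ ψ Λ) {u v : ℝ} (hu : u ∈ Λ) (hv : v ∈ Λ) :
    0 ≤ φ u - φ v - ψ v * (u - v) := by
  by_contra hc
  nlinarith [h.lower u hu v hv, h.pos, sq_nonneg (u - v)]

lemma Convx.psi_lower (h : Convx K φ ψ Λ) {u v : ℝ} (hu : u ∈ Λ) (hv : v ∈ Λ) (huv : u < v) :
    2 * (v - u) ≤ K * (ψ v - ψ u) := by
  have h1 := h.lower u hu v hv
  have h2 := h.lower v hv u hu
  have : (v - u) * (2 * (v - u)) ≤ (v - u) * (K * (ψ v - ψ u)) := by nlinarith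
  exact le_of_mul_le_mul_left this (by linarith)

lemma Convx.psi_upper (h : Convx K φ ψ Λ) {u v : ℝ} (hu : u ∈ Λ) (hv : v ∈ Λ) :
    |ψ v - ψ u| ≤ 2 * K * |v - u| := by
  have key : ∀ u ∈ Λ, ∀ v ∈ Λ, u < v → |ψ v - ψ u| ≤ 2 * K * |v - u| := by
    intro u hu v hv huv
    have h1 := h.upper u hu v hv
    have h2 := h.upper v hv u hu
    have h3 := h.psi_lower hu hv huv
    have h4 : 0 ≤ ψ v - ψ u := by
      by_contra hc
      nlinarith [h.pos]
    rw [abs_of_nonneg h4, abs_of_pos (by linarith)]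
    have : (v - u) * (ψ v - ψ u) ≤ (v - u) * (2 * K * (v - u)) := by nlinarith
    exact le_of_mul_le_mul_left this (by linarith)
  rcases lt_trichotomy u v with huv | rfl | huv
  · exact key u hu v hv huv
  · simp
  · rw [abs_sub_comm, abs_sub_comm v]; exact key v hv u hu huv

/-- The spectrum of the functions attached to `u`. -/
def sigmaSet (n k : ℕ) (r0 : ℝ) (φ : ℝ → ℝ) (u : ℝ) : Set Freq :=
  {ξ | (4 : ℝ) ^ n ≤ ξ.1 ∧ (ξ.1 : ℝ) ≤ 8 * 4 ^ n ∧ |(ξ.1 : ℝ) - r0| ≤ 4 ^ n / 4 ^ k ∧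
    |(ξ.2.1 : ℝ) - u * ξ.1| ≤ 1 ∧ |(ξ.2.2 : ℝ) - φ u * ξ.1| ≤ 1}

variable {n k : ℕ} {r0 : ℝ}

lemma bco_sigma_eq (u v : ℝ) (ξ : Freq) : bco v ξ = bco u ξ + (u - v) * ξ.1 := by
  simp only [bco]; ring

lemma cco_sigma_eq (u v : ℝ) (ξ : Freq) : cco φ ψ v ξ =
    ((ξ.2.2 : ℝ) - φ u * ξ.1) - ψ v * bco u ξ + (φ u - φ v - ψ v * (u - v)) * ξ.1 := by
  simp only [cco, bco]; ring

lemma Convx.abs_gap_le (h : Convx K φ ψ Λ) {u v w : ℝ} (hu : u ∈ Λ) (hv : v ∈ Λ)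
    (hw : |u - v| ≤ w) : |φ u - φ v - ψ v * (u - v)| ≤ K * w ^ 2 := by
  rw [abs_of_nonneg (h.gap_nonneg hu hv)]
  refine (h.upper u hu v hv).trans ?_
  have := h.pos
  have : (u - v) ^ 2 ≤ w ^ 2 := by rw [← sq_abs]; gcongr
  gcongr

lemma abs_bco_sigma {u v w : ℝ} {ξ : Freq} (hξ : ξ ∈ sigmaSet n k r0 φ u) (hw : |u - v| ≤ w)
    (hR : 1 ≤ (4 : ℝ) ^ n * w) : |bco v ξ| ≤ 9 * (4 ^ n * w) := by
  obtain ⟨h1, h2, _, h4, _⟩ := hξ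
  rw [bco_sigma_eq u v]
  have hp : (0 : ℝ) < 4 ^ n := by positivity
  have h0 : 0 ≤ w := (abs_nonneg _).trans hw
  have hx : (0 : ℝ) ≤ ξ.1 := hp.le.trans h1
  have e1 : |(u - v) * ξ.1| ≤ w * (8 * 4 ^ n) := by
    rw [abs_mul, abs_of_pos (lt_of_lt_of_le hp h1)]; gcongr
  have e2 : |bco u ξ| ≤ 1 := h4
  have := abs_add_le (bco u ξ) ((u - v) * ξ.1)
  linarith

lemma Convx.abs_cco_sigma (h : Convx K φ ψ Λ) {u v w : ℝ} {ξ : Freq} (hu : u ∈ Λ) (hv : v ∈ Λ)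
    (hξ : ξ ∈ sigmaSet n k r0 φ u) (hw : |u - v| ≤ w)
    (hR : 1 ≤ (4 : ℝ) ^ n * w ^ 2) : |cco φ ψ v ξ| ≤ 10 * K * (4 ^ n * w ^ 2) := by
  obtain ⟨h1, h2, _, h4, h5⟩ := hξ
  rw [cco_sigma_eq u v]
  have hp : (0 : ℝ) < 4 ^ n := by positivity
  have hK := h.one_le
  have hx : (0 : ℝ) ≤ ξ.1 := hp.le.trans h1
  have e1 : |(φ u - φ v - ψ v * (u - v)) * ξ.1| ≤ (K * w ^ 2) * (8 * 4 ^ n) := by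
    rw [abs_mul, abs_of_pos (lt_of_lt_of_le hp h1)]
    have := h.abs_gap_le hu hv hw
    gcongr
  have e2 : |ψ v * bco u ξ| ≤ K * 1 := by
    rw [abs_mul]; exact mul_le_mul (h.psi_le v hv) h4 (abs_nonneg _) (by linarith)
  have := abs_add_le ((ξ.2.2 : ℝ) - φ u * ξ.1 - ψ v * bco u ξ) ((φ u - φ v - ψ v * (u - v)) * ξ.1)
  have := abs_sub ((ξ.2.2 : ℝ) - φ u * ξ.1) (ψ v * bco u ξ)
  nlinarith

lemma Convx.kakeya_geom_aux (h : Convx K φ ψ Λ) {u v X : ℝ} {ω : Freq} (hu : u ∈ Λ) (hv : v ∈ Λ)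
    (huv : u < v) (h1 : |cco φ ψ u ω| ≤ X) (h2 : |cco φ ψ v ω| ≤ X)
    (hb1 : 0 ≤ bco u ω) (hb2 : 0 ≤ bco v ω) :
    |(ω.1 : ℝ)| * (v - u) ^ 2 ≤ 2 * K * X ∧ bco u ω * (v - u) ≤ 3 * K * X ∧
      bco v ω * (v - u) ≤ 3 * K * X := by
  set a : ℝ := (ω.1 : ℝ) with ha
  have hd : 0 < v - u := by linarith
  have hp := h.psi_lower hu hv huv
  have g1 := h.lower u hu v hv
  have g2 := h.lower v hv u hu
  have hK := h.pos
  have eb : bco u ω = bco v ω + (v - u) * a := by simp only [bco]; ring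
  have c12 : cco φ ψ u ω - cco φ ψ v ω ≤ 2 * X := by
    have := (abs_le.1 h1).2; have := (abs_le.1 h2).1; linarith
  have hψ : 0 ≤ ψ v - ψ u := by by_contra hc; nlinarith
  rcases le_total a 0 with hs | hs
  · have e1 : cco φ ψ u ω - cco φ ψ v ω = (ψ v - ψ u) * bco u ω - a * (φ u - φ v - ψ v * (u - v)) := by
      simp only [cco, bco]; ring
    rw [abs_of_nonpos hs]
    have t1 : 0 ≤ (ψ v - ψ u) * bco u ω := by positivity
    have gg := h.gap_nonneg hu hv
    have t2 : 0 ≤ -a * (φ u - φ v - ψ v * (u - v)) := mul_nonneg (by linarith) gg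
    have A1 : -a * (v - u) ^ 2 ≤ 2 * K * X := by
      calc -a * (v - u) ^ 2 ≤ -a * (K * (φ u - φ v - ψ v * (u - v))) := by
            apply mul_le_mul_of_nonneg_left _ (by linarith); linarith [g1, sq_nonneg (u-v), (by ring : (v-u)^2 = (u-v)^2)]
        _ = K * (-a * (φ u - φ v - ψ v * (u - v))) := by ring
        _ ≤ K * (2 * X) := mul_le_mul_of_nonneg_left (by linarith) hK.le
        _ = _ := by ring
    have A2 : bco u ω * (v - u) ≤ K * X := by
      have : bco u ω * (2 * (v - u)) ≤ K * (2 * X) := by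
        calc bco u ω * (2 * (v - u)) ≤ bco u ω * (K * (ψ v - ψ u)) := by gcongr
          _ = K * ((ψ v - ψ u) * bco u ω) := by ring
          _ ≤ K * (2 * X) := mul_le_mul_of_nonneg_left (by linarith) hK.le
      linarith
    have hX : 0 ≤ K * X := le_trans (by positivity) A2
    refine ⟨A1, by linarith, ?_⟩
    nlinarith
  · have e1 : cco φ ψ u ω - cco φ ψ v ω = (ψ v - ψ u) * bco v ω + a * (φ v - φ u - ψ u * (v - u)) := by
      simp only [cco, bco]; ring
    rw [abs_of_nonneg hs]
    have t1 : 0 ≤ (ψ v - ψ u) * bco v ω := by positivity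
    have gg := h.gap_nonneg hv hu
    have t2 : 0 ≤ a * (φ v - φ u - ψ u * (v - u)) := mul_nonneg (by linarith) gg
    have A1 : a * (v - u) ^ 2 ≤ 2 * K * X := by
      calc a * (v - u) ^ 2 ≤ a * (K * (φ v - φ u - ψ u * (v - u))) := by gcongr
        _ = K * (a * (φ v - φ u - ψ u * (v - u))) := by ring
        _ ≤ K * (2 * X) := mul_le_mul_of_nonneg_left (by linarith) hK.le
        _ = _ := by ring
    have A2 : bco v ω * (v - u) ≤ K * X := by
      have : bco v ω * (2 * (v - u)) ≤ K * (2 * X) := by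
        calc bco v ω * (2 * (v - u)) ≤ bco v ω * (K * (ψ v - ψ u)) := by gcongr
          _ = K * ((ψ v - ψ u) * bco v ω) := by ring
          _ ≤ K * (2 * X) := mul_le_mul_of_nonneg_left (by linarith) hK.le
      linarith
    have hX : 0 ≤ K * X := le_trans (by positivity) A2
    refine ⟨A1, ?_, by linarith⟩
    nlinarith

lemma Convx.kakeya_geom (h : Convx K φ ψ Λ) {u v X : ℝ} {ω : Freq} (hu : u ∈ Λ) (hv : v ∈ Λ)
    (huv : u < v) (h1 : |cco φ ψ u ω| ≤ X) (h2 : |cco φ ψ v ω| ≤ X)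
    (hb : (0 ≤ bco u ω ∧ 0 ≤ bco v ω) ∨ (bco u ω < 0 ∧ bco v ω < 0)) :
    |(ω.1 : ℝ)| * (v - u) ^ 2 ≤ 2 * K * X ∧ |bco u ω| * (v - u) ≤ 3 * K * X ∧
      |bco v ω| * (v - u) ≤ 3 * K * X := by
  rcases hb with ⟨b1, b2⟩ | ⟨b1, b2⟩
  · rw [abs_of_nonneg b1, abs_of_nonneg b2]
    exact h.kakeya_geom_aux hu hv huv h1 h2 b1 b2
  · have n1 : ∀ w, bco w (-ω) = - bco w ω := by intro w; simp only [bco, Prod.fst_neg, Prod.snd_neg]; push_cast; ring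
    have n2 : ∀ w, cco φ ψ w (-ω) = - cco φ ψ w ω := by
      intro w; simp only [cco, n1, Prod.fst_neg, Prod.snd_neg]; push_cast; ring
    have := h.kakeya_geom_aux (X := X) (ω := -ω) hu hv huv (by rwa [n2, abs_neg]) (by rwa [n2, abs_neg])
      (by rw [n1]; linarith) (by rw [n1]; linarith)
    rw [abs_of_neg b1, abs_of_neg b2]
    simpa [n1] using this

/-- Changing the base point within a cap. -/
lemma Convx.change_base (h : Convx K φ ψ Λ) {u v d A B C : ℝ} {ω : Freq} (hu : u ∈ Λ) (hv : v ∈ Λ)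
    (hd : |u - v| ≤ d) (hA : |(ω.1 : ℝ)| ≤ A) (hB : |bco u ω| ≤ B) (hC : |cco φ ψ u ω| ≤ C) :
    |bco v ω| ≤ B + d * A ∧ |cco φ ψ v ω| ≤ C + 2 * K * d * B + K * d ^ 2 * A := by
  have hK := h.pos
  have hd0 : 0 ≤ d := (abs_nonneg _).trans hd
  constructor
  · rw [bco_sigma_eq u v]
    refine (abs_add_le _ _).trans ?_
    rw [abs_mul]; gcongr
  · have e : cco φ ψ v ω = cco φ ψ u ω - (ψ v - ψ u) * bco u ω + ω.1 * (φ u - φ v - ψ v * (u - v)) := by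
      simp only [cco, bco]; ring
    rw [e]
    refine (abs_add_le _ _).trans ?_
    have h1 := abs_sub (cco φ ψ u ω) ((ψ v - ψ u) * bco u ω)
    have h2 : |(ψ v - ψ u) * bco u ω| ≤ (2 * K * d) * B := by
      rw [abs_mul]
      have := h.psi_upper hu hv
      rw [abs_sub_comm v] at this
      gcongr
      exact this.trans (by gcongr)
    have h3 : |(ω.1 : ℝ) * (φ u - φ v - ψ v * (u - v))| ≤ A * (K * d ^ 2) := by
      rw [abs_mul]
      have := h.abs_gap_le hu hv hd
      have hA0 : 0 ≤ A := (abs_nonneg _).trans hA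
      gcongr
    linarith

/-- If a difference of two spectral points is small at base `v`, then the parameters are close. -/
lemma refine_geom {u₁ u₂ v d A B : ℝ} {ξ₁ ξ₂ : Freq} (h1 : ξ₁ ∈ sigmaSet n k r0 φ u₁)
    (h2 : ξ₂ ∈ sigmaSet n k r0 φ u₂) (hd : |u₂ - v| ≤ d)
    (hA : |((ξ₁ - ξ₂).1 : ℝ)| ≤ A) (hB : |bco v (ξ₁ - ξ₂)| ≤ B) :
    |u₁ - u₂| * 4 ^ n ≤ 2 + B + d * A := by
  obtain ⟨a1, a2, _, a4, _⟩ := h1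
  obtain ⟨b1, b2, _, b4, _⟩ := h2
  have hp : (0 : ℝ) < 4 ^ n := by positivity
  have e : (u₁ - u₂) * ξ₁.1 = bco v (ξ₁ - ξ₂) - ((ξ₁.2.1 : ℝ) - u₁ * ξ₁.1) + ((ξ₂.2.1 : ℝ) - u₂ * ξ₂.1)
      - (u₂ - v) * ((ξ₁ - ξ₂).1 : ℝ) := by
    simp only [bco, Prod.fst_sub, Prod.snd_sub]; push_cast; ring
  have hd0 : 0 ≤ d := (abs_nonneg _).trans hd
  have e1 : |(u₂ - v) * ((ξ₁ - ξ₂).1 : ℝ)| ≤ d * A := by rw [abs_mul]; gcongr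
  have e2 : |(u₁ - u₂) * ξ₁.1| ≤ 2 + B + d * A := by
    rw [e, abs_le]; rw [abs_le] at *; constructor <;> linarith [hB.1, hB.2]
  rw [abs_mul, abs_of_pos (lt_of_lt_of_le hp a1)] at e2
  exact le_trans (by gcongr) e2

set_option maxHeartbeats 1000000 in
lemma Convx.l4_geom_aux (h : Convx K φ ψ Λ) {u₁ u₁' u₂ u₂' w w' : ℝ} {ξ₁ ξ₁' ξ₂ ξ₂' : Freq}
    (m1 : u₁ ∈ Λ) (m1' : u₁' ∈ Λ) (m2 : u₂ ∈ Λ) (m2' : u₂' ∈ Λ)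
    (s1 : ξ₁ ∈ sigmaSet n k r0 φ u₁) (s1' : ξ₁' ∈ sigmaSet n k r0 φ u₁')
    (s2 : ξ₂ ∈ sigmaSet n k r0 φ u₂) (s2' : ξ₂' ∈ sigmaSet n k r0 φ u₂')
    (heq : ξ₁ + ξ₁' = ξ₂ + ξ₂') (o2 : u₂ ≤ u₂') (o : u₁ ≤ u₂)
    (d1 : |u₁ - u₂| ≤ w) (d1' : |u₁' - u₂| ≤ w) (d2' : |u₂' - u₂| ≤ w)
    (hw1 : w ≤ 1) (hw' : 0 < w') (hww : w' ≤ w) (hR : 1 ≤ 4 ^ n * w' ^ 2) (hk : w ^ 2 ≤ 4 ^ k * w' ^ 2) :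
    |u₁ - u₂| ≤ 14 * K * w' ∧ |u₁' - u₂'| ≤ 14 * K * w' := by
  have hK := h.one_le
  have hw : 0 < w := hw'.trans_le hww
  set R : ℝ := 4 ^ n with hRdef
  have hR0 : 0 < R := by positivity
  set ε : ℝ := R / 4 ^ k with hε
  have h4k : (0 : ℝ) < 4 ^ k := by positivity
  obtain ⟨p1, q1, t1, x1, y1⟩ := s1
  obtain ⟨p1', q1', t1', x1', y1'⟩ := s1'
  obtain ⟨p2, q2, t2, x2, y2⟩ := s2
  obtain ⟨p2', q2', t2', x2', y2'⟩ := s2'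
  set a₁ : ℝ := (ξ₁.1 : ℝ)
  set a₁' : ℝ := (ξ₁'.1 : ℝ)
  set a₂' : ℝ := (ξ₂'.1 : ℝ)
  have hε0 : 0 ≤ ε := by positivity
  -- the scales
  have hε1 : w ^ 2 * ε ≤ R * w' ^ 2 := by
    rw [hε, mul_div_assoc', div_le_iff₀ h4k]; nlinarith
  have D1 : |a₁ - a₂'| ≤ 2 * ε := by rw [abs_le] at *; constructor <;> linarith
  have D1' : |a₁' - a₂'| ≤ 2 * ε := by rw [abs_le] at *; constructor <;> linarith
  -- first coordinate
  have B := congrArg (bco u₂) heq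
  rw [bco_add, bco_add, bco_sigma_eq u₁ u₂ ξ₁, bco_sigma_eq u₁' u₂ ξ₁', bco_sigma_eq u₂' u₂ ξ₂'] at B
  set η := u₁ + u₁' - u₂ - u₂' with hη
  have Bη : η * a₂' = bco u₂ ξ₂ + bco u₂' ξ₂' - bco u₁ ξ₁ - bco u₁' ξ₁' - (u₁ - u₂) * (a₁ - a₂')
      - (u₁' - u₂) * (a₁' - a₂') := by rw [hη]; linear_combination B
  have E1 : |(u₁ - u₂) * (a₁ - a₂')| ≤ w * (2 * ε) := by rw [abs_mul]; gcongr
  have E2 : |(u₁' - u₂) * (a₁' - a₂')| ≤ w * (2 * ε) := by rw [abs_mul]; gcongr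
  have hb1 : |bco u₁ ξ₁| ≤ 1 := x1
  have hb1' : |bco u₁' ξ₁'| ≤ 1 := x1'
  have hb2 : |bco u₂ ξ₂| ≤ 1 := x2
  have hb2' : |bco u₂' ξ₂'| ≤ 1 := x2'
  have B2 : |η * a₂'| ≤ 4 + 4 * w * ε := by
    rw [Bη]; rw [abs_le] at E1 E2 hb1 hb1' hb2 hb2' ⊢; constructor <;> linarith
  have B3 : |η| * R ≤ 4 + 4 * w * ε := by
    rw [abs_mul, abs_of_pos (hR0.trans_le p2')] at B2
    exact le_trans (by gcongr) B2
  have B4 : w * |η| ≤ 8 * w' ^ 2 := by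
    have : R * (w * |η|) ≤ R * (8 * w' ^ 2) := by
      calc R * (w * |η|) = w * (|η| * R) := by ring
        _ ≤ w * (4 + 4 * w * ε) := by gcongr
        _ = 4 * w + 4 * (w ^ 2 * ε) := by ring
        _ ≤ 4 * (R * w' ^ 2) + 4 * (R * w' ^ 2) := by gcongr; linarith
        _ = _ := by ring
    exact le_of_mul_le_mul_left this hR0
  -- second coordinate
  have C := congrArg (cco φ ψ u₂) heq
  rw [cco_add, cco_add, cco_sigma_eq u₁ u₂ ξ₁, cco_sigma_eq u₁' u₂ ξ₁', cco_sigma_eq u₂' u₂ ξ₂',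
    cco_sigma_eq u₂ u₂ ξ₂] at C
  set g₁ := φ u₁ - φ u₂ - ψ u₂ * (u₁ - u₂)
  set g₁' := φ u₁' - φ u₂ - ψ u₂ * (u₁' - u₂)
  set g₂' := φ u₂' - φ u₂ - ψ u₂ * (u₂' - u₂)
  have hg1 : |g₁| ≤ K * w ^ 2 := h.abs_gap_le m1 m2 d1
  have hg1' : |g₁'| ≤ K * w ^ 2 := h.abs_gap_le m1' m2 d1'
  have F1 : |g₁ * (a₁ - a₂')| ≤ K * w ^ 2 * (2 * ε) := by rw [abs_mul]; gcongr
  have F2 : |g₁' * (a₁' - a₂')| ≤ K * w ^ 2 * (2 * ε) := by rw [abs_mul]; gcongr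
  have hψ := h.psi_le u₂ m2
  have P : ∀ b : ℝ, |b| ≤ 1 → |ψ u₂ * b| ≤ K := by
    intro b hb; rw [abs_mul]
    exact (mul_le_mul hψ hb (abs_nonneg _) (by linarith)).trans_eq (mul_one K)
  have P1 := P _ hb1
  have P1' := P _ hb1'
  have P2 := P _ hb2
  have P2' := P _ hb2'
  have C1 : (g₁ + g₁' - g₂') * a₂' = ((ξ₂.2.2 : ℝ) - φ u₂ * ξ₂.1) - ψ u₂ * bco u₂ ξ₂
      + (((ξ₂'.2.2 : ℝ) - φ u₂' * ξ₂'.1) - ψ u₂ * bco u₂' ξ₂')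
      - (((ξ₁.2.2 : ℝ) - φ u₁ * ξ₁.1) - ψ u₂ * bco u₁ ξ₁)
      - (((ξ₁'.2.2 : ℝ) - φ u₁' * ξ₁'.1) - ψ u₂ * bco u₁' ξ₁')
      - g₁ * (a₁ - a₂') - g₁' * (a₁' - a₂') := by linear_combination C
  have C2 : (g₁ + g₁' - g₂') * a₂' ≤ 8 * K + 4 * K * (w ^ 2 * ε) := by
    rw [C1]; rw [abs_le] at F1 F2 P1 P1' P2 P2' y1 y1' y2 y2'; linarith [F1.1, F2.1, P1.2, P1'.2, P2.1, P2'.1, y1.1, y1'.1, y2.2, y2'.2]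
  have C3 : g₁ + g₁' - g₂' ≤ 12 * K * w' ^ 2 := by
    by_contra hc
    push Not at hc
    have : 12 * K * w' ^ 2 * R < (g₁ + g₁' - g₂') * a₂' := by
      have h0 : 0 ≤ 12 * K * w' ^ 2 := by positivity
      exact (mul_le_mul_of_nonneg_left p2' h0).trans_lt (mul_lt_mul_of_pos_right hc (hR0.trans_le p2'))
    have : K * 1 ≤ K * (R * w' ^ 2) := by gcongr
    have : K * (w ^ 2 * ε) ≤ K * (R * w' ^ 2) := by gcongr
    linarith
  -- convexity
  have G : (ψ u₂' - ψ u₂) * (u₁' - u₂') ≤ g₁' - g₂' := by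
    have := h.gap_nonneg m1' m2'
    simp only [g₁', g₂']; linarith
  have hψ2 := h.psi_upper m2 m2'
  have hψ3 : 0 ≤ ψ u₂' - ψ u₂ := by
    rcases o2.lt_or_eq with hlt | heq'
    · have := h.psi_lower m2 m2' hlt
      have : 0 ≤ K * (ψ u₂' - ψ u₂) := by linarith
      exact nonneg_of_mul_nonneg_right this h.pos
    · rw [heq']; simp
  have hψ4 : ψ u₂' - ψ u₂ ≤ 2 * K * w := (le_abs_self _).trans (hψ2.trans (by gcongr))
  have G2 : -(16 * K * w' ^ 2) ≤ g₁' - g₂' := by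
    have e : u₁' - u₂' = (u₂ - u₁) + η := by rw [hη]; ring
    rw [e] at G
    have i1 : 0 ≤ (ψ u₂' - ψ u₂) * (u₂ - u₁) := mul_nonneg hψ3 (by linarith)
    have i2 : (ψ u₂' - ψ u₂) * |η| ≤ 2 * K * w * |η| := by gcongr
    have i3 : -((ψ u₂' - ψ u₂) * |η|) ≤ (ψ u₂' - ψ u₂) * η := by
      rw [← mul_neg]; exact mul_le_mul_of_nonneg_left (neg_abs_le η) hψ3
    have i4 : 2 * K * (w * |η|) ≤ 2 * K * (8 * w' ^ 2) := by gcongr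
    linarith
  have L := h.lower u₁ m1 u₂ m2
  have L2 : (u₁ - u₂) ^ 2 ≤ (6 * K * w') ^ 2 := by
    have : K * g₁ ≤ K * (28 * K * w' ^ 2) := by gcongr; linarith
    have : 0 ≤ (K * w') ^ 2 := sq_nonneg _
    linarith
  have L3 : |u₁ - u₂| ≤ 6 * K * w' := abs_le_of_sq_le_sq L2 (by positivity)
  have L4 : |η| ≤ 8 * w' := by
    have : w * |η| ≤ w * (8 * w') := by
      have : w' * w' ≤ w * w' := by gcongr
      linarith
    exact le_of_mul_le_mul_left this hw
  have hKw : w' ≤ K * w' := le_mul_of_one_le_left hw'.le hK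
  refine ⟨by linarith, ?_⟩
  have e : u₁' - u₂' = (u₂ - u₁) + η := by rw [hη]; ring
  rw [e]
  refine (abs_add_le _ _).trans ?_
  rw [abs_sub_comm]; linarith

lemma Convx.l4_geom (h : Convx K φ ψ Λ) {u₁ u₁' u₂ u₂' w w' : ℝ} {ξ₁ ξ₁' ξ₂ ξ₂' : Freq}
    (m1 : u₁ ∈ Λ) (m1' : u₁' ∈ Λ) (m2 : u₂ ∈ Λ) (m2' : u₂' ∈ Λ)
    (s1 : ξ₁ ∈ sigmaSet n k r0 φ u₁) (s1' : ξ₁' ∈ sigmaSet n k r0 φ u₁')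
    (s2 : ξ₂ ∈ sigmaSet n k r0 φ u₂) (s2' : ξ₂' ∈ sigmaSet n k r0 φ u₂')
    (heq : ξ₁ + ξ₁' = ξ₂ + ξ₂')
    (hd : ∀ x ∈ ({u₁, u₁', u₂, u₂'} : Set ℝ), ∀ y ∈ ({u₁, u₁', u₂, u₂'} : Set ℝ), |x - y| ≤ w)
    (hw1 : w ≤ 1) (hw' : 0 < w') (hww : w' ≤ w) (hR : 1 ≤ 4 ^ n * w' ^ 2) (hk : w ^ 2 ≤ 4 ^ k * w' ^ 2) :
    (|u₁ - u₂| ≤ 14 * K * w' ∧ |u₁' - u₂'| ≤ 14 * K * w') ∨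
    (|u₁ - u₂'| ≤ 14 * K * w' ∧ |u₁' - u₂| ≤ 14 * K * w') := by
  have key : ∀ {u₁ u₁' u₂ u₂' : ℝ} {ξ₁ ξ₁' ξ₂ ξ₂' : Freq}
      (m1 : u₁ ∈ Λ) (m1' : u₁' ∈ Λ) (m2 : u₂ ∈ Λ) (m2' : u₂' ∈ Λ)
      (s1 : ξ₁ ∈ sigmaSet n k r0 φ u₁) (s1' : ξ₁' ∈ sigmaSet n k r0 φ u₁')
      (s2 : ξ₂ ∈ sigmaSet n k r0 φ u₂) (s2' : ξ₂' ∈ sigmaSet n k r0 φ u₂')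
      (heq : ξ₁ + ξ₁' = ξ₂ + ξ₂')
      (hd : ∀ x ∈ ({u₁, u₁', u₂, u₂'} : Set ℝ), ∀ y ∈ ({u₁, u₁', u₂, u₂'} : Set ℝ), |x - y| ≤ w)
      (o1 : u₁ ≤ u₁') (o2 : u₂ ≤ u₂'), |u₁ - u₂| ≤ 14 * K * w' ∧ |u₁' - u₂'| ≤ 14 * K * w' := by
    intro u₁ u₁' u₂ u₂' ξ₁ ξ₁' ξ₂ ξ₂' m1 m1' m2 m2' s1 s1' s2 s2' heq hd o1 o2
    rcases le_total u₁ u₂ with o | o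
    · exact h.l4_geom_aux m1 m1' m2 m2' s1 s1' s2 s2' heq o2 o (hd _ (by simp) _ (by simp))
        (hd _ (by simp) _ (by simp)) (hd _ (by simp) _ (by simp)) hw1 hw' hww hR hk
    · have := h.l4_geom_aux m2 m2' m1 m1' s2 s2' s1 s1' heq.symm o1 o (hd _ (by simp) _ (by simp))
        (hd _ (by simp) _ (by simp)) (hd _ (by simp) _ (by simp)) hw1 hw' hww hR hk
      rwa [abs_sub_comm, abs_sub_comm u₂'] at this
  rcases le_total u₁ u₁' with o1 | o1 <;> rcases le_total u₂ u₂' with o2 | o2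
  · exact Or.inl (key m1 m1' m2 m2' s1 s1' s2 s2' heq hd o1 o2)
  · exact Or.inr (key m1 m1' m2' m2 s1 s1' s2' s2 (by rw [heq, add_comm])
      (by simpa [or_comm, or_left_comm, or_assoc] using hd) o1 o2)
  · exact Or.inr ((key m1' m1 m2 m2' s1' s1 s2 s2' (by rw [← heq, add_comm])
      (by simpa [or_comm, or_left_comm, or_assoc] using hd) o1 o2).symm)
  · exact Or.inl ((key m1' m1 m2' m2 s1' s1 s2' s2 (by rw [add_comm, heq, add_comm])
      (by simpa [or_comm, or_left_comm, or_assoc] using hd) o1 o2).symm)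

end

/-- The index of the dyadic interval of length `2⁻ⁱ` containing `u`. -/
def cap (i : ℕ) (u : ℝ) : ℕ := ⌊2 ^ i * u⌋₊

lemma cap_lt {u : ℝ} (h : 0 ≤ u ∧ u < 1) (i : ℕ) : cap i u < 2 ^ i := by
  rw [cap, Nat.floor_lt (by have := h.1; positivity)]
  push_cast
  have : (0 : ℝ) < 2 ^ i := by positivity
  nlinarith [h.2]

lemma cap_div {i j : ℕ} (h : j ≤ i) (u : ℝ) : cap i u / 2 ^ (i - j) = cap j u := by
  rw [cap, cap, ← Nat.floor_div_natCast]
  congr 1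
  obtain ⟨d, rfl⟩ := Nat.exists_eq_add_of_le h
  simp only [Nat.add_sub_cancel_left, pow_add]
  push_cast
  field_simp

lemma cap_le_mul {i : ℕ} {u : ℝ} (hu : 0 ≤ u) :
    (cap i u : ℝ) ≤ 2 ^ i * u ∧ 2 ^ i * u < cap i u + 1 :=
  ⟨Nat.floor_le (by positivity), Nat.lt_floor_add_one _⟩

lemma abs_sub_le_of_cap_eq {i : ℕ} {u v : ℝ} (hu : 0 ≤ u) (hv : 0 ≤ v) (h : cap i u = cap i v) :
    |u - v| ≤ ((2 : ℝ) ^ i)⁻¹ := by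
  have h1 := cap_le_mul (i := i) hu
  have h2 := cap_le_mul (i := i) hv
  rw [h] at h1
  have hp : (0 : ℝ) < 2 ^ i := by positivity
  rw [← one_div, le_div_iff₀ hp]
  have : |2 ^ i * u - 2 ^ i * v| ≤ 1 := by rw [abs_le]; constructor <;> linarith [h1.1, h1.2, h2.1, h2.2]
  rwa [← mul_sub, abs_mul, abs_of_pos hp, mul_comm] at this

lemma cap_close {i m : ℕ} {u v : ℝ} (hu : 0 ≤ u) (hv : 0 ≤ v) (h : |u - v| ≤ m * ((2 : ℝ) ^ i)⁻¹) :
    cap i u ≤ cap i v + (m + 1) := by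
  have h1 := cap_le_mul (i := i) hu
  have h2 := cap_le_mul (i := i) hv
  have hp : (0 : ℝ) < 2 ^ i := by positivity
  have : |2 ^ i * u - 2 ^ i * v| ≤ m := by
    rw [← mul_sub, abs_mul, abs_of_pos hp]
    calc 2 ^ i * |u - v| ≤ 2 ^ i * (m * ((2 : ℝ) ^ i)⁻¹) := by gcongr
      _ = m := by field_simp
  have : (cap i u : ℝ) < cap i v + (m + 2) := by
    have := (abs_le.1 this).2; linarith [h1.1, h2.2]
  have : cap i u < cap i v + (m + 2) := by exact_mod_cast this
  omega

lemma cap_mono {i : ℕ} {u v : ℝ} (h : u ≤ v) : cap i u ≤ cap i v :=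
  Nat.floor_mono (by gcongr)

/-- Descendants at level `i` of the node `(j, k)`. -/
def ch (i j k : ℕ) : Finset ℕ := (Finset.range (2 ^ i)).filter (fun l => l / 2 ^ (i - j) = k)

lemma sum_ch {M : Type*} [AddCommMonoid M] {i j : ℕ} (h : j ≤ i) (g : ℕ → M) :
    ∑ k ∈ Finset.range (2 ^ j), ∑ l ∈ ch i j k, g l = ∑ l ∈ Finset.range (2 ^ i), g l := by
  unfold ch
  refine Finset.sum_fiberwise_of_maps_to (fun l hl => ?_) g
  simp only [Finset.mem_range] at hl ⊢
  rw [Nat.div_lt_iff_lt_mul (by positivity), ← pow_add]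
  rwa [Nat.add_sub_cancel' h]

lemma sum_ch_ch {M : Type*} [AddCommMonoid M] {i' i j k : ℕ} (h : j ≤ i) (h' : i ≤ i') (g : ℕ → M) :
    ∑ l ∈ ch i j k, ∑ l' ∈ ch i' i l, g l' = ∑ l ∈ ch i' j k, g l := by
  have hdiv : ∀ l, l / 2 ^ (i' - i) / 2 ^ (i - j) = l / 2 ^ (i' - j) := by
    intro l
    rw [Nat.div_div_eq_div_mul, ← pow_add]; congr 2; omega
  have hm : ∀ l ∈ ch i' j k, l / 2 ^ (i' - i) ∈ ch i j k := by
    intro l hl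
    simp only [ch, Finset.mem_filter, Finset.mem_range] at hl ⊢
    refine ⟨?_, by rw [hdiv]; exact hl.2⟩
    rw [Nat.div_lt_iff_lt_mul (by positivity), ← pow_add]
    rw [Nat.add_sub_cancel' h']; exact hl.1
  rw [← Finset.sum_fiberwise_of_maps_to hm g]
  refine Finset.sum_congr rfl fun l hl => Finset.sum_congr ?_ fun _ _ => rfl
  ext l'
  simp only [ch, Finset.mem_filter, Finset.mem_range] at hl ⊢
  constructor
  · rintro ⟨a, b⟩; exact ⟨⟨a, by rw [← hdiv, b]; exact hl.2⟩, b⟩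
  · rintro ⟨⟨a, _⟩, b⟩; exact ⟨a, b⟩

lemma card_filter_near (s : Finset ℕ) (p m : ℕ) [DecidablePred fun q => p ≤ q + m ∧ q ≤ p + m] :
    (s.filter (fun q => p ≤ q + m ∧ q ≤ p + m)).card ≤ 2 * m + 1 := by
  have : s.filter (fun q => p ≤ q + m ∧ q ≤ p + m) ⊆ Finset.Icc (p - m) (p + m) := by
    intro q hq
    simp only [Finset.mem_filter, Finset.mem_Icc] at hq ⊢
    omega
  refine (Finset.card_le_card this).trans ?_
  rw [Nat.card_Icc]; omega

/-- Data for the multi-scale estimate. -/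
structure CoreData (n k N : ℕ) (K : ℝ) where
  Λ : Finset ℝ
  φ : ℝ → ℝ
  ψ : ℝ → ℝ
  ν : ℝ → ℝ
  F : ℝ → Grid N → ℂ
  r0 : ℝ
  convx : Convx K φ ψ (Λ : Set ℝ)
  ν_nonneg : ∀ u ∈ Λ, 0 ≤ ν u
  F_spec : ∀ u ∈ Λ, F u ∈ spec (ech N) (sigmaSet n k r0 φ u)
  le_N : 100000 * K ^ 4 * 4 ^ n ≤ (N : ℝ)

namespace CoreData
variable {n k N : ℕ} {K : ℝ}

lemma N_pos (D : CoreData n k N K) : 0 < N := by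
  have h := D.le_N
  have := D.convx.pos
  have : (0 : ℝ) < N := lt_of_lt_of_le (by positivity) h
  exact_mod_cast this

lemma isChar (D : CoreData n k N K) : IsCharSystem (ech N) (fbox N) := isCharSystem_ech N D.N_pos

variable (D : CoreData n k N K)

/-- The part of the function coming from the cap `l` at level `i`. -/
def f (i l : ℕ) (x : Grid N) : ℂ := ∑ u ∈ D.Λ.filter (fun u => cap i u = l), (D.ν u : ℂ) * D.F u x

/-- The spectrum of `f i l`. -/
def Sg (i l : ℕ) : Set Freq := {ξ | ∃ u ∈ D.Λ, cap i u = l ∧ ξ ∈ sigmaSet n k D.r0 D.φ u}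

lemma f_spec (i l : ℕ) : D.f i l ∈ spec (ech N) (D.Sg i l) := by
  have : D.f i l = ∑ u ∈ D.Λ.filter (fun u => cap i u = l), (D.ν u : ℂ) • D.F u := by
    ext x; simp [f]
  rw [this]
  refine Submodule.sum_mem _ fun u hu => Submodule.smul_mem _ _ ?_
  rw [Finset.mem_filter] at hu
  have hsub : sigmaSet n k D.r0 D.φ u ⊆ D.Sg i l := fun ξ hξ => ⟨u, hu.1, hu.2, hξ⟩
  exact spec_mono hsub (D.F_spec u hu.1)

lemma f_split {i i' : ℕ} (h : i ≤ i') (l : ℕ) (x : Grid N) :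
    D.f i l x = ∑ l' ∈ ch i' i l, D.f i' l' x := by
  unfold f
  have hm : ∀ u ∈ D.Λ.filter (fun u => cap i u = l), cap i' u ∈ ch i' i l := by
    intro u hu
    rw [Finset.mem_filter] at hu
    simp only [ch, Finset.mem_filter, Finset.mem_range]
    exact ⟨cap_lt (D.convx.mem u hu.1) i', by rw [cap_div h]; exact hu.2⟩
  rw [← Finset.sum_fiberwise_of_maps_to hm]
  refine Finset.sum_congr rfl fun l' hl' => Finset.sum_congr ?_ fun _ _ => rfl
  ext u
  simp only [ch, Finset.mem_filter, Finset.mem_range] at hl' ⊢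
  constructor
  · rintro ⟨⟨a, _⟩, c⟩; exact ⟨a, c⟩
  · rintro ⟨a, c⟩; exact ⟨⟨a, by rw [← cap_div h, c]; exact hl'.2⟩, c⟩

/-- The square function over the descendants of a node. -/
def G (i j k : ℕ) (x : Grid N) : ℝ := ∑ l ∈ ch i j k, ‖D.f i l x‖ ^ 2

lemma G_nonneg (i j k : ℕ) (x : Grid N) : 0 ≤ D.G i j k x := Finset.sum_nonneg fun _ _ => sq_nonneg _

/-- The energy at level `i` with respect to the nodes of level `j`. -/
def J (i j : ℕ) : ℝ := ∑ k ∈ Finset.range (2 ^ j), avg (fun x => D.G i j k x ^ 2)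

lemma J_nonneg (i j : ℕ) : 0 ≤ D.J i j :=
  Finset.sum_nonneg fun _ _ => avg_nonneg fun _ => sq_nonneg _

lemma sigma_bounds {u : ℝ} (hu : u ∈ D.Λ) {ξ : Freq} (hξ : ξ ∈ sigmaSet n k D.r0 D.φ u) :
    |(ξ.1 : ℝ)| ≤ 9 * K * 4 ^ n ∧ |(ξ.2.1 : ℝ)| ≤ 9 * K * 4 ^ n ∧ |(ξ.2.2 : ℝ)| ≤ 9 * K * 4 ^ n := by
  obtain ⟨h1, h2, _, h4, h5⟩ := hξ
  have hK := D.convx.one_le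
  have hu' := D.convx.mem u hu
  have hp : (1 : ℝ) ≤ 4 ^ n := one_le_pow₀ (by norm_num)
  have hφ := D.convx.phi_le u hu
  have hx : (0 : ℝ) < ξ.1 := by linarith
  have hKR : (4 : ℝ) ^ n ≤ K * 4 ^ n := le_mul_of_one_le_left (by positivity) hK
  have e1 : |u * ξ.1| ≤ 1 * (8 * 4 ^ n) := by
    rw [abs_mul, abs_of_nonneg hu'.1, abs_of_pos hx]; gcongr; exact hu'.2.le
  have e2 : |D.φ u * ξ.1| ≤ K * (8 * 4 ^ n) := by
    rw [abs_mul, abs_of_pos hx]; gcongr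
  refine ⟨?_, ?_, ?_⟩
  · rw [abs_of_pos hx]; linarith
  · have := abs_sub_abs_le_abs_sub (ξ.2.1 : ℝ) (u * ξ.1); linarith
  · have := abs_sub_abs_le_abs_sub (ξ.2.2 : ℝ) (D.φ u * ξ.1); linarith

/-- Real bounds on the coordinates of a frequency. -/
def coordLe (X : ℝ) (ξ : Freq) : Prop := |(ξ.1 : ℝ)| ≤ X ∧ |(ξ.2.1 : ℝ)| ≤ X ∧ |(ξ.2.2 : ℝ)| ≤ X

lemma coordLe.add {X Y : ℝ} {ξ η : Freq} (h1 : coordLe X ξ) (h2 : coordLe Y η) :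
    coordLe (X + Y) (ξ + η) := by
  obtain ⟨a, b, c⟩ := h1
  obtain ⟨a', b', c'⟩ := h2
  refine ⟨?_, ?_, ?_⟩ <;> simp only [Prod.fst_add, Prod.snd_add] <;> push_cast <;>
    exact (abs_add_le _ _).trans (by linarith)

lemma coordLe.neg {X : ℝ} {ξ : Freq} (h1 : coordLe X ξ) : coordLe X (-ξ) := by
  obtain ⟨a, b, c⟩ := h1
  refine ⟨?_, ?_, ?_⟩ <;> simp only [Prod.fst_neg, Prod.snd_neg] <;> push_cast <;> rwa [abs_neg]

lemma coordLe.sub {X Y : ℝ} {ξ η : Freq} (h1 : coordLe X ξ) (h2 : coordLe Y η) :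
    coordLe (X + Y) (ξ - η) := by rw [sub_eq_add_neg]; exact h1.add h2.neg

lemma coordLe.mono {X Y : ℝ} {ξ : Freq} (h1 : coordLe X ξ) (h : X ≤ Y) : coordLe Y ξ :=
  ⟨h1.1.trans h, h1.2.1.trans h, h1.2.2.trans h⟩

lemma coordLe.mem_fbox {X : ℝ} {ξ : Freq} (h1 : coordLe X ξ) (h : X < N) : ξ ∈ fbox N := by
  obtain ⟨a, b, c⟩ := h1
  refine ⟨?_, ?_, ?_⟩
  · exact_mod_cast a.trans_lt h
  · exact_mod_cast b.trans_lt h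
  · exact_mod_cast c.trans_lt h

/-- Passing from level `i` to level `i'` by almost orthogonality. -/
lemma schur_caps {i i' l m : ℕ} (h : i ≤ i') (V : Grid N → ℝ) (hV : ∀ x, 0 ≤ V x) (SV : Set Freq)
    (hVs : (fun x => (V x : ℂ)) ∈ spec (ech N) SV) {X : ℝ} (hX : 18 * K * 4 ^ n + X < N)
    (hSV : ∀ q ∈ SV, coordLe X q)
    (hrel : ∀ u₁ ∈ D.Λ, ∀ u₂ ∈ D.Λ, cap i u₁ = l → cap i u₂ = l →
      ∀ ξ₁ ∈ sigmaSet n k D.r0 D.φ u₁, ∀ ξ₂ ∈ sigmaSet n k D.r0 D.φ u₂, ∀ q ∈ SV,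
        ξ₁ - ξ₂ + q = 0 → |u₁ - u₂| ≤ m * ((2 : ℝ) ^ i')⁻¹) :
    avg (fun x => ‖D.f i l x‖ ^ 2 * V x) ≤
      ((2 * (m + 1) + 1 : ℕ) : ℝ) * ∑ l' ∈ ch i' i l, avg (fun x => ‖D.f i' l' x‖ ^ 2 * V x) := by
  classical
  simp only [D.f_split h l]
  refine schur_avg (ch i' i l) (fun l' => D.f i' l') V hV
    (fun p q => p ≤ q + (m + 1) ∧ q ≤ p + (m + 1)) (fun p q h => ⟨h.2, h.1⟩) _
    (fun p _ => card_filter_near _ _ _) ?_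
  intro p hp q hq hpq
  have hs : (fun x => D.f i' p x * (starRingEnd ℂ) (D.f i' q x) * (V x : ℂ)) ∈
      spec (ech N) {ω | ∃ ξ₁ ∈ D.Sg i' p, ∃ ξ₂ ∈ D.Sg i' q, ∃ v ∈ SV, ω = ξ₁ - ξ₂ + v} := by
    refine spec_mul D.isChar (S := {ω | ∃ ξ₁ ∈ D.Sg i' p, ∃ ξ₂ ∈ D.Sg i' q, ω = ξ₁ - ξ₂}) ?_ ?_ hVs
    · rintro _ ⟨ξ₁, h1, ξ₂, h2, rfl⟩ v hv; exact ⟨ξ₁, h1, ξ₂, h2, v, hv, rfl⟩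
    · refine spec_mul D.isChar (T := {ω | ∃ ξ₂ ∈ D.Sg i' q, ω = -ξ₂}) ?_ (D.f_spec i' p)
        (spec_conj D.isChar (U := {ω | ∃ ξ₂ ∈ D.Sg i' q, ω = -ξ₂}) (fun a ha => ⟨a, ha, rfl⟩) (D.f_spec i' q))
      rintro ξ₁ h1 _ ⟨ξ₂, h2, rfl⟩; exact ⟨ξ₁, h1, ξ₂, h2, by abel⟩
  refine avg_eq_zero_of_spec D.isChar ?_ hs
  rintro _ ⟨ξ₁, ⟨u₁, m1, c1, s1⟩, ξ₂, ⟨u₂, m2, c2, s2⟩, v, hv, rfl⟩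
  have b1 : coordLe _ ξ₁ := D.sigma_bounds m1 s1
  have b2 : coordLe _ ξ₂ := D.sigma_bounds m2 s2
  refine ⟨((b1.sub b2).add (hSV v hv)).mem_fbox (by linarith), fun h0 => hpq ?_⟩
  simp only [ch, Finset.mem_filter] at hp hq
  have k1 : cap i u₁ = l := by rw [← cap_div h, c1]; exact hp.2
  have k2 : cap i u₂ = l := by rw [← cap_div h, c2]; exact hq.2
  have hd := hrel u₁ m1 u₂ m2 k1 k2 ξ₁ s1 ξ₂ s2 v hv h0
  have p1 := (D.convx.mem u₁ m1).1
  have p2 := (D.convx.mem u₂ m2).1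
  rw [← c1, ← c2]
  exact ⟨cap_close p1 p2 hd, cap_close p2 p1 (by rwa [abs_sub_comm])⟩

end CoreData

/-- Sum over the descendants at level `i` of the node `(j, k)`. -/
def nsum (i : ℕ) (c : ℕ → ℂ) (j k : ℕ) : ℂ := ∑ l ∈ ch i j k, c l

lemma mem_ch {i j k l : ℕ} : l ∈ ch i j k ↔ l < 2 ^ i ∧ l / 2 ^ (i - j) = k := by
  simp [ch]

lemma div_pow_div {i j j' : ℕ} (h : j ≤ j') (h' : j' ≤ i) (l : ℕ) :
    l / 2 ^ (i - j') / 2 ^ (j' - j) = l / 2 ^ (i - j) := by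
  rw [Nat.div_div_eq_div_mul, ← pow_add]; congr 2; omega

lemma div_mem_ch {i j j' k l : ℕ} (h : j ≤ j') (h' : j' ≤ i) (hl : l ∈ ch i j k) :
    l / 2 ^ (i - j') ∈ ch j' j k := by
  rw [mem_ch] at hl ⊢
  refine ⟨?_, by rw [div_pow_div h h']; exact hl.2⟩
  rw [Nat.div_lt_iff_lt_mul (by positivity), ← pow_add, Nat.add_sub_cancel' h']
  exact hl.1

lemma norm_sum_sq_le_two {ι : Type*} (s : Finset ι) (hs : s.card ≤ 2) (c : ι → ℂ) :
    ‖∑ i ∈ s, c i‖ ^ 2 ≤ 2 * ∑ i ∈ s, ‖c i‖ ^ 2 := by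
  calc ‖∑ i ∈ s, c i‖ ^ 2 ≤ (∑ i ∈ s, ‖c i‖) ^ 2 := by gcongr; exact norm_sum_le _ _
    _ ≤ s.card * ∑ i ∈ s, ‖c i‖ ^ 2 := sq_sum_le_card_mul_sum_sq
    _ ≤ 2 * ∑ i ∈ s, ‖c i‖ ^ 2 := by
      gcongr
      exact_mod_cast hs

lemma sum_filter_nodes {i j j' k : ℕ} (h : j ≤ j') (h' : j' ≤ i) (c : ℕ → ℂ) (p : ℕ → Prop)
    [DecidablePred p] :
    ∑ l ∈ (ch i j k).filter (fun l => p (l / 2 ^ (i - j'))), c l =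
      ∑ κ ∈ (ch j' j k).filter p, nsum i c j' κ := by
  have hm : ∀ l ∈ (ch i j k).filter (fun l => p (l / 2 ^ (i - j'))),
      l / 2 ^ (i - j') ∈ (ch j' j k).filter p := by
    intro l hl
    rw [Finset.mem_filter] at hl ⊢
    exact ⟨div_mem_ch h h' hl.1, hl.2⟩
  rw [← Finset.sum_fiberwise_of_maps_to hm]
  refine Finset.sum_congr rfl fun κ hκ => ?_
  unfold nsum
  refine Finset.sum_congr ?_ fun _ _ => rfl
  ext l
  rw [Finset.mem_filter] at hκ
  simp only [Finset.mem_filter, mem_ch] at hκ ⊢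
  constructor
  · rintro ⟨⟨⟨a, _⟩, _⟩, d⟩; exact ⟨a, d⟩
  · rintro ⟨a, d⟩
    exact ⟨⟨⟨a, by rw [← div_pow_div h h', d]; exact hκ.1.2⟩, by rw [d]; exact hκ.2⟩, d⟩

/-- Two families of at most two nodes covering the active leaves control the whole sum. -/
lemma two_class_bound {i j k : ℕ} (c : ℕ → ℂ) (good : ℕ → Finset ℕ) {j₁ j₂ : ℕ} (K₁ K₂ : Finset ℕ)
    (hj1 : j ≤ j₁) (h12 : j₁ ≤ j₂) (hj2 : j₂ ≤ i) (c1 : K₁.card ≤ 2) (c2 : K₂.card ≤ 2)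
    (g1 : K₁ ⊆ good j₁) (g2 : K₂ ⊆ good j₂)
    (hcov : ∀ l ∈ ch i j k, c l ≠ 0 → l / 2 ^ (i - j₁) ∈ K₁ ∨ l / 2 ^ (i - j₂) ∈ K₂) :
    ‖∑ l ∈ ch i j k, c l‖ ^ 2 ≤
      8 * ∑ j' ∈ Finset.Icc j i, ∑ κ ∈ (ch j' j k).filter (· ∈ good j'), ‖nsum i c j' κ‖ ^ 2 := by
  have e1 : ∑ l ∈ ch i j k, c l =
      ∑ l ∈ (ch i j k).filter (fun l => l / 2 ^ (i - j₁) ∈ K₁), c l +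
      ∑ l ∈ (ch i j k).filter (fun l => l / 2 ^ (i - j₂) ∈ K₂ ∧ (l / 2 ^ (i - j₂)) / 2 ^ (j₂ - j₁) ∉ K₁),
        c l := by
    rw [← Finset.sum_filter_add_sum_filter_not (ch i j k) (fun l => l / 2 ^ (i - j₁) ∈ K₁)]
    congr 1
    symm
    refine Finset.sum_subset ?_ ?_
    · intro l hl
      rw [Finset.mem_filter] at hl ⊢
      rw [div_pow_div h12 hj2] at hl
      exact ⟨hl.1, hl.2.2⟩
    · intro l hl hl'
      rw [Finset.mem_filter] at hl hl'
      rw [div_pow_div h12 hj2] at hl'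
      by_contra h0
      rcases hcov l hl.1 h0 with h | h
      · exact hl.2 h
      · exact hl' ⟨hl.1, h, hl.2⟩
  rw [e1, sum_filter_nodes hj1 (h12.trans hj2) c (· ∈ K₁),
    sum_filter_nodes (hj1.trans h12) hj2 c (fun κ => κ ∈ K₂ ∧ κ / 2 ^ (j₂ - j₁) ∉ K₁)]
  have key : ∀ j' ∈ Finset.Icc j i, ∀ s : Finset ℕ, s ⊆ (ch j' j k).filter (· ∈ good j') → s.card ≤ 2 →
      ‖∑ κ ∈ s, nsum i c j' κ‖ ^ 2 ≤
      2 * ∑ j' ∈ Finset.Icc j i, ∑ κ ∈ (ch j' j k).filter (· ∈ good j'), ‖nsum i c j' κ‖ ^ 2 := by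
    intro j' hj' s hs hc
    refine (norm_sum_sq_le_two s hc _).trans ?_
    gcongr
    refine (Finset.sum_le_sum_of_subset_of_nonneg hs fun _ _ _ => sq_nonneg _).trans ?_
    exact Finset.single_le_sum (f := fun j' => ∑ κ ∈ (ch j' j k).filter (· ∈ good j'),
      ‖nsum i c j' κ‖ ^ 2) (fun _ _ => Finset.sum_nonneg fun _ _ => sq_nonneg _) hj'
  have k1 := key j₁ (Finset.mem_Icc.2 ⟨hj1, h12.trans hj2⟩) ((ch j₁ j k).filter (· ∈ K₁))
    (fun κ hκ => by rw [Finset.mem_filter] at hκ ⊢; exact ⟨hκ.1, g1 hκ.2⟩)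
    ((Finset.card_le_card (fun κ hκ => (Finset.mem_filter.1 hκ).2)).trans c1)
  have k2 := key j₂ (Finset.mem_Icc.2 ⟨hj1.trans h12, hj2⟩)
    ((ch j₂ j k).filter (fun κ => κ ∈ K₂ ∧ κ / 2 ^ (j₂ - j₁) ∉ K₁))
    (fun κ hκ => by rw [Finset.mem_filter] at hκ ⊢; exact ⟨hκ.1, g2 hκ.2.1⟩)
    ((Finset.card_le_card (fun κ hκ => (Finset.mem_filter.1 hκ).2.1)).trans c2)
  generalize ∑ κ ∈ (ch j₁ j k).filter (· ∈ K₁), nsum i c j₁ κ = z at k1 ⊢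
  generalize ∑ κ ∈ (ch j₂ j k).filter (fun κ => κ ∈ K₂ ∧ κ / 2 ^ (j₂ - j₁) ∉ K₁), nsum i c j₂ κ = w at k2 ⊢
  have := norm_add_le z w
  nlinarith [sq_nonneg (‖z‖ - ‖w‖), norm_nonneg z, norm_nonneg w, norm_nonneg (z + w)]

lemma exists_level {i j : ℕ} (hij : j ≤ i) {d : ℝ} (hd : d ≤ ((2 : ℝ) ^ j)⁻¹) :
    ∃ j', j ≤ j' ∧ j' ≤ i ∧ d ≤ ((2 : ℝ) ^ j')⁻¹ ∧ (j' = i ∨ ((2 : ℝ) ^ (j' + 1))⁻¹ < d) := by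
  classical
  have h := Nat.findGreatest_spec (P := fun j' => d ≤ ((2 : ℝ) ^ j')⁻¹) hij hd
  refine ⟨Nat.findGreatest (fun j' => d ≤ ((2 : ℝ) ^ j')⁻¹) i, Nat.le_findGreatest hij hd,
    Nat.findGreatest_le i, h, ?_⟩
  rcases (Nat.findGreatest_le (P := fun j' => d ≤ ((2 : ℝ) ^ j')⁻¹) i).lt_or_eq with hlt | heq
  · right
    by_contra hc
    exact Nat.findGreatest_is_greatest (Nat.lt_succ_self _) hlt (not_lt.1 hc)
  · exact Or.inl heq

/-- The convex body `|a| ≤ A`, `|b| ≤ B`, `|c| ≤ C` in the frame at `v`. -/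
def body (φ ψ : ℝ → ℝ) (v A B C : ℝ) (ω : Freq) : Prop :=
  |(ω.1 : ℝ)| ≤ A ∧ |bco v ω| ≤ B ∧ |cco φ ψ v ω| ≤ C

/-- The finite box of frequencies with coordinates bounded by `M`. -/
def tbox (M : ℕ) : Finset Freq :=
  Finset.Icc (-(M : ℤ)) M ×ˢ Finset.Icc (-(M : ℤ)) M ×ˢ Finset.Icc (-(M : ℤ)) M

lemma mem_tbox {M : ℕ} {ω : Freq} : ω ∈ tbox M ↔ CoreData.coordLe M ω := by
  simp only [tbox, Finset.mem_product, Finset.mem_Icc, CoreData.coordLe, ← abs_le]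
  refine and_congr ?_ (and_congr ?_ ?_) <;> norm_cast

namespace CoreData
variable {n k N : ℕ} {K : ℝ} (D : CoreData n k N K)

/-- A chosen element of `Λ` in the node. -/
def rep (j κ : ℕ) : ℝ := open Classical in if h : ∃ u ∈ D.Λ, cap j u = κ then h.choose else 0

lemma rep_spec {j : ℕ} {u : ℝ} (hu : u ∈ D.Λ) : D.rep j (cap j u) ∈ D.Λ ∧ cap j (D.rep j (cap j u)) = cap j u := by
  have h : ∃ v ∈ D.Λ, cap j v = cap j u := ⟨u, hu, rfl⟩
  rw [rep, dif_pos h]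
  exact h.choose_spec

/-- `4^n / 4^i`. -/
def rad (_ : CoreData n k N K) (i : ℕ) : ℝ := 4 ^ n / 4 ^ i

lemma rad_pos (i : ℕ) : 0 < D.rad i := by unfold rad; positivity

/-- Size of the big box. -/
def bigM (_ : CoreData n k N K) : ℕ := ⌊3000 * K ^ 4 * 4 ^ n⌋₊

lemma bigM_le : (D.bigM : ℝ) ≤ 3000 * K ^ 4 * 4 ^ n :=
  Nat.floor_le (by have := D.convx.pos; positivity)

/-- Membership in the frequency body of a node. -/
def nbody (c : ℝ) (i j κ : ℕ) (ω : Freq) : Prop :=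
  body D.φ D.ψ (D.rep j κ) (c * (500 * K ^ 3) * (D.rad i * 4 ^ j)) (c * (500 * K ^ 3) * (D.rad i * 2 ^ j))
    (c * (500 * K ^ 3) * D.rad i) ω

open Classical in
/-- Frequencies good for a node. -/
def gset (i j κ : ℕ) : Finset Freq :=
  (tbox D.bigM).filter (fun ω => D.nbody 1 i j κ ω ∧ ∃ u ∈ D.Λ, cap j u = κ)

/-- Fourier coefficients of `|f i l|²`. -/
def cl (i : ℕ) (ω : Freq) (l : ℕ) : ℂ := fc (ech N) (fun x => ((‖D.f i l x‖ ^ 2 : ℝ) : ℂ)) ω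

/-- The spectrum of `|f i l|²`. -/
def Dg (i l : ℕ) : Set Freq := {ω | ∃ ξ₁ ∈ D.Sg i l, ∃ ξ₂ ∈ D.Sg i l, ω = ξ₁ - ξ₂}

lemma normSq_spec (i l : ℕ) : (fun x => ((‖D.f i l x‖ ^ 2 : ℝ) : ℂ)) ∈ spec (ech N) (D.Dg i l) := by
  have h : (fun x => ((‖D.f i l x‖ ^ 2 : ℝ) : ℂ)) =
      fun x => D.f i l x * (starRingEnd ℂ) (D.f i l x) := by
    ext x; rw [Complex.mul_conj, Complex.normSq_eq_norm_sq]
  rw [h]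
  refine spec_mul D.isChar (T := {ω | ∃ ξ₂ ∈ D.Sg i l, ω = -ξ₂}) ?_ (D.f_spec i l)
        (spec_conj D.isChar (U := {ω | ∃ ξ₂ ∈ D.Sg i l, ω = -ξ₂}) (fun a ha => ⟨a, ha, rfl⟩) (D.f_spec i l))
  rintro ξ₁ h1 _ ⟨ξ₂, h2, rfl⟩; exact ⟨ξ₁, h1, ξ₂, h2, by abel⟩

lemma Dg_coord {i l : ℕ} {ω : Freq} (h : ω ∈ D.Dg i l) : coordLe (18 * K * 4 ^ n) ω := by
  obtain ⟨ξ₁, ⟨u₁, m1, c1, s1⟩, ξ₂, ⟨u₂, m2, c2, s2⟩, rfl⟩ := h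
  have b1 : coordLe _ ξ₁ := D.sigma_bounds m1 s1
  have b2 : coordLe _ ξ₂ := D.sigma_bounds m2 s2
  exact (b1.sub b2).mono (by linarith)

lemma K_pow_le (D : CoreData n k N K) : K * 4 ^ n ≤ K ^ 4 * 4 ^ n := by
  have := D.convx.one_le
  gcongr
  exact le_self_pow₀ this (by norm_num)

lemma Dg_tbox {i l : ℕ} {ω : Freq} (h : ω ∈ D.Dg i l) : ω ∈ tbox D.bigM := by
  rw [mem_tbox]
  have h1 := D.Dg_coord h
  have hK := D.K_pow_le
  have e : 18 * K * 4 ^ n ≤ 3000 * K ^ 4 * 4 ^ n := by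
    have := D.convx.pos
    have : 0 < K * 4 ^ n := by positivity
    linarith
  have key : ∀ z : ℤ, |(z : ℝ)| ≤ 18 * K * 4 ^ n → |(z : ℝ)| ≤ D.bigM := by
    intro z hz
    have h2 : ((z.natAbs : ℕ) : ℝ) ≤ 3000 * K ^ 4 * 4 ^ n := by
      rw [Nat.cast_natAbs, Int.cast_abs]; exact hz.trans e
    have h3 : z.natAbs ≤ D.bigM := Nat.le_floor h2
    rw [← Int.cast_abs, ← Nat.cast_natAbs]
    exact_mod_cast h3
  exact ⟨key _ h1.1, key _ h1.2.1, key _ h1.2.2⟩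

lemma tbox_sub_fbox {a b : Freq} (ha : a ∈ tbox D.bigM) (hb : b ∈ tbox D.bigM) : a - b ∈ fbox N := by
  rw [mem_tbox] at ha hb
  refine (ha.sub hb).mem_fbox ?_
  have := D.bigM_le
  have h2 := D.le_N
  have := D.convx.pos
  have : 0 < K ^ 4 * 4 ^ n := by positivity
  linarith

lemma active_spec {i l : ℕ} {ω : Freq} (hω : ω ∈ tbox D.bigM) (h : D.cl i ω l ≠ 0) : ω ∈ D.Dg i l := by
  by_contra hc
  exact h (fc_eq_zero D.isChar hc (fun b hb => D.tbox_sub_fbox (D.Dg_tbox hb) hω) (D.normSq_spec i l))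

lemma one_le_rad {i : ℕ} (hi : i ≤ n) : 1 ≤ D.rad i := by
  unfold rad
  rw [one_le_div (by positivity)]
  exact pow_le_pow_right₀ (by norm_num) hi

lemma inv_pow_sq (i : ℕ) : (((2 : ℝ) ^ i)⁻¹) ^ 2 = ((4 : ℝ) ^ i)⁻¹ := by
  rw [inv_pow, ← pow_mul, mul_comm, pow_mul]; norm_num

lemma rad_eq_sq (i : ℕ) : (4 : ℝ) ^ n * (((2 : ℝ) ^ i)⁻¹) ^ 2 = D.rad i := by
  rw [inv_pow_sq]; rfl

lemma rad_eq (i : ℕ) : (4 : ℝ) ^ n * ((2 : ℝ) ^ i)⁻¹ = D.rad i * 2 ^ i := by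
  rw [← rad_eq_sq]; field_simp

lemma rad_eq' (i : ℕ) : (4 : ℝ) ^ n = D.rad i * 4 ^ i := by
  unfold rad; field_simp

/-- Size bounds at an active leaf. -/
lemma active_bounds {i l : ℕ} {ω : Freq} (hi : i ≤ n) (hω : ω ∈ D.Dg i l) :
    D.rep i l ∈ D.Λ ∧ cap i (D.rep i l) = l ∧ |(ω.1 : ℝ)| ≤ 8 * (D.rad i * 4 ^ i) ∧
      |bco (D.rep i l) ω| ≤ 18 * (D.rad i * 2 ^ i) ∧ |cco D.φ D.ψ (D.rep i l) ω| ≤ 20 * K * D.rad i := by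
  obtain ⟨ξ₁, ⟨u₁, m1, c1, s1⟩, ξ₂, ⟨u₂, m2, c2, s2⟩, rfl⟩ := hω
  have hr := D.rep_spec (j := i) m1
  rw [c1] at hr
  have p1 := (D.convx.mem u₁ m1).1
  have p2 := (D.convx.mem u₂ m2).1
  have p3 := (D.convx.mem _ hr.1).1
  have d1 := abs_sub_le_of_cap_eq p1 p3 (c1.trans hr.2.symm)
  have d2 := abs_sub_le_of_cap_eq p2 p3 (c2.trans hr.2.symm)
  have hR := D.one_le_rad hi
  have hR1 : 1 ≤ (4 : ℝ) ^ n * ((2 : ℝ) ^ i)⁻¹ := by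
    rw [D.rad_eq]; exact one_le_mul_of_one_le_of_one_le hR (one_le_pow₀ (by norm_num))
  have hR2 : 1 ≤ (4 : ℝ) ^ n * (((2 : ℝ) ^ i)⁻¹) ^ 2 := by rw [D.rad_eq_sq]; exact hR
  have b1 := abs_bco_sigma s1 d1 hR1
  have b2 := abs_bco_sigma s2 d2 hR1
  have e1 := D.convx.abs_cco_sigma m1 hr.1 s1 d1 hR2
  have e2 := D.convx.abs_cco_sigma m2 hr.1 s2 d2 hR2
  rw [D.rad_eq] at b1 b2
  rw [D.rad_eq_sq] at e1 e2
  refine ⟨hr.1, hr.2, ?_, ?_, ?_⟩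
  · rw [← D.rad_eq']
    have a1 := s1.1; have a2 := s1.2.1; have a3 := s2.1; have a4 := s2.2.1
    have : (0 : ℝ) < 4 ^ n := by positivity
    simp only [Prod.fst_sub]; push_cast
    rw [abs_le]; constructor <;> linarith
  · rw [bco_sub]; have := abs_sub (bco (D.rep i l) ξ₁) (bco (D.rep i l) ξ₂); linarith
  · rw [cco_sub]; have := abs_sub (cco D.φ D.ψ (D.rep i l) ξ₁) (cco D.φ D.ψ (D.rep i l) ξ₂); linarith

lemma cap_lt_of {i : ℕ} {u v : ℝ} (h : cap i u < cap i v) : u < v := by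
  by_contra hc
  exact absurd (cap_mono (i := i) (not_lt.1 hc)) (by omega)

/-- A class of active leaves with the same sign is covered by two good nodes. -/
lemma class_cover {i j κ : ℕ} {ω : Freq} (hij : j ≤ i) (hi : i ≤ n) (hω : ω ∈ tbox D.bigM)
    (P : Finset ℕ) (hP : P ⊆ ch i j κ) (hact : ∀ l ∈ P, ω ∈ D.Dg i l)
    (hsign : (∀ l ∈ P, 0 ≤ bco (D.rep i l) ω) ∨ (∀ l ∈ P, bco (D.rep i l) ω < 0)) :
    ∃ j', j ≤ j' ∧ j' ≤ i ∧ ∃ Q : Finset ℕ, Q.card ≤ 2 ∧ (∀ q ∈ Q, ω ∈ D.gset i j' q) ∧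
      ∀ l ∈ P, l / 2 ^ (i - j') ∈ Q := by
  classical
  rcases P.eq_empty_or_nonempty with rfl | hne
  · exact ⟨i, hij, le_rfl, ∅, by simp, by simp, by simp⟩
  set l₁ := P.min' hne
  set l₂ := P.max' hne
  have hl1 : l₁ ∈ P := P.min'_mem hne
  have hl2 : l₂ ∈ P := P.max'_mem hne
  set v₁ := D.rep i l₁
  set v₂ := D.rep i l₂
  obtain ⟨m1, k1, A1, B1, C1⟩ := D.active_bounds hi (hact l₁ hl1)
  obtain ⟨m2, k2, A2, B2, C2⟩ := D.active_bounds hi (hact l₂ hl2)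
  have hmono : ∀ l ∈ P, ∀ l' ∈ P, l ≤ l' → D.rep i l ≤ D.rep i l' := by
    intro l hl l' hl' hll
    obtain ⟨_, q, _⟩ := D.active_bounds hi (hact l hl)
    obtain ⟨_, q', _⟩ := D.active_bounds hi (hact l' hl')
    rcases hll.eq_or_lt with h | h
    · rw [h]
    · exact (cap_lt_of (i := i) (by rw [q, q']; exact h)).le
  have hle : v₁ ≤ v₂ := hmono _ hl1 _ hl2 (P.min'_le _ hl2)
  have p1 := (D.convx.mem _ m1).1
  have p2 := (D.convx.mem _ m2).1
  have hcj : ∀ l ∈ P, cap j (D.rep i l) = κ := by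
    intro l hl
    obtain ⟨_, q, _⟩ := D.active_bounds hi (hact l hl)
    rw [← cap_div hij, q]; exact (mem_ch.1 (hP hl)).2
  have hd : v₂ - v₁ ≤ ((2 : ℝ) ^ j)⁻¹ :=
    (le_abs_self _).trans (abs_sub_le_of_cap_eq p2 p1 ((hcj _ hl2).trans (hcj _ hl1).symm))
  obtain ⟨j', hj1, hj2, hd1, hd2⟩ := exists_level hij hd
  have hK := D.convx.one_le
  have hK0 := D.convx.pos
  have hr := D.rad_pos i
  have hK2 : 1 ≤ K ^ 2 := one_le_pow₀ hK
  have hK3 : K ≤ K ^ 3 := le_self_pow₀ hK (by norm_num)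
  have hK23 : K ^ 2 ≤ K ^ 3 := pow_le_pow_right₀ hK (by norm_num)
  have hp : (0 : ℝ) < 2 ^ j' := by positivity
  have h42 : (4 : ℝ) ^ j' = 2 ^ j' * 2 ^ j' := by rw [← mul_pow]; norm_num
  -- size bounds
  have hsize : |(ω.1 : ℝ)| ≤ 160 * K ^ 2 * (D.rad i * 4 ^ j') ∧
      |bco v₁ ω| ≤ 120 * K ^ 2 * (D.rad i * 2 ^ j') ∧ |bco v₂ ω| ≤ 120 * K ^ 2 * (D.rad i * 2 ^ j') := by
    rcases hd2 with h | h
    · rw [h]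
      have e1 : 0 < D.rad i * 4 ^ i := by positivity
      have e2 : 0 < D.rad i * 2 ^ i := by positivity
      refine ⟨A1.trans ?_, B1.trans ?_, B2.trans ?_⟩ <;> gcongr <;> linarith
    · have hdpos : 0 < v₂ - v₁ := lt_trans (by positivity) h
      have hg := D.convx.kakeya_geom m1 m2 (by linarith) C1 C2 (by
        rcases hsign with hs | hs
        · exact Or.inl ⟨hs _ hl1, hs _ hl2⟩
        · exact Or.inr ⟨hs _ hl1, hs _ hl2⟩)
      have h' : 1 ≤ 2 * 2 ^ j' * (v₂ - v₁) := by
        rw [pow_succ, inv_eq_one_div, div_lt_iff₀ (by positivity)] at h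
        linarith
      have h'' : 1 ≤ 4 * 4 ^ j' * (v₂ - v₁) ^ 2 := by
        have := one_le_pow₀ (n := 2) h'
        rw [h42]; linarith [this, show (2 * 2 ^ j' * (v₂ - v₁)) ^ 2 = 4 * (2 ^ j' * 2 ^ j') * (v₂ - v₁) ^ 2 by ring]
      have s1 : ∀ z : ℝ, 0 ≤ z → z * (v₂ - v₁) ≤ 3 * K * (20 * K * D.rad i) →
          z ≤ 120 * K ^ 2 * (D.rad i * 2 ^ j') := by
        intro z hz h0
        calc z ≤ z * (2 * 2 ^ j' * (v₂ - v₁)) := le_mul_of_one_le_right hz h'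
          _ = (z * (v₂ - v₁)) * (2 * 2 ^ j') := by ring
          _ ≤ (3 * K * (20 * K * D.rad i)) * (2 * 2 ^ j') := by gcongr
          _ = _ := by ring
      refine ⟨?_, s1 _ (abs_nonneg _) hg.2.1, s1 _ (abs_nonneg _) hg.2.2⟩
      calc |(ω.1 : ℝ)| ≤ |(ω.1 : ℝ)| * (4 * 4 ^ j' * (v₂ - v₁) ^ 2) :=
            le_mul_of_one_le_right (abs_nonneg _) h''
        _ = (|(ω.1 : ℝ)| * (v₂ - v₁) ^ 2) * (4 * 4 ^ j') := by ring
        _ ≤ (2 * K * (20 * K * D.rad i)) * (4 * 4 ^ j') :=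
            mul_le_mul_of_nonneg_right hg.1 (by positivity)
        _ = _ := by ring
  have hgood : ∀ v ∈ D.Λ, |bco v ω| ≤ 120 * K ^ 2 * (D.rad i * 2 ^ j') →
      |cco D.φ D.ψ v ω| ≤ 20 * K * D.rad i → ω ∈ D.gset i j' (cap j' v) := by
    intro v hv hB hC
    unfold gset
    rw [Finset.mem_filter]
    refine ⟨hω, ?_, v, hv, rfl⟩
    have hrep := D.rep_spec (j := j') hv
    have hdd := abs_sub_le_of_cap_eq (D.convx.mem _ hv).1 (D.convx.mem _ hrep.1).1 hrep.2.symm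
    have hcb := D.convx.change_base hv hrep.1 hdd hsize.1 hB hC
    refine ⟨hsize.1.trans ?_, hcb.1.trans ?_, hcb.2.trans ?_⟩
    · exact mul_le_mul_of_nonneg_right (by linarith) (by positivity)
    · have : ((2 : ℝ) ^ j')⁻¹ * (160 * K ^ 2 * (D.rad i * 4 ^ j')) = 160 * K ^ 2 * (D.rad i * 2 ^ j') := by
        rw [h42]; field_simp
      rw [this, ← add_mul]
      exact mul_le_mul_of_nonneg_right (by linarith) (by positivity)
    · have e1 : 2 * K * ((2 : ℝ) ^ j')⁻¹ * (120 * K ^ 2 * (D.rad i * 2 ^ j')) = 240 * K ^ 3 * D.rad i := by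
        field_simp; ring
      have e2 : K * (((2 : ℝ) ^ j')⁻¹) ^ 2 * (160 * K ^ 2 * (D.rad i * 4 ^ j')) = 160 * K ^ 3 * D.rad i := by
        rw [h42]; field_simp
      rw [e1, e2, ← add_mul, ← add_mul]
      exact mul_le_mul_of_nonneg_right (by linarith) (by positivity)
  refine ⟨j', hj1, hj2, {cap j' v₁, cap j' v₂}, Finset.card_le_two, ?_, ?_⟩
  · intro q hq
    rw [Finset.mem_insert, Finset.mem_singleton] at hq
    rcases hq with rfl | rfl
    · exact hgood _ m1 hsize.2.1 C1
    · exact hgood _ m2 hsize.2.2 C2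
  · intro l hl
    obtain ⟨_, q, _⟩ := D.active_bounds hi (hact l hl)
    have e : l / 2 ^ (i - j') = cap j' (D.rep i l) := by rw [← cap_div hj2, q]
    have h1 : cap j' v₁ ≤ cap j' (D.rep i l) := cap_mono (hmono _ hl1 _ hl (P.min'_le _ hl))
    have h2 : cap j' (D.rep i l) ≤ cap j' v₂ := cap_mono (hmono _ hl _ hl2 (P.le_max' _ hl))
    have h3 : cap j' v₂ ≤ cap j' v₁ + 1 := by
      unfold cap
      rw [← Nat.floor_add_one (by positivity)]
      refine Nat.floor_mono ?_
      have : 2 ^ j' * (v₂ - v₁) ≤ 1 := by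
        rwa [← le_inv_mul_iff₀ hp, mul_one]
      linarith
    rw [e, Finset.mem_insert, Finset.mem_singleton]
    omega

end CoreData

lemma sum_nodes_swap {Ω : Type*} (i j : ℕ) (T : Finset Ω) (g : ℕ → ℕ → Ω → ℝ) :
    ∑ κ ∈ Finset.range (2 ^ j), ∑ ω ∈ T, 8 * ∑ j' ∈ Finset.Icc j i, ∑ κ' ∈ ch j' j κ, g j' κ' ω =
      8 * ∑ j' ∈ Finset.Icc j i, ∑ κ' ∈ Finset.range (2 ^ j'), ∑ ω ∈ T, g j' κ' ω := by
  simp only [← Finset.mul_sum]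
  congr 1
  calc _ = ∑ κ ∈ Finset.range (2 ^ j), ∑ j' ∈ Finset.Icc j i, ∑ κ' ∈ ch j' j κ, ∑ ω ∈ T, g j' κ' ω := by
        refine Finset.sum_congr rfl fun κ _ => ?_
        rw [Finset.sum_comm]
        refine Finset.sum_congr rfl fun j' _ => ?_
        rw [Finset.sum_comm]
    _ = _ := by
        rw [Finset.sum_comm]
        refine Finset.sum_congr rfl fun j' hj' => ?_
        exact sum_ch (Finset.mem_Icc.1 hj').1 _

namespace CoreData
variable {n k N : ℕ} {K : ℝ} (D : CoreData n k N K)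

lemma fc_G (i j κ : ℕ) (ω : Freq) :
    fc (ech N) (fun x => (D.G i j κ x : ℂ)) ω = nsum i (D.cl i ω) j κ := by
  unfold nsum cl G
  rw [← fc_sum]
  congr 1; ext x; push_cast; rfl

lemma G_spec (i j κ : ℕ) : (fun x => (D.G i j κ x : ℂ)) ∈ spec (ech N) (tbox D.bigM : Set Freq) := by
  have : (fun x => (D.G i j κ x : ℂ)) = ∑ l ∈ ch i j κ, (fun x => ((‖D.f i l x‖ ^ 2 : ℝ) : ℂ)) := by
    ext x; simp [G]
  rw [this]
  exact Submodule.sum_mem _ fun l _ =>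
    spec_mono (fun ω hω => Finset.mem_coe.2 (D.Dg_tbox hω)) (D.normSq_spec i l)

lemma avg_G_sq (i j κ : ℕ) : avg (fun x => D.G i j κ x ^ 2) =
    ∑ ω ∈ tbox D.bigM, ‖nsum i (D.cl i ω) j κ‖ ^ 2 := by
  have h := parseval D.isChar (tbox D.bigM) (fun a ha b hb => D.tbox_sub_fbox ha hb) (D.G_spec i j κ)
  simp only [D.fc_G] at h
  rw [← h]
  simp

/-- The part of the energy with frequencies good for the node. -/
def H (i j : ℕ) : ℝ := ∑ κ ∈ Finset.range (2 ^ j), ∑ ω ∈ D.gset i j κ, ‖nsum i (D.cl i ω) j κ‖ ^ 2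

lemma gset_subset (i j κ : ℕ) : D.gset i j κ ⊆ tbox D.bigM := by
  classical exact Finset.filter_subset _ _

lemma H_le_J (i j : ℕ) : D.H i j ≤ D.J i j := by
  unfold H J
  simp only [D.avg_G_sq]
  gcongr
  exact D.gset_subset i j _

open Classical in
/-- The contribution of a node at a frequency, if good. -/
def nterm (i j' κ' : ℕ) (ω : Freq) : ℝ :=
  if ω ∈ D.gset i j' κ' then ‖nsum i (D.cl i ω) j' κ'‖ ^ 2 else 0

lemma sum_nterm (i j' κ' : ℕ) : ∑ ω ∈ tbox D.bigM, D.nterm i j' κ' ω =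
    ∑ ω ∈ D.gset i j' κ', ‖nsum i (D.cl i ω) j' κ'‖ ^ 2 := by
  classical
  unfold nterm
  rw [← Finset.sum_filter]
  refine Finset.sum_congr ?_ fun _ _ => rfl
  rw [Finset.filter_mem_eq_inter, Finset.inter_eq_right.2 (D.gset_subset i j' κ')]

lemma kakeya_pointwise {i j : ℕ} (hij : j ≤ i) (hi : i ≤ n) (κ : ℕ) {ω : Freq} (hω : ω ∈ tbox D.bigM) :
    ‖nsum i (D.cl i ω) j κ‖ ^ 2 ≤
      8 * ∑ j' ∈ Finset.Icc j i, ∑ κ' ∈ ch j' j κ, D.nterm i j' κ' ω := by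
  classical
  set good : ℕ → Finset ℕ := fun j' => (Finset.range (2 ^ j')).filter (fun q => ω ∈ D.gset i j' q)
  have hgood : ∀ j' (Q : Finset ℕ), (∀ q ∈ Q, ω ∈ D.gset i j' q) → Q ⊆ good j' := by
    intro j' Q hQ q hq
    simp only [good, Finset.mem_filter, Finset.mem_range]
    refine ⟨?_, hQ q hq⟩
    obtain ⟨u, hu, rfl⟩ := (Finset.mem_filter.1 (hQ q hq)).2.2
    exact cap_lt (D.convx.mem u hu) _
  set act := (ch i j κ).filter (fun l => ω ∈ D.Dg i l)
  obtain ⟨j₁, a1, b1, K₁, c1, g1, v1⟩ := D.class_cover hij hi hω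
    (act.filter (fun l => 0 ≤ bco (D.rep i l) ω))
    ((Finset.filter_subset _ _).trans (Finset.filter_subset _ _))
    (fun l hl => (Finset.mem_filter.1 (Finset.mem_filter.1 hl).1).2)
    (Or.inl fun l hl => (Finset.mem_filter.1 hl).2)
  obtain ⟨j₂, a2, b2, K₂, c2, g2, v2⟩ := D.class_cover hij hi hω
    (act.filter (fun l => bco (D.rep i l) ω < 0))
    ((Finset.filter_subset _ _).trans (Finset.filter_subset _ _))
    (fun l hl => (Finset.mem_filter.1 (Finset.mem_filter.1 hl).1).2)
    (Or.inr fun l hl => (Finset.mem_filter.1 hl).2)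
  have hcov : ∀ l ∈ ch i j κ, D.cl i ω l ≠ 0 → l / 2 ^ (i - j₁) ∈ K₁ ∨ l / 2 ^ (i - j₂) ∈ K₂ := by
    intro l hl h0
    have hact : l ∈ act := Finset.mem_filter.2 ⟨hl, D.active_spec hω h0⟩
    rcases le_or_gt 0 (bco (D.rep i l) ω) with h | h
    · exact Or.inl (v1 l (Finset.mem_filter.2 ⟨hact, h⟩))
    · exact Or.inr (v2 l (Finset.mem_filter.2 ⟨hact, h⟩))
  have hfin : ‖∑ l ∈ ch i j κ, D.cl i ω l‖ ^ 2 ≤ 8 * ∑ j' ∈ Finset.Icc j i,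
      ∑ κ' ∈ (ch j' j κ).filter (· ∈ good j'), ‖nsum i (D.cl i ω) j' κ'‖ ^ 2 := by
    rcases le_total j₁ j₂ with h | h
    · exact two_class_bound (D.cl i ω) good K₁ K₂ a1 h b2 c1 c2 (hgood _ _ g1) (hgood _ _ g2) hcov
    · exact two_class_bound (D.cl i ω) good K₂ K₁ a2 h b1 c2 c1 (hgood _ _ g2) (hgood _ _ g1)
        (fun l hl h0 => (hcov l hl h0).symm)
  refine hfin.trans ?_
  gcongr with j' _
  rw [Finset.sum_filter]
  refine Finset.sum_le_sum fun κ' _ => ?_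
  unfold nterm
  split_ifs with h1 h2 h2
  · exact le_rfl
  · exact absurd (Finset.mem_filter.1 h1).2 h2
  · exact sq_nonneg _
  · exact le_rfl

lemma J_le_sum_H {i j : ℕ} (hij : j ≤ i) (hi : i ≤ n) :
    D.J i j ≤ 8 * ∑ j' ∈ Finset.Icc j i, D.H i j' := by
  have hH : ∀ j', D.H i j' = ∑ κ' ∈ Finset.range (2 ^ j'), ∑ ω ∈ tbox D.bigM, D.nterm i j' κ' ω := by
    intro j'; unfold H; simp only [D.sum_nterm]
  simp only [hH]
  rw [← sum_nodes_swap]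
  unfold J
  refine Finset.sum_le_sum fun κ _ => ?_
  rw [D.avg_G_sq]
  exact Finset.sum_le_sum fun ω hω => D.kakeya_pointwise hij hi κ hω

end CoreData

lemma card_ch_le (i j κ : ℕ) : (ch i j κ).card ≤ 2 ^ (i - j) := by
  have : ch i j κ ⊆ Finset.Ico (κ * 2 ^ (i - j)) ((κ + 1) * 2 ^ (i - j)) := by
    intro l hl
    rw [mem_ch] at hl
    rw [Finset.mem_Ico]
    obtain ⟨_, rfl⟩ := hl
    exact ⟨Nat.div_mul_le_self _ _, by
      have h1 := Nat.div_add_mod l (2 ^ (i - j))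
      have h2 := Nat.mod_lt l (show 0 < 2 ^ (i - j) by positivity)
      rw [add_mul, one_mul, mul_comm]; omega⟩
  refine (Finset.card_le_card this).trans ?_
  rw [Nat.card_Ico, add_mul, one_mul, Nat.add_sub_cancel_left]

lemma ch_self {i κ : ℕ} (h : κ < 2 ^ i) : ch i i κ = {κ} := by
  ext l; rw [mem_ch]; simp only [Nat.sub_self, pow_zero, Nat.div_one, Finset.mem_singleton]
  constructor
  · rintro ⟨_, h⟩; exact h
  · rintro rfl; exact ⟨h, rfl⟩

/-- Covering a convex body by translates of its half. -/
lemma card_body_le (φ ψ : ℝ → ℝ) (v : ℝ) {A B C : ℝ} (hA : 0 < A) (hB : 0 < B) (hC : 0 < C)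
    (Q U : Finset Freq) (hQ : ∀ q ∈ Q, body φ ψ v (2 * A) (2 * B) (2 * C) q)
    (hU : ∀ q, body φ ψ v A B C q → q ∈ U) : (Q.card : ℝ) ≤ 125 * U.card := by
  classical
  set T : Finset (ℤ × ℤ × ℤ) := Finset.Icc (-2) 2 ×ˢ Finset.Icc (-2) 2 ×ˢ Finset.Icc (-2) 2
  set m : Freq → ℤ × ℤ × ℤ := fun q => (⌊(q.1 : ℝ) / A⌋, ⌊bco v q / B⌋, ⌊cco φ ψ v q / C⌋)
  have hfl : ∀ x y : ℝ, 0 < y → |x| ≤ 2 * y → ⌊x / y⌋ ∈ Finset.Icc (-2 : ℤ) 2 := by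
    intro x y hy h
    rw [Finset.mem_Icc, Int.le_floor, ← Int.lt_add_one_iff, Int.floor_lt]
    rw [abs_le] at h
    push_cast
    rw [le_div_iff₀ hy, div_lt_iff₀ hy]
    constructor <;> linarith
  have hmaps : ∀ q ∈ Q, m q ∈ T := by
    intro q hq
    obtain ⟨a, b, c⟩ := hQ q hq
    simp only [T, m, Finset.mem_product]
    exact ⟨hfl _ _ hA a, hfl _ _ hB b, hfl _ _ hC c⟩
  have hdiff : ∀ x x' y : ℝ, 0 < y → ⌊x / y⌋ = ⌊x' / y⌋ → |x - x'| ≤ y := by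
    intro x x' y hy h
    have := Int.abs_sub_lt_one_of_floor_eq_floor h
    rw [← sub_div, abs_div, abs_of_pos hy, div_lt_one hy] at this
    exact this.le
  have hfib : ∀ p ∈ T, (Q.filter (fun q => m q = p)).card ≤ U.card := by
    intro p _
    rcases (Q.filter (fun q => m q = p)).eq_empty_or_nonempty with h | ⟨q₀, h₀⟩
    · rw [h]; simp
    · refine Finset.card_le_card_of_injOn (fun q => q - q₀) ?_ ?_
      · intro q hq
        rw [Finset.mem_coe, Finset.mem_filter] at hq
        rw [Finset.mem_filter] at h₀
        have e := hq.2.trans h₀.2.symm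
        simp only [m, Prod.mk.injEq] at e
        refine hU _ ⟨?_, ?_, ?_⟩
        · simp only [Prod.fst_sub]; push_cast; exact hdiff _ _ _ hA e.1
        · rw [bco_sub]; exact hdiff _ _ _ hB e.2.1
        · rw [cco_sub]; exact hdiff _ _ _ hC e.2.2
      · intro a _ b _ h; exact sub_left_injective h
  have h1 := Finset.card_le_mul_card_image_of_maps_to hmaps U.card hfib
  have h2 : T.card = 125 := by simp [T, Finset.card_product]
  rw [h2] at h1
  have : (Q.card : ℝ) ≤ ((U.card * 125 : ℕ) : ℝ) := by exact_mod_cast h1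
  push_cast at this; linarith

namespace CoreData
variable {n k N : ℕ} {K : ℝ} (D : CoreData n k N K)

lemma J_le_diag (i j : ℕ) (hij : j ≤ i) : D.J i j ≤ 2 ^ (i - j) * D.J i i := by
  have e : D.J i i = ∑ l ∈ Finset.range (2 ^ i), avg (fun x => (‖D.f i l x‖ ^ 2) ^ 2) := by
    unfold J
    refine Finset.sum_congr rfl fun l hl => ?_
    congr 1; ext x
    rw [G, ch_self (Finset.mem_range.1 hl), Finset.sum_singleton]
  rw [e, ← sum_ch hij]
  unfold J
  rw [Finset.mul_sum]
  refine Finset.sum_le_sum fun κ _ => ?_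
  rw [← avg_sum, ← avg_const_mul]
  refine avg_mono fun x => ?_
  unfold G
  refine (sq_sum_le_card_mul_sum_sq).trans ?_
  have := card_ch_le i j κ
  gcongr
  exact_mod_cast this

lemma mem_tbox_of_coordLe {ω : Freq} (h : coordLe (3000 * K ^ 4 * 4 ^ n) ω) : ω ∈ tbox D.bigM := by
  rw [mem_tbox]
  have key : ∀ z : ℤ, |(z : ℝ)| ≤ 3000 * K ^ 4 * 4 ^ n → |(z : ℝ)| ≤ D.bigM := by
    intro z hz
    have h2 : ((z.natAbs : ℕ) : ℝ) ≤ 3000 * K ^ 4 * 4 ^ n := by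
      rw [Nat.cast_natAbs, Int.cast_abs]; exact hz
    have h3 : z.natAbs ≤ D.bigM := Nat.le_floor h2
    rw [← Int.cast_abs, ← Nat.cast_natAbs]
    exact_mod_cast h3
  exact ⟨key _ h.1, key _ h.2.1, key _ h.2.2⟩

open Classical in
/-- The doubled frequency set of a node. -/
def Qs (i j κ : ℕ) : Finset Freq := (tbox D.bigM).filter (fun ω => D.nbody 2 i j κ ω)

lemma Qs_sub {i j κ : ℕ} : ∀ a ∈ D.Qs i j κ, ∀ b ∈ D.Qs i j κ, a - b ∈ fbox N := by
  classical
  intro a ha b hb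
  exact D.tbox_sub_fbox (Finset.mem_filter.1 ha).1 (Finset.mem_filter.1 hb).1

lemma Qs_nonempty (i j κ : ℕ) : (D.Qs i j κ).Nonempty := by
  classical
  refine ⟨0, Finset.mem_filter.2 ⟨?_, ?_⟩⟩
  · rw [mem_tbox]; simp [coordLe]
  · have := D.rad_pos i
    have := D.convx.pos
    refine ⟨?_, ?_, ?_⟩ <;> simp [bco, cco] <;> positivity

lemma rad_mul_le {i j : ℕ} (hij : j ≤ i) : D.rad i * 4 ^ j ≤ 4 ^ n := by
  rw [D.rad_eq' i]
  have := D.rad_pos i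
  gcongr
  norm_num

lemma rad_le {i j : ℕ} : D.rad i ≤ D.rad i * 2 ^ j :=
  le_mul_of_one_le_right (D.rad_pos i).le (one_le_pow₀ (by norm_num))

lemma rad_two_le {i j : ℕ} : D.rad i * 2 ^ j ≤ D.rad i * 4 ^ j := by
  have := D.rad_pos i
  gcongr
  norm_num

lemma nbody_coord {i j : ℕ} (hij : j ≤ i) {u : ℝ} (hu : u ∈ D.Λ) {ω : Freq}
    (h : D.nbody 2 i j (cap j u) ω) : coordLe (3000 * K ^ 4 * 4 ^ n) ω := by
  have hr := (D.rep_spec (j := j) hu).1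
  obtain ⟨h1, h2, h3⟩ := h
  set v := D.rep j (cap j u)
  have hv := D.convx.mem v hr
  have hφ := D.convx.phi_le v hr
  have hψ := D.convx.psi_le v hr
  have hK := D.convx.one_le
  have hK0 := D.convx.pos
  set X := 1000 * K ^ 3 * 4 ^ n with hX
  have hX0 : 0 < X := by positivity
  have l1 := D.rad_mul_le hij
  have l2 := D.rad_two_le (i := i) (j := j)
  have l3 := D.rad_le (i := i) (j := j)
  have hk3 : 0 ≤ 2 * (500 * K ^ 3) := by positivity
  have a1 : |(ω.1 : ℝ)| ≤ X := h1.trans ((mul_le_mul_of_nonneg_left l1 hk3).trans (le_of_eq (by rw [hX]; ring)))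
  have a2 : |bco v ω| ≤ X :=
    h2.trans ((mul_le_mul_of_nonneg_left (l2.trans l1) hk3).trans (le_of_eq (by rw [hX]; ring)))
  have a3 : |cco D.φ D.ψ v ω| ≤ X :=
    h3.trans ((mul_le_mul_of_nonneg_left (l3.trans (l2.trans l1)) hk3).trans (le_of_eq (by rw [hX]; ring)))
  have e : 3000 * K ^ 4 * 4 ^ n = 3 * (K * X) := by rw [hX]; ring
  have hKX : X ≤ K * X := le_mul_of_one_le_left hX0.le hK
  rw [e]
  refine ⟨by linarith, ?_, ?_⟩
  · have e1 : (ω.2.1 : ℝ) = bco v ω + v * ω.1 := by simp only [bco]; ring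
    have e2 : |v * ω.1| ≤ 1 * X := by
      rw [abs_mul, abs_of_nonneg hv.1]; exact mul_le_mul hv.2.le a1 (abs_nonneg _) (by norm_num)
    rw [e1]; exact (abs_add_le _ _).trans (by linarith)
  · have e1 : (ω.2.2 : ℝ) = cco D.φ D.ψ v ω + (D.φ v * ω.1 + D.ψ v * bco v ω) := by simp only [cco]; ring
    have e2 : |D.φ v * ω.1| ≤ K * X := by
      rw [abs_mul]; exact mul_le_mul hφ a1 (abs_nonneg _) hK0.le
    have e3 : |D.ψ v * bco v ω| ≤ K * X := by
      rw [abs_mul]; exact mul_le_mul hψ a2 (abs_nonneg _) hK0.le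
    have e4 := abs_add_le (D.φ v * ω.1) (D.ψ v * bco v ω)
    rw [e1]; exact (abs_add_le _ _).trans (by linarith)

lemma nbody_mono {i j κ : ℕ} {ω : Freq} (h : D.nbody 1 i j κ ω) : D.nbody 2 i j κ ω := by
  have := D.rad_pos i
  have := D.convx.pos
  obtain ⟨h1, h2, h3⟩ := h
  refine ⟨h1.trans ?_, h2.trans ?_, h3.trans ?_⟩ <;> gcongr <;> norm_num

/-- Energy at level `i'` averaged against the weights of level `(i, j)`. -/
def Qf (i' i j : ℕ) : ℝ :=
  ∑ κ ∈ Finset.range (2 ^ j), avg (fun x => wavg (ech N) (D.Qs i j κ) (D.G i' j κ) x ^ 2)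

lemma H_le_Qf {i j : ℕ} (hij : j ≤ i) : D.H i j ≤ 125 ^ 2 * D.Qf i i j := by
  classical
  unfold H Qf
  rw [Finset.mul_sum]
  refine Finset.sum_le_sum fun κ _ => ?_
  by_cases hκ : ∃ u ∈ D.Λ, cap j u = κ
  swap
  · have : D.gset i j κ = ∅ := by
      unfold gset; simp [hκ]
    rw [this, Finset.sum_empty]
    have := avg_nonneg (f := fun x => wavg (ech N) (D.Qs i j κ) (D.G i j κ) x ^ 2) (fun x => sq_nonneg _)
    positivity
  obtain ⟨u, hu, rfl⟩ := hκ
  simp only [← D.fc_G]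
  have hr := D.rad_pos i
  have hK0 := D.convx.pos
  have hmem : ∀ ω, D.nbody 1 i j (cap j u) ω → ω ∈ D.gset i j (cap j u) := fun ω hω =>
    Finset.mem_filter.2 ⟨D.mem_tbox_of_coordLe (D.nbody_coord hij hu (D.nbody_mono hω)), hω, u, hu, rfl⟩
  have hbox := D.gset_subset i j (cap j u)
  refine sum_fc_le_wavg D.isChar (D.gset i j (cap j u)) 125 (by norm_num) ?_ ?_ ?_ ?_ ?_ _
  · exact fun a ha b hb => D.tbox_sub_fbox (hbox ha) (hbox hb)
  · intro a ha b hb ω hω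
    have h1 := mem_tbox.1 (Finset.mem_filter.1 ha).1
    have h2 := mem_tbox.1 (Finset.mem_filter.1 hb).1
    have h3 := mem_tbox.1 (hbox hω)
    refine ((h1.sub h2).sub h3).mem_fbox ?_
    have := D.bigM_le
    have h2 := D.le_N
    have : 0 < K ^ 4 * 4 ^ n := by positivity
    linarith
  · intro ω hω
    exact Finset.mem_filter.2 ⟨hbox hω, D.nbody_mono (Finset.mem_filter.1 hω).2.1⟩
  · intro a ha b hb
    have h1 := (Finset.mem_filter.1 ha).2.1
    have h2 := (Finset.mem_filter.1 hb).2.1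
    have h3 : D.nbody 2 i j (cap j u) (a + b) := by
      obtain ⟨p1, p2, p3⟩ := h1
      obtain ⟨q1, q2, q3⟩ := h2
      refine ⟨?_, ?_, ?_⟩
      · simp only [Prod.fst_add]; push_cast; exact (abs_add_le _ _).trans (by linarith)
      · rw [bco_add]; exact (abs_add_le _ _).trans (by linarith)
      · rw [cco_add]; exact (abs_add_le _ _).trans (by linarith)
    exact Finset.mem_filter.2 ⟨D.mem_tbox_of_coordLe (D.nbody_coord hij hu h3), h3⟩
  · refine card_body_le D.φ D.ψ (D.rep j (cap j u)) (A := 1 * (500 * K ^ 3) * (D.rad i * 4 ^ j))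
      (B := 1 * (500 * K ^ 3) * (D.rad i * 2 ^ j)) (C := 1 * (500 * K ^ 3) * D.rad i)
      (by positivity) (by positivity) (by positivity) _ _ ?_ hmem
    intro q hq
    have := (Finset.mem_filter.1 hq).2
    unfold nbody at this
    simpa only [← mul_assoc, mul_one] using this

/-- Overlap number in the refinement step. -/
def mR (K : ℝ) : ℕ := ⌈2 + 4000 * K ^ 3⌉₊

/-- Loss in the refinement step. -/
def cR (K : ℝ) : ℝ := ((2 * (mR K + 1) + 1 : ℕ) : ℝ)

lemma le_mR (K : ℝ) : 2 + 4000 * K ^ 3 ≤ mR K := Nat.le_ceil _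

lemma one_le_cR (K : ℝ) : 1 ≤ cR K := by unfold cR; norm_cast; omega

lemma refine_caps {i i' j κ l : ℕ} (hij : j ≤ i) (hii : i ≤ i') (h1 : i' + j ≤ 2 * i) (h2 : i' ≤ 2 * n)
    (hl : l ∈ ch i j κ) (x : Grid N) :
    avg (fun y => ‖D.f i l y‖ ^ 2 * wgt (ech N) (D.Qs i j κ) x y) ≤
      cR K * ∑ l' ∈ ch i' i l, avg (fun y => ‖D.f i' l' y‖ ^ 2 * wgt (ech N) (D.Qs i j κ) x y) := by
  classical
  refine D.schur_caps hii _ (fun y => wgt_nonneg x y) _ (wgt_spec D.isChar x) (X := 6000 * K ^ 4 * 4 ^ n) ?_ ?_ ?_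
  · have h2 := D.le_N
    have h3 := D.K_pow_le
    have := D.convx.pos
    have : 0 < K ^ 4 * 4 ^ n := by positivity
    linarith
  · rintro _ ⟨q, hq, q', hq', rfl⟩
    have h1 := mem_tbox.1 (Finset.mem_filter.1 hq).1
    have h2 := mem_tbox.1 (Finset.mem_filter.1 hq').1
    have := D.bigM_le
    exact (h1.sub h2).mono (by linarith)
  · rintro u₁ m₁ u₂ m₂ c₁ c₂ ξ₁ s₁ ξ₂ s₂ _ ⟨q, hq, q', hq', rfl⟩ h0
    have hκ : cap j u₂ = κ := by rw [← cap_div hij, c₂]; exact (mem_ch.1 hl).2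
    have hrep := D.rep_spec (j := j) m₂
    rw [hκ] at hrep
    have hd := abs_sub_le_of_cap_eq (D.convx.mem _ m₂).1 (D.convx.mem _ hrep.1).1 (hκ.trans hrep.2.symm)
    obtain ⟨a1, b1, _⟩ := (Finset.mem_filter.1 hq).2
    obtain ⟨a2, b2, _⟩ := (Finset.mem_filter.1 hq').2
    have e : ξ₁ - ξ₂ = q' - q := by
      have : ξ₁ - ξ₂ = -(q - q') := eq_neg_of_add_eq_zero_left h0
      rw [this]; abel
    have hr := D.rad_pos i
    have hK0 := D.convx.pos
    have hg := refine_geom (v := D.rep j κ) s₁ s₂ hd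
      (A := 2000 * K ^ 3 * (D.rad i * 4 ^ j)) (B := 2000 * K ^ 3 * (D.rad i * 2 ^ j))
      (by rw [e]; simp only [Prod.fst_sub]; push_cast
          exact (abs_sub _ _).trans (by linarith))
      (by rw [e, bco_sub]; exact (abs_sub _ _).trans (by linarith))
    have hp : (0 : ℝ) < 2 ^ i' := by positivity
    have e3 : ((2 : ℝ) ^ j)⁻¹ * (2000 * K ^ 3 * (D.rad i * 4 ^ j)) = 2000 * K ^ 3 * (D.rad i * 2 ^ j) := by
      rw [show (4 : ℝ) ^ j = 2 ^ j * 2 ^ j by rw [← mul_pow]; norm_num]; field_simp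
    rw [e3] at hg
    have e4 : (2 : ℝ) ^ i' * (D.rad i * 2 ^ j) ≤ 4 ^ n := by
      rw [D.rad_eq' i]
      have : (2 : ℝ) ^ i' * 2 ^ j ≤ 4 ^ i := by
        rw [← pow_add, show (4 : ℝ) = 2 ^ 2 by norm_num, ← pow_mul]
        exact pow_le_pow_right₀ (by norm_num) h1
      calc (2 : ℝ) ^ i' * (D.rad i * 2 ^ j) = D.rad i * ((2 : ℝ) ^ i' * 2 ^ j) := by ring
        _ ≤ _ := by gcongr
    have e5 : (2 : ℝ) ^ i' ≤ 4 ^ n := by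
      rw [show (4 : ℝ) = 2 ^ 2 by norm_num, ← pow_mul]
      exact pow_le_pow_right₀ (by norm_num) h2
    have hR : (0 : ℝ) < 4 ^ n := by positivity
    rw [← div_eq_mul_inv, le_div_iff₀ hp]
    refine le_trans ?_ (le_mR K)
    refine le_of_mul_le_mul_right ?_ hR
    calc |u₁ - u₂| * 2 ^ i' * 4 ^ n = (|u₁ - u₂| * 4 ^ n) * 2 ^ i' := by ring
      _ ≤ (2 + 2000 * K ^ 3 * (D.rad i * 2 ^ j) + 2000 * K ^ 3 * (D.rad i * 2 ^ j)) * 2 ^ i' := by gcongr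
      _ = 2 * 2 ^ i' + 4000 * K ^ 3 * (2 ^ i' * (D.rad i * 2 ^ j)) := by ring
      _ ≤ 2 * 4 ^ n + 4000 * K ^ 3 * 4 ^ n := by gcongr
      _ = _ := by ring

lemma wavg_G (i' i j κ : ℕ) (x : Grid N) : wavg (ech N) (D.Qs i j κ) (D.G i' j κ) x =
    ∑ l ∈ ch i' j κ, avg (fun y => ‖D.f i' l y‖ ^ 2 * wgt (ech N) (D.Qs i j κ) x y) := by
  unfold wavg G
  simp only [Finset.sum_mul, avg_sum]

lemma refine_wavg {i i' j κ : ℕ} (hij : j ≤ i) (hii : i ≤ i') (h1 : i' + j ≤ 2 * i) (h2 : i' ≤ 2 * n)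
    (x : Grid N) : wavg (ech N) (D.Qs i j κ) (D.G i j κ) x ≤
      cR K * wavg (ech N) (D.Qs i j κ) (D.G i' j κ) x := by
  rw [wavg_G, wavg_G, ← sum_ch_ch hij hii, Finset.mul_sum]
  exact Finset.sum_le_sum fun l hl => D.refine_caps hij hii h1 h2 hl x

lemma Qf_refine {i i' j : ℕ} (hij : j ≤ i) (hii : i ≤ i') (h1 : i' + j ≤ 2 * i) (h2 : i' ≤ 2 * n) :
    D.Qf i i j ≤ cR K ^ 2 * D.Qf i' i j := by
  unfold Qf
  rw [Finset.mul_sum]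
  refine Finset.sum_le_sum fun κ _ => ?_
  rw [← avg_const_mul]
  refine avg_mono fun x => ?_
  rw [← mul_pow]
  exact pow_le_pow_left₀ (wavg_nonneg (fun y => D.G_nonneg _ _ _ y) x) (D.refine_wavg hij hii h1 h2 x) 2

lemma Qf_le_J (i' i j : ℕ) : D.Qf i' i j ≤ D.J i' j :=
  Finset.sum_le_sum fun κ _ => avg_wavg_sq_le D.isChar D.Qs_sub (D.Qs_nonempty i j κ) _

/-- Refinement: the good part of the energy is controlled at a finer level. -/
lemma H_le_J_refine {i i' j : ℕ} (hij : j ≤ i) (hii : i ≤ i') (h1 : i' + j ≤ 2 * i) (h2 : i' ≤ 2 * n) :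
    D.H i j ≤ 125 ^ 2 * cR K ^ 2 * D.J i' j := by
  refine (D.H_le_Qf hij).trans ?_
  rw [mul_assoc]
  gcongr
  refine (D.Qf_refine hij hii h1 h2).trans ?_
  gcongr
  exact D.Qf_le_J i' i j

end CoreData

/-- A bound on the number of neighbours in the `L⁴` estimate. -/
def mL (K : ℝ) : ℕ := ⌈14 * K⌉₊

def cL (K : ℝ) : ℕ := 2 * (2 * (mL K + 1) + 1) ^ 2

namespace CoreData
variable {n k N : ℕ} {K : ℝ} (D : CoreData n k N K)

lemma J_diag (i : ℕ) : D.J i i = ∑ l ∈ Finset.range (2 ^ i), avg (fun x => ‖D.f i l x * D.f i l x‖ ^ 2) := by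
  unfold J
  refine Finset.sum_congr rfl fun l hl => ?_
  congr 1; ext x
  rw [G, ch_self (Finset.mem_range.1 hl), Finset.sum_singleton, norm_mul]; ring

lemma l4_node {i i' : ℕ} (h : i ≤ i') (hk : i' ≤ i + k) (hn : i' ≤ n) (l : ℕ) :
    avg (fun x => ‖D.f i l x * D.f i l x‖ ^ 2) ≤ cL K * avg (fun x => D.G i' i l x ^ 2) := by
  classical
  set M := mL K + 1
  set near : ℕ → ℕ → Prop := fun p q => p ≤ q + M ∧ q ≤ p + M
  set s := ch i' i l ×ˢ ch i' i l
  set h' : ℕ × ℕ → Grid N → ℂ := fun p x => D.f i' p.1 x * D.f i' p.2 x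
  set r : ℕ × ℕ → ℕ × ℕ → Prop := fun p q => (near p.1 q.1 ∧ near p.2 q.2) ∨ (near p.1 q.2 ∧ near p.2 q.1)
  have hsplit : ∀ x, D.f i l x * D.f i l x = ∑ p ∈ s, h' p x := by
    intro x
    rw [D.f_split h l x, Finset.sum_mul_sum, ← Finset.sum_product']
  have hcard : ∀ p ∈ s, (s.filter (r p)).card ≤ cL K := by
    intro p _
    have hsub : s.filter (r p) ⊆
        ((ch i' i l).filter (near p.1) ×ˢ (ch i' i l).filter (near p.2)) ∪
        ((ch i' i l).filter (near p.2) ×ˢ (ch i' i l).filter (near p.1)) := by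
      intro q hq
      simp only [s, r, Finset.mem_filter, Finset.mem_product, Finset.mem_union] at hq ⊢
      tauto
    refine (Finset.card_le_card hsub).trans ((Finset.card_union_le _ _).trans ?_)
    rw [Finset.card_product, Finset.card_product]
    have h1 := card_filter_near (ch i' i l) p.1 M
    have h2 := card_filter_near (ch i' i l) p.2 M
    have := Nat.mul_le_mul h1 h2
    have := Nat.mul_le_mul h2 h1
    have e : cL K = 2 * (2 * M + 1) ^ 2 := rfl
    rw [e, two_mul, sq]
    exact Nat.add_le_add ‹_› ‹_›
  have hsymm : ∀ p q, r p q → r q p := by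
    rintro p q (⟨⟨a, b⟩, c, d⟩ | ⟨⟨a, b⟩, c, d⟩)
    · exact Or.inl ⟨⟨b, a⟩, d, c⟩
    · exact Or.inr ⟨⟨d, c⟩, b, a⟩
  have horth : ∀ p ∈ s, ∀ q ∈ s, ¬ r p q →
      avg (fun x => h' p x * (starRingEnd ℂ) (h' q x) * ((fun _ => (1 : ℝ)) x : ℝ)) = 0 := by
    intro p hp q hq hpq
    simp only [Complex.ofReal_one, mul_one]
    have hpr : ∀ a b, (fun x => D.f i' a x * D.f i' b x) ∈ spec (ech N)
        {ω | ∃ ξ₁ ∈ D.Sg i' a, ∃ ξ₂ ∈ D.Sg i' b, ω = ξ₁ + ξ₂} := fun a b =>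
      spec_mul D.isChar (U := {ω | ∃ ξ₁ ∈ D.Sg i' a, ∃ ξ₂ ∈ D.Sg i' b, ω = ξ₁ + ξ₂})
        (fun ξ₁ h1 ξ₂ h2 => ⟨ξ₁, h1, ξ₂, h2, rfl⟩) (D.f_spec i' a) (D.f_spec i' b)
    have hs : (fun x => h' p x * (starRingEnd ℂ) (h' q x)) ∈ spec (ech N)
        {ω | ∃ ξ₁ ∈ D.Sg i' p.1, ∃ ξ₁' ∈ D.Sg i' p.2, ∃ ξ₂ ∈ D.Sg i' q.1, ∃ ξ₂' ∈ D.Sg i' q.2,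
          ω = ξ₁ + ξ₁' - (ξ₂ + ξ₂')} := by
      refine spec_mul D.isChar (T := {ω | ∃ ξ₁ ∈ D.Sg i' q.1, ∃ ξ₂ ∈ D.Sg i' q.2, ω = -(ξ₁ + ξ₂)}) ?_
        (hpr p.1 p.2) (spec_conj D.isChar ?_ (hpr q.1 q.2))
      · rintro _ ⟨a, ha, b, hb, rfl⟩ _ ⟨a', ha', b', hb', rfl⟩
        exact ⟨a, ha, b, hb, a', ha', b', hb', by abel⟩
      · rintro _ ⟨a, ha, b, hb, rfl⟩; exact ⟨a, ha, b, hb, rfl⟩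
    refine avg_eq_zero_of_spec D.isChar ?_ hs
    rintro _ ⟨ξ₁, ⟨u₁, m1, c1, s1⟩, ξ₁', ⟨u₁', m1', c1', s1'⟩, ξ₂, ⟨u₂, m2, c2, s2⟩,
      ξ₂', ⟨u₂', m2', c2', s2'⟩, rfl⟩
    have b1 : coordLe _ ξ₁ := D.sigma_bounds m1 s1
    have b1' : coordLe _ ξ₁' := D.sigma_bounds m1' s1'
    have b2 : coordLe _ ξ₂ := D.sigma_bounds m2 s2
    have b2' : coordLe _ ξ₂' := D.sigma_bounds m2' s2'
    have hK := D.convx.one_le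
    refine ⟨((b1.add b1').sub (b2.add b2')).mem_fbox ?_, fun h0 => hpq ?_⟩
    · refine lt_of_lt_of_le ?_ D.le_N
      have : K ≤ K ^ 4 := le_self_pow₀ hK (by norm_num)
      have h4 : (0 : ℝ) < 4 ^ n := by positivity
      have : K * 4 ^ n ≤ K ^ 4 * 4 ^ n := by gcongr
      have : 0 < K * 4 ^ n := by positivity
      linarith
    · simp only [s, Finset.mem_product, ch, Finset.mem_filter] at hp hq
      have k1 : cap i u₁ = l := by rw [← cap_div h, c1]; exact hp.1.2
      have k1' : cap i u₁' = l := by rw [← cap_div h, c1']; exact hp.2.2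
      have k2 : cap i u₂ = l := by rw [← cap_div h, c2]; exact hq.1.2
      have k2' : cap i u₂' = l := by rw [← cap_div h, c2']; exact hq.2.2
      have hpos : ∀ u ∈ D.Λ, 0 ≤ u := fun u hu => (D.convx.mem u hu).1
      have hall : ∀ x ∈ ({u₁, u₁', u₂, u₂'} : Set ℝ), 0 ≤ x ∧ cap i x = l := by
        rintro x (rfl | rfl | rfl | rfl)
        exacts [⟨hpos _ m1, k1⟩, ⟨hpos _ m1', k1'⟩, ⟨hpos _ m2, k2⟩, ⟨hpos _ m2', k2'⟩]
      have hi : (0 : ℝ) < 2 ^ i' := by positivity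
      have res := D.convx.l4_geom m1 m1' m2 m2' s1 s1' s2 s2' (sub_eq_zero.1 h0)
        (w := ((2 : ℝ) ^ i)⁻¹) (w' := ((2 : ℝ) ^ i')⁻¹)
        (fun x hx y hy => abs_sub_le_of_cap_eq (hall x hx).1 (hall y hy).1
          ((hall x hx).2.trans (hall y hy).2.symm))
        (inv_le_one_of_one_le₀ (one_le_pow₀ (by norm_num))) (by positivity)
        (by gcongr; norm_num)
        (by
          rw [inv_pow, ← pow_mul, mul_comm i', pow_mul, ← div_eq_mul_inv, one_le_div (by positivity)]
          norm_num
          gcongr; norm_num)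
        (by
          rw [inv_pow, inv_pow, ← pow_mul, ← pow_mul, mul_comm i', mul_comm i, pow_mul, pow_mul,
            ← div_eq_mul_inv, inv_le_comm₀ (by positivity) (by positivity), inv_div,
            div_le_iff₀ (by positivity)]
          norm_num
          rw [← pow_add]
          gcongr; norm_num)
      have hm : 14 * K ≤ mL K := Nat.le_ceil _
      have close : ∀ u ∈ D.Λ, ∀ v ∈ D.Λ, |u - v| ≤ 14 * K * ((2 : ℝ) ^ i')⁻¹ →
          near (cap i' u) (cap i' v) := by
        intro u hu v hv huv
        have huv' : |u - v| ≤ mL K * ((2 : ℝ) ^ i')⁻¹ := huv.trans (by gcongr)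
        exact ⟨cap_close (hpos u hu) (hpos v hv) huv',
          cap_close (hpos v hv) (hpos u hu) (by rwa [abs_sub_comm])⟩
      simp only [r, ← c1, ← c1', ← c2, ← c2']
      exact res.imp (fun q => ⟨close _ m1 _ m2 q.1, close _ m1' _ m2' q.2⟩)
        (fun q => ⟨close _ m1 _ m2' q.1, close _ m1' _ m2 q.2⟩)
  have := schur_avg s h' (fun _ => 1) (fun _ => zero_le_one) r hsymm (cL K) hcard horth
  simp only [mul_one, ← hsplit] at this
  refine this.trans (le_of_eq ?_)
  congr 1
  rw [← avg_sum]
  congr 1; ext x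
  simp only [h', G, norm_mul, mul_pow, s]
  rw [sq, Finset.sum_mul_sum, ← Finset.sum_product']

/-- The `L⁴` estimate. -/
lemma J_diag_le {i i' : ℕ} (h : i ≤ i') (hk : i' ≤ i + k) (hn : i' ≤ n) :
    D.J i i ≤ cL K * D.J i' i := by
  rw [J_diag, J, Finset.mul_sum]
  exact Finset.sum_le_sum fun l _ => D.l4_node h hk hn l

end CoreData

namespace CoreData
variable {n k N : ℕ} {K : ℝ} (D : CoreData n k N K)

/-- Frostman and size conditions on the data. -/
structure Frost (q Hb : ℝ) (E : ℝ → ℝ) : Prop where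
  q_pos : 0 < q
  mass : ∀ i ≤ 2 * n, ∀ l, ∑ u ∈ D.Λ.filter (fun u => cap i u = l), D.ν u ≤ q ^ i
  F_le : ∀ u ∈ D.Λ, ∀ x, ‖D.F u x‖ ≤ Hb
  F_sq : ∀ u ∈ D.Λ, avg (fun x => ‖D.F u x‖ ^ 2) ≤ E u

variable {D} {q Hb : ℝ} {E : ℝ → ℝ}

lemma Frost.norm_f_le (h : D.Frost q Hb E) (i l : ℕ) (x : Grid N) :
    ‖D.f i l x‖ ≤ Hb * ∑ u ∈ D.Λ.filter (fun u => cap i u = l), D.ν u := by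
  unfold f
  refine (norm_sum_le _ _).trans ?_
  rw [Finset.mul_sum]
  refine Finset.sum_le_sum fun u hu => ?_
  have hu := (Finset.mem_filter.1 hu).1
  have hν := D.ν_nonneg u hu
  rw [norm_mul, Complex.norm_real, Real.norm_of_nonneg hν, mul_comm]
  exact mul_le_mul_of_nonneg_right (h.F_le u hu x) hν

variable (D) in
lemma mass_nonneg (i l : ℕ) : 0 ≤ ∑ u ∈ D.Λ.filter (fun u => cap i u = l), D.ν u :=
  Finset.sum_nonneg fun u hu => D.ν_nonneg u (Finset.mem_filter.1 hu).1

variable (D) in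
lemma sum_mass_ch {i j : ℕ} (hij : j ≤ i) (κ : ℕ) (g : ℝ → ℝ) :
    ∑ l ∈ ch i j κ, ∑ u ∈ D.Λ.filter (fun u => cap i u = l), g u =
      ∑ u ∈ D.Λ.filter (fun u => cap j u = κ), g u := by
  have hm : ∀ u ∈ D.Λ.filter (fun u => cap j u = κ), cap i u ∈ ch i j κ := by
    intro u hu
    rw [Finset.mem_filter] at hu
    exact mem_ch.2 ⟨cap_lt (D.convx.mem u hu.1) i, by rw [cap_div hij]; exact hu.2⟩
  rw [← Finset.sum_fiberwise_of_maps_to hm]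
  refine Finset.sum_congr rfl fun l' hl' => Finset.sum_congr ?_ fun _ _ => rfl
  ext u
  rw [mem_ch] at hl'
  simp only [Finset.mem_filter]
  constructor
  · rintro ⟨a, c⟩; exact ⟨⟨a, by rw [← cap_div hij, c]; exact hl'.2⟩, c⟩
  · rintro ⟨⟨a, _⟩, c⟩; exact ⟨a, c⟩

lemma Frost.G_le (h : D.Frost q Hb E) {i j : ℕ} (hij : j ≤ i) (hi : i ≤ 2 * n) (κ : ℕ) (x : Grid N) :
    D.G i j κ x ≤ Hb ^ 2 * q ^ (i + j) := by
  have hq := h.q_pos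
  set m : ℕ → ℝ := fun l => ∑ u ∈ D.Λ.filter (fun u => cap i u = l), D.ν u
  have hm0 : ∀ l, 0 ≤ m l := D.mass_nonneg i
  calc D.G i j κ x ≤ ∑ l ∈ ch i j κ, Hb ^ 2 * q ^ i * m l := by
        refine Finset.sum_le_sum fun l _ => ?_
        calc ‖D.f i l x‖ ^ 2 ≤ (Hb * m l) ^ 2 := pow_le_pow_left₀ (norm_nonneg _) (h.norm_f_le i l x) 2
          _ = Hb ^ 2 * (m l * m l) := by ring
          _ ≤ Hb ^ 2 * (q ^ i * m l) := by have := h.mass i hi l; have := hm0 l; gcongr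
          _ = _ := by ring
    _ = Hb ^ 2 * q ^ i * ∑ u ∈ D.Λ.filter (fun u => cap j u = κ), D.ν u := by
        rw [← Finset.mul_sum, D.sum_mass_ch hij]
    _ ≤ Hb ^ 2 * q ^ i * q ^ j := by gcongr; exact h.mass j (hij.trans hi) κ
    _ = _ := by rw [pow_add]; ring

lemma Frost.norm_f_sq_le (h : D.Frost q Hb E) (l : ℕ) (x : Grid N) :
    ‖D.f (2 * n) l x‖ ^ 2 ≤ q ^ (2 * n) *
      ∑ u ∈ D.Λ.filter (fun u => cap (2 * n) u = l), D.ν u * ‖D.F u x‖ ^ 2 := by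
  set S := D.Λ.filter (fun u => cap (2 * n) u = l)
  have hν : ∀ u ∈ S, 0 ≤ D.ν u := fun u hu => D.ν_nonneg u (Finset.mem_filter.1 hu).1
  have h1 : ‖D.f (2 * n) l x‖ ≤ ∑ u ∈ S, D.ν u * ‖D.F u x‖ := by
    unfold f
    refine (norm_sum_le _ _).trans (Finset.sum_le_sum fun u hu => ?_)
    rw [norm_mul, Complex.norm_real, Real.norm_of_nonneg (hν u hu)]
  have h2 : (∑ u ∈ S, D.ν u * ‖D.F u x‖) ^ 2 ≤ (∑ u ∈ S, D.ν u) * ∑ u ∈ S, D.ν u * ‖D.F u x‖ ^ 2 := by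
    refine Finset.sum_sq_le_sum_mul_sum_of_sq_le_mul S hν
      (fun u hu => mul_nonneg (hν u hu) (sq_nonneg _)) (fun u _ => le_of_eq (by ring))
  refine (pow_le_pow_left₀ (norm_nonneg _) h1 2).trans (h2.trans ?_)
  exact mul_le_mul_of_nonneg_right (h.mass _ le_rfl l)
    (Finset.sum_nonneg fun u hu => mul_nonneg (hν u hu) (sq_nonneg _))

lemma Frost.sum_avg_f_le (h : D.Frost q Hb E) {i : ℕ} (hi : i ≤ 2 * n) :
    ∑ l ∈ Finset.range (2 ^ i), avg (fun x => ‖D.f i l x‖ ^ 2) ≤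
      cR K * (q ^ (2 * n) * ∑ u ∈ D.Λ, D.ν u * E u) := by
  have hK := D.convx.one_le
  have hK0 := D.convx.pos
  have step : ∀ l, avg (fun x => ‖D.f i l x‖ ^ 2) ≤
      cR K * ∑ l' ∈ ch (2 * n) i l, avg (fun x => ‖D.f (2 * n) l' x‖ ^ 2) := by
    intro l
    have := D.schur_caps (l := l) (m := mR K) hi (fun _ => 1) (fun _ => zero_le_one) {0} (X := 0) ?_ ?_ ?_ ?_
    · simp only [mul_one] at this; exact this
    · have e : (fun _ : Grid N => ((1 : ℝ) : ℂ)) = ech N 0 := by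
        ext x; rw [D.isChar.zero]; simp
      rw [e]; exact mem_spec rfl
    · have h2 := D.le_N
      have h3 := D.K_pow_le
      have : 0 < K ^ 4 * 4 ^ n := by positivity
      linarith
    · rintro q rfl; simp [coordLe]
    · rintro u₁ m₁ u₂ m₂ _ _ ξ₁ s₁ ξ₂ s₂ _ rfl h0
      rw [add_zero] at h0
      have hg := refine_geom (v := u₂) s₁ s₂ (d := 0) (by simp) (A := 0) (B := 0)
        (by rw [h0]; simp) (by rw [h0]; simp [bco])
      have hp : (0 : ℝ) < 4 ^ n := by positivity
      rw [← div_eq_mul_inv, pow_mul, show ((2 : ℝ) ^ 2) = 4 by norm_num, le_div_iff₀ hp]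
      have := le_mR K
      have : 0 < K ^ 3 := by positivity
      linarith
  have hc : 0 ≤ cR K := zero_le_one.trans (one_le_cR K)
  refine (Finset.sum_le_sum fun l _ => step l).trans ?_
  rw [← Finset.mul_sum, sum_ch hi]
  gcongr
  calc ∑ l ∈ Finset.range (2 ^ (2 * n)), avg (fun x => ‖D.f (2 * n) l x‖ ^ 2)
      ≤ ∑ l ∈ Finset.range (2 ^ (2 * n)), q ^ (2 * n) *
        ∑ u ∈ D.Λ.filter (fun u => cap (2 * n) u = l), D.ν u * avg (fun x => ‖D.F u x‖ ^ 2) := by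
        refine Finset.sum_le_sum fun l _ => ?_
        refine (avg_mono fun x => h.norm_f_sq_le l x).trans (le_of_eq ?_)
        simp only [avg_const_mul, avg_sum]
    _ = q ^ (2 * n) * ∑ u ∈ D.Λ, D.ν u * avg (fun x => ‖D.F u x‖ ^ 2) := by
        rw [← Finset.mul_sum]
        congr 1
        exact Finset.sum_fiberwise_of_maps_to
          (fun u hu => Finset.mem_range.2 (cap_lt (D.convx.mem u hu) _)) _
    _ ≤ _ := by
        have := h.q_pos
        gcongr with u hu
        · exact D.ν_nonneg u hu
        · exact h.F_sq u hu

variable (D) in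
/-- The final bound. -/
def Xb (q Hb : ℝ) (E : ℝ → ℝ) : ℝ := Hb ^ 2 * q ^ (4 * n) * ∑ u ∈ D.Λ, D.ν u * E u

lemma Frost.Xb_nonneg (h : D.Frost q Hb E) : 0 ≤ D.Xb q Hb E := by
  have := h.q_pos
  refine mul_nonneg (by positivity) (Finset.sum_nonneg fun u hu => mul_nonneg (D.ν_nonneg u hu) ?_)
  exact (avg_nonneg fun x => sq_nonneg _).trans (h.F_sq u hu)

lemma Frost.Qf_le (h : D.Frost q Hb E) {j : ℕ} (hj : j ≤ n) :
    D.Qf (2 * n - j) n j ≤ cR K * D.Xb q Hb E := by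
  have hq := h.q_pos
  set i' := 2 * n - j
  have hsup : ∀ κ x, wavg (ech N) (D.Qs n j κ) (D.G i' j κ) x ≤ Hb ^ 2 * q ^ (2 * n) := by
    intro κ x
    have e : Hb ^ 2 * q ^ (2 * n) = avg (fun y => Hb ^ 2 * q ^ (2 * n) * wgt (ech N) (D.Qs n j κ) x y) := by
      rw [avg_const_mul, avg_wgt D.isChar D.Qs_sub (D.Qs_nonempty n j κ), mul_one]
    rw [e]
    refine avg_mono fun y => mul_le_mul_of_nonneg_right ?_ (wgt_nonneg x y)
    have := h.G_le (i := i') (j := j) (by omega) (by omega) κ y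
    rwa [show i' + j = 2 * n by omega] at this
  have h1 : ∀ κ, avg (fun x => wavg (ech N) (D.Qs n j κ) (D.G i' j κ) x ^ 2) ≤
      Hb ^ 2 * q ^ (2 * n) * ∑ l ∈ ch i' j κ, avg (fun x => ‖D.f i' l x‖ ^ 2) := by
    intro κ
    rw [← avg_sum]
    have e := avg_wavg D.isChar D.Qs_sub (D.Qs_nonempty n j κ) (D.G i' j κ)
    have e2 : (fun x => ∑ l ∈ ch i' j κ, ‖D.f i' l x‖ ^ 2) = D.G i' j κ := rfl
    rw [e2, ← e, ← avg_const_mul]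
    refine avg_mono fun x => ?_
    rw [sq]
    exact mul_le_mul_of_nonneg_right (hsup κ x) (wavg_nonneg (fun y => D.G_nonneg _ _ _ y) x)
  unfold Qf
  refine (Finset.sum_le_sum fun κ _ => h1 κ).trans ?_
  rw [← Finset.mul_sum, sum_ch (by omega)]
  refine (mul_le_mul_of_nonneg_left (h.sum_avg_f_le (by omega)) (by positivity)).trans (le_of_eq ?_)
  unfold Xb
  rw [show 4 * n = 2 * n + 2 * n by ring, pow_add]; ring

/-- The top level estimate. -/
lemma Frost.J_top (h : D.Frost q Hb E) {j : ℕ} (hj : j ≤ n) :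
    D.J n j ≤ 8 * 125 ^ 2 * cR K ^ 3 * (n + 1) * D.Xb q Hb E := by
  refine (D.J_le_sum_H hj le_rfl).trans ?_
  have hX := h.Xb_nonneg
  have hc : 0 ≤ cR K := zero_le_one.trans (one_le_cR K)
  have : ∀ j' ∈ Finset.Icc j n, D.H n j' ≤ 125 ^ 2 * cR K ^ 3 * D.Xb q Hb E := by
    intro j' hj'
    rw [Finset.mem_Icc] at hj'
    calc D.H n j' ≤ 125 ^ 2 * D.Qf n n j' := D.H_le_Qf hj'.2
      _ ≤ 125 ^ 2 * (cR K ^ 2 * (cR K * D.Xb q Hb E)) := by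
          gcongr
          refine (D.Qf_refine (i' := 2 * n - j') hj'.2 (by omega) (by omega) (by omega)).trans ?_
          gcongr
          exact h.Qf_le hj'.2
      _ = _ := by ring
  have h2 := Finset.sum_le_card_nsmul _ _ _ this
  rw [nsmul_eq_mul] at h2
  have hcard : ((Finset.Icc j n).card : ℝ) ≤ n + 1 := by
    rw [Nat.card_Icc]; exact_mod_cast Nat.sub_le _ _
  calc 8 * ∑ j' ∈ Finset.Icc j n, D.H n j' ≤ 8 * ((n + 1) * (125 ^ 2 * cR K ^ 3 * D.Xb q Hb E)) := by
        gcongr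
        exact h2.trans (by gcongr)
    _ = _ := by ring

end CoreData

section
open CoreData

/-- The constant in the recursion. -/
def cP (K : ℝ) : ℝ := 8 * 125 ^ 2 * (cR K ^ 3 + cL K)

lemma one_le_cP (K : ℝ) : 1 ≤ cP K := by
  have h1 := one_le_cR K
  have : 1 ≤ cR K ^ 3 := one_le_pow₀ h1
  have : (0 : ℝ) ≤ cL K := Nat.cast_nonneg _
  unfold cP; linarith

namespace CoreData
variable {n k N : ℕ} {K : ℝ} {D : CoreData n k N K} {q Hb : ℝ} {E : ℝ → ℝ}

/-- The recursion over scales. -/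
lemma Frost.recursion (h : D.Frost q Hb E) {k1 : ℕ} (hk1 : 1 ≤ k1) (hk : 1 ≤ k) {B : ℝ} (hB : 1 ≤ B)
    (h1 : cP K * (n + 1) ≤ B ^ k1) (h2 : cP K * (n + 1) * 2 ^ k1 ≤ B ^ k) :
    ∀ d i : ℕ, i + d = n → ∀ j ≤ i,
      D.J i j ≤ (cP K * (n + 1)) ^ 2 * 2 ^ k1 * B ^ d * D.Xb q Hb E := by
  have hX := h.Xb_nonneg
  have hR := one_le_cR K
  have hR0 : 0 ≤ cR K := zero_le_one.trans hR
  have hL : (0 : ℝ) ≤ cL K := Nat.cast_nonneg _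
  have hn1 : (1 : ℝ) ≤ n + 1 := by have : (0 : ℝ) ≤ n := Nat.cast_nonneg _; linarith
  have hn0 : (0 : ℝ) ≤ n + 1 := zero_le_one.trans hn1
  set P := cP K * (n + 1) with hP
  have hP1 : 1 ≤ P := one_le_mul_of_one_le_of_one_le (one_le_cP K) hn1
  have hP0 : 0 ≤ P := zero_le_one.trans hP1
  have hB0 : 0 ≤ B := zero_le_one.trans hB
  have h2k : (1 : ℝ) ≤ 2 ^ k1 := one_le_pow₀ (by norm_num)
  set X := D.Xb q Hb E
  set W := P ^ 2 * 2 ^ k1 with hW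
  have hW0 : 0 ≤ W := by positivity
  have hR3 : cR K ^ 2 ≤ cR K ^ 3 := pow_le_pow_right₀ hR (by norm_num)
  have hR3' : 0 ≤ cR K ^ 3 := by positivity
  have hPR : 8 * (n + 1) * (125 ^ 2 * cR K ^ 2) ≤ P := by
    rw [hP, cP]
    calc 8 * ((n : ℝ) + 1) * (125 ^ 2 * cR K ^ 2) = 8 * 125 ^ 2 * cR K ^ 2 * (n + 1) := by ring
      _ ≤ _ := by gcongr; linarith
  have hPL : 8 * (n + 1) * (cL K : ℝ) ≤ P := by
    rw [hP, cP]
    calc 8 * ((n : ℝ) + 1) * (cL K) = 8 * (cL K : ℝ) * (n + 1) := by ring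
      _ ≤ _ := by gcongr <;> linarith
  have top : ∀ j ≤ n, D.J n j ≤ P * X := by
    intro j hj
    refine (h.J_top hj).trans ?_
    gcongr
    rw [hP, cP]; gcongr; linarith
  intro d
  induction d using Nat.strong_induction_on with
  | _ d ih =>
  intro i hid j hj
  rcases Nat.eq_zero_or_pos d with rfl | hd
  · obtain rfl : i = n := by omega
    refine (top j hj).trans ?_
    gcongr
    rw [pow_zero, mul_one, hW]
    calc P = P * 1 * 1 := by ring
      _ ≤ P * P * 2 ^ k1 := by gcongr
      _ = _ := by ring
  have hBd : 1 ≤ B ^ d := one_le_pow₀ hB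
  have term : ∀ j' ∈ Finset.Icc j i, 8 * (n + 1) * D.H i j' ≤ W * B ^ d * X := by
    intro j' hj'
    rw [Finset.mem_Icc] at hj'
    rcases le_or_gt k1 (i - j') with hc | hc
    · set i' := min (2 * i - j') n with hi'
      have hH := D.H_le_J_refine (i' := i') hj'.2 (by omega) (by omega) (by omega)
      have hJ : P * D.J i' j' ≤ W * B ^ d * X := by
        rcases le_or_gt n (2 * i - j') with hh | hh
        · have : i' = n := by omega
          rw [this]
          calc P * D.J n j' ≤ P * (P * X) := by gcongr; exact top j' (by omega)
            _ = P ^ 2 * 1 * 1 * X := by ring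
            _ ≤ P ^ 2 * 2 ^ k1 * B ^ d * X := by gcongr
        · have e : i' = 2 * i - j' := by omega
          have := ih (d - (i - j')) (by omega) i' (by omega) j' (by omega)
          calc P * D.J i' j' ≤ B ^ (i - j') * (W * B ^ (d - (i - j')) * X) := by
                have := D.J_nonneg i' j'
                gcongr
                exact h1.trans (pow_le_pow_right₀ hB hc)
            _ = W * (B ^ (i - j') * B ^ (d - (i - j'))) * X := by ring
            _ = _ := by rw [← pow_add, Nat.add_sub_cancel' (by omega)]
      calc 8 * (n + 1) * D.H i j' ≤ 8 * (n + 1) * (125 ^ 2 * cR K ^ 2 * D.J i' j') := by gcongr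
        _ = 8 * (n + 1) * (125 ^ 2 * cR K ^ 2) * D.J i' j' := by ring
        _ ≤ P * D.J i' j' := by gcongr; exact D.J_nonneg _ _
        _ ≤ _ := hJ
    · set i' := min (i + k) n with hi'
      have hH : D.H i j' ≤ 2 ^ k1 * (cL K * D.J i' i) := by
        refine (D.H_le_J i j').trans ((D.J_le_diag i j' hj'.2).trans ?_)
        refine mul_le_mul (pow_le_pow_right₀ (by norm_num) hc.le) (D.J_diag_le (by omega) (by omega) (by omega))
          (D.J_nonneg _ _) (by positivity)
      have hJ : P * 2 ^ k1 * D.J i' i ≤ W * B ^ d * X := by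
        rcases le_or_gt n (i + k) with hh | hh
        · have : i' = n := by omega
          rw [this]
          calc P * 2 ^ k1 * D.J n i ≤ P * 2 ^ k1 * (P * X) := by gcongr; exact top i (by omega)
            _ = P ^ 2 * 2 ^ k1 * 1 * X := by ring
            _ ≤ P ^ 2 * 2 ^ k1 * B ^ d * X := by gcongr
        · have e : i' = i + k := by omega
          have := ih (d - k) (by omega) i' (by omega) i (by omega)
          calc P * 2 ^ k1 * D.J i' i ≤ B ^ k * (W * B ^ (d - k) * X) := by
                have := D.J_nonneg i' i
                gcongr
            _ = W * (B ^ k * B ^ (d - k)) * X := by ring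
            _ = _ := by rw [← pow_add, Nat.add_sub_cancel' (by omega)]
      calc 8 * (n + 1) * D.H i j' ≤ 8 * (n + 1) * (2 ^ k1 * (cL K * D.J i' i)) := by gcongr
        _ = 8 * (n + 1) * cL K * (2 ^ k1 * D.J i' i) := by ring
        _ ≤ P * (2 ^ k1 * D.J i' i) := by
            have := D.J_nonneg i' i
            gcongr
        _ = P * 2 ^ k1 * D.J i' i := by ring
        _ ≤ _ := hJ
  have hsum := D.J_le_sum_H hj (by omega : i ≤ n)
  have h3 := Finset.sum_le_card_nsmul _ _ _ term
  rw [nsmul_eq_mul, ← Finset.mul_sum] at h3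
  have hcard : ((Finset.Icc j i).card : ℝ) ≤ n + 1 := by
    rw [Nat.card_Icc]; exact_mod_cast (by omega : i + 1 - j ≤ n + 1)
  have h4 : (n + 1) * (8 * ∑ j' ∈ Finset.Icc j i, D.H i j') ≤ (n + 1) * (W * B ^ d * X) := by
    calc (n + 1) * (8 * ∑ j' ∈ Finset.Icc j i, D.H i j') = 8 * (n + 1) * ∑ j' ∈ Finset.Icc j i, D.H i j' := by ring
      _ ≤ _ := h3.trans (by gcongr)
  exact hsum.trans (le_of_mul_le_mul_left h4 (by linarith))

variable (D) in
lemma J_zero : D.J 0 0 = avg (fun x => ‖∑ u ∈ D.Λ, (D.ν u : ℂ) * D.F u x‖ ^ 4) := by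
  rw [J_diag]
  simp only [pow_zero, Finset.range_one, Finset.sum_singleton]
  congr 1; ext x
  have : D.f 0 0 x = ∑ u ∈ D.Λ, (D.ν u : ℂ) * D.F u x := by
    unfold f
    rw [Finset.filter_true_of_mem]
    intro u hu
    have := cap_lt (D.convx.mem u hu) 0
    omega
  rw [this, norm_mul]; ring

end CoreData

lemma exists_scale {c β κ : ℝ} (hc : 1 ≤ c) (hβ : 0 < β) (hκ : 0 < κ) :
    ∃ n0 : ℕ, ∀ n ≥ n0, ∀ k : ℕ, κ * n ≤ k → ∃ k1 : ℕ, 1 ≤ k1 ∧ 1 ≤ k ∧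
      c * (n + 1) ≤ ((2 : ℝ) ^ β) ^ k1 ∧ c * (n + 1) * 2 ^ k1 ≤ ((2 : ℝ) ^ β) ^ k ∧
      (c * (n + 1)) ^ 2 * 2 ^ k1 * ((2 : ℝ) ^ β) ^ n ≤ (2 : ℝ) ^ (2 * β * n) := by
  set ε := min (β * κ / 4) (β / 4) with hε
  have hε0 : 0 < ε := by positivity
  have hε1 : ε ≤ β * κ / 4 := min_le_left _ _
  have hε2 : ε ≤ β / 4 := min_le_right _ _
  set η := min (β * ε) ε with hη
  have hη0 : 0 < η := by positivity
  have hη1 : η ≤ β * ε := min_le_left _ _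
  have hη2 : η ≤ ε := min_le_right _ _
  have ev : ∀ᶠ n : ℕ in Filter.atTop, c * (n + 1) * 2 ≤ (2 : ℝ) ^ (η * n) := by
    have hr : (1 : ℝ) < (2 : ℝ) ^ η := Real.one_lt_rpow (by norm_num) hη0
    have h1 := tendsto_pow_const_div_const_pow_of_one_lt 1 hr
    have h2 : ∀ᶠ n : ℕ in Filter.atTop, (n : ℝ) ^ 1 / ((2 : ℝ) ^ η) ^ n < 1 / (4 * c) :=
      h1.eventually (gt_mem_nhds (by positivity))
    filter_upwards [h2, Filter.eventually_ge_atTop 1] with n hn hn1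
    have hn1' : (1 : ℝ) ≤ n := by exact_mod_cast hn1
    rw [pow_one, div_lt_div_iff₀ (by positivity) (by positivity)] at hn
    rw [Real.rpow_mul (by norm_num), Real.rpow_natCast]
    nlinarith
  obtain ⟨n0, hn0⟩ := Filter.eventually_atTop.1 ev
  refine ⟨max n0 1, fun n hn k hk => ?_⟩
  have hA := hn0 n ((le_max_left _ _).trans hn)
  have hn1 : (1 : ℝ) ≤ n := by exact_mod_cast (le_max_right _ _).trans hn
  refine ⟨⌊ε * n⌋₊ + 1, by omega, ?_, ?_, ?_, ?_⟩
  · have : (0 : ℝ) < k := lt_of_lt_of_le (by positivity) hk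
    exact_mod_cast this
  · rw [← Real.rpow_natCast, ← Real.rpow_mul (by norm_num)]
    have : ε * n ≤ ((⌊ε * n⌋₊ + 1 : ℕ) : ℝ) := by push_cast; exact (Nat.lt_floor_add_one _).le
    calc c * (n + 1) ≤ c * (n + 1) * 2 := by have : 0 ≤ c * (n + 1 : ℝ) := by positivity
                                             linarith
      _ ≤ (2 : ℝ) ^ (η * n) := hA
      _ ≤ _ := by
        refine Real.rpow_le_rpow_of_exponent_le (by norm_num) ?_
        calc η * n ≤ β * ε * n := by gcongr
          _ = β * (ε * n) := by ring
          _ ≤ _ := by gcongr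
  all_goals
    have hk1 : (2 : ℝ) ^ (⌊ε * n⌋₊ + 1) ≤ 2 * (2 : ℝ) ^ (ε * n) := by
      rw [pow_succ, mul_comm, ← Real.rpow_natCast]
      gcongr
      · norm_num
      · exact Nat.floor_le (by positivity)
  · calc c * (n + 1) * 2 ^ (⌊ε * n⌋₊ + 1) ≤ c * (n + 1) * (2 * (2 : ℝ) ^ (ε * n)) := by gcongr
      _ = c * (n + 1) * 2 * (2 : ℝ) ^ (ε * n) := by ring
      _ ≤ (2 : ℝ) ^ (η * n) * (2 : ℝ) ^ (ε * n) := by gcongr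
      _ = (2 : ℝ) ^ (η * n + ε * n) := by rw [← Real.rpow_add (by norm_num)]
      _ ≤ (2 : ℝ) ^ (β * k) := by
        refine Real.rpow_le_rpow_of_exponent_le (by norm_num) ?_
        have : η * n ≤ β * κ / 4 * n := by gcongr; exact hη2.trans hε1
        have : ε * n ≤ β * κ / 4 * n := by gcongr
        have : β * (κ * n) ≤ β * k := by gcongr
        have : 0 < β * κ * n := by positivity
        linarith
      _ = _ := by rw [Real.rpow_mul (by norm_num), Real.rpow_natCast]
  · calc (c * (n + 1)) ^ 2 * 2 ^ (⌊ε * n⌋₊ + 1) * ((2 : ℝ) ^ β) ^ n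
        ≤ (c * (n + 1)) ^ 2 * (2 * (2 : ℝ) ^ (ε * n)) * ((2 : ℝ) ^ β) ^ n := by gcongr
      _ ≤ (c * (n + 1) * 2) ^ 2 * (2 : ℝ) ^ (ε * n) * ((2 : ℝ) ^ β) ^ n := by
        have : 0 ≤ (c * (n + 1)) ^ 2 * (2 : ℝ) ^ (ε * n) * ((2 : ℝ) ^ β) ^ n := by positivity
        nlinarith
      _ ≤ ((2 : ℝ) ^ (η * n)) ^ 2 * (2 : ℝ) ^ (ε * n) * ((2 : ℝ) ^ β) ^ n := by gcongr
      _ = (2 : ℝ) ^ (η * n + η * n + ε * n + β * n) := by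
        rw [Real.rpow_add (by norm_num), Real.rpow_add (by norm_num), Real.rpow_add (by norm_num), sq,
          Real.rpow_mul (by norm_num) β, Real.rpow_natCast]
      _ ≤ _ := by
        refine Real.rpow_le_rpow_of_exponent_le (by norm_num) ?_
        have : η * n ≤ β / 4 * n := by gcongr; exact hη2.trans hε2
        have : ε * n ≤ β / 4 * n := by gcongr
        have : 0 < β * n := by positivity
        linarith

/-- The main `L⁴` estimate. -/
theorem CoreData.main_L4 (K : ℝ) {β κ : ℝ} (hβ : 0 < β) (hκ : 0 < κ) :
    ∃ n0 : ℕ, ∀ n ≥ n0, ∀ k N : ℕ, κ * n ≤ k → ∀ (D : CoreData n k N K) (q Hb : ℝ) (E : ℝ → ℝ),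
      D.Frost q Hb E → avg (fun x => ‖∑ u ∈ D.Λ, (D.ν u : ℂ) * D.F u x‖ ^ 4) ≤
        (2 : ℝ) ^ (β * n) * (Hb ^ 2 * q ^ (4 * n) * ∑ u ∈ D.Λ, D.ν u * E u) := by
  obtain ⟨n0, hn0⟩ := exists_scale (one_le_cP K) (half_pos hβ) hκ
  refine ⟨n0, fun n hn k N hk D q Hb E h => ?_⟩
  obtain ⟨k1, a1, a2, a3, a4, a5⟩ := hn0 n hn k hk
  rw [← D.J_zero]
  refine (h.recursion a1 a2 (Real.one_le_rpow (by norm_num) (by positivity)) a3 a4 n 0 (by omega) 0 le_rfl).trans ?_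
  refine mul_le_mul_of_nonneg_right (a5.trans (le_of_eq ?_)) h.Xb_nonneg
  congr 1; ring
end

/-- The Fejér kernel. -/
def fej (D : ℕ) (t : ℝ) : ℝ := (D : ℝ)⁻¹ * ‖∑ a ∈ Finset.range D, eR (a * t)‖ ^ 2

/-- The tent multiplier of width `D`. -/
def hat (D : ℕ) (r : ℤ) : ℝ := max 0 (1 - |(r : ℝ)| / D)

lemma fej_nonneg (D : ℕ) (t : ℝ) : 0 ≤ fej D t := by unfold fej; positivity

lemma hat_nonneg (D : ℕ) (r : ℤ) : 0 ≤ hat D r := le_max_left _ _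

lemma hat_le_one (D : ℕ) (r : ℤ) : hat D r ≤ 1 := by
  unfold hat; exact max_le zero_le_one (by simp; positivity)

lemma hat_zero (D : ℕ) : hat D 0 = 1 := by simp [hat]

lemma hat_neg (D : ℕ) (r : ℤ) : hat D (-r) = hat D r := by simp [hat]

lemma hat_eq {D : ℕ} (hD : 0 < D) {r : ℤ} (h : |r| ≤ D) : hat D r = 1 - |(r : ℝ)| / D := by
  unfold hat
  refine max_eq_right ?_
  have : |(r : ℝ)| ≤ D := by exact_mod_cast h
  have hD' : (0 : ℝ) < D := by exact_mod_cast hD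
  rw [sub_nonneg, div_le_one hD']; exact this

lemma hat_eq_zero {D : ℕ} (hD : 0 < D) {r : ℤ} (h : (D : ℤ) ≤ |r|) : hat D r = 0 := by
  unfold hat
  refine max_eq_left ?_
  have : (D : ℝ) ≤ |(r : ℝ)| := by exact_mod_cast h
  have hD' : (0 : ℝ) < D := by exact_mod_cast hD
  rw [sub_nonpos, one_le_div hD']; exact this

lemma card_diff_eq (D : ℕ) (r : ℤ) :
    ((Finset.range D ×ˢ Finset.range D).filter (fun p => (p.1 : ℤ) - p.2 = r)).card = D - r.natAbs := by
  rw [← Finset.card_range (D - r.natAbs)]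
  rcases le_total 0 r with h | h
  · refine Finset.card_nbij' (fun p => p.2) (fun b => (b + r.natAbs, b)) ?_ ?_ ?_ ?_
    · rintro ⟨a, b⟩ hp; simp at hp ⊢; omega
    · rintro b hp; simp at hp ⊢; omega
    · rintro ⟨a, b⟩ hp; simp at hp ⊢; omega
    · rintro b hp; simp
  · refine Finset.card_nbij' (fun p => p.1) (fun b => (b, b + r.natAbs)) ?_ ?_ ?_ ?_
    · rintro ⟨a, b⟩ hp; simp at hp ⊢; omega
    · rintro b hp; simp [abs_of_nonpos h] at hp ⊢; omega
    · rintro ⟨a, b⟩ hp; simp at hp ⊢; omega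
    · rintro b hp; simp

lemma fej_eq {D : ℕ} (hD : 0 < D) (t : ℝ) :
    (fej D t : ℂ) = ∑ r ∈ Finset.Ioo (-(D : ℤ)) D, (hat D r : ℂ) * eR (r * t) := by
  have h1 : ((‖∑ a ∈ Finset.range D, eR (a * t)‖ ^ 2 : ℝ) : ℂ) =
      ∑ p ∈ Finset.range D ×ˢ Finset.range D, eR (((p.1 : ℤ) - (p.2 : ℤ) : ℤ) * t) := by
    rw [Complex.ofReal_pow, ← Complex.mul_conj', map_sum, Finset.sum_mul_sum, Finset.sum_product]
    refine Finset.sum_congr rfl fun a _ => Finset.sum_congr rfl fun b _ => ?_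
    rw [← eR_neg, ← eR_add]; congr 1; push_cast; ring
  have h2 : ∀ p ∈ Finset.range D ×ˢ Finset.range D, ((p.1 : ℤ) - (p.2 : ℤ)) ∈ Finset.Ioo (-(D : ℤ)) D := by
    rintro ⟨a, b⟩ hp; simp at hp ⊢; omega
  rw [fej, Complex.ofReal_mul, h1, ← Finset.sum_fiberwise_of_maps_to h2, Finset.mul_sum]
  refine Finset.sum_congr rfl fun r hr => ?_
  rw [Finset.sum_congr rfl (g := fun _ => eR (r * t))
    (fun p hp => by rw [(Finset.mem_filter.1 hp).2]), Finset.sum_const, card_diff_eq]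
  have hr' : |r| ≤ D := by rw [abs_le]; simp only [Finset.mem_Ioo] at hr; constructor <;> omega
  have hr'' : r.natAbs ≤ D := by rw [abs_le] at hr'; omega
  rw [hat_eq hD hr', nsmul_eq_mul, ← mul_assoc]
  congr 1
  have : (D : ℂ) ≠ 0 := by exact_mod_cast hD.ne'
  push_cast [Nat.cast_sub hr'']
  rw [show ((r.natAbs : ℕ) : ℂ) = ((|(r : ℝ)| : ℝ) : ℂ) by
    rw [show |(r : ℝ)| = ((r.natAbs : ℕ) : ℝ) by rw [Nat.cast_natAbs, Int.cast_abs]]; push_cast; rfl]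
  field_simp

lemma window_eq {D : ℕ} (hD : 0 < D) (c : ℤ) (t : ℝ) :
    ∑ r ∈ Finset.Ioo (c - D) (c + D), (hat D (r - c) : ℂ) * eR (r * t) = eR (c * t) * fej D t := by
  rw [fej_eq hD, Finset.mul_sum]
  refine Finset.sum_nbij' (fun r => r - c) (fun r => r + c) ?_ ?_ ?_ ?_ ?_
  · intro r hr; simp at hr ⊢; omega
  · intro r hr; simp at hr ⊢; omega
  · intro r _; simp
  · intro r _; simp
  · intro r _
    rw [mul_left_comm, ← eR_add]; congr 2; push_cast; ring

lemma avg_ech1_eq {N : ℕ} (hN : 0 < N) {a : ℤ} (h : |a| < N) :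
    avg (ech1 N a) = if a = 0 then 1 else 0 := by
  have := avg_char (isCharSystem_ech1 N hN) a 0 (by simpa using h)
  simp only [(isCharSystem_ech1 N hN).zero, map_one, mul_one] at this
  exact this

lemma avg_eR_mul_fej {N D : ℕ} (hD : 0 < D) {r : ℤ} (h : |r| + D ≤ N) (x : ℝ) :
    avg (fun j : Fin N => eR (r * ((j : ℕ) / N : ℝ)) * fej D (x - ((j : ℕ) / N : ℝ))) =
      hat D r * eR (r * x) := by
  have hN : 0 < N := by have := abs_nonneg r; omega
  have h1 : ∀ j : Fin N, eR (r * ((j : ℕ) / N : ℝ)) * fej D (x - ((j : ℕ) / N : ℝ)) =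
      ∑ ρ ∈ Finset.Ioo (-(D : ℤ)) D, (hat D ρ * eR (ρ * x)) * ech1 N (r - ρ) j := by
    intro j
    rw [fej_eq hD, Finset.mul_sum]
    refine Finset.sum_congr rfl fun ρ _ => ?_
    rw [ech1, mul_left_comm, mul_assoc, ← eR_add, ← eR_add]; congr 2; push_cast; ring
  simp only [h1]
  rw [avg_sum]
  have h2 : ∀ ρ ∈ Finset.Ioo (-(D : ℤ)) D, avg (fun j => (hat D ρ * eR (ρ * x)) * ech1 N (r - ρ) j) =
      if r = ρ then (hat D ρ * eR (ρ * x)) else 0 := by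
    intro ρ hρ
    rw [avg_const_mul, avg_ech1_eq hN (by
      have : |r - ρ| ≤ |r| + |ρ| := abs_sub _ _
      have : |ρ| < D := by rw [abs_lt]; simpa using hρ
      omega)]
    simp [sub_eq_zero]
  rw [Finset.sum_congr rfl h2, Finset.sum_ite_eq]
  split_ifs with h3
  · rfl
  · rw [hat_eq_zero hD (by
      by_contra h4; push Not at h4; rw [abs_lt] at h4; exact h3 (by simpa using h4))]; simp

lemma avg_fej_shift {N D : ℕ} (hD : 0 < D) (h : D ≤ N) (x : ℝ) :
    avg (fun j : Fin N => fej D (x - ((j : ℕ) / N : ℝ))) = 1 := by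
  have := avg_eR_mul_fej hD (r := 0) (N := N) (by simpa using h) x
  simp only [Int.cast_zero, zero_mul, eR_zero, one_mul, hat_zero, mul_one] at this
  rw [avg_ofReal] at this
  exact_mod_cast this

lemma fej_le (D : ℕ) (t : ℝ) : fej D t ≤ D := by
  rcases Nat.eq_zero_or_pos D with rfl | hD
  · simp [fej]
  have : ‖∑ a ∈ Finset.range D, eR (a * t)‖ ≤ D := by
    refine (norm_sum_le _ _).trans ?_
    simp [norm_eR]
  unfold fej
  have hD' : (0 : ℝ) < D := by exact_mod_cast hD
  rw [inv_mul_le_iff₀ hD', ← sq]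
  gcongr

lemma fej_periodic (D : ℕ) (t : ℝ) (l : ℤ) : fej D (t + l) = fej D t := by
  unfold fej
  congr 4
  ext a
  rw [mul_add, eR_add, show (a : ℝ) * (l : ℝ) = ((a * l : ℤ) : ℝ) by push_cast; ring, eR_int, mul_one]

lemma four_mul_abs_le_norm_one_sub_eR {t : ℝ} (h : |t| ≤ 1 / 2) : 4 * |t| ≤ ‖eR t - 1‖ := by
  have h1 : ‖eR t - 1‖ = ‖2 * Real.sin (Real.pi * t)‖ := by
    have := Complex.norm_exp_I_mul_ofReal_sub_one (2 * Real.pi * t)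
    rw [eR, mul_comm _ Complex.I, this]; congr 3; ring
  rw [h1, norm_mul, Real.norm_eq_abs, Real.norm_eq_abs]
  have h2 : |Real.sin (Real.pi * t)| = Real.sin (Real.pi * |t|) := by
    rcases le_total 0 t with h0 | h0
    · rw [abs_of_nonneg h0, abs_of_nonneg]
      rw [abs_of_nonneg h0] at h
      exact Real.sin_nonneg_of_nonneg_of_le_pi (by positivity) (by nlinarith [Real.pi_pos])
    · rw [abs_of_nonpos h0, mul_neg, Real.sin_neg, abs_of_nonpos]
      rw [abs_of_nonpos h0] at h
      exact Real.sin_nonpos_of_nonpos_of_neg_pi_le (by nlinarith [Real.pi_pos]) (by nlinarith [Real.pi_pos])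
  rw [h2]
  have h3 := Real.mul_le_sin (x := Real.pi * |t|) (by positivity) (by nlinarith [Real.pi_pos])
  have : 2 / Real.pi * (Real.pi * |t|) = 2 * |t| := by field_simp
  rw [this] at h3
  simp only [abs_two]; linarith

lemma fej_decay {D : ℕ} {t : ℝ} (h : |t| ≤ 1 / 2) : 4 * D * t ^ 2 * fej D t ≤ 1 := by
  rcases Nat.eq_zero_or_pos D with rfl | hD
  · simp
  have hD' : (0 : ℝ) < D := by exact_mod_cast hD
  have h1 : (∑ a ∈ Finset.range D, eR (a * t)) * (eR t - 1) = eR (D * t) - 1 := by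
    simp only [eR_nat_mul]; exact geom_sum_mul _ _
  have h2 : ‖∑ a ∈ Finset.range D, eR (a * t)‖ * ‖eR t - 1‖ ≤ 2 := by
    rw [← norm_mul, h1]
    refine (norm_sub_le _ _).trans ?_
    rw [norm_eR]; norm_num
  have h3 : ‖∑ a ∈ Finset.range D, eR (a * t)‖ * (4 * |t|) ≤ 2 :=
    (mul_le_mul_of_nonneg_left (four_mul_abs_le_norm_one_sub_eR h) (norm_nonneg _)).trans h2
  have h4 := pow_le_pow_left₀ (by positivity) h3 2
  unfold fej
  rw [mul_pow, mul_pow, sq_abs] at h4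
  have : 4 * (D : ℝ) * t ^ 2 * ((D : ℝ)⁻¹ * ‖∑ a ∈ Finset.range D, eR (a * t)‖ ^ 2) =
    4 * t ^ 2 * ‖∑ a ∈ Finset.range D, eR (a * t)‖ ^ 2 := by field_simp
  rw [this]; linarith

/-- Majorant of the de la Vallée Poussin kernel. -/
def vker (D : ℕ) (t : ℝ) : ℝ := 2 * fej (2 * D) t + fej D t

lemma vker_nonneg (D : ℕ) (t : ℝ) : 0 ≤ vker D t := by
  unfold vker; have := fej_nonneg D t; have := fej_nonneg (2 * D) t; positivity

lemma avg_vker {N D : ℕ} (hD : 0 < D) (h : 2 * D ≤ N) (x : ℝ) :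
    avg (fun j : Fin N => vker D (x - ((j : ℕ) / N : ℝ))) = 3 := by
  unfold vker
  rw [avg_add, avg_const_mul, avg_fej_shift (by omega) h, avg_fej_shift hD (by omega)]
  norm_num

lemma vker_le (D : ℕ) (t : ℝ) : vker D t ≤ 5 * D := by
  have h1 := fej_le (2 * D) t
  have h2 := fej_le D t
  unfold vker; push_cast at h1; linarith

lemma vker_periodic (D : ℕ) (t : ℝ) (l : ℤ) : vker D (t + l) = vker D t := by
  unfold vker; rw [fej_periodic, fej_periodic]

lemma vker_decay {D : ℕ} {t : ℝ} (h : |t| ≤ 1 / 2) : 2 * D * t ^ 2 * vker D t ≤ 1 := by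
  have h1 := fej_decay (D := 2 * D) h
  have h2 := fej_decay (D := D) h
  unfold vker; push_cast at h1; nlinarith

lemma avg_mul_sq_le {X : Type*} [Fintype X] (f w : X → ℝ) (hw : ∀ x, 0 ≤ w x) :
    (avg (fun x => f x * w x)) ^ 2 ≤ avg (fun x => f x ^ 2 * w x) * avg w := by
  have := Finset.sum_sq_le_sum_mul_sum_of_sq_le_mul Finset.univ (r := fun x => f x * w x)
    (f := fun x => f x ^ 2 * w x) (g := w) (fun x _ => mul_nonneg (sq_nonneg _) (hw x)) (fun x _ => hw x)
    (fun x _ => le_of_eq (by ring))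
  simp only [avg] at *
  rw [mul_pow]
  calc _ ≤ _ := mul_le_mul_of_nonneg_left this (by positivity)
    _ = _ := by ring

/-- Pointwise values of trigonometric polynomials are controlled by weighted grid averages. -/
lemma norm_sq_le_avg_vker {ι : Type*} (S : Finset ι) (c : ι → ℂ) (r : ι → ℤ) {D N : ℕ} (hD : 0 < D)
    (hN : 3 * D ≤ N) (hr : ∀ i ∈ S, |r i| ≤ D) (x : ℝ) :
    ‖∑ i ∈ S, c i * eR (r i * x)‖ ^ 2 ≤ 3 * avg (fun j : Fin N =>
      ‖∑ i ∈ S, c i * eR (r i * ((j : ℕ) / N : ℝ))‖ ^ 2 * vker D (x - ((j : ℕ) / N : ℝ))) := by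
  set g : ℝ → ℂ := fun x => ∑ i ∈ S, c i * eR (r i * x) with hg
  have h1 : g x = avg (fun j : Fin N => g ((j : ℕ) / N : ℝ) *
      ((2 * fej (2 * D) (x - ((j : ℕ) / N : ℝ)) - fej D (x - ((j : ℕ) / N : ℝ)) : ℝ) : ℂ)) := by
    simp only [hg, Finset.sum_mul]
    rw [avg_sum]
    refine Finset.sum_congr rfl fun i hi => ?_
    have e1 := avg_eR_mul_fej (N := N) (D := 2 * D) (r := r i) (by omega)
      (by have := hr i hi; push_cast; omega) x
    have e2 := avg_eR_mul_fej (N := N) (D := D) (r := r i) hD (by have := hr i hi; omega) x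
    have e3 : ∀ j : Fin N, c i * eR (r i * ((j : ℕ) / N : ℝ)) *
      ((2 * fej (2 * D) (x - ((j : ℕ) / N : ℝ)) - fej D (x - ((j : ℕ) / N : ℝ)) : ℝ) : ℂ) =
      (2 * c i) * (eR (r i * ((j : ℕ) / N : ℝ)) * fej (2 * D) (x - ((j : ℕ) / N : ℝ))) +
      (-c i) * (eR (r i * ((j : ℕ) / N : ℝ)) * fej D (x - ((j : ℕ) / N : ℝ))) := by
      intro j; push_cast; ring
    simp only [e3]
    rw [avg_add, avg_const_mul, avg_const_mul, e1, e2, hat_eq hD (hr i hi), hat_eq (by omega)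
      (by have := hr i hi; push_cast; omega)]
    have : (D : ℂ) ≠ 0 := by exact_mod_cast hD.ne'
    push_cast
    field_simp
    ring
  have h2 : ‖g x‖ ≤ avg (fun j : Fin N => ‖g ((j : ℕ) / N : ℝ)‖ * vker D (x - ((j : ℕ) / N : ℝ))) := by
    conv_lhs => rw [h1]
    refine (norm_avg_le _).trans (avg_mono fun j => ?_)
    rw [norm_mul, Complex.norm_real, Real.norm_eq_abs]
    refine mul_le_mul_of_nonneg_left ?_ (norm_nonneg _)
    unfold vker
    have := fej_nonneg D (x - ((j : ℕ) / N : ℝ))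
    have := fej_nonneg (2 * D) (x - ((j : ℕ) / N : ℝ))
    rw [abs_le]; constructor <;> linarith
  calc ‖g x‖ ^ 2 ≤ _ := pow_le_pow_left₀ (norm_nonneg _) h2 2
    _ ≤ _ := avg_mul_sq_le _ _ fun j => vker_nonneg _ _
    _ = _ := by rw [avg_vker hD (by omega)]; ring

/-- The piecewise linear interpolation of the characters `t ↦ e(m t)` between integer frequencies. -/
def lerp (ξ t : ℝ) : ℂ :=
  (1 - Int.fract ξ : ℝ) * eR (⌊ξ⌋ * t) + (Int.fract ξ : ℝ) * eR ((⌊ξ⌋ + 1 : ℤ) * t)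

lemma continuous_lerp (ξ : ℝ) : Continuous (lerp ξ) := by
  unfold lerp
  have := continuous_eR
  fun_prop

lemma integral_tent_eR {a : ℝ} (ha : a ≠ 0) :
    ∫ v in (0 : ℝ)..1, ((1 - v : ℝ) * eR (-(v * a)) + (v : ℝ) * eR ((1 - v) * a)) =
      ((Real.sinc (Real.pi * a) ^ 2 : ℝ) : ℂ) := by
  set c : ℂ := 2 * Real.pi * Complex.I * a with hc
  have hc0 : c ≠ 0 := by
    simp [hc, Real.pi_ne_zero, ha, Complex.I_ne_zero]
  have e1 : ∀ v : ℝ, eR (-(v * a)) = Complex.exp (-c * v) := by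
    intro v; rw [eR]; congr 1; rw [hc]; push_cast; ring
  have e2 : ∀ v : ℝ, eR ((1 - v) * a) = Complex.exp (c * (1 - v)) := by
    intro v; rw [eR]; congr 1; rw [hc]; push_cast; ring
  have hd : ∀ v : ℝ, HasDerivAt (fun v : ℝ => -(1 - (v : ℂ)) * Complex.exp (-c * v) / c
      + Complex.exp (-c * v) / c ^ 2 + (-(v : ℂ) * Complex.exp (c * (1 - v)) / c
      - Complex.exp (c * (1 - v)) / c ^ 2))
      ((1 - v : ℝ) * eR (-(v * a)) + (v : ℝ) * eR ((1 - v) * a)) v := by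
    intro v
    have hE : HasDerivAt (fun w : ℂ => Complex.exp (-c * w)) (Complex.exp (-c * v) * -c) (v : ℂ) := by
      have := ((hasDerivAt_id (v : ℂ)).const_mul (-c)).cexp
      simpa using this
    have hE2 : HasDerivAt (fun w : ℂ => Complex.exp (c * (1 - w))) (Complex.exp (c * (1 - v)) * -c) (v : ℂ) := by
      have := (((hasDerivAt_id (v : ℂ)).const_sub 1).const_mul c).cexp
      simpa using this
    have h1 : HasDerivAt (fun w : ℂ => -(1 - w)) 1 (v : ℂ) := by
      have h0 := ((hasDerivAt_id (v : ℂ)).const_sub 1).neg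
      rw [neg_neg] at h0
      exact h0
    have h2 : HasDerivAt (fun w : ℂ => -w) (-1) (v : ℂ) := (hasDerivAt_id (v : ℂ)).neg
    have := (((h1.mul hE).div_const c).add (hE.div_const (c ^ 2))).add
      (((h2.mul hE2).div_const c).sub (hE2.div_const (c ^ 2)))
    have := this.comp_ofReal
    rw [e1, e2]
    convert! this using 1
    push_cast
    field_simp
    ring
  rw [intervalIntegral.integral_eq_sub_of_hasDerivAt (fun v _ => hd v)]
  · have hcos : Complex.exp c + Complex.exp (-c) = 2 * (Real.cos (2 * (Real.pi * a)) : ℂ) := by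
      rw [Complex.ofReal_cos, Complex.cos]
      have h1 : ((2 * (Real.pi * a) : ℝ) : ℂ) * Complex.I = c := by rw [hc]; push_cast; ring
      have h2 : -((2 * (Real.pi * a) : ℝ) : ℂ) * Complex.I = -c := by rw [hc]; push_cast; ring
      rw [h1, h2]; ring
    have hc2 : c ^ 2 = -(4 * (Real.pi * a) ^ 2 : ℝ) := by
      rw [hc]; push_cast; ring_nf; rw [Complex.I_sq]; ring
    have hpa : Real.pi * a ≠ 0 := mul_ne_zero Real.pi_ne_zero ha
    have key : (Complex.exp c + Complex.exp (-c) - 2) / c ^ 2 =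
        ((Real.sinc (Real.pi * a) ^ 2 : ℝ) : ℂ) := by
      rw [hcos, hc2, Real.sinc_of_ne_zero hpa, Real.cos_two_mul, Real.cos_sq']
      have : ((Real.pi * a : ℝ) : ℂ) ≠ 0 := by exact_mod_cast hpa
      push_cast at this ⊢
      field_simp
      ring
    rw [← key]
    push_cast
    simp only [sub_self, mul_zero, Complex.exp_zero, sub_zero, mul_one, neg_zero, zero_mul, zero_div]
    field_simp
    ring
  · refine Continuous.intervalIntegrable ?_ _ _
    have := continuous_eR
    fun_prop

lemma summable_sinc_sq (t : ℝ) : Summable (fun k : ℤ => Real.sinc (Real.pi * (t + k)) ^ 2) := by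
  have h := (Real.summable_one_div_int_add_rpow t 2).2 (by norm_num)
  refine Summable.of_norm_bounded_eventually h ?_
  have hfin : {k : ℤ | t + (k : ℝ) = 0}.Finite :=
    Set.Subsingleton.finite fun k hk l hl => by
      have h1 : t + (k : ℝ) = 0 := hk
      have h2 : t + (l : ℝ) = 0 := hl
      exact_mod_cast (by linarith : (k : ℝ) = l)
  filter_upwards [hfin.compl_mem_cofinite] with k hk
  have hk' : t + (k : ℝ) ≠ 0 := hk
  have hpa : Real.pi * (t + k) ≠ 0 := mul_ne_zero Real.pi_ne_zero hk'
  rw [Real.norm_of_nonneg (sq_nonneg _), Real.sinc_of_ne_zero hpa, div_pow, mul_pow, Real.rpow_two,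
    sq_abs, add_comm (k : ℝ)]
  have h0 : 0 < (t + (k : ℝ)) ^ 2 := by positivity
  rw [div_le_div_iff₀ (by positivity) h0]
  have := Real.sin_sq_le_one (Real.pi * (t + k))
  have hpi : (1 : ℝ) ≤ Real.pi ^ 2 := by nlinarith [Real.pi_gt_three]
  nlinarith

lemma hasSum_tent (t : ℝ) {v : ℝ} (hv : v ∈ Ico (0 : ℝ) 1) :
    HasSum (fun k : ℤ => ((Real.sinc (Real.pi * (t + k)) ^ 2 : ℝ) : ℂ) * eR (v * (t + k)))
      ((1 - v : ℝ) + (v : ℝ) * eR t) := by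
  have : Fact ((0 : ℝ) < 1) := ⟨one_pos⟩
  set f : ℝ → ℂ := fun v => eR (-(v * t)) * ((1 - v : ℝ) + (v : ℝ) * eR t) with hf
  have hfc : Continuous f := by
    have := continuous_eR
    rw [hf]; fun_prop
  have hf01 : f 0 = f 1 := by
    simp only [hf]; simp only [zero_mul, neg_zero, eR_zero, sub_zero, Complex.ofReal_one,
      Complex.ofReal_zero, add_zero, mul_one, one_mul, sub_self, zero_add]
    rw [← eR_add]; simp [eR_zero]
  let F : C(AddCircle (1 : ℝ), ℂ) :=
    ⟨AddCircle.liftIco 1 0 f, AddCircle.liftIco_zero_continuous hf01 hfc.continuousOn⟩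
  have hcoef : ∀ k : ℤ, fourierCoeff F k = ((Real.sinc (Real.pi * (t + k)) ^ 2 : ℝ) : ℂ) := by
    intro k
    rw [fourierCoeff_eq_intervalIntegral _ _ 0, zero_add, div_one, one_smul]
    have h1 : ∫ x in (0 : ℝ)..1, fourier (-k) (x : AddCircle (1 : ℝ)) • F x =
        ∫ v in (0 : ℝ)..1, ((1 - v : ℝ) * eR (-(v * (t + k))) + (v : ℝ) * eR ((1 - v) * (t + k))) := by
      refine intervalIntegral.integral_congr_Ioo_of_le zero_le_one fun x hx => ?_
      have : F (x : AddCircle (1 : ℝ)) = f x :=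
        AddCircle.liftIco_zero_coe_apply (p := (1 : ℝ)) (f := f) (Ioo_subset_Ico_self hx)
      simp only [this, smul_eq_mul]
      rw [fourier_coe_apply]
      have h2 : Complex.exp (2 * Real.pi * Complex.I * ((-k : ℤ) : ℂ) * x / (1 : ℝ)) = eR (-(k * x)) := by
        rw [eR]; congr 1; push_cast; ring
      rw [h2, hf]
      have h3 : eR ((1 - x) * (t + k)) = eR (-(k * x)) * (eR (-(x * t)) * eR t) := by
        rw [← eR_add, ← eR_add, show (1 - x) * (t + k) = (-(k * x) + (-(x * t) + t)) + (k : ℝ) by ring,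
          eR_add, eR_int, mul_one]
      have h4 : eR (-(x * (t + k))) = eR (-(k * x)) * eR (-(x * t)) := by
        rw [← eR_add]; congr 1; ring
      rw [h3, h4]; ring
    rw [h1]
    by_cases ha : t + k = 0
    · rw [ha]; simp [eR_zero]
    · exact integral_tent_eR ha
  have hsum : Summable (fourierCoeff F) := by
    rw [show fourierCoeff F = fun k : ℤ => ((Real.sinc (Real.pi * (t + k)) ^ 2 : ℝ) : ℂ) from funext hcoef]
    exact Complex.hasSum_ofReal.2 (summable_sinc_sq t).hasSum |>.summable
  have h := has_pointwise_sum_fourier_series_of_summable hsum (v : AddCircle (1 : ℝ))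
  have hFv : F (v : AddCircle (1 : ℝ)) = f v := 
    AddCircle.liftIco_zero_coe_apply (p := (1 : ℝ)) (f := f) hv
  rw [hFv] at h
  have h' := h.mul_left (eR (v * t))
  convert! h' using 1
  · ext k
    rw [hcoef, fourier_coe_apply]
    have h2 : Complex.exp (2 * Real.pi * Complex.I * (k : ℂ) * v / (1 : ℝ)) = eR (k * v) := by
      rw [eR]; congr 1; push_cast; ring
    rw [h2, smul_eq_mul, mul_left_comm, ← eR_add]; congr 2; ring
  · rw [hf]; simp only; rw [← mul_assoc, ← eR_add]; simp [eR_zero]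

lemma hasSum_lerp (ξ t : ℝ) :
    HasSum (fun k : ℤ => ((Real.sinc (Real.pi * (t + k)) ^ 2 : ℝ) : ℂ) * eR (ξ * (t + k))) (lerp ξ t) := by
  have h := (hasSum_tent t ⟨Int.fract_nonneg ξ, Int.fract_lt_one ξ⟩).mul_left (eR (⌊ξ⌋ * t))
  convert! h using 1
  · ext k
    rw [mul_left_comm, ← eR_add, show ξ * (t + k) = (⌊ξ⌋ * t + Int.fract ξ * (t + k)) + ((⌊ξ⌋ * k : ℤ) : ℝ) by
      conv_lhs => rw [← Int.floor_add_fract ξ]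
      push_cast; ring]
    rw [eR_add _ ((⌊ξ⌋ * k : ℤ) : ℝ), eR_int, mul_one]
  · rw [lerp]; push_cast
    rw [show ((⌊ξ⌋ : ℝ) + 1) * t = ⌊ξ⌋ * t + t by ring, eR_add]; ring

lemma hasSum_sinc_sq (t : ℝ) : HasSum (fun k : ℤ => Real.sinc (Real.pi * (t + k)) ^ 2) 1 := by
  have h := hasSum_lerp 0 t
  simp only [zero_mul, eR_zero, mul_one, lerp] at h
  simp only [Int.fract_zero, Int.floor_zero, Int.cast_zero, zero_mul, eR_zero] at h
  have := Complex.hasSum_re h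
  simpa only [Complex.ofReal_re, sub_zero, Complex.ofReal_one, one_mul, Complex.ofReal_zero, zero_mul, add_zero, Complex.one_re] using this

lemma lerp_neg (ξ t : ℝ) : lerp (-ξ) t = (starRingEnd ℂ) (lerp ξ t) := by
  refine (hasSum_lerp (-ξ) t).unique ?_
  convert! (hasSum_lerp ξ t).map (starRingEnd ℂ) Complex.continuous_conj using 1
  ext k
  simp only [Function.comp_apply, map_mul, Complex.conj_ofReal]
  rw [← eR_neg]; congr 2; ring

lemma norm_lerp_le (ξ t : ℝ) : ‖lerp ξ t‖ ≤ 1 := by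
  unfold lerp
  refine (norm_add_le _ _).trans ?_
  rw [norm_mul, norm_mul, norm_eR, norm_eR, Complex.norm_real, Complex.norm_real,
    Real.norm_of_nonneg (Int.fract_nonneg ξ), Real.norm_of_nonneg (by linarith [Int.fract_lt_one ξ])]
  linarith

lemma hasSum_sum_lerp (S : Finset ℤ) (p : ℤ → ℂ) (α t w : ℝ) :
    HasSum (fun k : ℤ => ((Real.sinc (Real.pi * (t + k)) ^ 2 : ℝ) : ℂ) *
      ∑ r ∈ S, p r * eR (r * (w + α * (t + k)))) (∑ r ∈ S, p r * lerp (r * α) t * eR (r * w)) := by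
  have h : HasSum (fun k : ℤ => ∑ r ∈ S, (p r * eR (r * w)) *
      (((Real.sinc (Real.pi * (t + k)) ^ 2 : ℝ) : ℂ) * eR (r * α * (t + k))))
      (∑ r ∈ S, (p r * eR (r * w)) * lerp (r * α) t) :=
    hasSum_sum fun r _ => (hasSum_lerp (r * α) t).mul_left _
  convert! h using 1
  · ext k
    rw [Finset.mul_sum]
    refine Finset.sum_congr rfl fun r _ => ?_
    rw [show (r : ℝ) * (w + α * (t + k)) = r * w + r * α * (t + k) by ring, eR_add]; ring
  · exact Finset.sum_congr rfl fun r _ => by ring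

lemma norm_sum_lerp_le (S : Finset ℤ) (p : ℤ → ℂ) {B : ℝ} (α t w : ℝ)
    (h : ∀ z : ℝ, ‖∑ r ∈ S, p r * eR (r * z)‖ ≤ B) :
    ‖∑ r ∈ S, p r * lerp (r * α) t * eR (r * w)‖ ≤ B := by
  have h1 := hasSum_sum_lerp S p α t w
  have h2 := (hasSum_sinc_sq t).mul_right B
  rw [one_mul] at h2
  rw [← h1.tsum_eq]
  refine tsum_of_norm_bounded h2 fun k => ?_
  rw [norm_mul, Complex.norm_real, Real.norm_of_nonneg (sq_nonneg _)]
  exact mul_le_mul_of_nonneg_left (h _) (sq_nonneg _)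

lemma one_fourth_le_sinc_sq {t : ℝ} (ht : |t| ≤ 1 / 2) : 1 / 4 ≤ Real.sinc (Real.pi * t) ^ 2 := by
  have h0 : Real.sinc (Real.pi * t) ^ 2 = Real.sinc (Real.pi * |t|) ^ 2 := by
    rcases abs_cases t with ⟨h, _⟩ | ⟨h, _⟩ <;> rw [h]
    rw [mul_neg, Real.sinc_neg]
  rw [h0]
  by_cases h : t = 0
  · simp [h]; norm_num
  have hpos : 0 < |t| := abs_pos.2 h
  have hp : 0 < Real.pi * |t| := by positivity
  rw [Real.sinc_of_ne_zero hp.ne']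
  have h3 := Real.mul_le_sin (x := Real.pi * |t|) (by positivity) (by nlinarith [Real.pi_pos])
  have h4 : 1 / 2 ≤ Real.sin (Real.pi * |t|) / (Real.pi * |t|) := by
    refine le_trans ?_ ((le_div_iff₀ hp).2 h3)
    rw [div_le_div_iff₀ two_pos Real.pi_pos]; linarith [Real.pi_lt_four]
  nlinarith

lemma re_sum_lerp_ge (S : Finset ℤ) (p : ℤ → ℂ) (α w : ℝ) {t : ℝ} (ht : |t| ≤ 1 / 2)
    (h : ∀ z : ℝ, 0 ≤ (∑ r ∈ S, p r * eR (r * z)).re) :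
    1 / 4 * (∑ r ∈ S, p r * eR (r * (w + α * t))).re ≤
      (∑ r ∈ S, p r * lerp (r * α) t * eR (r * w)).re := by
  have h1 := Complex.hasSum_re (hasSum_sum_lerp S p α t w)
  have h2 := le_hasSum h1 0 (fun k _ => by
    rw [Complex.re_ofReal_mul]; exact mul_nonneg (sq_nonneg _) (h _))
  refine le_trans ?_ h2
  rw [Complex.re_ofReal_mul]
  simp only [Int.cast_zero, add_zero]
  exact mul_le_mul_of_nonneg_right (one_fourth_le_sinc_sq ht) (h _)

lemma avg_prod {X Y : Type*} [Fintype X] [Fintype Y] (f : X × Y → ℝ) :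
    avg f = avg (fun x => avg (fun y => f (x, y))) := by
  simp only [avg, Fintype.sum_prod_type, Fintype.card_prod, ← Finset.mul_sum]
  push_cast
  rw [mul_inv]; ring

/-- Tensor product majorant kernel. -/
def vker3 (D : ℕ) (x : Pt) : ℝ := vker D x.1 * (vker D x.2.1 * vker D x.2.2)

lemma vker3_nonneg (D : ℕ) (x : Pt) : 0 ≤ vker3 D x :=
  mul_nonneg (vker_nonneg _ _) (mul_nonneg (vker_nonneg _ _) (vker_nonneg _ _))

lemma continuous_vker (D : ℕ) : Continuous (vker D) := by
  have := continuous_eR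
  unfold vker fej; fun_prop

lemma continuous_vker3 (D : ℕ) : Continuous (vker3 D) := by
  have := continuous_vker D
  unfold vker3; fun_prop

lemma norm_sq_le_avg_vker3 {ι : Type*} (S : Finset ι) (c : ι → ℂ) (ξ : ι → Freq) {D N : ℕ} (hD : 0 < D)
    (hN : 3 * D ≤ N) (h1 : ∀ i ∈ S, |(ξ i).1| ≤ D) (h2 : ∀ i ∈ S, |(ξ i).2.1| ≤ D)
    (h3 : ∀ i ∈ S, |(ξ i).2.2| ≤ D) (x : Pt) :
    ‖∑ i ∈ S, c i * eP (ξ i) x‖ ^ 2 ≤ 27 * avg (fun g : Grid N =>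
      ‖∑ i ∈ S, c i * eP (ξ i) (gpt g)‖ ^ 2 * vker3 D (x - gpt g)) := by
  set G : ℝ → ℝ → ℝ → ℂ := fun a b d => ∑ i ∈ S, c i * eP (ξ i) (a, b, d) with hG
  have s1 : ∀ a b d, ‖G a b d‖ ^ 2 ≤ 3 * avg (fun j : Fin N =>
      ‖G ((j : ℕ) / N : ℝ) b d‖ ^ 2 * vker D (a - ((j : ℕ) / N : ℝ))) := by
    intro a b d
    have := norm_sq_le_avg_vker S (fun i => c i * eR ((ξ i).2.1 * b + (ξ i).2.2 * d)) (fun i => (ξ i).1) hD hN h1 a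
    have e : ∀ a', G a' b d = ∑ i ∈ S, c i * eR ((ξ i).2.1 * b + (ξ i).2.2 * d) * eR ((ξ i).1 * a') := by
      intro a'
      refine Finset.sum_congr rfl fun i _ => ?_
      rw [eP, mul_assoc, ← eR_add]; congr 2; simp only; ring
    simp only [e]
    exact this
  have s2 : ∀ a b d, ‖G a b d‖ ^ 2 ≤ 3 * avg (fun j : Fin N =>
      ‖G a ((j : ℕ) / N : ℝ) d‖ ^ 2 * vker D (b - ((j : ℕ) / N : ℝ))) := by
    intro a b d
    have := norm_sq_le_avg_vker S (fun i => c i * eR ((ξ i).1 * a + (ξ i).2.2 * d)) (fun i => (ξ i).2.1) hD hN h2 b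
    have e : ∀ b', G a b' d = ∑ i ∈ S, c i * eR ((ξ i).1 * a + (ξ i).2.2 * d) * eR ((ξ i).2.1 * b') := by
      intro b'
      refine Finset.sum_congr rfl fun i _ => ?_
      rw [eP, mul_assoc, ← eR_add]; congr 2; simp only; ring
    simp only [e]
    exact this
  have s3 : ∀ a b d, ‖G a b d‖ ^ 2 ≤ 3 * avg (fun j : Fin N =>
      ‖G a b ((j : ℕ) / N : ℝ)‖ ^ 2 * vker D (d - ((j : ℕ) / N : ℝ))) := by
    intro a b d
    have := norm_sq_le_avg_vker S (fun i => c i * eR ((ξ i).1 * a + (ξ i).2.1 * b)) (fun i => (ξ i).2.2) hD hN h3 d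
    have e : ∀ d', G a b d' = ∑ i ∈ S, c i * eR ((ξ i).1 * a + (ξ i).2.1 * b) * eR ((ξ i).2.2 * d') := by
      intro d'
      refine Finset.sum_congr rfl fun i _ => ?_
      rw [eP, mul_assoc, ← eR_add]
    simp only [e]
    exact this
  obtain ⟨a, b, d⟩ := x
  refine (s1 a b d).trans ?_
  rw [avg_prod, show (27 : ℝ) = 3 * 9 by norm_num, mul_assoc, ← avg_const_mul (9 : ℝ)]
  refine mul_le_mul_of_nonneg_left (avg_mono fun j1 => ?_) zero_le_three
  rw [avg_prod]
  refine (mul_le_mul_of_nonneg_right (s2 _ b d) (vker_nonneg _ _)).trans ?_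
  rw [show (9 : ℝ) = 3 * 3 by norm_num, mul_assoc, mul_assoc, ← avg_const_mul (3 : ℝ), ← avg_mul_const]
  refine mul_le_mul_of_nonneg_left (avg_mono fun j2 => ?_) zero_le_three
  refine (mul_le_mul_of_nonneg_right (mul_le_mul_of_nonneg_right (s3 _ _ d) (vker_nonneg _ _)) (vker_nonneg _ _)).trans ?_
  rw [mul_assoc, mul_assoc, ← avg_mul_const]
  refine mul_le_mul_of_nonneg_left (le_of_eq ?_) zero_le_three
  congr 1; ext j3
  simp only [vker3, gpt, hG, Prod.fst_sub, Prod.snd_sub]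
  ring

/-- The summable weight `1 / (1 + c²)`. -/
def tau (c : ℤ) : ℝ := 1 / (1 + (c : ℝ) ^ 2)

lemma tau_nonneg (c : ℤ) : 0 ≤ tau c := by unfold tau; positivity

lemma summable_tau : Summable tau := by
  have h : Summable (fun c : ℤ => 1 / (c : ℝ) ^ 2) := Real.summable_one_div_int_pow.2 (by norm_num)
  refine Summable.of_norm_bounded_eventually h ?_
  filter_upwards [(finite_singleton (0 : ℤ)).compl_mem_cofinite] with c hc
  have hc' : (c : ℝ) ≠ 0 := by exact_mod_cast (show c ≠ 0 from hc)
  rw [Real.norm_of_nonneg (tau_nonneg c), tau]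
  have : 0 < (c : ℝ) ^ 2 := by positivity
  exact one_div_le_one_div_of_le this (by linarith)

/-- Total mass of `tau`. -/
def tauSum : ℝ := ∑' c, tau c

lemma sum_tau_le (s : Finset ℤ) (d : ℤ) : ∑ c ∈ s, tau (c + d) ≤ tauSum := by
  have h : Summable (fun c => tau (c + d)) := (Equiv.addRight d).summable_iff.2 summable_tau
  refine (h.sum_le_tsum s fun c _ => tau_nonneg _).trans (le_of_eq ?_)
  exact (Equiv.addRight d).tsum_eq tau

lemma vker_le_tau_self {D : ℕ} (hD : 0 < D) {s : ℝ} (h : |s| ≤ 1 / 2) : vker D s ≤ 30 * D * tau ⌊D * s⌋ := by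
  have hD' : (0 : ℝ) < D := by exact_mod_cast hD
  have h1 := vker_le D s
  have h2 := vker_decay (D := D) h
  set X := (D : ℝ) * s with hX
  have h3 : 2 * X ^ 2 * vker D s ≤ D := by
    have := mul_le_mul_of_nonneg_left h2 hD'.le
    calc _ = D * (2 * D * s ^ 2 * vker D s) := by rw [hX]; ring
      _ ≤ _ := by linarith
  have h5 := Int.floor_le X
  have h6 := Int.lt_floor_add_one X
  have h4 : 1 + (⌊X⌋ : ℝ) ^ 2 ≤ 3 * (1 + X ^ 2) := by nlinarith [sq_nonneg (X - 1), sq_nonneg (X + 1)]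
  have hv := vker_nonneg D s
  unfold tau
  rw [mul_one_div, le_div_iff₀ (by positivity)]
  nlinarith

lemma vker_le_tau {D : ℕ} (hD : 0 < D) {s : ℝ} (h1 : -(3 / 2) ≤ s) (h2 : s ≤ 1 / 2) :
    vker D s ≤ 30 * D * (tau ⌊D * s⌋ + tau (⌊D * s⌋ + D)) := by
  have hD' : (0 : ℝ) < D := by exact_mod_cast hD
  rcases le_total (-(1 / 2)) s with h | h
  · refine (vker_le_tau_self hD (abs_le.2 ⟨h, h2⟩)).trans ?_
    gcongr
    linarith [tau_nonneg (⌊D * s⌋ + D)]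
  · have h3 := vker_le_tau_self hD (s := s + 1) (abs_le.2 ⟨by linarith, by linarith⟩)
    have h4 := vker_periodic D s 1
    push_cast at h4
    rw [h4, mul_add, mul_one, show (D : ℝ) * s + D = D * s + ((D : ℤ) : ℝ) by push_cast; rfl, Int.floor_add_intCast] at h3
    refine h3.trans ?_
    gcongr
    linarith [tau_nonneg ⌊D * s⌋]

/-- Measures on the unit box satisfying a Frostman condition. -/
structure BoxMeas (μ : Measure Pt) (t CF : ℝ) : Prop where
  fin : IsFiniteMeasure μ
  CF_nonneg : 0 ≤ CF
  box : ∀ᵐ x ∂μ, |x.1| ≤ 1 / 2 ∧ |x.2.1| ≤ 1 / 2 ∧ |x.2.2| ≤ 1 / 2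
  frost : ∀ x ρ, 0 < ρ → μ.real (closedBall x ρ) ≤ CF * ρ ^ t

lemma abs_sub_le_of_floor {D : ℕ} (hD : 0 < D) {s y : ℝ} {c : ℤ} (h : ⌊D * (s - y)⌋ = c) :
    |s - (c / D + y)| ≤ 1 / D := by
  have hD' : (0 : ℝ) < D := by exact_mod_cast hD
  have h5 := Int.floor_le (D * (s - y))
  have h6 := Int.lt_floor_add_one (D * (s - y))
  rw [h] at h5 h6
  have h7 : (s - (c / D + y)) = (D * (s - y) - c) / D := by field_simp; ring
  rw [h7, abs_div, abs_of_pos hD']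
  gcongr
  rw [abs_le]; constructor <;> linarith

lemma BoxMeas.integral_vker3_le {μ : Measure Pt} {t CF : ℝ} (h : BoxMeas μ t CF) {D N : ℕ} (hD : 0 < D)
    (g : Grid N) :
    ∫ x, vker3 D (x - gpt g) ∂μ ≤ (60 * tauSum) ^ 3 * CF * (D : ℝ) ^ (3 - t) := by
  have := h.fin
  have hD' : (0 : ℝ) < D := by exact_mod_cast hD
  set y := gpt g with hy
  have hy1 : (0 ≤ y.1 ∧ y.1 ≤ 1) ∧ (0 ≤ y.2.1 ∧ y.2.1 ≤ 1) ∧ (0 ≤ y.2.2 ∧ y.2.2 ≤ 1) := by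
    have key : ∀ j : Fin N, 0 ≤ ((j : ℕ) / N : ℝ) ∧ ((j : ℕ) / N : ℝ) ≤ 1 := fun j =>
      ⟨by positivity, div_le_one_of_le₀ (by exact_mod_cast j.2.le) (by positivity)⟩
    exact ⟨key _, key _, key _⟩
  set a : ℤ → ℝ := fun c => 30 * D * (tau c + tau (c + D)) with ha
  have ha0 : ∀ c, 0 ≤ a c := fun c => by
    have := tau_nonneg c; have := tau_nonneg (c + D); simp only [ha]; positivity
  set B : Finset ℤ := Finset.Icc (-2 * (D : ℤ)) D with hB
  have hsum : ∑ c ∈ B, a c ≤ 60 * tauSum * D := by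
    simp only [ha]
    rw [← Finset.mul_sum, Finset.sum_add_distrib]
    have h1 := sum_tau_le B 0
    have h2 := sum_tau_le B D
    simp only [add_zero] at h1
    nlinarith
  have hfl : ∀ s : ℝ, -(3 / 2) ≤ s → s ≤ 1 / 2 → ⌊D * s⌋ ∈ B := by
    intro s h1 h2
    rw [hB, Finset.mem_Icc, Int.le_floor, Int.floor_le_iff]
    push_cast
    constructor <;> nlinarith
  let cell : ℤ × ℤ × ℤ → Set Pt := fun c =>
    {x | ⌊D * (x.1 - y.1)⌋ = c.1 ∧ ⌊D * (x.2.1 - y.2.1)⌋ = c.2.1 ∧ ⌊D * (x.2.2 - y.2.2)⌋ = c.2.2}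
  have hcm : ∀ c, MeasurableSet (cell c) := by
    intro c
    have e1 : Measurable fun x : Pt => ⌊D * (x.1 - y.1)⌋ := by fun_prop
    have e2 : Measurable fun x : Pt => ⌊D * (x.2.1 - y.2.1)⌋ := by fun_prop
    have e3 : Measurable fun x : Pt => ⌊D * (x.2.2 - y.2.2)⌋ := by fun_prop
    exact (e1 (measurableSet_singleton c.1)).inter
      ((e2 (measurableSet_singleton c.2.1)).inter (e3 (measurableSet_singleton c.2.2)))
  have hcb : ∀ c, μ.real (cell c) ≤ CF * (1 / D) ^ t := by
    intro c
    refine le_trans (measureReal_mono ?_ (measure_ne_top _ _)) (h.frost (c.1 / D + y.1, c.2.1 / D + y.2.1, c.2.2 / D + y.2.2) (1 / D) (by positivity))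
    rintro x ⟨h1, h2, h3⟩
    simp only [mem_closedBall, Prod.dist_eq, Real.dist_eq, max_le_iff]
    exact ⟨abs_sub_le_of_floor hD h1, abs_sub_le_of_floor hD h2, abs_sub_le_of_floor hD h3⟩
  have hpt : ∀ᵐ x ∂μ, vker3 D (x - y) ≤ ∑ c ∈ B ×ˢ B ×ˢ B, (cell c).indicator (fun _ => a c.1 * (a c.2.1 * a c.2.2)) x := by
    filter_upwards [h.box] with x hx
    obtain ⟨b1, b2, b3⟩ := hx
    rw [abs_le] at b1 b2 b3
    obtain ⟨⟨p1, q1⟩, ⟨p2, q2⟩, ⟨p3, q3⟩⟩ := hy1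
    have hmem : (⌊D * (x.1 - y.1)⌋, ⌊D * (x.2.1 - y.2.1)⌋, ⌊D * (x.2.2 - y.2.2)⌋) ∈ B ×ˢ B ×ˢ B := by
      simp only [Finset.mem_product]
      exact ⟨hfl _ (by linarith) (by linarith), hfl _ (by linarith) (by linarith), hfl _ (by linarith) (by linarith)⟩
    refine le_trans ?_ (Finset.single_le_sum (fun c _ => indicator_nonneg (fun _ _ =>
      mul_nonneg (ha0 _) (mul_nonneg (ha0 _) (ha0 _))) x) hmem)
    have hx : x ∈ cell (⌊D * (x.1 - y.1)⌋, ⌊D * (x.2.1 - y.2.1)⌋, ⌊D * (x.2.2 - y.2.2)⌋) := ⟨rfl, rfl, rfl⟩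
    rw [indicator_of_mem hx]
    have v1 := vker_le_tau hD (s := x.1 - y.1) (by linarith) (by linarith)
    have v2 := vker_le_tau hD (s := x.2.1 - y.2.1) (by linarith) (by linarith)
    have v3 := vker_le_tau hD (s := x.2.2 - y.2.2) (by linarith) (by linarith)
    exact mul_le_mul v1 (mul_le_mul v2 v3 (vker_nonneg _ _) (ha0 _))
      (mul_nonneg (vker_nonneg _ _) (vker_nonneg _ _)) (ha0 _)
  have hinteg : ∀ c ∈ B ×ˢ B ×ˢ B, Integrable ((cell c).indicator (fun _ => a c.1 * (a c.2.1 * a c.2.2))) μ :=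
    fun c _ => (integrable_const _).indicator (hcm c)
  calc ∫ x, vker3 D (x - y) ∂μ ≤ ∫ x, ∑ c ∈ B ×ˢ B ×ˢ B, (cell c).indicator (fun _ => a c.1 * (a c.2.1 * a c.2.2)) x ∂μ := by
        refine integral_mono_of_nonneg (ae_of_all _ fun x => vker3_nonneg _ _) (integrable_finsetSum _ hinteg) hpt
    _ = ∑ c ∈ B ×ˢ B ×ˢ B, μ.real (cell c) * (a c.1 * (a c.2.1 * a c.2.2)) := by
        rw [integral_finsetSum _ hinteg]
        refine Finset.sum_congr rfl fun c _ => ?_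
        rw [integral_indicator_const _ (hcm c), smul_eq_mul]
    _ ≤ ∑ c ∈ B ×ˢ B ×ˢ B, CF * (1 / D) ^ t * (a c.1 * (a c.2.1 * a c.2.2)) :=
        Finset.sum_le_sum fun c _ => mul_le_mul_of_nonneg_right (hcb c)
          (mul_nonneg (ha0 _) (mul_nonneg (ha0 _) (ha0 _)))
    _ = CF * (1 / D) ^ t * (∑ c ∈ B, a c) ^ 3 := by
        rw [← Finset.mul_sum, Finset.sum_product]
        simp only [Finset.sum_product, ← Finset.mul_sum, ← Finset.sum_mul]
        ring
    _ ≤ CF * (1 / D) ^ t * (60 * tauSum * D) ^ 3 := by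
        have := h.CF_nonneg
        gcongr
        exact Finset.sum_nonneg fun c _ => ha0 c
    _ = _ := by
        rw [mul_pow, one_div, Real.inv_rpow hD'.le, Real.rpow_sub hD', ← Real.rpow_natCast (D : ℝ) 3]
        push_cast
        field_simp

lemma tauSum_nonneg : 0 ≤ tauSum := tsum_nonneg tau_nonneg

/-- The large sieve inequality for Frostman measures. -/
lemma BoxMeas.large_sieve {μ : Measure Pt} {t CF : ℝ} (h : BoxMeas μ t CF) {ι : Type*} (S : Finset ι)
    (c : ι → ℂ) (ξ : ι → Freq) {D N : ℕ} (hD : 0 < D)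
    (hN : 3 * D ≤ N) (h1 : ∀ i ∈ S, |(ξ i).1| ≤ D) (h2 : ∀ i ∈ S, |(ξ i).2.1| ≤ D)
    (h3 : ∀ i ∈ S, |(ξ i).2.2| ≤ D) :
    ∫ x, ‖∑ i ∈ S, c i * eP (ξ i) x‖ ^ 2 ∂μ ≤ 27 * (60 * tauSum) ^ 3 * CF * (D : ℝ) ^ (3 - t) *
      avg (fun g : Grid N => ‖∑ i ∈ S, c i * eP (ξ i) (gpt g)‖ ^ 2) := by
  have := h.fin
  have hinteg : ∀ g : Grid N, Integrable (fun x => vker3 D (x - gpt g)) μ := by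
    intro g
    refine Integrable.of_bound ((continuous_vker3 D).comp (continuous_id.sub continuous_const)).aestronglyMeasurable
      (5 * D * (5 * D * (5 * D))) (ae_of_all _ fun x => ?_)
    rw [Real.norm_of_nonneg (vker3_nonneg _ _)]
    unfold vker3
    exact mul_le_mul (vker_le _ _) (mul_le_mul (vker_le _ _) (vker_le _ _) (vker_nonneg _ _) (by positivity))
      (mul_nonneg (vker_nonneg _ _) (vker_nonneg _ _)) (by positivity)
  set q : Grid N → ℝ := fun g => ‖∑ i ∈ S, c i * eP (ξ i) (gpt g)‖ ^ 2 with hq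
  calc _ ≤ ∫ x, 27 * avg (fun g : Grid N => q g * vker3 D (x - gpt g)) ∂μ := by
        refine integral_mono_of_nonneg (ae_of_all _ fun x => by positivity) ?_
          (ae_of_all _ fun x => norm_sq_le_avg_vker3 S c ξ hD hN h1 h2 h3 x)
        unfold avg
        exact ((integrable_finsetSum _ fun g _ => (hinteg g).const_mul _).const_mul _).const_mul _
    _ = 27 * avg (fun g : Grid N => q g * ∫ x, vker3 D (x - gpt g) ∂μ) := by
        rw [integral_const_mul]
        unfold avg
        rw [integral_const_mul, integral_finsetSum _ fun g _ => (hinteg g).const_mul _]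
        simp only [integral_const_mul]
    _ ≤ 27 * avg (fun g : Grid N => q g * ((60 * tauSum) ^ 3 * CF * (D : ℝ) ^ (3 - t))) := by
        gcongr
        exact avg_mono fun g => mul_le_mul_of_nonneg_left (h.integral_vker3_le hD g) (by positivity)
    _ = _ := by rw [avg_mul_const]; ring

/-- A trigonometric polynomial on `ℝ³` imitating the plane wave `x ↦ e(r(x₁ + u x₂ + v x₃))`. -/
def wv (u v : ℝ) (r : ℤ) (x : Pt) : ℂ := eR (r * x.1) * lerp (r * u) x.2.1 * lerp (r * v) x.2.2

lemma continuous_wv (u v : ℝ) (r : ℤ) : Continuous (wv u v r) := by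
  have := continuous_eR
  have := continuous_lerp (r * u)
  have := continuous_lerp (r * v)
  unfold wv; fun_prop

lemma norm_wv_le (u v : ℝ) (r : ℤ) (x : Pt) : ‖wv u v r x‖ ≤ 1 := by
  rw [wv, norm_mul, norm_mul, norm_eR, one_mul]
  exact mul_le_one₀ (norm_lerp_le _ _) (norm_nonneg _) (norm_lerp_le _ _)

lemma wv_neg (u v : ℝ) (r : ℤ) (x : Pt) : wv u v (-r) x = (starRingEnd ℂ) (wv u v r x) := by
  simp only [wv, Int.cast_neg, neg_mul, eR_neg, lerp_neg, map_mul]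

/-- Frequencies near the direction `(1, u, v)` at height `r`. -/
def nearRay (u v : ℝ) (r : ℤ) : Set Freq :=
  {ξ | ξ.1 = r ∧ |(ξ.2.1 : ℝ) - u * r| ≤ 1 ∧ |(ξ.2.2 : ℝ) - v * r| ≤ 1}

lemma floor_near (a : ℝ) : |(⌊a⌋ : ℝ) - a| ≤ 1 ∧ |((⌊a⌋ + 1 : ℤ) : ℝ) - a| ≤ 1 := by
  have h1 := Int.floor_le a
  have h2 := Int.lt_floor_add_one a
  push_cast
  constructor <;> rw [abs_le] <;> constructor <;> linarith

lemma wv_mem_spec (u v : ℝ) (r : ℤ) : wv u v r ∈ spec eP (nearRay u v r) := by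
  have e : ∀ a b d : ℤ, ∀ x : Pt, eP (a, b, d) x = eR (a * x.1) * eR (b * x.2.1) * eR (d * x.2.2) := by
    intro a b d x
    rw [eP, eR_add, eR_add]
  have hw : wv u v r =
      (((1 - Int.fract (r * u) : ℝ) : ℂ) * (1 - Int.fract (r * v) : ℝ)) • eP (r, ⌊r * u⌋, ⌊r * v⌋) +
      (((1 - Int.fract (r * u) : ℝ) : ℂ) * (Int.fract (r * v) : ℝ)) • eP (r, ⌊r * u⌋, ⌊r * v⌋ + 1) +
      (((Int.fract (r * u) : ℝ) : ℂ) * (1 - Int.fract (r * v) : ℝ)) • eP (r, ⌊r * u⌋ + 1, ⌊r * v⌋) +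
      (((Int.fract (r * u) : ℝ) : ℂ) * (Int.fract (r * v) : ℝ)) • eP (r, ⌊r * u⌋ + 1, ⌊r * v⌋ + 1) := by
    ext x
    simp only [wv, lerp, Pi.add_apply, Pi.smul_apply, smul_eq_mul, e]
    ring
  have h1 := floor_near (r * u)
  have h2 := floor_near (r * v)
  rw [hw]
  refine add_mem (add_mem (add_mem ?_ ?_) ?_) ?_ <;> refine Submodule.smul_mem _ _ (Submodule.subset_span (mem_image_of_mem _ ?_))
  all_goals
    refine ⟨rfl, ?_, ?_⟩
    all_goals
      simp only [mul_comm u, mul_comm v]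
      first
      | exact h1.1 | exact h1.2 | exact h2.1 | exact h2.2

lemma spec_comp_gpt {S : Set Freq} {f : Pt → ℂ} (hf : f ∈ spec eP S) (N : ℕ) :
    (fun x : Grid N => f (gpt x)) ∈ spec (ech N) S := by
  have h : LinearMap.funLeft ℂ ℂ (gpt (N := N)) f ∈ (spec eP S).map (LinearMap.funLeft ℂ ℂ (gpt (N := N))) :=
    Submodule.mem_map_of_mem hf
  rw [spec, Submodule.map_span, image_image] at h
  exact h

lemma spec_eP_mul {S T U : Set Freq} (hU : ∀ a ∈ S, ∀ b ∈ T, a + b ∈ U)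
    {f g : Pt → ℂ} (hf : f ∈ spec eP S) (hg : g ∈ spec eP T) : f * g ∈ spec eP U := by
  have h1 : f * g ∈ spec eP S * spec eP T := Submodule.mul_mem_mul hf hg
  unfold spec at h1
  rw [Submodule.span_mul_span] at h1
  refine Submodule.span_mono ?_ h1
  rintro _ ⟨_, ⟨a, ha, rfl⟩, _, ⟨b, hb, rfl⟩, rfl⟩
  refine ⟨a + b, hU a ha b hb, ?_⟩
  ext x
  simp only [eP, Pi.mul_apply, ← eR_add, Prod.fst_add, Prod.snd_add]
  congr 1; push_cast; ring

lemma exists_sum_of_spec {S : Set Freq} {f : Pt → ℂ} (hf : f ∈ spec eP S) :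
    ∃ (T : Finset Freq) (c : Freq → ℂ), (↑T : Set Freq) ⊆ S ∧ ∀ x, f x = ∑ ξ ∈ T, c ξ * eP ξ x := by
  obtain ⟨l, hl, rfl⟩ := (Finsupp.mem_span_image_iff_linearCombination ℂ).1 hf
  refine ⟨l.support, l, (Finsupp.mem_supported _ _).1 hl, fun x => ?_⟩
  rw [Finsupp.linearCombination_apply, Finsupp.sum, Finset.sum_apply]
  rfl

/-- Fourth power version of the large sieve. -/
lemma BoxMeas.large_sieve_four {μ : Measure Pt} {t CF : ℝ} (h : BoxMeas μ t CF) {f : Pt → ℂ} {D N : ℕ}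
    (hD : 0 < D) (hN : 3 * (2 * D) ≤ N)
    (hf : f ∈ spec eP {ξ | |ξ.1| ≤ D ∧ |ξ.2.1| ≤ D ∧ |ξ.2.2| ≤ D}) :
    ∫ x, ‖f x‖ ^ 4 ∂μ ≤ 27 * (60 * tauSum) ^ 3 * CF * ((2 * D : ℕ) : ℝ) ^ (3 - t) *
      avg (fun g : Grid N => ‖f (gpt g)‖ ^ 4) := by
  have h2 : f * f ∈ spec eP {ξ | |ξ.1| ≤ (2 * D : ℕ) ∧ |ξ.2.1| ≤ (2 * D : ℕ) ∧ |ξ.2.2| ≤ (2 * D : ℕ)} := by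
    refine spec_eP_mul ?_ hf hf
    rintro a ⟨a1, a2, a3⟩ b ⟨b1, b2, b3⟩
    refine ⟨(abs_add_le _ _).trans ?_, (abs_add_le _ _).trans ?_, (abs_add_le _ _).trans ?_⟩ <;>
      push_cast <;> linarith
  obtain ⟨T, c, hT, he⟩ := exists_sum_of_spec h2
  have e4 : ∀ x, ‖f x‖ ^ 4 = ‖∑ ξ ∈ T, c ξ * eP ξ x‖ ^ 2 := by
    intro x
    rw [← he, Pi.mul_apply, norm_mul]; ring
  simp only [e4]
  exact h.large_sieve T c id (by omega) hN (fun i hi => (hT hi).1) (fun i hi => (hT hi).2.1)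
    (fun i hi => (hT hi).2.2)

/-- A finite superposition of model plane waves. -/
def wsum (u v : ℝ) (S : Finset ℤ) (a : ℤ → ℂ) (x : Pt) : ℂ := ∑ r ∈ S, a r * wv u v r x

lemma norm_wsum_le (u v : ℝ) (S : Finset ℤ) (a : ℤ → ℂ) {B : ℝ}
    (h : ∀ z : ℝ, ‖∑ r ∈ S, a r * eR (r * z)‖ ≤ B) (x : Pt) : ‖wsum u v S a x‖ ≤ B := by
  have h1 : ∀ w, ‖∑ r ∈ S, a r * lerp (r * u) x.2.1 * eR (r * w)‖ ≤ B :=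
    fun w => norm_sum_lerp_le S a u x.2.1 w h
  have h2 := norm_sum_lerp_le S (fun r => a r * lerp (r * u) x.2.1) v x.2.2 x.1 h1
  refine (le_of_eq ?_).trans h2
  rw [wsum]; congr 1
  exact Finset.sum_congr rfl fun r _ => by rw [wv]; ring

lemma avg_norm_sq_wsum_le (u v : ℝ) (S : Finset ℤ) (a : ℤ → ℂ) {N : ℕ} (hN : 0 < N)
    (hS : ∀ r ∈ S, ∀ s ∈ S, |r - s| < (N : ℤ)) :
    avg (fun g : Grid N => ‖wsum u v S a (gpt g)‖ ^ 2) ≤ ∑ r ∈ S, ‖a r‖ ^ 2 := by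
  have : Nonempty (Fin N) := ⟨⟨0, hN⟩⟩
  rw [avg_prod, avg_comm]
  refine (avg_mono (g := fun _ => ∑ r ∈ S, ‖a r‖ ^ 2) fun y => ?_).trans (avg_const _).le
  have h := avg_sum_mul_conj (isCharSystem_ech1 N hN) S (fun r hr s hs => hS r hr s hs)
    (fun r => a r * lerp (r * u) (((y.1 : ℕ) : ℝ) / N) * lerp (r * v) (((y.2 : ℕ) : ℝ) / N))
  refine (le_of_eq ?_).trans (h.le.trans ?_)
  · congr 1; ext x
    congr 2
    exact Finset.sum_congr rfl fun r _ => by simp only [wv, gpt, ech1]; ring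
  · refine Finset.sum_le_sum fun r _ => ?_
    rw [norm_mul, norm_mul]
    gcongr
    calc _ ≤ ‖a r‖ * 1 * 1 := by gcongr <;> exact norm_lerp_le _ _
      _ = _ := by ring

/-- The frequency-localised density of the model projection of `μ`. -/
def lam (μ : Measure Pt) (u v : ℝ) (D : ℕ) (c : ℤ) (y : ℝ) : ℂ :=
  ∑ r ∈ Finset.Ioo (c - D) (c + D), (hat D (r - c) : ℂ) * eR (r * (-y)) * ∫ x, wv u v r x ∂μ

lemma continuous_lam (μ : Measure Pt) (u v : ℝ) (D : ℕ) (c : ℤ) : Continuous (lam μ u v D c) := by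
  have := continuous_eR
  unfold lam; fun_prop

/-- Coefficients dual to `lam`. -/
def dualCoef {N : ℕ} (h : Fin N → ℂ) (D : ℕ) (c : ℤ) (y₀ : ℝ) (r : ℤ) : ℂ :=
  hat D (r - c) * avg (fun j : Fin N => h j * eR (r * (-(y₀ + (j : ℕ) / N))))

lemma norm_sum_dualCoef_le {N : ℕ} (h : Fin N → ℂ) (hh : ∀ j, ‖h j‖ ≤ 1) {D : ℕ} (hD : 0 < D)
    (hDN : D ≤ N) (c : ℤ) (y₀ z : ℝ) :
    ‖∑ r ∈ Finset.Ioo (c - D) (c + D), dualCoef h D c y₀ r * eR (r * z)‖ ≤ 1 := by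
  have e : ∑ r ∈ Finset.Ioo (c - D) (c + D), dualCoef h D c y₀ r * eR (r * z) =
      avg (fun j : Fin N => h j * (eR (c * ((z - y₀) - (j : ℕ) / N)) * fej D ((z - y₀) - (j : ℕ) / N))) := by
    simp only [← window_eq hD, Finset.mul_sum]
    rw [avg_sum]
    refine Finset.sum_congr rfl fun r _ => ?_
    rw [dualCoef, ← avg_const_mul, ← avg_mul_const]
    congr 1; ext j
    rw [show r * (z - y₀ - (j : ℕ) / N) = r * (-(y₀ + (j : ℕ) / N)) + r * z by ring, eR_add]
    ring
  rw [e]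
  refine (norm_avg_le _).trans (le_trans (avg_mono fun j => ?_) (avg_fej_shift hD hDN (z - y₀)).le)
  rw [norm_mul, norm_mul, norm_eR, one_mul, Complex.norm_real, Real.norm_of_nonneg (fej_nonneg _ _)]
  exact mul_le_of_le_one_left (fej_nonneg _ _) (hh j)

lemma sum_norm_sq_dualCoef_le {N : ℕ} (hN : 0 < N) (h : Fin N → ℂ) {D : ℕ} (hDN : 2 * D ≤ N) (c : ℤ) (y₀ : ℝ) :
    ∑ r ∈ Finset.Ioo (c - D) (c + D), ‖dualCoef h D c y₀ r‖ ^ 2 ≤ avg (fun j => ‖h j‖ ^ 2) := by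
  refine le_trans (Finset.sum_le_sum fun r _ => ?_) (bessel (isCharSystem_ech1 N hN) (Finset.Ioo (c - D) (c + D)) ?_ h)
  · have : avg (fun j : Fin N => h j * eR (r * (-(y₀ + (j : ℕ) / N)))) = eR (r * (-y₀)) * fc (ech1 N) h r := by
      rw [fc, ← avg_const_mul]
      congr 1; ext j
      rw [ech1, ← eR_neg, show r * (-(y₀ + (j : ℕ) / N)) = r * (-y₀) + -(r * ((j : ℕ) / N : ℝ)) by ring, eR_add]
      ring
    rw [dualCoef, this, norm_mul, norm_mul, norm_eR, one_mul, Complex.norm_real, Real.norm_of_nonneg (hat_nonneg _ _)]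
    exact pow_le_pow_left₀ (mul_nonneg (hat_nonneg _ _) (norm_nonneg _))
      (mul_le_of_le_one_left (norm_nonneg _) (hat_le_one _ _)) 2
  · intro a ha b hb
    rw [Finset.mem_Ioo] at ha hb
    change |a - b| < (N : ℤ)
    rw [abs_lt]; omega

lemma integral_wv_integrable (μ : Measure Pt) [IsFiniteMeasure μ] (u v : ℝ) (r : ℤ) : Integrable (wv u v r) μ :=
  Integrable.of_bound (continuous_wv u v r).aestronglyMeasurable 1 (ae_of_all _ (norm_wv_le u v r))

lemma avg_mul_lam {N : ℕ} (μ : Measure Pt) [IsFiniteMeasure μ] (u v : ℝ) (h : Fin N → ℂ) (D : ℕ) (c : ℤ) (y₀ : ℝ) :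
    avg (fun j : Fin N => h j * lam μ u v D c (y₀ + (j : ℕ) / N)) =
      ∫ x, wsum u v (Finset.Ioo (c - D) (c + D)) (dualCoef h D c y₀) x ∂μ := by
  unfold wsum lam
  rw [integral_finsetSum _ fun r _ => (integral_wv_integrable μ u v r).const_mul _]
  simp only [Finset.mul_sum, integral_const_mul]
  rw [avg_sum]
  refine Finset.sum_congr rfl fun r _ => ?_
  rw [dualCoef, ← avg_const_mul, ← avg_mul_const]
  congr 1; ext j; ring

lemma norm_integral_pow_four_le {X : Type*} [MeasurableSpace X] (μ : Measure X) [IsFiniteMeasure μ] {f : X → ℂ}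
    (hf : AEStronglyMeasurable f μ) {B : ℝ} (hB : ∀ x, ‖f x‖ ≤ B) :
    ‖∫ x, f x ∂μ‖ ^ 4 ≤ μ.real univ ^ 3 * ∫ x, ‖f x‖ ^ 4 ∂μ := by
  have hq : ∀ g : X → ℝ, AEStronglyMeasurable g μ → ∀ B : ℝ, (∀ x, ‖g x‖ ≤ B) →
      (∫ x, g x ∂μ) ^ 2 ≤ μ.real univ * ∫ x, g x ^ 2 ∂μ := by
    intro g hg B hB
    have i1 : Integrable g μ := Integrable.of_bound hg B (ae_of_all _ hB)
    have i2 : Integrable (fun x => g x ^ 2) μ := by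
      refine Integrable.of_bound (hg.pow 2) (B ^ 2) (ae_of_all _ fun x => ?_)
      rw [norm_pow]; exact pow_le_pow_left₀ (norm_nonneg _) (hB x) 2
    set m := μ.real univ with hm
    set I := ∫ x, g x ∂μ with hI
    have key : 0 ≤ ∫ x, (m * g x - I) ^ 2 ∂μ := integral_nonneg fun x => sq_nonneg _
    have e : ∫ x, (m * g x - I) ^ 2 ∂μ = m ^ 2 * ∫ x, g x ^ 2 ∂μ - 2 * m * I * I + I ^ 2 * m := by
      have : ∀ x, (m * g x - I) ^ 2 = (m ^ 2 * g x ^ 2 - 2 * m * I * g x) + I ^ 2 := fun x => by ring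
      simp only [this]
      have i3 : Integrable (fun x => m ^ 2 * g x ^ 2 - 2 * m * I * g x) μ :=
        (i2.const_mul _).sub (i1.const_mul _)
      rw [integral_add i3 (integrable_const _), integral_sub (i2.const_mul _) (i1.const_mul _), integral_const_mul, integral_const_mul, integral_const,
        smul_eq_mul, ← hm, ← hI]
      ring
    rw [e] at key
    have hm0 : 0 ≤ m := measureReal_nonneg
    rcases hm0.eq_or_lt with h0 | h0
    · have : μ = 0 := by
        rw [← Measure.measure_univ_eq_zero]
        exact (measureReal_eq_zero_iff).1 h0.symm
      rw [hI, this]; simp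
    · have : 0 ≤ m * (m * ∫ x, g x ^ 2 ∂μ - I ^ 2) := by linarith
      linarith [nonneg_of_mul_nonneg_right this h0]
  have h1 := hq (fun x => ‖f x‖) hf.norm B (fun x => by rw [norm_norm]; exact hB x)
  have h2 := hq (fun x => ‖f x‖ ^ 2) (hf.norm.pow 2) (B ^ 2) (fun x => by
    rw [norm_pow, norm_norm]; exact pow_le_pow_left₀ (norm_nonneg _) (hB x) 2)
  have h3 := norm_integral_le_integral_norm (μ := μ) f
  have h4 : 0 ≤ ∫ x, ‖f x‖ ∂μ := integral_nonneg fun x => norm_nonneg _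
  have h5 : 0 ≤ ∫ x, ‖f x‖ ^ 2 ∂μ := integral_nonneg fun x => by positivity
  have hm0 : 0 ≤ μ.real univ := measureReal_nonneg
  simp only [← pow_mul] at h2
  calc ‖∫ x, f x ∂μ‖ ^ 4 ≤ (∫ x, ‖f x‖ ∂μ) ^ 4 := by gcongr
    _ = ((∫ x, ‖f x‖ ∂μ) ^ 2) ^ 2 := by ring
    _ ≤ (μ.real univ * ∫ x, ‖f x‖ ^ 2 ∂μ) ^ 2 := by gcongr
    _ = μ.real univ ^ 2 * (∫ x, ‖f x‖ ^ 2 ∂μ) ^ 2 := by ring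
    _ ≤ μ.real univ ^ 2 * (μ.real univ * ∫ x, ‖f x‖ ^ (2 * 2) ∂μ) := by gcongr
    _ = _ := by norm_num; ring

/-- A discrete measure on parameters with dyadic masses at most `q ^ i`. -/
structure ParamMeas (n : ℕ) (K : ℝ) (φ ψ : ℝ → ℝ) (Λ : Finset ℝ) (ν : ℝ → ℝ) (q : ℝ) : Prop where
  convx : Convx K φ ψ (Λ : Set ℝ)
  ν_nonneg : ∀ u ∈ Λ, 0 ≤ ν u
  q_pos : 0 < q
  mass : ∀ i ≤ 2 * n, ∀ l, ∑ u ∈ Λ.filter (fun u => cap i u = l), ν u ≤ q ^ i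

lemma ParamMeas.sum_le_one {n : ℕ} {K : ℝ} {φ ψ : ℝ → ℝ} {Λ : Finset ℝ} {ν : ℝ → ℝ} {q : ℝ}
    (h : ParamMeas n K φ ψ Λ ν q) : ∑ u ∈ Λ, ν u ≤ 1 := by
  have := h.mass 0 (by omega) 0
  rw [pow_zero, Finset.filter_true_of_mem] at this
  · exact this
  · intro u hu
    have := h.convx.mem u hu
    simp only [cap, pow_zero, one_mul]
    exact Nat.floor_eq_zero.2 this.2

/-- The constant in the dual estimate. -/
def dualConst (K t CF β q : ℝ) (n : ℕ) : ℝ :=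
  27 * (60 * tauSum) ^ 3 * CF * ((2 * (⌈9 * K⌉₊ * 4 ^ n) : ℕ) : ℝ) ^ (3 - t) * ((2 : ℝ) ^ (β * n) * q ^ (4 * n))

lemma dualConst_nonneg (K t : ℝ) {CF : ℝ} (hCF : 0 ≤ CF) (β : ℝ) {q : ℝ} (hq : 0 < q) (n : ℕ) :
    0 ≤ dualConst K t CF β q n := by
  have := tauSum_nonneg
  unfold dualConst; positivity

/-- Duality form of the main `L⁴` estimate. -/
theorem dual_L4 (K : ℝ) {β κ : ℝ} (hβ : 0 < β) (hκ : 0 < κ) :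
    ∃ n0 : ℕ, ∀ n ≥ n0, ∀ k N : ℕ, κ * n ≤ k → k ≤ n → 100000 * K ^ 4 * 4 ^ n ≤ (N : ℝ) →
      ∀ (c : ℤ), 4 ^ n + 4 ^ (n - k) ≤ c → c + 4 ^ (n - k) ≤ 8 * 4 ^ n →
      ∀ (μ : Measure Pt) (t CF : ℝ), BoxMeas μ t CF →
      ∀ (φ ψ : ℝ → ℝ) (Λ : Finset ℝ) (ν : ℝ → ℝ) (q : ℝ), ParamMeas n K φ ψ Λ ν q →
      ∀ (h : ℝ → Fin N → ℂ), (∀ u j, ‖h u j‖ ≤ 1) → ∀ y₀ : ℝ,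
      ‖∑ u ∈ Λ, (ν u : ℂ) * avg (fun j : Fin N => h u j * lam μ u (φ u) (4 ^ (n - k)) c (y₀ + (j : ℕ) / N))‖ ^ 4 ≤
        μ.real univ ^ 3 * (dualConst K t CF β q n * ∑ u ∈ Λ, ν u * avg (fun j => ‖h u j‖ ^ 2)) := by
  obtain ⟨n0, hn0⟩ := CoreData.main_L4 K hβ hκ
  refine ⟨n0, fun n hn k N hk hkn hN c hc1 hc2 μ t CF hμ φ ψ Λ ν q hν h hh y₀ => ?_⟩
  have := hμ.fin
  set Δ : ℕ := 4 ^ (n - k) with hΔ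
  have hΔ0 : 0 < Δ := by positivity
  have hΔ4 : Δ ≤ 4 ^ n := Nat.pow_le_pow_right (by norm_num) (by omega)
  have hK := hν.convx.one_le
  have hK4 : (1 : ℝ) ≤ K ^ 4 := one_le_pow₀ hK
  have hp : (1 : ℝ) ≤ 4 ^ n := one_le_pow₀ (by norm_num)
  have hNR : (100000 : ℝ) * 4 ^ n ≤ N := by nlinarith
  have hNN : 100000 * 4 ^ n ≤ N := by exact_mod_cast hNR
  have hN0 : 0 < N := by have : 0 < 4 ^ n := by positivity
                         omega
  have hcΔ1 : (4 : ℤ) ^ n + Δ ≤ c := by rw [hΔ]; exact_mod_cast hc1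
  have hcΔ2 : c + (Δ : ℤ) ≤ 8 * 4 ^ n := by rw [hΔ]; exact_mod_cast hc2
  set S := Finset.Ioo (c - (Δ : ℤ)) (c + Δ) with hS
  set F : ℝ → Pt → ℂ := fun u => wsum u (φ u) S (dualCoef (h u) Δ c y₀) with hF
  have hray : ∀ u, ∀ r ∈ S, nearRay u (φ u) r ⊆ sigmaSet n k c φ u := by
    rintro u r hr ξ ⟨h1, h2, h3⟩
    rw [hS, Finset.mem_Ioo] at hr
    have e1 : (4 : ℤ) ^ n ≤ r := by omega
    have e2 : r ≤ 8 * 4 ^ n := by omega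
    have e3 : |r - c| ≤ (Δ : ℤ) := by rw [abs_le]; omega
    refine ⟨?_, ?_, ?_, ?_, ?_⟩
    · rw [h1]; exact_mod_cast e1
    · rw [h1]; exact_mod_cast e2
    · rw [h1]
      have e4 : |(r : ℝ) - c| ≤ (Δ : ℝ) := by exact_mod_cast e3
      refine e4.trans (le_of_eq ?_)
      rw [hΔ]; push_cast
      rw [pow_sub₀ _ (by norm_num) hkn]; rfl
    · rw [h1]; exact h2
    · rw [h1]; exact h3
  have hFspec : ∀ u, F u ∈ spec eP (sigmaSet n k c φ u) := by
    intro u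
    have : F u = ∑ r ∈ S, dualCoef (h u) Δ c y₀ r • wv u (φ u) r := by
      ext x; simp [hF, wsum]
    rw [this]
    exact Submodule.sum_mem _ fun r hr => Submodule.smul_mem _ _
      (Submodule.span_mono (image_mono (hray u r hr)) (wv_mem_spec u (φ u) r))
  let D : CoreData n k N K :=
    { Λ := Λ, φ := φ, ψ := ψ, ν := ν, F := fun u x => F u (gpt x), r0 := c, convx := hν.convx,
      ν_nonneg := hν.ν_nonneg, F_spec := fun u _ => spec_comp_gpt (hFspec u) N, le_N := hN }
  have hFle : ∀ u x, ‖F u x‖ ≤ 1 := fun u x => norm_wsum_le _ _ _ _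
    (norm_sum_dualCoef_le (h u) (hh u) hΔ0 (by omega) c y₀) x
  have hFrost : D.Frost q 1 (fun u => avg (fun j => ‖h u j‖ ^ 2)) :=
    { q_pos := hν.q_pos
      mass := hν.mass
      F_le := fun u _ x => hFle u _
      F_sq := fun u _ => (avg_norm_sq_wsum_le u (φ u) S _ hN0 (by
          intro a ha b hb
          rw [hS, Finset.mem_Ioo] at ha hb
          rw [abs_lt]; omega)).trans (sum_norm_sq_dualCoef_le hN0 (h u) (by omega) c y₀) }
  have hmain := hn0 n hn k N hk D q 1 _ hFrost
  set f : Pt → ℂ := fun x => ∑ u ∈ Λ, (ν u : ℂ) * F u x with hf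
  have hFc : ∀ u, Continuous (F u) := fun u => by
    have := continuous_wv u (φ u)
    simp only [hF]; unfold wsum; fun_prop
  have hfc : Continuous f := by fun_prop
  have hfb : ∀ x, ‖f x‖ ≤ ∑ u ∈ Λ, ν u := by
    intro x
    refine (norm_sum_le _ _).trans (Finset.sum_le_sum fun u hu => ?_)
    rw [norm_mul, Complex.norm_real, Real.norm_of_nonneg (hν.ν_nonneg u hu)]
    exact mul_le_of_le_one_right (hν.ν_nonneg u hu) (hFle u x)
  have hFi : ∀ u, Integrable (F u) μ := fun u =>
    Integrable.of_bound (hFc u).aestronglyMeasurable 1 (ae_of_all _ (hFle u))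
  have e1 : ∑ u ∈ Λ, (ν u : ℂ) * avg (fun j : Fin N => h u j * lam μ u (φ u) Δ c (y₀ + (j : ℕ) / N)) =
      ∫ x, f x ∂μ := by
    simp only [hf]
    rw [integral_finsetSum _ fun u _ => (hFi u).const_mul _]
    exact Finset.sum_congr rfl fun u _ => by rw [integral_const_mul, avg_mul_lam]
  rw [e1]
  refine (norm_integral_pow_four_le μ hfc.aestronglyMeasurable hfb).trans ?_
  refine mul_le_mul_of_nonneg_left ?_ (by positivity)
  set Dd : ℕ := ⌈9 * K⌉₊ * 4 ^ n with hDd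
  have hceil : 9 * K ≤ ⌈9 * K⌉₊ := Nat.le_ceil _
  have hceil2 : (⌈9 * K⌉₊ : ℝ) < 9 * K + 1 := Nat.ceil_lt_add_one (by linarith)
  have hD0 : 0 < Dd := by
    have : 0 < ⌈9 * K⌉₊ := Nat.ceil_pos.2 (by linarith)
    positivity
  have hDN : 3 * (2 * Dd) ≤ N := by
    have hKK : K ≤ K ^ 4 := le_self_pow₀ hK (by norm_num)
    have : (3 * (2 * Dd) : ℝ) ≤ N := by
      rw [hDd]; push_cast
      calc (3 * (2 * (⌈9 * K⌉₊ * 4 ^ n)) : ℝ) ≤ 3 * (2 * ((100 * K) * 4 ^ n)) := by gcongr; linarith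
        _ ≤ 100000 * K ^ 4 * 4 ^ n := by nlinarith
        _ ≤ N := hN
    exact_mod_cast this
  have hfspec : f ∈ spec eP {ξ | |ξ.1| ≤ Dd ∧ |ξ.2.1| ≤ Dd ∧ |ξ.2.2| ≤ Dd} := by
    have : f = ∑ u ∈ Λ, (ν u : ℂ) • F u := by ext x; simp [hf]
    rw [this]
    refine Submodule.sum_mem _ fun u hu => Submodule.smul_mem _ _ (Submodule.span_mono (image_mono ?_) (hFspec u))
    intro ξ hξ
    have hb := D.sigma_bounds (u := u) hu hξ
    have hle : 9 * K * 4 ^ n ≤ (Dd : ℝ) := by rw [hDd]; push_cast; gcongr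
    have cast : ∀ a : ℤ, |(a : ℝ)| ≤ 9 * K * 4 ^ n → |a| ≤ (Dd : ℤ) := by
      intro a ha
      have : |(a : ℝ)| ≤ (Dd : ℝ) := ha.trans hle
      exact_mod_cast this
    exact ⟨cast _ hb.1, cast _ hb.2.1, cast _ hb.2.2⟩
  refine (hμ.large_sieve_four hD0 hDN hfspec).trans ?_
  rw [dualConst, mul_assoc _ ((2 : ℝ) ^ (β * n) * q ^ (4 * n))]
  have hτ := tauSum_nonneg
  have hCF := hμ.CF_nonneg
  refine mul_le_mul_of_nonneg_left (hmain.trans (le_of_eq ?_)) (by positivity)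
  simp only [one_pow, one_mul, mul_assoc]
  rfl

/-- Weak type bound for the localised densities. -/
theorem weak_type (K : ℝ) {β κ : ℝ} (hβ : 0 < β) (hκ : 0 < κ) :
    ∃ n0 : ℕ, ∀ n ≥ n0, ∀ k N : ℕ, κ * n ≤ k → k ≤ n → 100000 * K ^ 4 * 4 ^ n ≤ (N : ℝ) →
      ∀ (c : ℤ), 4 ^ n + 4 ^ (n - k) ≤ c → c + 4 ^ (n - k) ≤ 8 * 4 ^ n →
      ∀ (μ : Measure Pt) (t CF : ℝ), BoxMeas μ t CF →
      ∀ (φ ψ : ℝ → ℝ) (Λ : Finset ℝ) (ν : ℝ → ℝ) (q : ℝ), ParamMeas n K φ ψ Λ ν q →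
      ∀ y₀ α : ℝ, 0 < α →
      α ^ (4 / 3 : ℝ) * ∑ u ∈ Λ, ν u * avg (fun j : Fin N =>
        if α < ‖lam μ u (φ u) (4 ^ (n - k)) c (y₀ + (j : ℕ) / N)‖ then (1 : ℝ) else 0) ≤
        μ.real univ * dualConst K t CF β q n ^ (1 / 3 : ℝ) := by
  obtain ⟨n0, hn0⟩ := dual_L4 K hβ hκ
  refine ⟨n0, fun n hn k N hk hkn hN c hc1 hc2 μ t CF hμ φ ψ Λ ν q hν y₀ α hα => ?_⟩
  set l : ℝ → Fin N → ℂ := fun u j => lam μ u (φ u) (4 ^ (n - k)) c (y₀ + (j : ℕ) / N) with hl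
  set h : ℝ → Fin N → ℂ := fun u j => if α < ‖l u j‖ then (starRingEnd ℂ) (l u j) / ‖l u j‖ else 0 with hh
  set S := ∑ u ∈ Λ, ν u * avg (fun j : Fin N => if α < ‖l u j‖ then (1 : ℝ) else 0) with hS
  have hn1 : ∀ u j, ‖h u j‖ = if α < ‖l u j‖ then (1 : ℝ) else 0 := by
    intro u j
    simp only [hh]
    split_ifs with H
    · have : (0 : ℝ) < ‖l u j‖ := hα.trans H
      rw [norm_div, RCLike.norm_conj, Complex.norm_real, norm_norm, div_self this.ne']
    · simp
  have hmain := hn0 n hn k N hk hkn hN c hc1 hc2 μ t CF hμ φ ψ Λ ν q hν h (fun u j => by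
    rw [hn1]; split_ifs <;> norm_num) y₀
  have e2 : ∀ u, avg (fun j => ‖h u j‖ ^ 2) = avg (fun j : Fin N => if α < ‖l u j‖ then (1 : ℝ) else 0) := by
    intro u; congr 1; ext j; rw [hn1]; split_ifs <;> norm_num
  simp only [e2] at hmain
  rw [← hS] at hmain
  have hS0 : 0 ≤ S := Finset.sum_nonneg fun u hu => mul_nonneg (hν.ν_nonneg u hu)
    (avg_nonneg fun j => by split_ifs <;> norm_num)
  have hlow : α * S ≤ ‖∑ u ∈ Λ, (ν u : ℂ) * avg (fun j : Fin N => h u j * l u j)‖ := by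
    have e3 : ∀ u j, h u j * l u j = ((if α < ‖l u j‖ then ‖l u j‖ else 0 : ℝ) : ℂ) := by
      intro u j
      simp only [hh]
      split_ifs with H
      · have : (‖l u j‖ : ℂ) ≠ 0 := by
          have : (0 : ℝ) < ‖l u j‖ := hα.trans H
          exact_mod_cast this.ne'
        rw [div_mul_eq_mul_div, mul_comm, Complex.mul_conj, Complex.normSq_eq_norm_sq]
        push_cast; field_simp
      · simp
    simp only [e3, avg_ofReal, ← Complex.ofReal_mul]
    rw [← Complex.ofReal_sum, Complex.norm_real]
    refine le_trans ?_ (le_abs_self _)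
    rw [hS, Finset.mul_sum]
    refine Finset.sum_le_sum fun u hu => ?_
    rw [mul_left_comm, ← avg_const_mul]
    refine mul_le_mul_of_nonneg_left (avg_mono fun j => ?_) (hν.ν_nonneg u hu)
    split_ifs with H
    · linarith
    · simp
  have hm0 : 0 ≤ μ.real univ := measureReal_nonneg
  have hd0 := dualConst_nonneg K t hμ.CF_nonneg β hν.q_pos n
  have h4 : (α * S) ^ 4 ≤ μ.real univ ^ 3 * (dualConst K t CF β q n * S) :=
    (pow_le_pow_left₀ (by positivity) hlow 4).trans hmain
  rcases hS0.eq_or_lt with h0 | h0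
  · rw [← h0, mul_zero]; positivity
  have h5 : α ^ 4 * S ^ 3 ≤ μ.real univ ^ 3 * dualConst K t CF β q n := by
    refine le_of_mul_le_mul_right ?_ h0
    calc _ = (α * S) ^ 4 := by ring
      _ ≤ _ := h4
      _ = _ := by ring
  have h6 := Real.rpow_le_rpow (by positivity) h5 (by norm_num : (0 : ℝ) ≤ 1 / 3)
  have cube : ∀ x : ℝ, 0 ≤ x → (x ^ 3) ^ (1 / 3 : ℝ) = x := by
    intro x hx
    rw [← Real.rpow_natCast x 3, ← Real.rpow_mul hx]; norm_num
  rw [Real.mul_rpow (by positivity) (by positivity), Real.mul_rpow (by positivity) (by positivity), cube _ hS0, cube _ hm0,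
    ← Real.rpow_natCast α 4, ← Real.rpow_mul hα.le] at h6
  norm_num at h6 ⊢
  exact h6

lemma layer_cake {v m₀ : ℝ} (hm : 0 < m₀) (hv : 0 ≤ v) (L : ℕ) (hL : v ≤ 2 ^ L * m₀) :
    v ^ (4 / 3 : ℝ) ≤ m₀ ^ (4 / 3 : ℝ) +
      ∑ l ∈ Finset.range L, (2 ^ (l + 1) * m₀) ^ (4 / 3 : ℝ) * (if 2 ^ l * m₀ < v then (1 : ℝ) else 0) := by
  induction L with
  | zero =>
    simp only [pow_zero, one_mul, Finset.range_zero, Finset.sum_empty, add_zero] at hL ⊢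
    exact Real.rpow_le_rpow hv hL (by norm_num)
  | succ L ih =>
    rw [Finset.sum_range_succ]
    by_cases h : 2 ^ L * m₀ < v
    · rw [if_pos h, mul_one]
      have h1 := Real.rpow_le_rpow hv hL (by norm_num : (0 : ℝ) ≤ 4 / 3)
      have h2 : 0 ≤ ∑ l ∈ Finset.range L, (2 ^ (l + 1) * m₀) ^ (4 / 3 : ℝ) * (if 2 ^ l * m₀ < v then (1 : ℝ) else 0) :=
        Finset.sum_nonneg fun l _ => mul_nonneg (by positivity) (by split_ifs <;> norm_num)
      have h3 : 0 ≤ m₀ ^ (4 / 3 : ℝ) := by positivity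
      linarith
    · rw [if_neg h, mul_zero, add_zero]
      exact ih (not_lt.1 h)

lemma norm_integral_wv_le (μ : Measure Pt) [IsFiniteMeasure μ] (u v : ℝ) (r : ℤ) :
    ‖∫ x, wv u v r x ∂μ‖ ≤ μ.real univ := by
  have := norm_integral_le_of_norm_le_const (μ := μ) (ae_of_all _ (norm_wv_le u v r))
  rwa [one_mul] at this

lemma norm_lam_le (μ : Measure Pt) [IsFiniteMeasure μ] (u v : ℝ) (D : ℕ) (c : ℤ) (y : ℝ) :
    ‖lam μ u v D c y‖ ≤ 2 * D * μ.real univ := by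
  have hm0 : 0 ≤ μ.real univ := measureReal_nonneg
  unfold lam
  refine (norm_sum_le _ _).trans (le_trans (Finset.sum_le_card_nsmul _ _ (μ.real univ) fun r _ => ?_) ?_)
  · rw [norm_mul, norm_mul, norm_eR, mul_one, Complex.norm_real, Real.norm_of_nonneg (hat_nonneg _ _)]
    calc _ ≤ 1 * μ.real univ := mul_le_mul (hat_le_one _ _) (norm_integral_wv_le μ u v r) (norm_nonneg _) zero_le_one
      _ = _ := one_mul _
  · rw [nsmul_eq_mul]
    refine mul_le_mul_of_nonneg_right ?_ hm0
    rw [Int.card_Ioo]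
    have : (c + (D : ℤ) - (c - D) - 1).toNat ≤ 2 * D := by omega
    exact_mod_cast this

/-- Strong type bound on shifted grids. -/
theorem strong_type (K : ℝ) {β κ : ℝ} (hβ : 0 < β) (hκ : 0 < κ) :
    ∃ n0 : ℕ, ∀ n ≥ n0, ∀ k N : ℕ, κ * n ≤ k → k ≤ n → 100000 * K ^ 4 * 4 ^ n ≤ (N : ℝ) → 0 < N →
      ∀ (c : ℤ), 4 ^ n + 4 ^ (n - k) ≤ c → c + 4 ^ (n - k) ≤ 8 * 4 ^ n →
      ∀ (μ : Measure Pt) (t CF : ℝ), BoxMeas μ t CF →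
      ∀ (φ ψ : ℝ → ℝ) (Λ : Finset ℝ) (ν : ℝ → ℝ) (q : ℝ), ParamMeas n K φ ψ Λ ν q →
      ∀ y₀ : ℝ, ∑ u ∈ Λ, ν u * avg (fun j : Fin N =>
        ‖lam μ u (φ u) (4 ^ (n - k)) c (y₀ + (j : ℕ) / N)‖ ^ (4 / 3 : ℝ)) ≤
        (μ.real univ * (2 : ℝ) ^ (-(n : ℝ))) ^ (4 / 3 : ℝ) +
          (3 * n + 1) * (4 * (μ.real univ * dualConst K t CF β q n ^ (1 / 3 : ℝ))) := by
  obtain ⟨n0, hn0⟩ := weak_type K hβ hκ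
  refine ⟨n0, fun n hn k N hk hkn hN hN0 c hc1 hc2 μ t CF hμ φ ψ Λ ν q hν y₀ => ?_⟩
  have := hμ.fin
  have : Nonempty (Fin N) := ⟨⟨0, hN0⟩⟩
  have hd0 := dualConst_nonneg K t hμ.CF_nonneg β hν.q_pos n
  have hM0 : 0 ≤ μ.real univ := measureReal_nonneg
  set M := μ.real univ with hM
  set l : ℝ → Fin N → ℂ := fun u j => lam μ u (φ u) (4 ^ (n - k)) c (y₀ + (j : ℕ) / N) with hl
  have hle : ∀ u j, ‖l u j‖ ≤ 2 * 4 ^ n * M := by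
    intro u j
    refine (norm_lam_le μ _ _ _ _ _).trans ?_
    push_cast
    gcongr
    · norm_num
    · omega
  rcases hM0.eq_or_lt with h0 | h0
  · have : ∀ u j, ‖l u j‖ = 0 := fun u j => le_antisymm ((hle u j).trans (by rw [← h0, mul_zero])) (norm_nonneg _)
    have h2 : ∑ u ∈ Λ, ν u * avg (fun j : Fin N => ‖l u j‖ ^ (4 / 3 : ℝ)) = 0 := by
      simp only [this]
      rw [Real.zero_rpow (by norm_num)]
      simp only [avg_const, mul_zero, Finset.sum_const_zero]
    refine h2.le.trans ?_
    positivity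
  set m₀ := M * (2 : ℝ) ^ (-(n : ℝ)) with hm₀
  have hm0 : 0 < m₀ := by positivity
  have hL : ∀ u j, ‖l u j‖ ≤ 2 ^ (3 * n + 1) * m₀ := by
    intro u j
    refine (hle u j).trans (le_of_eq ?_)
    rw [hm₀, Real.rpow_neg zero_le_two, Real.rpow_natCast, show (4 : ℝ) ^ n = 2 ^ n * 2 ^ n by rw [← mul_pow]; norm_num]
    field_simp; ring
  have step : ∀ i : ℕ, (2 ^ (i + 1) * m₀) ^ (4 / 3 : ℝ) * ∑ u ∈ Λ, ν u * avg (fun j : Fin N =>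
        if 2 ^ i * m₀ < ‖l u j‖ then (1 : ℝ) else 0) ≤ 4 * (M * dualConst K t CF β q n ^ (1 / 3 : ℝ)) := by
    intro i
    have h1 := hn0 n hn k N hk hkn hN c hc1 hc2 μ t CF hμ φ ψ Λ ν q hν y₀ (2 ^ i * m₀) (by positivity)
    have h2 : (2 ^ (i + 1) * m₀) ^ (4 / 3 : ℝ) ≤ 4 * (2 ^ i * m₀) ^ (4 / 3 : ℝ) := by
      rw [show (2 : ℝ) ^ (i + 1) * m₀ = 2 * (2 ^ i * m₀) by ring, Real.mul_rpow zero_le_two (by positivity)]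
      gcongr
      calc (2 : ℝ) ^ (4 / 3 : ℝ) ≤ 2 ^ (2 : ℝ) := Real.rpow_le_rpow_of_exponent_le one_le_two (by norm_num)
        _ = 4 := by norm_num
    refine (mul_le_mul_of_nonneg_right h2 (Finset.sum_nonneg fun u hu => mul_nonneg (hν.ν_nonneg u hu)
      (avg_nonneg fun j => by split_ifs <;> norm_num))).trans ?_
    rw [mul_assoc]
    exact mul_le_mul_of_nonneg_left h1 (by norm_num)
  have hsum := hν.sum_le_one
  calc _ ≤ ∑ u ∈ Λ, ν u * (m₀ ^ (4 / 3 : ℝ) + ∑ i ∈ Finset.range (3 * n + 1), (2 ^ (i + 1) * m₀) ^ (4 / 3 : ℝ) *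
          avg (fun j : Fin N => if 2 ^ i * m₀ < ‖l u j‖ then (1 : ℝ) else 0)) := by
        refine Finset.sum_le_sum fun u hu => mul_le_mul_of_nonneg_left ?_ (hν.ν_nonneg u hu)
        refine (avg_mono fun j => layer_cake hm0 (norm_nonneg _) (3 * n + 1) (hL u j)).trans (le_of_eq ?_)
        rw [avg_add, avg_const, avg_sum]
        simp only [avg_const_mul]
    _ = (∑ u ∈ Λ, ν u) * m₀ ^ (4 / 3 : ℝ) + ∑ i ∈ Finset.range (3 * n + 1), (2 ^ (i + 1) * m₀) ^ (4 / 3 : ℝ) *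
          ∑ u ∈ Λ, ν u * avg (fun j : Fin N => if 2 ^ i * m₀ < ‖l u j‖ then (1 : ℝ) else 0) := by
        simp only [mul_add, Finset.sum_add_distrib, Finset.sum_mul, Finset.mul_sum]
        rw [Finset.sum_comm]
        congr 1
        exact Finset.sum_congr rfl fun i _ => Finset.sum_congr rfl fun u _ => by ring
    _ ≤ 1 * m₀ ^ (4 / 3 : ℝ) + ∑ i ∈ Finset.range (3 * n + 1), 4 * (M * dualConst K t CF β q n ^ (1 / 3 : ℝ)) := by
        exact add_le_add (mul_le_mul_of_nonneg_right hsum (by positivity)) (Finset.sum_le_sum fun i _ => step i)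
    _ = _ := by rw [Finset.sum_const, Finset.card_range, nsmul_eq_mul]; push_cast; ring

lemma integral_le_of_avg_le {f : ℝ → ℝ} (hf : Continuous f) {N : ℕ} (hN : 0 < N) {B : ℝ}
    (h : ∀ y₀, avg (fun j : Fin N => f (y₀ + (j : ℕ) / N)) ≤ B) : ∫ y in (0 : ℝ)..1, f y ≤ B := by
  have hN' : (0 : ℝ) < N := by exact_mod_cast hN
  have h1 := intervalIntegral.sum_integral_adjacent_intervals (f := f) (μ := volume) (a := fun j : ℕ => (j : ℝ) / N) (n := N)
    (fun k _ => hf.intervalIntegrable _ _)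
  have e0 : ((0 : ℕ) : ℝ) / N = 0 := by simp
  rw [e0, div_self hN'.ne'] at h1
  have h2 : ∀ j : ℕ, ∫ y in (j : ℝ) / N..((j + 1 : ℕ) : ℝ) / N, f y = ∫ y in (0 : ℝ)..1 / N, f (y + (j : ℝ) / N) := by
    intro j
    rw [intervalIntegral.integral_comp_add_right]
    congr 1
    · ring
    · push_cast; ring
  simp only [h2] at h1
  have hsw : ∫ y in (0 : ℝ)..1 / N, ∑ j : Fin N, f (y + (j : ℕ) / N) =
      ∑ j : Fin N, ∫ y in (0 : ℝ)..1 / N, f (y + (j : ℕ) / N) :=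
    intervalIntegral.integral_finsetSum fun j _ =>
      (by fun_prop : Continuous fun y => f (y + ((j : ℕ) : ℝ) / N)).intervalIntegrable _ _
  rw [← h1, Finset.sum_range, ← hsw]
  have h3 : ∀ y, ∑ j : Fin N, f (y + (j : ℕ) / N) ≤ N * B := by
    intro y
    have := h y
    rw [avg, Fintype.card_fin, inv_mul_le_iff₀ hN'] at this
    exact this
  calc _ ≤ ∫ y in (0 : ℝ)..1 / N, N * B :=
        intervalIntegral.integral_mono_on (by positivity)
          ((by fun_prop : Continuous fun y => ∑ j : Fin N, f (y + (j : ℕ) / N)).intervalIntegrable _ _)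
          (by simp) (fun y _ => h3 y)
    _ = B := by rw [intervalIntegral.integral_const, smul_eq_mul]; field_simp; ring

/-- Indices of the frequency windows at scale `n`. -/
def wins (k : ℕ) : Finset ℤ := Finset.Icc (4 ^ k + 1) (8 * 4 ^ k - 1)

lemma card_wins_le (k : ℕ) : ((wins k).card : ℝ) ≤ 8 * 4 ^ k := by
  have : (wins k).card ≤ 8 * 4 ^ k := by
    rw [wins, Int.card_Icc]
    have h : (0 : ℤ) < 4 ^ k := by positivity
    zify
    omega
  exact_mod_cast this

/-- Total `L^{4/3}` energy of the localised densities at scale `n`. -/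
def Xn (μ : Measure Pt) (u v : ℝ) (n k : ℕ) : ℝ :=
  ∑ i ∈ wins k, ∫ y in (0 : ℝ)..1, ‖lam μ u v (4 ^ (n - k)) (i * 4 ^ (n - k)) y‖ ^ (4 / 3 : ℝ)

lemma Xn_nonneg (μ : Measure Pt) (u v : ℝ) (n k : ℕ) : 0 ≤ Xn μ u v n k :=
  Finset.sum_nonneg fun i _ => intervalIntegral.integral_nonneg zero_le_one fun y _ => by positivity

lemma sum_Xn_le_aux (K : ℝ) {β κ : ℝ} (hβ : 0 < β) (hκ : 0 < κ) :
    ∃ n0 : ℕ, ∀ n ≥ n0, ∀ k : ℕ, κ * n ≤ k → k ≤ n →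
      ∀ (μ : Measure Pt) (t CF : ℝ), BoxMeas μ t CF →
      ∀ (φ ψ : ℝ → ℝ) (Λ : Finset ℝ) (ν : ℝ → ℝ) (q : ℝ), ParamMeas n K φ ψ Λ ν q →
      ∑ u ∈ Λ, ν u * Xn μ u (φ u) n k ≤ 8 * 4 ^ k * (
        (μ.real univ * (2 : ℝ) ^ (-(n : ℝ))) ^ (4 / 3 : ℝ) +
          (3 * n + 1) * (4 * (μ.real univ * dualConst K t CF β q n ^ (1 / 3 : ℝ)))) := by
  obtain ⟨n0, hn0⟩ := strong_type K hβ hκ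
  refine ⟨n0, fun n hn k hk hkn μ t CF hμ φ ψ Λ ν q hν => ?_⟩
  have hd0 := dualConst_nonneg K t hμ.CF_nonneg β hν.q_pos n
  have hM0 : 0 ≤ μ.real univ := measureReal_nonneg
  set N : ℕ := ⌈100000 * K ^ 4 * 4 ^ n⌉₊ + 1 with hN
  have hN1 : 100000 * K ^ 4 * 4 ^ n ≤ (N : ℝ) := by
    rw [hN]; push_cast; linarith [Nat.le_ceil (100000 * K ^ 4 * 4 ^ n)]
  set B := (μ.real univ * (2 : ℝ) ^ (-(n : ℝ))) ^ (4 / 3 : ℝ) +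
          (3 * n + 1) * (4 * (μ.real univ * dualConst K t CF β q n ^ (1 / 3 : ℝ))) with hB
  have hcont : ∀ u (c : ℤ), Continuous fun y => ‖lam μ u (φ u) (4 ^ (n - k)) c y‖ ^ (4 / 3 : ℝ) := fun u c =>
    (continuous_lam μ u (φ u) _ c).norm.rpow_const fun _ => Or.inr (by norm_num)
  have hi : ∀ i ∈ wins k, ∑ u ∈ Λ, ν u * ∫ y in (0 : ℝ)..1,
      ‖lam μ u (φ u) (4 ^ (n - k)) (i * 4 ^ (n - k)) y‖ ^ (4 / 3 : ℝ) ≤ B := by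
    intro i hi
    rw [wins, Finset.mem_Icc] at hi
    have hsp : (4 : ℤ) ^ n = 4 ^ k * 4 ^ (n - k) := by rw [← pow_add]; congr 1; omega
    have hpos : (0 : ℤ) < 4 ^ (n - k) := by positivity
    have hc1 : (4 : ℤ) ^ n + 4 ^ (n - k) ≤ i * 4 ^ (n - k) := by rw [hsp]; nlinarith
    have hc2 : i * (4 : ℤ) ^ (n - k) + 4 ^ (n - k) ≤ 8 * 4 ^ n := by rw [hsp]; nlinarith
    have key := hn0 n hn k N hk hkn hN1 (by omega) _ hc1 hc2 μ t CF hμ φ ψ Λ ν q hν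
    have hi' : ∀ u, Continuous fun y => ν u * ‖lam μ u (φ u) (4 ^ (n - k)) (i * 4 ^ (n - k)) y‖ ^ (4 / 3 : ℝ) :=
      fun u => continuous_const.mul (hcont u _)
    have h1 : ∫ y in (0 : ℝ)..1, ∑ u ∈ Λ, ν u * ‖lam μ u (φ u) (4 ^ (n - k)) (i * 4 ^ (n - k)) y‖ ^ (4 / 3 : ℝ) ≤ B := by
      refine integral_le_of_avg_le (continuous_finsetSum _ fun u _ => hi' u) (N := N) (by omega) fun y₀ => ?_
      refine le_trans (le_of_eq ?_) (key y₀)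
      rw [avg_sum]
      exact Finset.sum_congr rfl fun u _ => avg_const_mul _ _
    rw [intervalIntegral.integral_finsetSum fun u _ => (hi' u).intervalIntegrable _ _] at h1
    simpa only [intervalIntegral.integral_const_mul] using h1
  calc ∑ u ∈ Λ, ν u * Xn μ u (φ u) n k = ∑ i ∈ wins k, ∑ u ∈ Λ, ν u * ∫ y in (0 : ℝ)..1,
      ‖lam μ u (φ u) (4 ^ (n - k)) (i * 4 ^ (n - k)) y‖ ^ (4 / 3 : ℝ) := by
        simp only [Xn, Finset.mul_sum]; rw [Finset.sum_comm]
    _ ≤ ∑ i ∈ wins k, B := Finset.sum_le_sum hi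
    _ = (wins k).card * B := by rw [Finset.sum_const, nsmul_eq_mul]
    _ ≤ _ := mul_le_mul_of_nonneg_right (card_wins_le k) (by positivity)

lemma exists_linear_le_two_rpow {η : ℝ} (hη : 0 < η) : ∃ C : ℝ, 0 < C ∧ ∀ n : ℕ, (3 * n + 1 : ℝ) ≤ C * 2 ^ (η * n) := by
  have hl : 0 < Real.log 2 := Real.log_pos one_lt_two
  refine ⟨3 / (η * Real.log 2) + 1, by positivity, fun n => ?_⟩
  have h1 : η * Real.log 2 * n + 1 ≤ (2 : ℝ) ^ (η * n) := by
    rw [Real.rpow_def_of_pos two_pos]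
    calc _ ≤ Real.exp (η * Real.log 2 * n) := Real.add_one_le_exp _
      _ = _ := by congr 1; ring
  have h2 : (1 : ℝ) ≤ 2 ^ (η * n) := Real.one_le_rpow one_le_two (by positivity)
  calc (3 * n + 1 : ℝ) = 3 / (η * Real.log 2) * (η * Real.log 2 * n) + 1 := by field_simp
    _ ≤ 3 / (η * Real.log 2) * 2 ^ (η * n) + 2 ^ (η * n) := by gcongr; linarith
    _ = _ := by ring

/-- Averaged decay of the localised energies. -/
theorem sum_Xn_le (K t : ℝ) {s : ℝ} (hs : (3 - t) / 2 < s) :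
    ∃ ε κ C : ℝ, 0 < ε ∧ 0 < κ ∧ κ ≤ 1 ∧ κ ≤ ε / 4 ∧ 0 < C ∧ ∃ n0 : ℕ, ∀ n ≥ n0,
      ∀ (μ : Measure Pt) (CF : ℝ), BoxMeas μ t CF → μ.real univ ≤ CF →
      ∀ (φ ψ : ℝ → ℝ) (Λ : Finset ℝ) (ν : ℝ → ℝ), ParamMeas n K φ ψ Λ ν ((2 : ℝ) ^ (-s)) →
      ∑ u ∈ Λ, ν u * Xn μ u (φ u) n ⌈κ * n⌉₊ ≤ C * 2 ^ (-(ε * n)) * CF ^ (1 / 3 : ℝ) * μ.real univ := by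
  set δ := 4 * s - 2 * (3 - t) with hδ
  have hδ0 : 0 < δ := by rw [hδ]; linarith
  set ε := min δ 1 / 12 with hε
  have hm0 : 0 < min δ 1 := lt_min hδ0 one_pos
  have hε1 : ε ≤ δ / 12 := by rw [hε]; linarith [min_le_left δ 1]
  have hε2 : ε ≤ 1 / 12 := by rw [hε]; linarith [min_le_right δ 1]
  have hε0 : 0 < ε := by rw [hε]; linarith
  obtain ⟨n0, hn0⟩ := sum_Xn_le_aux K (β := δ / 4) (κ := ε / 4) (by linarith) (by linarith)
  obtain ⟨C3, hC3, hlin⟩ := exists_linear_le_two_rpow (η := δ / 12) (by linarith)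
  have hτ := tauSum_nonneg
  set C2 : ℝ := 27 * (60 * tauSum) ^ 3 * ((2 * ⌈9 * K⌉₊ : ℕ) : ℝ) ^ (3 - t) with hC2
  have hC20 : 0 ≤ C2 := by positivity
  refine ⟨ε, ε / 4, 32 * (1 + C3 * (4 * C2 ^ (1 / 3 : ℝ))), hε0, by linarith, by linarith, le_rfl, by positivity, n0,
    fun n hn μ CF hμ hμC φ ψ Λ ν hν => ?_⟩
  have hM0 : 0 ≤ μ.real univ := measureReal_nonneg
  have hCF := hμ.CF_nonneg
  have hceil1 : ε / 4 * n ≤ ⌈ε / 4 * n⌉₊ := Nat.le_ceil _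
  have hceil2 : (⌈ε / 4 * n⌉₊ : ℝ) < ε / 4 * n + 1 := Nat.ceil_lt_add_one (by positivity)
  have hceil3 : ⌈ε / 4 * n⌉₊ ≤ n := Nat.ceil_le.2 (by
    have : (0 : ℝ) ≤ n := by positivity
    nlinarith)
  refine (hn0 n hn _ hceil1 hceil3 μ t CF hμ φ ψ Λ ν _ hν).trans ?_
  set k := ⌈ε / 4 * n⌉₊ with hk
  have hdc : dualConst K t CF (δ / 4) ((2 : ℝ) ^ (-s)) n = C2 * CF * 2 ^ (-(3 * δ / 4 * n)) := by
    rw [dualConst, hC2, ← Real.rpow_natCast _ (4 * n), ← Real.rpow_mul zero_le_two]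
    have e1 : ((2 * (⌈9 * K⌉₊ * 4 ^ n) : ℕ) : ℝ) ^ (3 - t) = ((2 * ⌈9 * K⌉₊ : ℕ) : ℝ) ^ (3 - t) * 2 ^ (2 * (3 - t) * n) := by
      rw [← mul_assoc, Nat.cast_mul, Real.mul_rpow (by positivity) (by positivity)]
      congr 1
      rw [show ((4 ^ n : ℕ) : ℝ) = (2 : ℝ) ^ ((2 * n : ℕ) : ℝ) by
        rw [Real.rpow_natCast, pow_mul]; norm_num, ← Real.rpow_mul zero_le_two]
      congr 1; push_cast; ring
    rw [e1]
    calc _ = 27 * (60 * tauSum) ^ 3 * ((2 * ⌈9 * K⌉₊ : ℕ) : ℝ) ^ (3 - t) * CF *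
          ((2 : ℝ) ^ (2 * (3 - t) * n) * (2 ^ (δ / 4 * n) * 2 ^ (-s * (4 * n : ℕ)))) := by ring
      _ = _ := by
        rw [← Real.rpow_add two_pos, ← Real.rpow_add two_pos]
        congr 2
        rw [hδ]; push_cast; ring
  have hdc3 : dualConst K t CF (δ / 4) ((2 : ℝ) ^ (-s)) n ^ (1 / 3 : ℝ) =
      C2 ^ (1 / 3 : ℝ) * CF ^ (1 / 3 : ℝ) * 2 ^ (-(δ / 4 * n)) := by
    rw [hdc, Real.mul_rpow (by positivity) (by positivity), Real.mul_rpow hC20 hCF, ← Real.rpow_mul zero_le_two]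
    congr 2; ring
  rw [hdc3]
  have h4k : (4 : ℝ) ^ k ≤ 4 * 2 ^ (ε / 2 * n) := by
    rw [show (4 : ℝ) ^ k = 2 ^ (2 * (k : ℝ)) by
      rw [Real.rpow_mul zero_le_two, Real.rpow_natCast]; norm_num,
      show (4 : ℝ) * 2 ^ (ε / 2 * n) = 2 ^ (2 + ε / 2 * n) by rw [Real.rpow_add two_pos]; norm_num]
    exact Real.rpow_le_rpow_of_exponent_le one_le_two (by linarith)
  set M := μ.real univ with hM
  have hn' : (0 : ℝ) ≤ n := by positivity
  have hfirst : (M * (2 : ℝ) ^ (-(n : ℝ))) ^ (4 / 3 : ℝ) ≤ CF ^ (1 / 3 : ℝ) * M * 2 ^ (-(n : ℝ)) := by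
    rw [Real.mul_rpow hM0 (by positivity), ← Real.rpow_mul zero_le_two]
    have e1 : M ^ (4 / 3 : ℝ) ≤ CF ^ (1 / 3 : ℝ) * M := by
      rw [show (4 / 3 : ℝ) = 1 / 3 + 1 by norm_num, Real.rpow_add_one' hM0 (by norm_num)]
      gcongr
    refine mul_le_mul e1 (Real.rpow_le_rpow_of_exponent_le one_le_two (by linarith)) (by positivity) (by positivity)
  set G := CF ^ (1 / 3 : ℝ) * M with hG
  have hG0 : 0 ≤ G := by positivity
  have hsec : (3 * n + 1 : ℝ) * (4 * (M * (C2 ^ (1 / 3 : ℝ) * CF ^ (1 / 3 : ℝ) * 2 ^ (-(δ / 4 * n))))) ≤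
      C3 * (4 * C2 ^ (1 / 3 : ℝ)) * G * 2 ^ (-(δ / 6 * n)) := by
    calc _ ≤ (C3 * 2 ^ (δ / 12 * n)) * (4 * (M * (C2 ^ (1 / 3 : ℝ) * CF ^ (1 / 3 : ℝ) * 2 ^ (-(δ / 4 * n))))) := by
          gcongr; exact hlin n
      _ = C3 * (4 * C2 ^ (1 / 3 : ℝ)) * G * (2 ^ (δ / 12 * n) * 2 ^ (-(δ / 4 * n))) := by rw [hG]; ring
      _ = _ := by rw [← Real.rpow_add two_pos]; congr 2; ring
  have p1 : (2 : ℝ) ^ (ε / 2 * n) * 2 ^ (-(n : ℝ)) ≤ 2 ^ (-(ε * n)) := by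
    rw [← Real.rpow_add two_pos]
    exact Real.rpow_le_rpow_of_exponent_le one_le_two (by nlinarith)
  have p2 : (2 : ℝ) ^ (ε / 2 * n) * 2 ^ (-(δ / 6 * n)) ≤ 2 ^ (-(ε * n)) := by
    rw [← Real.rpow_add two_pos]
    exact Real.rpow_le_rpow_of_exponent_le one_le_two (by nlinarith)
  calc _ ≤ 8 * (4 * 2 ^ (ε / 2 * n)) * (G * 2 ^ (-(n : ℝ)) + C3 * (4 * C2 ^ (1 / 3 : ℝ)) * G * 2 ^ (-(δ / 6 * n))) := by
        gcongr
    _ = 32 * G * ((2 ^ (ε / 2 * n) * 2 ^ (-(n : ℝ))) +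
          C3 * (4 * C2 ^ (1 / 3 : ℝ)) * (2 ^ (ε / 2 * n) * 2 ^ (-(δ / 6 * n)))) := by ring
    _ ≤ 32 * G * (2 ^ (-(ε * n)) + C3 * (4 * C2 ^ (1 / 3 : ℝ)) * 2 ^ (-(ε * n))) := by gcongr
    _ = _ := by rw [hG]; ring

lemma fej_ge {D : ℕ} (hD : 0 < D) {t : ℝ} (h : |t| ≤ 1 / (16 * D)) : (D : ℝ) / 2 ≤ fej D t := by
  have hD' : (0 : ℝ) < D := by exact_mod_cast hD
  have h1 : ∀ a ∈ Finset.range D, (9 / 10 : ℝ) ≤ (eR (a * t)).re := by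
    intro a ha
    have ha' : (a : ℝ) ≤ D := by exact_mod_cast (Finset.mem_range.1 ha).le
    have e : (eR (a * t)).re = Real.cos (2 * Real.pi * (a * t)) := by
      rw [eR, Complex.exp_ofReal_mul_I_re]
    have h2 : |(a : ℝ) * t| ≤ 1 / 16 := by
      rw [abs_mul, abs_of_nonneg (by positivity)]
      calc (a : ℝ) * |t| ≤ D * (1 / (16 * D)) := by gcongr
        _ = 1 / 16 := by field_simp
    have h3 := Real.one_sub_sq_div_two_le_cos (x := 2 * Real.pi * (a * t))
    have h4 : (2 * Real.pi * (a * t)) ^ 2 ≤ (2 * 3.15 * (1 / 16)) ^ 2 := by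
      rw [← sq_abs, abs_mul, abs_of_pos (by positivity : 0 < 2 * Real.pi)]
      have := Real.pi_lt_d2
      gcongr
    rw [e]
    norm_num at h4
    linarith
  have h2 : 9 / 10 * (D : ℝ) ≤ ‖∑ a ∈ Finset.range D, eR (a * t)‖ := by
    refine le_trans ?_ (Complex.re_le_norm _)
    rw [Complex.re_sum]
    calc 9 / 10 * (D : ℝ) = ∑ a ∈ Finset.range D, (9 / 10 : ℝ) := by simp [mul_comm]
      _ ≤ _ := Finset.sum_le_sum h1
  have h3 : (9 / 10 * (D : ℝ)) ^ 2 ≤ ‖∑ a ∈ Finset.range D, eR (a * t)‖ ^ 2 := by gcongr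
  rw [fej, inv_mul_eq_div, le_div_iff₀ hD']
  nlinarith

/-- The linear functional `x ↦ x₁ + u x₂ + v x₃`. -/
def dirProj (u v : ℝ) (x : Pt) : ℝ := x.1 + u * x.2.1 + v * x.2.2

lemma continuous_dirProj (u v : ℝ) : Continuous (dirProj u v) := by unfold dirProj; fun_prop

lemma fej_le_re_sum {D : ℕ} (hD : 0 < D) (u v y : ℝ) {x : Pt} (h1 : |x.2.1| ≤ 1 / 2) (h2 : |x.2.2| ≤ 1 / 2) :
    fej D (dirProj u v x - y) ≤
      16 * (∑ r ∈ Finset.Ioo (-(D : ℤ)) D, (hat D r : ℂ) * eR (r * (-y)) * wv u v r x).re := by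
  set S := Finset.Ioo (-(D : ℤ)) D
  have hpos : ∀ z : ℝ, (∑ r ∈ S, ((hat D r : ℂ) * eR (r * (-y))) * eR (r * z)).re = fej D (z - y) := by
    intro z
    rw [← Complex.ofReal_re (fej D (z - y)), fej_eq hD]
    congr 1
    refine Finset.sum_congr rfl fun r _ => ?_
    rw [mul_assoc, ← eR_add]; congr 2; ring
  have s1 : ∀ w, 1 / 4 * fej D (w + u * x.2.1 - y) ≤
      (∑ r ∈ S, ((hat D r : ℂ) * eR (r * (-y))) * lerp (r * u) x.2.1 * eR (r * w)).re := by
    intro w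
    rw [← hpos]
    exact re_sum_lerp_ge S _ u w h1 fun z => by rw [hpos]; exact fej_nonneg _ _
  have s2 := re_sum_lerp_ge S (fun r => ((hat D r : ℂ) * eR (r * (-y))) * lerp (r * u) x.2.1) v x.1 h2
    (fun z => le_trans (mul_nonneg (by norm_num) (fej_nonneg _ _)) (s1 z))
  have s3 := s1 (x.1 + v * x.2.2)
  have e1 : (∑ r ∈ S, (hat D r : ℂ) * eR (r * (-y)) * wv u v r x) =
      ∑ r ∈ S, ((hat D r : ℂ) * eR (r * (-y))) * lerp (r * u) x.2.1 * lerp (r * v) x.2.2 * eR (r * x.1) :=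
    Finset.sum_congr rfl fun r _ => by rw [wv]; ring
  have e2 : dirProj u v x - y = x.1 + v * x.2.2 + u * x.2.1 - y := by rw [dirProj]; ring
  rw [e1, e2]
  linarith

lemma measure_strip_le_lam {μ : Measure Pt} {t CF : ℝ} (hμ : BoxMeas μ t CF) {D : ℕ} (hD : 0 < D) (u v y : ℝ) :
    μ.real {x | |dirProj u v x - y| ≤ 1 / (16 * D)} * (D / 2) ≤ 16 * ‖lam μ u v D 0 y‖ := by
  have := hμ.fin
  have hm : MeasurableSet {x | |dirProj u v x - y| ≤ 1 / (16 * (D : ℝ))} :=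
    (isClosed_le ((continuous_dirProj u v).sub continuous_const).abs continuous_const).measurableSet
  have hinteg : Integrable (fun x => ∑ r ∈ Finset.Ioo (-(D : ℤ)) D, (hat D r : ℂ) * eR (r * (-y)) * wv u v r x) μ :=
    integrable_finsetSum _ fun r _ => (integral_wv_integrable μ u v r).const_mul _
  have e1 : ∫ x, ∑ r ∈ Finset.Ioo (-(D : ℤ)) D, (hat D r : ℂ) * eR (r * (-y)) * wv u v r x ∂μ = lam μ u v D 0 y := by
    rw [integral_finsetSum _ fun r _ => (integral_wv_integrable μ u v r).const_mul _, lam]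
    simp only [integral_const_mul, zero_sub, zero_add, sub_zero]
  calc μ.real {x | |dirProj u v x - y| ≤ 1 / (16 * D)} * (D / 2)
      = ∫ x, {x | |dirProj u v x - y| ≤ 1 / (16 * (D : ℝ))}.indicator (fun _ => (D / 2 : ℝ)) x ∂μ := by
        rw [integral_indicator hm, setIntegral_const, smul_eq_mul]
    _ ≤ ∫ x, 16 * (∑ r ∈ Finset.Ioo (-(D : ℤ)) D, (hat D r : ℂ) * eR (r * (-y)) * wv u v r x).re ∂μ := by
        refine integral_mono_ae ((integrable_const _).indicator hm) (hinteg.re.const_mul 16) ?_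
        filter_upwards [hμ.box] with x hx
        refine le_trans ?_ (fej_le_re_sum hD u v y hx.2.1 hx.2.2)
        rw [indicator_apply]
        split_ifs with h
        · exact fej_ge hD h
        · exact fej_nonneg _ _
    _ = 16 * (lam μ u v D 0 y).re := by
        rw [integral_const_mul, ← e1]; congr 1; exact integral_re hinteg
    _ ≤ _ := by gcongr; exact Complex.re_le_norm _

lemma sum_hat_eq {Δ : ℕ} (hΔ : 0 < Δ) (F : ℤ → ℝ) (T : Finset ℤ) (hF : ∀ i ∉ T, F i = 0) {r q : ℤ}
    (h1 : q * Δ ≤ r) (h2 : r < (q + 1) * Δ) :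
    ∑ i ∈ T, F i * hat Δ (r - i * Δ) = F q * hat Δ (r - q * Δ) + F (q + 1) * hat Δ (r - (q + 1) * Δ) := by
  have hΔ' : (0 : ℤ) < Δ := by exact_mod_cast hΔ
  rw [← Finset.sum_pair (f := fun i => F i * hat Δ (r - i * Δ)) (by omega : q ≠ q + 1)]
  rw [Finset.sum_subset (Finset.subset_union_left (s₁ := T) (s₂ := {q, q + 1})) fun i _ hi => by rw [hF i hi, zero_mul]]
  symm
  refine Finset.sum_subset Finset.subset_union_right fun i _ hi => ?_
  simp only [Finset.mem_insert, Finset.mem_singleton, not_or] at hi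
  rw [hat_eq_zero hΔ, mul_zero]
  rcases lt_or_gt_of_ne hi.1 with h | h
  · refine le_trans ?_ (le_abs_self _); nlinarith
  · refine le_trans ?_ (neg_le_abs _)
    have : q + 2 ≤ i := by omega
    nlinarith

lemma hat_interp {d Δ : ℕ} (hd : 0 < d) (hΔ : 0 < Δ) {r q : ℤ} (h1 : q * Δ ≤ r) (h2 : r < (q + 1) * Δ) :
    hat (d * Δ) r = hat (d * Δ) (q * Δ) * hat Δ (r - q * Δ) + hat (d * Δ) ((q + 1) * Δ) * hat Δ (r - (q + 1) * Δ) := by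
  have hΔ' : (0 : ℤ) < Δ := by exact_mod_cast hΔ
  have hΔR : (0 : ℝ) < Δ := by exact_mod_cast hΔ
  have hdR : (0 : ℝ) < d := by exact_mod_cast hd
  have hdd : 0 < d * Δ := by positivity
  have a1 : hat Δ (r - q * Δ) = 1 - ((r : ℝ) - q * Δ) / Δ := by
    rw [hat_eq hΔ (by rw [abs_of_nonneg (by linarith)]; linarith)]
    push_cast
    rw [abs_of_nonneg (by have : ((q * Δ : ℤ) : ℝ) ≤ r := by exact_mod_cast h1
                          push_cast at this; linarith)]
  have a2 : hat Δ (r - (q + 1) * Δ) = ((r : ℝ) - q * Δ) / Δ := by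
    rw [hat_eq hΔ (by rw [abs_of_nonpos (by linarith)]; linarith)]
    push_cast
    rw [abs_of_nonpos (by have : (r : ℝ) < (((q + 1) * Δ : ℤ) : ℝ) := by exact_mod_cast h2
                          push_cast at this; linarith)]
    field_simp; ring
  rw [a1, a2]
  have z : ∀ a : ℤ, (d * Δ : ℤ) ≤ |a| → hat (d * Δ) a = 0 := fun a ha => hat_eq_zero hdd (by push_cast; exact ha)
  have e : ∀ a : ℤ, |a| ≤ (d * Δ : ℤ) → hat (d * Δ) a = 1 - |(a : ℝ)| / (d * Δ) := fun a ha => by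
    rw [hat_eq hdd (by push_cast; exact ha)]; push_cast; rfl
  rcases le_or_gt 0 q with hq | hq
  · have b0 : 0 ≤ q * Δ := by positivity
    rcases le_or_gt (d : ℤ) q with hqd | hqd
    · have : (d : ℤ) * Δ ≤ q * Δ := by nlinarith
      rw [z _ (by rw [abs_of_nonneg (by linarith)]; linarith), z _ (by rw [abs_of_nonneg b0]; linarith),
        z _ (by rw [abs_of_nonneg (by nlinarith)]; nlinarith)]
      ring
    · have : (q + 1) * Δ ≤ (d : ℤ) * Δ := by nlinarith
      rw [e _ (by rw [abs_of_nonneg (by linarith)]; linarith), e _ (by rw [abs_of_nonneg b0]; linarith),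
        e _ (by rw [abs_of_nonneg (by nlinarith)]; nlinarith)]
      have c0 : (0 : ℝ) ≤ r := by exact_mod_cast b0.trans h1
      have c1 : (0 : ℝ) ≤ q := by exact_mod_cast hq
      push_cast
      rw [abs_of_nonneg c0, abs_of_nonneg (by positivity), abs_of_nonneg (by positivity)]
      field_simp; ring
  · have b0 : (q + 1) * Δ ≤ 0 := by nlinarith
    rcases le_or_gt (q + 1) (-d : ℤ) with hqd | hqd
    · have : (q + 1) * Δ ≤ -(d : ℤ) * Δ := by nlinarith
      rw [z _ (by rw [abs_of_nonpos (by linarith)]; linarith), z _ (by rw [abs_of_nonpos (by nlinarith)]; nlinarith),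
        z _ (by rw [abs_of_nonpos b0]; nlinarith)]
      ring
    · have : -(d : ℤ) * Δ ≤ q * Δ := by nlinarith
      rw [e _ (by rw [abs_of_nonpos (by linarith)]; linarith), e _ (by rw [abs_of_nonpos (by nlinarith)]; nlinarith),
        e _ (by rw [abs_of_nonpos b0]; nlinarith)]
      have c0 : (r : ℝ) ≤ 0 := by exact_mod_cast h2.le.trans b0
      have c1 : (q : ℝ) + 1 ≤ 0 := by exact_mod_cast hq
      push_cast
      rw [abs_of_nonpos c0, abs_of_nonpos (by nlinarith), abs_of_nonpos (by nlinarith)]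
      field_simp; ring

/-- Piecewise linear multiplier supported in the annulus `2^l < |r| < 2^(l+2)`. -/
def ann (l : ℕ) (r : ℤ) : ℝ := 2 * hat (2 ^ (l + 2)) r - 3 * hat (2 ^ (l + 1)) r + hat (2 ^ l) r

lemma ann_neg (l : ℕ) (r : ℤ) : ann l (-r) = ann l r := by simp only [ann, hat_neg]

lemma abs_ann_le (l : ℕ) (r : ℤ) : |ann l r| ≤ 3 := by
  have h := fun D => hat_nonneg D r
  have h' := fun D => hat_le_one D r
  rw [ann, abs_le]
  constructor <;> linarith [h (2 ^ (l + 2)), h (2 ^ (l + 1)), h (2 ^ l), h' (2 ^ (l + 2)), h' (2 ^ (l + 1)), h' (2 ^ l)]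

lemma ann_eq_zero {l : ℕ} {r : ℤ} (h : |r| ≤ 2 ^ l ∨ 2 ^ (l + 2) ≤ |r|) : ann l r = 0 := by
  have p : (0 : ℤ) < 2 ^ l := by positivity
  rcases h with h | h
  · rw [ann, hat_eq (by positivity) (by push_cast; rw [pow_add]; linarith),
      hat_eq (by positivity) (by push_cast; rw [pow_add]; linarith), hat_eq (by positivity) (by push_cast; linarith)]
    push_cast
    rw [pow_add, pow_add]
    field_simp; ring
  · rw [pow_add] at h
    rw [ann, hat_eq_zero (by positivity) (by push_cast; rw [pow_add]; linarith),
      hat_eq_zero (by positivity) (by push_cast; rw [pow_add]; linarith), hat_eq_zero (by positivity) (by push_cast; linarith)]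
    ring

lemma ann_eq_sum {n k l : ℕ} (hk : k ≤ n) (hl : l = 2 * n ∨ l = 2 * n + 1) (r : ℤ) :
    ann l r = ∑ i ∈ wins k, ann l (i * 4 ^ (n - k)) *
      (hat (4 ^ (n - k)) (r - i * 4 ^ (n - k)) + hat (4 ^ (n - k)) (r - (-i) * 4 ^ (n - k))) := by
  set Δ : ℕ := 4 ^ (n - k) with hΔ
  have hΔ0 : 0 < Δ := by positivity
  have hΔ0' : (0 : ℤ) < Δ := by exact_mod_cast hΔ0
  have hΔc : (4 : ℤ) ^ (n - k) = Δ := by rw [hΔ]; push_cast; rfl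
  have hsp : (4 : ℤ) ^ n = 4 ^ k * Δ := by rw [← hΔc, ← pow_add]; congr 1; omega
  obtain ⟨d, hd⟩ : ∃ d, 2 ^ l = d * Δ := by
    rw [hΔ, show (4 : ℕ) = 2 ^ 2 by norm_num, ← pow_mul]
    exact ⟨2 ^ (l - 2 * (n - k)), by rw [← pow_add]; congr 1; omega⟩
  have hd0 : 0 < d := Nat.pos_of_ne_zero fun h => by rw [h, zero_mul] at hd; exact absurd hd (by positivity)
  set T : Finset ℤ := wins k ∪ (wins k).image (fun i => -i) with hT
  have h4k : (0 : ℤ) < 4 ^ k := by positivity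
  have hdisj : Disjoint (wins k) ((wins k).image (fun i => -i)) := by
    rw [Finset.disjoint_left]
    intro a ha hb
    simp only [Finset.mem_image] at hb
    obtain ⟨b, hb, rfl⟩ := hb
    rw [wins, Finset.mem_Icc] at ha hb
    omega
  have hl4 : (2 : ℤ) ^ l = 4 ^ n ∨ (2 : ℤ) ^ l = 2 * 4 ^ n := by
    rcases hl with rfl | rfl
    · left; rw [pow_mul]; norm_num
    · right; rw [pow_add, pow_mul]; norm_num; ring
  have hF : ∀ i ∉ T, ann l (i * Δ) = 0 := by
    intro i hi
    simp only [hT, Finset.mem_union, Finset.mem_image, not_or, not_exists, not_and] at hi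
    have h1 := hi.1
    have h2 : -i ∉ wins k := fun h => hi.2 _ h (neg_neg i)
    rw [wins, Finset.mem_Icc, not_and_or] at h1 h2
    apply ann_eq_zero
    rw [abs_mul, abs_of_pos hΔ0', pow_add]
    have : |i| ≤ 4 ^ k ∨ 8 * 4 ^ k ≤ |i| := by
      rcases le_total 0 i with h | h
      · rw [abs_of_nonneg h]; omega
      · rw [abs_of_nonpos h]; omega
    have h4n : (0 : ℤ) < 4 ^ n := by positivity
    rcases this with h | h
    · left
      have : |i| * Δ ≤ 4 ^ n := by rw [hsp]; gcongr
      omega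
    · right
      have : 8 * 4 ^ n ≤ |i| * Δ := by rw [hsp, ← mul_assoc]; gcongr
      omega
  have h1 : r / Δ * Δ ≤ r := Int.ediv_mul_le _ hΔ0'.ne'
  have h2 : r < (r / Δ + 1) * Δ := Int.lt_ediv_add_one_mul_self _ hΔ0'
  have hsum := sum_hat_eq hΔ0 (fun i => ann l (i * Δ)) T hF h1 h2
  have hi : ∀ {d' : ℕ}, 0 < d' → _ := fun {d'} h => hat_interp (d := d') h hΔ0 h1 h2
  have e1 : 2 ^ (l + 1) = (2 * d) * Δ := by rw [pow_add, hd]; ring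
  have e2 : 2 ^ (l + 2) = (4 * d) * Δ := by rw [pow_add, hd]; ring
  have key : ann l r = ∑ i ∈ T, ann l (i * Δ) * hat Δ (r - i * Δ) := by
    rw [hsum]
    simp only [ann, e1, e2, hd]
    rw [hi (by positivity : 0 < 4 * d), hi (by positivity : 0 < 2 * d), hi hd0]
    ring
  rw [key, hT, Finset.sum_union hdisj, Finset.sum_image (fun a _ b _ h => neg_injective h), ← Finset.sum_add_distrib]
  refine Finset.sum_congr rfl fun i _ => ?_
  rw [hΔc, neg_mul, ann_neg]; ring

lemma lam_eq_sum {M D : ℕ} (hD : 0 < D) {c : ℤ} (h : |c| + D ≤ M) (μ : Measure Pt) (u v y : ℝ) :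
    lam μ u v D c y = ∑ r ∈ Finset.Ioo (-(M : ℤ)) M, (hat D (r - c) : ℂ) * (eR (r * (-y)) * ∫ x, wv u v r x ∂μ) := by
  have := neg_abs_le c
  have := le_abs_self c
  rw [lam]
  simp only [mul_assoc]
  refine Finset.sum_subset (Finset.Ioo_subset_Ioo (by omega) (by omega)) fun r _ hr => ?_
  rw [hat_eq_zero hD, Complex.ofReal_zero, zero_mul]
  rw [Finset.mem_Ioo, not_and_or] at hr
  rcases hr with hr | hr
  · exact le_trans (by omega) (neg_le_abs _)
  · exact le_trans (by omega) (le_abs_self _)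

lemma lam_neg (μ : Measure Pt) (u v : ℝ) (D : ℕ) (c : ℤ) (y : ℝ) :
    lam μ u v D (-c) y = (starRingEnd ℂ) (lam μ u v D c y) := by
  rw [lam, lam, map_sum]
  refine Finset.sum_nbij' (fun r => -r) (fun r => -r) ?_ ?_ (fun _ _ => neg_neg _) (fun _ _ => neg_neg _) ?_
  · intro r hr; rw [Finset.mem_Ioo] at hr ⊢; omega
  · intro r hr; rw [Finset.mem_Ioo] at hr ⊢; omega
  · intro r _
    have : ∫ x, wv u v r x ∂μ = (starRingEnd ℂ) (∫ x, wv u v (-r) x ∂μ) := by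
      rw [← integral_conj]
      refine integral_congr_ae (ae_of_all _ fun x => ?_)
      simp only [wv_neg, Complex.conj_conj]
    rw [this, map_mul, map_mul, Complex.conj_ofReal, ← eR_neg, ← hat_neg]
    congr 3
    · congr 1; ring
    · push_cast; ring

/-- The part of the density with frequencies in an annulus. -/
def lamAnn (μ : Measure Pt) (u v : ℝ) (l : ℕ) (y : ℝ) : ℂ :=
  2 * lam μ u v (2 ^ (l + 2)) 0 y - 3 * lam μ u v (2 ^ (l + 1)) 0 y + lam μ u v (2 ^ l) 0 y

lemma lamAnn_eq {n k l : ℕ} (hk : k ≤ n) (hl : l = 2 * n ∨ l = 2 * n + 1) (μ : Measure Pt) (u v y : ℝ) :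
    lamAnn μ u v l y = ∑ i ∈ wins k, (ann l (i * 4 ^ (n - k)) : ℂ) *
      (lam μ u v (4 ^ (n - k)) (i * 4 ^ (n - k)) y + lam μ u v (4 ^ (n - k)) (-(i * 4 ^ (n - k))) y) := by
  set M : ℕ := 8 * 4 ^ n with hM
  have h4n : 0 < 4 ^ n := by positivity
  have hl4 : 2 ^ l = 4 ^ n ∨ 2 ^ l = 2 * 4 ^ n := by
    rcases hl with rfl | rfl
    · left; rw [pow_mul]; norm_num
    · right; rw [pow_add, pow_mul]; norm_num; ring
  have hsp : (4 : ℤ) ^ n = 4 ^ k * 4 ^ (n - k) := by rw [← pow_add]; congr 1; omega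
  have hp : (0 : ℤ) < 4 ^ (n - k) := by positivity
  have hwin : ∀ i ∈ wins k, |i * 4 ^ (n - k)| + ((4 ^ (n - k) : ℕ) : ℤ) ≤ M := by
    intro i hi
    rw [wins, Finset.mem_Icc] at hi
    have : (0 : ℤ) < 4 ^ k := by positivity
    rw [abs_of_nonneg (mul_nonneg (by omega) hp.le), hM]
    push_cast
    rw [hsp]; nlinarith
  have a : ∀ j ≤ 2, |(0 : ℤ)| + ((2 ^ (l + j) : ℕ) : ℤ) ≤ M := by
    intro j hj
    have : 2 ^ (l + j) ≤ 2 ^ (l + 2) := Nat.pow_le_pow_right (by norm_num) (by omega)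
    rw [pow_add 2 l 2] at this
    rw [abs_zero, zero_add]
    exact_mod_cast this.trans (by omega)
  rw [lamAnn, lam_eq_sum (by positivity) (a 2 le_rfl), lam_eq_sum (by positivity) (a 1 (by norm_num)),
    lam_eq_sum (D := 2 ^ l) (by positivity) (a 0 (by norm_num))]
  have e : ∀ i ∈ wins k, (ann l (i * 4 ^ (n - k)) : ℂ) *
      (lam μ u v (4 ^ (n - k)) (i * 4 ^ (n - k)) y + lam μ u v (4 ^ (n - k)) (-(i * 4 ^ (n - k))) y) =
      ∑ r ∈ Finset.Ioo (-(M : ℤ)) M, ((ann l (i * 4 ^ (n - k)) *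
        (hat (4 ^ (n - k)) (r - i * 4 ^ (n - k)) + hat (4 ^ (n - k)) (r - (-i) * 4 ^ (n - k))) : ℝ) : ℂ) *
        (eR (r * (-y)) * ∫ x, wv u v r x ∂μ) := by
    intro i hi
    rw [lam_eq_sum (by positivity) (hwin i hi), lam_eq_sum (by positivity) (by rw [abs_neg]; exact hwin i hi),
      ← Finset.sum_add_distrib, Finset.mul_sum]
    refine Finset.sum_congr rfl fun r _ => ?_
    rw [neg_mul]; push_cast; ring
  rw [Finset.sum_congr rfl e, Finset.sum_comm, Finset.mul_sum, Finset.mul_sum, ← Finset.sum_sub_distrib,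
    ← Finset.sum_add_distrib]
  refine Finset.sum_congr rfl fun r _ => ?_
  rw [← Finset.sum_mul, ← Complex.ofReal_sum, ← ann_eq_sum hk hl, ann]
  simp only [sub_zero]
  push_cast; ring

lemma norm_lamAnn_le {n k l : ℕ} (hk : k ≤ n) (hl : l = 2 * n ∨ l = 2 * n + 1) (μ : Measure Pt) (u v y : ℝ) :
    ‖lamAnn μ u v l y‖ ≤ 6 * ∑ i ∈ wins k, ‖lam μ u v (4 ^ (n - k)) (i * 4 ^ (n - k)) y‖ := by
  rw [lamAnn_eq hk hl, Finset.mul_sum]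
  refine (norm_sum_le _ _).trans (Finset.sum_le_sum fun i _ => ?_)
  rw [norm_mul, Complex.norm_real, Real.norm_eq_abs]
  have h1 := abs_ann_le l (i * 4 ^ (n - k))
  have h2 := norm_add_le (lam μ u v (4 ^ (n - k)) (i * 4 ^ (n - k)) y) (lam μ u v (4 ^ (n - k)) (-(i * 4 ^ (n - k))) y)
  rw [lam_neg, RCLike.norm_conj] at h2
  rw [lam_neg]
  calc _ ≤ 3 * (‖lam μ u v (4 ^ (n - k)) (i * 4 ^ (n - k)) y‖ + ‖lam μ u v (4 ^ (n - k)) (i * 4 ^ (n - k)) y‖) := by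
        gcongr
    _ = _ := by ring

lemma continuous_lamAnn (μ : Measure Pt) (u v : ℝ) (l : ℕ) : Continuous (lamAnn μ u v l) := by
  have := continuous_lam μ u v
  unfold lamAnn
  fun_prop

lemma integral_lamAnn_le {n k l : ℕ} (hk : k ≤ n) (hl : l = 2 * n ∨ l = 2 * n + 1) (μ : Measure Pt) (u v : ℝ) :
    ∫ y in (0 : ℝ)..1, ‖lamAnn μ u v l y‖ ^ (4 / 3 : ℝ) ≤ 72 * ((4 : ℝ) ^ k) ^ (1 / 3 : ℝ) * Xn μ u v n k := by
  have hcont : ∀ (c : ℤ), Continuous fun y => ‖lam μ u v (4 ^ (n - k)) c y‖ ^ (4 / 3 : ℝ) := fun c =>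
    (continuous_lam μ u v _ c).norm.rpow_const fun _ => Or.inr (by norm_num)
  have h1 : ∀ y, ‖lamAnn μ u v l y‖ ^ (4 / 3 : ℝ) ≤ 72 * ((4 : ℝ) ^ k) ^ (1 / 3 : ℝ) *
      ∑ i ∈ wins k, ‖lam μ u v (4 ^ (n - k)) (i * 4 ^ (n - k)) y‖ ^ (4 / 3 : ℝ) := by
    intro y
    have a1 := Real.rpow_le_rpow (norm_nonneg _) (norm_lamAnn_le hk hl μ u v y) (by norm_num : (0 : ℝ) ≤ 4 / 3)
    have a2 := Real.rpow_sum_le_const_mul_sum_rpow (wins k) (fun i => ‖lam μ u v (4 ^ (n - k)) (i * 4 ^ (n - k)) y‖)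
      (p := 4 / 3) (by norm_num)
    simp only [abs_norm] at a2
    rw [Real.mul_rpow (by norm_num) (Finset.sum_nonneg fun _ _ => norm_nonneg _)] at a1
    have a3 : ((wins k).card : ℝ) ^ (4 / 3 - 1 : ℝ) ≤ 2 * ((4 : ℝ) ^ k) ^ (1 / 3 : ℝ) := by
      rw [show (4 / 3 - 1 : ℝ) = 1 / 3 by norm_num]
      refine (Real.rpow_le_rpow (by positivity) (card_wins_le k) (by norm_num)).trans (le_of_eq ?_)
      rw [Real.mul_rpow (by norm_num) (by positivity)]
      congr 1
      rw [show (8 : ℝ) = 2 ^ (3 : ℝ) by norm_num, ← Real.rpow_mul zero_le_two]; norm_num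
    have a4 : (6 : ℝ) ^ (4 / 3 : ℝ) ≤ 36 := by
      calc (6 : ℝ) ^ (4 / 3 : ℝ) ≤ 6 ^ (2 : ℝ) := Real.rpow_le_rpow_of_exponent_le (by norm_num) (by norm_num)
        _ = 36 := by norm_num
    have a5 : 0 ≤ ∑ i ∈ wins k, ‖lam μ u v (4 ^ (n - k)) (i * 4 ^ (n - k)) y‖ ^ (4 / 3 : ℝ) :=
      Finset.sum_nonneg fun _ _ => by positivity
    calc _ ≤ _ := a1
      _ ≤ 36 * (2 * ((4 : ℝ) ^ k) ^ (1 / 3 : ℝ) * ∑ i ∈ wins k, ‖lam μ u v (4 ^ (n - k)) (i * 4 ^ (n - k)) y‖ ^ (4 / 3 : ℝ)) := by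
          refine mul_le_mul a4 (a2.trans (mul_le_mul_of_nonneg_right a3 a5)) (by positivity) (by norm_num)
      _ = _ := by ring
  have hc2 : Continuous fun y => ‖lamAnn μ u v l y‖ ^ (4 / 3 : ℝ) :=
    (continuous_lamAnn μ u v l).norm.rpow_const fun _ => Or.inr (by norm_num)
  have hc3 : Continuous fun y => 72 * ((4 : ℝ) ^ k) ^ (1 / 3 : ℝ) *
      ∑ i ∈ wins k, ‖lam μ u v (4 ^ (n - k)) (i * 4 ^ (n - k)) y‖ ^ (4 / 3 : ℝ) :=
    continuous_const.mul (continuous_finsetSum _ fun i _ => hcont _)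
  refine (intervalIntegral.integral_mono_on zero_le_one (hc2.intervalIntegrable _ _)
    (hc3.intervalIntegrable _ _) fun y _ => h1 y).trans ?_
  rw [intervalIntegral.integral_const_mul, intervalIntegral.integral_finsetSum fun i _ => (hcont _).intervalIntegrable _ _, Xn]

/-- The exponent `4/3`. -/
abbrev p43 : ℝ≥0∞ := ENNReal.ofReal (4 / 3)

lemma p43_toReal : p43.toReal = 4 / 3 := ENNReal.toReal_ofReal (by norm_num)

lemma one_le_p43 : 1 ≤ p43 := by rw [p43, ENNReal.one_le_ofReal]; norm_num

/-- Lebesgue measure on the unit interval. -/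
abbrev unitVol : Measure ℝ := volume.restrict (Ioc 0 1)

lemma eLpNorm_le_of_integral_le {f : ℝ → ℂ} (hf : Continuous f) {B : ℝ}
    (h : ∫ y in (0 : ℝ)..1, ‖f y‖ ^ (4 / 3 : ℝ) ≤ B) : eLpNorm f p43 unitVol ≤ ENNReal.ofReal (B ^ (3 / 4 : ℝ)) := by
  have hc : Continuous fun y => ‖f y‖ ^ (4 / 3 : ℝ) := hf.norm.rpow_const fun _ => Or.inr (by norm_num)
  rw [intervalIntegral.integral_of_le zero_le_one] at h
  have hB : 0 ≤ B := le_trans (integral_nonneg fun y => by positivity) h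
  have h2 : ∫⁻ y, ‖f y‖ₑ ^ (4 / 3 : ℝ) ∂unitVol = ENNReal.ofReal (∫ y in Ioc (0 : ℝ) 1, ‖f y‖ ^ (4 / 3 : ℝ)) := by
    rw [ofReal_integral_eq_lintegral_ofReal
      (hc.integrableOn_Icc.mono_set Ioc_subset_Icc_self) (ae_of_all _ fun y => by positivity)]
    refine lintegral_congr fun y => ?_
    rw [← ofReal_norm, ENNReal.ofReal_rpow_of_nonneg (norm_nonneg _) (by norm_num)]
  rw [eLpNorm_eq_lintegral_rpow_enorm_toReal (by simp) ENNReal.ofReal_ne_top, p43_toReal, h2,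
    ENNReal.ofReal_rpow_of_nonneg (integral_nonneg fun y => by positivity) (by norm_num)]
  refine ENNReal.ofReal_le_ofReal ?_
  rw [show (1 / (4 / 3) : ℝ) = 3 / 4 by norm_num]
  exact Real.rpow_le_rpow (integral_nonneg fun y => by positivity) h (by norm_num)

lemma eLpNorm_lamAnn_le (ε : ℝ) (hε : 0 < ε) (μ : Measure Pt) (u v : ℝ) {κ W : ℝ} (hκ0 : 0 ≤ κ) (hκ : κ ≤ ε / 4)
    (hκ1 : κ ≤ 1) (hW : 0 ≤ W) (l : ℕ) (h : (2 : ℝ) ^ (ε / 4 * (l / 2 : ℕ)) * Xn μ u v (l / 2) ⌈κ * (l / 2 : ℕ)⌉₊ ≤ W) :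
    eLpNorm (lamAnn μ u v l) p43 unitVol ≤
      ENNReal.ofReal (144 * W ^ (3 / 4 : ℝ) * 2 ^ (ε / 32) * ((2 : ℝ) ^ (-(ε / 32))) ^ l) := by
  set n := l / 2 with hn
  set k := ⌈κ * (n : ℝ)⌉₊ with hk
  have hn0 : (0 : ℝ) ≤ n := by positivity
  have hkn : k ≤ n := Nat.ceil_le.2 (by nlinarith)
  have hk2 : (k : ℝ) < κ * n + 1 := Nat.ceil_lt_add_one (by positivity)
  refine (eLpNorm_le_of_integral_le (continuous_lamAnn μ u v l)
    (integral_lamAnn_le hkn (by omega) μ u v)).trans (ENNReal.ofReal_le_ofReal ?_)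
  have hX := Xn_nonneg μ u v n k
  have h1 : ((4 : ℝ) ^ k) ^ (1 / 3 : ℝ) ≤ 2 * 2 ^ (ε / 6 * n) := by
    rw [← Real.rpow_natCast, ← Real.rpow_mul (by norm_num), show (4 : ℝ) = 2 ^ (2 : ℝ) by norm_num,
      ← Real.rpow_mul zero_le_two, ← Real.rpow_one_add' zero_le_two (by positivity)]
    exact Real.rpow_le_rpow_of_exponent_le one_le_two (by nlinarith)
  have h2 : Xn μ u v n k ≤ W * 2 ^ (-(ε / 4 * n)) := by
    rw [Real.rpow_neg zero_le_two, ← div_eq_mul_inv, le_div_iff₀ (by positivity), mul_comm]; exact h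
  have h3 : 72 * ((4 : ℝ) ^ k) ^ (1 / 3 : ℝ) * Xn μ u v n k ≤ 144 * (W * 2 ^ (-(ε / 12 * n))) := by
    calc _ ≤ 72 * (2 * 2 ^ (ε / 6 * n)) * (W * 2 ^ (-(ε / 4 * n))) := by gcongr
      _ = 144 * (W * (2 ^ (ε / 6 * n) * 2 ^ (-(ε / 4 * n)))) := by ring
      _ = _ := by rw [← Real.rpow_add two_pos]; congr 3; ring
  calc _ ≤ (144 * (W * (2 : ℝ) ^ (-(ε / 12 * n)))) ^ (3 / 4 : ℝ) := Real.rpow_le_rpow (by positivity) h3 (by norm_num)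
    _ = 144 ^ (3 / 4 : ℝ) * (W ^ (3 / 4 : ℝ) * 2 ^ (-(ε / 16 * n))) := by
        rw [Real.mul_rpow (by norm_num) (by positivity), Real.mul_rpow hW (by positivity), ← Real.rpow_mul zero_le_two]
        congr 3; ring
    _ ≤ 144 * (W ^ (3 / 4 : ℝ) * (2 ^ (ε / 32) * ((2 : ℝ) ^ (-(ε / 32))) ^ l)) := by
        gcongr
        · calc (144 : ℝ) ^ (3 / 4 : ℝ) ≤ 144 ^ (1 : ℝ) :=
              Real.rpow_le_rpow_of_exponent_le (by norm_num) (by norm_num)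
            _ = 144 := by norm_num
        · rw [← Real.rpow_natCast, ← Real.rpow_mul zero_le_two, ← Real.rpow_add two_pos]
          refine Real.rpow_le_rpow_of_exponent_le one_le_two ?_
          have : (l : ℝ) ≤ 2 * n + 1 := by exact_mod_cast (by omega : l ≤ 2 * n + 1)
          nlinarith
    _ = _ := by ring

/-- Uniform `L^{4/3}` bound for the smoothed projections. -/
theorem eLpNorm_lam_le {ε : ℝ} (hε : 0 < ε) (n1 : ℕ) : ∃ C0 : ℝ, 0 < C0 ∧ ∀ (μ : Measure Pt) (_ : IsFiniteMeasure μ)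
    (u v κ W : ℝ), 0 ≤ κ → κ ≤ ε / 4 → κ ≤ 1 → 0 ≤ W →
    (∀ n ≥ n1, (2 : ℝ) ^ (ε / 4 * n) * Xn μ u v n ⌈κ * n⌉₊ ≤ W) →
    ∀ l ≥ 2 * n1, eLpNorm (lam μ u v (2 ^ l) 0) p43 unitVol ≤
      ENNReal.ofReal (C0 * (μ.real univ + W ^ (3 / 4 : ℝ))) := by
  set q : ℝ := 2 ^ (-(ε / 32)) with hq
  have hq0 : 0 < q := by positivity
  have hq1 : q < 1 := Real.rpow_lt_one_of_one_lt_of_neg one_lt_two (by linarith)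
  set C0 : ℝ := 10 * 2 ^ (2 * n1) + 144 * 2 ^ (ε / 32) * (1 - q)⁻¹ with hC0
  have hC1 : 0 < (1 - q)⁻¹ := inv_pos.2 (by linarith)
  refine ⟨C0, by positivity, fun μ _ u v κ W hκ0 hκ hκ1 hW h => ?_⟩
  set m := μ.real univ with hm
  have hm0 : 0 ≤ m := measureReal_nonneg
  have hWW : 0 ≤ W ^ (3 / 4 : ℝ) := by positivity
  have hcl := continuous_lam μ u v
  have hbase : ∀ f : ℝ → ℂ, (∀ y, ‖f y‖ ≤ 10 * 2 ^ (2 * n1) * m) → eLpNorm f p43 unitVol ≤ ENNReal.ofReal (10 * 2 ^ (2 * n1) * m) := by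
    intro f hf
    refine (eLpNorm_le_of_ae_bound (ae_of_all _ hf)).trans (le_of_eq ?_)
    simp
  have hl1 : ∀ y, ‖lam μ u v (2 ^ (2 * n1)) 0 y‖ ≤ 2 * 2 ^ (2 * n1) * m := fun y => by
    have := norm_lam_le μ u v (2 ^ (2 * n1)) 0 y; push_cast at this; exact this
  have hl2 : ∀ y, ‖lam μ u v (2 ^ (2 * n1 + 1)) 0 y‖ ≤ 4 * 2 ^ (2 * n1) * m := fun y => by
    have := norm_lam_le μ u v (2 ^ (2 * n1 + 1)) 0 y; push_cast at this; rw [pow_succ (2 : ℝ)] at this; linarith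
  have hmm : 0 ≤ 2 ^ (2 * n1) * m := by positivity
  have hV : ∀ j : ℕ, eLpNorm (fun y => 2 * lam μ u v (2 ^ (2 * n1 + j + 1)) 0 y - lam μ u v (2 ^ (2 * n1 + j)) 0 y) p43 unitVol ≤
      ENNReal.ofReal (10 * 2 ^ (2 * n1) * m + 144 * W ^ (3 / 4 : ℝ) * 2 ^ (ε / 32) * ∑ i ∈ Finset.range j, q ^ i) := by
    intro j
    induction j with
    | zero =>
      simp only [Finset.range_zero, Finset.sum_empty, mul_zero, add_zero]
      refine hbase _ fun y => (norm_sub_le _ _).trans ?_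
      rw [norm_mul, Complex.norm_ofNat]
      linarith [hl1 y, hl2 y]
    | succ j ih =>
      have e : (fun y => 2 * lam μ u v (2 ^ (2 * n1 + (j + 1) + 1)) 0 y - lam μ u v (2 ^ (2 * n1 + (j + 1))) 0 y) =
          (fun y => 2 * lam μ u v (2 ^ (2 * n1 + j + 1)) 0 y - lam μ u v (2 ^ (2 * n1 + j)) 0 y) +
            lamAnn μ u v (2 * n1 + j) := by
        funext y
        simp only [Pi.add_apply, lamAnn, ← add_assoc]
        rw [show 2 * n1 + j + 1 + 1 = 2 * n1 + j + 2 by ring]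
        ring
      rw [e]
      have hU := eLpNorm_lamAnn_le ε hε μ u v hκ0 hκ hκ1 hW (2 * n1 + j) (h _ (by omega))
      refine (eLpNorm_add_le (by fun_prop) (continuous_lamAnn μ u v _).aestronglyMeasurable one_le_p43).trans
        ((add_le_add ih hU).trans ?_)
      have hqs : 0 ≤ ∑ i ∈ Finset.range j, q ^ i := Finset.sum_nonneg fun _ _ => by positivity
      rw [← ENNReal.ofReal_add (by positivity) (by positivity)]
      refine ENNReal.ofReal_le_ofReal ?_
      rw [Finset.sum_range_succ, mul_add _ _ (q ^ j), ← add_assoc]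
      refine add_le_add_right (mul_le_mul_of_nonneg_left ?_ (by positivity)) _
      exact pow_le_pow_of_le_one hq0.le hq1.le (Nat.le_add_left j (2 * n1))
  have hV' : ∀ j : ℕ, eLpNorm (fun y => 2 * lam μ u v (2 ^ (2 * n1 + j + 1)) 0 y - lam μ u v (2 ^ (2 * n1 + j)) 0 y) p43 unitVol ≤
      ENNReal.ofReal (C0 * (m + W ^ (3 / 4 : ℝ))) := by
    intro j
    refine (hV j).trans (ENNReal.ofReal_le_ofReal ?_)
    have : ∑ i ∈ Finset.range j, q ^ i ≤ (1 - q)⁻¹ := by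
      rw [← tsum_geometric_of_lt_one hq0.le hq1]
      exact (summable_geometric_of_lt_one hq0.le hq1).sum_le_tsum _ fun _ _ => by positivity
    calc _ ≤ 10 * 2 ^ (2 * n1) * m + 144 * W ^ (3 / 4 : ℝ) * 2 ^ (ε / 32) * (1 - q)⁻¹ := by gcongr
      _ ≤ _ := by
        have a1 : 0 ≤ (10 : ℝ) * 2 ^ (2 * n1) * W ^ (3 / 4 : ℝ) := by positivity
        have a2 : 0 ≤ 144 * (2 : ℝ) ^ (ε / 32) * (1 - q)⁻¹ * m := by positivity
        rw [hC0]; linarith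
  intro l hl
  obtain ⟨j, rfl⟩ := Nat.exists_eq_add_of_le hl
  induction j with
  | zero =>
    rw [add_zero]
    refine (hbase _ fun y => (hl1 y).trans (by linarith)).trans (ENNReal.ofReal_le_ofReal ?_)
    rw [hC0]
    have a1 : 0 ≤ (10 : ℝ) * 2 ^ (2 * n1) * W ^ (3 / 4 : ℝ) := by positivity
    have a2 : 0 ≤ 144 * (2 : ℝ) ^ (ε / 32) * (1 - q)⁻¹ * (m + W ^ (3 / 4 : ℝ)) := by positivity
    linarith
  | succ j ih =>
    have e : lam μ u v (2 ^ (2 * n1 + (j + 1))) 0 = (2⁻¹ : ℂ) •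
        ((fun y => 2 * lam μ u v (2 ^ (2 * n1 + j + 1)) 0 y - lam μ u v (2 ^ (2 * n1 + j)) 0 y) +
          lam μ u v (2 ^ (2 * n1 + j)) 0) := by
      funext y
      simp only [Pi.add_apply, Pi.smul_apply, smul_eq_mul, ← add_assoc]
      ring
    rw [e, eLpNorm_const_smul]
    refine (mul_le_mul_right ((eLpNorm_add_le (by fun_prop) (by fun_prop) one_le_p43).trans
      (add_le_add (hV' j) (ih (by omega)))) _).trans (le_of_eq ?_)
    rw [← two_mul, ← mul_assoc]
    have : ‖(2⁻¹ : ℂ)‖ₑ * 2 = 1 := by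
      rw [enorm_inv (by norm_num)]
      have : ‖(2 : ℂ)‖ₑ = 2 := by rw [← ofReal_norm]; simp
      rw [this]; exact ENNReal.inv_mul_cancel (by norm_num) (by norm_num)
    rw [this, one_mul]

lemma measurable_measure_closedBall (m : Measure ℝ) [IsFiniteMeasure m] (r : ℝ) :
    Measurable fun y => m (closedBall y r) := by
  have h : MeasurableSet {p : ℝ × ℝ | dist p.2 p.1 ≤ r} :=
    (isClosed_le (continuous_snd.dist continuous_fst) continuous_const).measurableSet
  exact measurable_measure_prodMk_left h

lemma measure_le_of_averages {m : Measure ℝ} [IsFiniteMeasure m] {r : ℝ} (hr : 0 < r) {E : Set ℝ} (hE : MeasurableSet E)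
    {R : ℝ≥0∞} (h : ∫⁻ y, (m (closedBall y r) / ENNReal.ofReal (2 * r)) ^ (4 / 3 : ℝ) ≤ R) :
    m E ≤ R ^ (3 / 4 : ℝ) * volume (cthickening r E) ^ (1 / 4 : ℝ) := by
  have hr2 : ENNReal.ofReal (2 * r) ≠ 0 := by rw [Ne, ENNReal.ofReal_eq_zero]; linarith
  have hT : MeasurableSet (cthickening r E) := isClosed_cthickening.measurableSet
  have hmeas := (measurable_measure_closedBall m r).div_const (ENNReal.ofReal (2 * r))
  have h1 : m E ≤ ∫⁻ y, m (closedBall y r) / ENNReal.ofReal (2 * r) * (cthickening r E).indicator 1 y := by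
    have hS : MeasurableSet {p : ℝ × ℝ | dist p.2 p.1 ≤ r} :=
      (isClosed_le (continuous_snd.dist continuous_fst) continuous_const).measurableSet
    have e1 : ∀ y, m (closedBall y r) / ENNReal.ofReal (2 * r) * (cthickening r E).indicator 1 y =
        (ENNReal.ofReal (2 * r))⁻¹ * ∫⁻ z, {p : ℝ × ℝ | dist p.2 p.1 ≤ r}.indicator 1 (y, z) *
          (cthickening r E).indicator 1 y ∂m := by
      intro y
      have hmz : Measurable fun z => {p : ℝ × ℝ | dist p.2 p.1 ≤ r}.indicator (1 : ℝ × ℝ → ℝ≥0∞) (y, z) :=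
        (measurable_one.indicator hS).comp measurable_prodMk_left
      rw [lintegral_mul_const _ hmz]
      have : ∫⁻ z, {p : ℝ × ℝ | dist p.2 p.1 ≤ r}.indicator 1 (y, z) ∂m = m (closedBall y r) := by
        rw [← lintegral_indicator_one measurableSet_closedBall]; rfl
      rw [this, div_eq_mul_inv]; ring
    simp_rw [e1]
    have hjm : Measurable fun p : ℝ × ℝ => {p : ℝ × ℝ | dist p.2 p.1 ≤ r}.indicator (1 : ℝ × ℝ → ℝ≥0∞) p *
          (cthickening r E).indicator 1 p.1 :=
      (measurable_one.indicator hS).mul ((measurable_one.indicator hT).comp measurable_fst)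
    rw [lintegral_const_mul _ (Measurable.lintegral_prod_right' hjm), lintegral_lintegral_swap hjm.aemeasurable]
    rw [← ENNReal.div_eq_inv_mul, ENNReal.le_div_iff_mul_le (Or.inl hr2) (Or.inl ENNReal.ofReal_ne_top),
      mul_comm, ← lintegral_indicator_const hE]
    refine lintegral_mono fun z => ?_
    by_cases hz : z ∈ E
    · rw [indicator_of_mem hz]
      calc ENNReal.ofReal (2 * r) = volume (closedBall z r) := (Real.volume_closedBall z r).symm
        _ = ∫⁻ y, (closedBall z r).indicator 1 y := (lintegral_indicator_one measurableSet_closedBall).symm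
        _ ≤ _ := by
          refine lintegral_mono fun y => ?_
          by_cases hy : y ∈ closedBall z r
          · rw [indicator_of_mem hy]
            have a1 : (y, z) ∈ {p : ℝ × ℝ | dist p.2 p.1 ≤ r} := by
              change dist z y ≤ r; rw [dist_comm]; exact hy
            have a2 : y ∈ cthickening r E := mem_cthickening_of_dist_le y z r E hz hy
            rw [indicator_of_mem a1, indicator_of_mem a2]; simp
          · rw [indicator_of_notMem hy]; exact zero_le
    · rw [indicator_of_notMem hz]; exact zero_le
  refine h1.trans ((ENNReal.lintegral_mul_le_Lp_mul_Lq volume (p := 4 / 3) (q := 4)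
    (Real.holderConjugate_iff.2 ⟨by norm_num, by norm_num⟩) hmeas.aemeasurable
    (measurable_one.indicator hT).aemeasurable).trans ?_)
  rw [show (1 / (4 / 3) : ℝ) = 3 / 4 by norm_num]
  gcongr
  rw [← lintegral_indicator_one hT]
  refine lintegral_mono fun y => ?_
  by_cases hy : y ∈ cthickening r E <;> simp [hy]

lemma ac_of_averages {m : Measure ℝ} [IsFiniteMeasure m] {r : ℕ → ℝ} (hr0 : ∀ l, 0 < r l)
    (hr : Filter.Tendsto r Filter.atTop (nhds 0)) {R : ℝ≥0∞} (hR : R ≠ ∞)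
    (h : ∀ l, ∫⁻ y, (m (closedBall y (r l)) / ENNReal.ofReal (2 * r l)) ^ (4 / 3 : ℝ) ≤ R) :
    m ≪ volume ∧ ∫⁻ y, (m.rnDeriv volume y) ^ (4 / 3 : ℝ) ≤ R := by
  constructor
  · refine Measure.AbsolutelyContinuous.mk fun s hs h0 => ?_
    rw [hs.measure_eq_iSup_isCompact]
    simp only [ENNReal.iSup_eq_zero]
    intro E hEs hE
    have hE0 : volume E = 0 := measure_mono_null hEs h0
    have t1 := (tendsto_measure_cthickening_of_isCompact (μ := (volume : Measure ℝ)) hE).comp hr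
    rw [hE0] at t1
    have t2 := ENNReal.Tendsto.const_mul (a := R ^ (3 / 4 : ℝ)) (t1.ennrpow_const (1 / 4 : ℝ))
      (Or.inr (ENNReal.rpow_ne_top_of_nonneg (by norm_num) hR))
    rw [ENNReal.zero_rpow_of_pos (by norm_num), mul_zero] at t2
    exact le_antisymm (ge_of_tendsto' t2 fun l => measure_le_of_averages (hr0 l) hE.measurableSet (h l)) zero_le
  · have hae := Besicovitch.ae_tendsto_rnDeriv m (volume : Measure ℝ)
    have hr' : Filter.Tendsto r Filter.atTop (nhdsWithin 0 (Ioi 0)) :=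
      tendsto_nhdsWithin_iff.2 ⟨hr, Filter.Eventually.of_forall hr0⟩
    calc ∫⁻ y, (m.rnDeriv volume y) ^ (4 / 3 : ℝ)
        = ∫⁻ y, Filter.liminf (fun l => (m (closedBall y (r l)) / ENNReal.ofReal (2 * r l)) ^ (4 / 3 : ℝ)) Filter.atTop := by
          refine lintegral_congr_ae ?_
          filter_upwards [hae] with y hy
          have := ((hy.comp hr').ennrpow_const (4 / 3 : ℝ)).liminf_eq
          rw [← this]
          simp only [Function.comp_def, Real.volume_closedBall]
      _ ≤ Filter.liminf (fun l => ∫⁻ y, (m (closedBall y (r l)) / ENNReal.ofReal (2 * r l)) ^ (4 / 3 : ℝ)) Filter.atTop :=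
          lintegral_liminf_le fun l => ((measurable_measure_closedBall m (r l)).div_const _).pow_const _
      _ ≤ Filter.liminf (fun _ : ℕ => R) Filter.atTop := Filter.liminf_le_liminf (Filter.Eventually.of_forall h)
      _ = R := Filter.liminf_const _

/-- `L^{4/3}` bound for the projected measure. -/
theorem lintegral_rnDeriv_map_le {ε : ℝ} (hε : 0 < ε) (n1 : ℕ) : ∃ C1 : ℝ, 0 < C1 ∧ ∀ (μ : Measure Pt) (t CF : ℝ),
    BoxMeas μ t CF → ∀ (u v κ W : ℝ), (∀ᵐ x ∂μ, dirProj u v x ∈ Icc (1 / 4 : ℝ) (3 / 4)) →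
    0 ≤ κ → κ ≤ ε / 4 → κ ≤ 1 → 0 ≤ W →
    (∀ n ≥ n1, (2 : ℝ) ^ (ε / 4 * n) * Xn μ u v n ⌈κ * n⌉₊ ≤ W) →
    μ.map (dirProj u v) ≪ volume ∧ ∫⁻ y, ((μ.map (dirProj u v)).rnDeriv volume y) ^ (4 / 3 : ℝ) ≤
      ENNReal.ofReal (C1 * (μ.real univ ^ (4 / 3 : ℝ) + W)) := by
  obtain ⟨C0, hC0, H⟩ := eLpNorm_lam_le hε n1
  refine ⟨(256 * C0) ^ (4 / 3 : ℝ) * 4, by positivity, fun μ t CF hμ u v κ W hbox hκ0 hκ hκ1 hW h => ?_⟩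
  have := hμ.fin
  have hm0 : 0 ≤ μ.real univ := measureReal_nonneg
  have hdm : Measurable (dirProj u v) := (continuous_dirProj u v).measurable
  have hfin : IsFiniteMeasure (μ.map (dirProj u v)) := Measure.isFiniteMeasure_map μ _
  set r : ℕ → ℝ := fun l => 1 / (16 * (2 ^ (2 * n1 + l) : ℕ)) with hr
  have hr0 : ∀ l, 0 < r l := fun l => by rw [hr]; positivity
  have hr1 : ∀ l, r l ≤ 1 / 16 := fun l => by
    rw [hr]
    have : (1 : ℝ) ≤ (2 ^ (2 * n1 + l) : ℕ) := by exact_mod_cast Nat.one_le_two_pow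
    exact one_div_le_one_div_of_le (by norm_num) (by linarith)
  have hrt : Filter.Tendsto r Filter.atTop (nhds 0) := by
    have h1 : Filter.Tendsto (fun l : ℕ => (1 / 2 : ℝ) ^ l) Filter.atTop (nhds 0) :=
      tendsto_pow_atTop_nhds_zero_of_lt_one (by norm_num) (by norm_num)
    have h2 := h1.const_mul (1 / (16 * 2 ^ (2 * n1) : ℝ))
    rw [mul_zero] at h2
    refine h2.congr fun l => ?_
    simp only [hr]; push_cast; rw [pow_add, one_div_pow]; field_simp
  have key : ∀ l, ∫⁻ y, ((μ.map (dirProj u v)) (closedBall y (r l)) / ENNReal.ofReal (2 * r l)) ^ (4 / 3 : ℝ) ≤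
      ENNReal.ofReal ((256 * C0) ^ (4 / 3 : ℝ) * 4 * (μ.real univ ^ (4 / 3 : ℝ) + W)) := by
    intro l
    set D : ℕ := 2 ^ (2 * n1 + l) with hD
    have hD0 : 0 < D := by positivity
    have hDR : (0 : ℝ) < D := by exact_mod_cast hD0
    have hball : ∀ y, (μ.map (dirProj u v)) (closedBall y (r l)) = μ {x | |dirProj u v x - y| ≤ 1 / (16 * D)} := fun y => by
      rw [Measure.map_apply hdm measurableSet_closedBall]; rfl
    have hout : ∀ y, y ∉ Ioc (0 : ℝ) 1 → (μ.map (dirProj u v)) (closedBall y (r l)) = 0 := by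
      intro y hy
      rw [hball]
      refine measure_mono_null (fun x hx => ?_) (ae_iff.1 hbox)
      simp only [mem_ofPred_eq, mem_Icc, not_and_or] at hx ⊢
      by_contra hc
      push Not at hc
      have h1 := abs_le.1 hx
      have h2 : 1 / (16 * (D : ℝ)) ≤ 1 / 16 := hr1 l
      exact hy ⟨by linarith, by linarith⟩
    have hin : ∀ y, (μ.map (dirProj u v)) (closedBall y (r l)) / ENNReal.ofReal (2 * r l) ≤
        ENNReal.ofReal 256 * ‖lam μ u v D 0 y‖ₑ := by
      intro y
      have h1 := measure_strip_le_lam hμ hD0 u v y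
      rw [hball, ENNReal.div_le_iff (by rw [Ne, ENNReal.ofReal_eq_zero]; linarith [hr0 l]) ENNReal.ofReal_ne_top,
        ← ofReal_norm, ← ENNReal.ofReal_mul (by norm_num), ← ENNReal.ofReal_mul (by positivity),
        ← ofReal_measureReal]
      refine ENNReal.ofReal_le_ofReal ?_
      have e : r l = 1 / (16 * D) := rfl
      rw [e]
      have : 256 * ‖lam μ u v D 0 y‖ * (2 * (1 / (16 * D))) = 16 * ‖lam μ u v D 0 y‖ * (2 / D) := by field_simp; ring
      rw [this]
      calc _ = μ.real {x | |dirProj u v x - y| ≤ 1 / (16 * D)} * (D / 2) * (2 / D) := by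
            rw [mul_assoc, show (D : ℝ) / 2 * (2 / D) = 1 by field_simp, mul_one]
        _ ≤ _ := by gcongr
    calc ∫⁻ y, ((μ.map (dirProj u v)) (closedBall y (r l)) / ENNReal.ofReal (2 * r l)) ^ (4 / 3 : ℝ)
        ≤ ∫⁻ y, (Ioc (0 : ℝ) 1).indicator (fun y => (ENNReal.ofReal 256 * ‖lam μ u v D 0 y‖ₑ) ^ (4 / 3 : ℝ)) y := by
          refine lintegral_mono fun y => ?_
          by_cases hy : y ∈ Ioc (0 : ℝ) 1
          · rw [indicator_of_mem hy]
            exact ENNReal.rpow_le_rpow (hin y) (by norm_num)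
          · rw [hout y hy, ENNReal.zero_div, ENNReal.zero_rpow_of_pos (by norm_num)]; exact zero_le
      _ = ENNReal.ofReal 256 ^ (4 / 3 : ℝ) * ∫⁻ y, ‖lam μ u v D 0 y‖ₑ ^ (4 / 3 : ℝ) ∂unitVol := by
          rw [lintegral_indicator measurableSet_Ioc, ← lintegral_const_mul _
            (((continuous_lam μ u v D 0).measurable.enorm).pow_const _)]
          refine lintegral_congr fun y => ?_
          rw [ENNReal.mul_rpow_of_nonneg _ _ (by norm_num)]
      _ = ENNReal.ofReal 256 ^ (4 / 3 : ℝ) * (eLpNorm (lam μ u v D 0) p43 unitVol) ^ (4 / 3 : ℝ) := by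
          rw [eLpNorm_eq_lintegral_rpow_enorm_toReal (by simp) ENNReal.ofReal_ne_top, p43_toReal, ← ENNReal.rpow_mul]
          norm_num
      _ ≤ ENNReal.ofReal 256 ^ (4 / 3 : ℝ) * (ENNReal.ofReal (C0 * (μ.real univ + W ^ (3 / 4 : ℝ)))) ^ (4 / 3 : ℝ) := by
          gcongr
          exact H μ this u v κ W hκ0 hκ hκ1 hW h _ (by omega)
      _ = ENNReal.ofReal ((256 * C0) ^ (4 / 3 : ℝ) * (μ.real univ + W ^ (3 / 4 : ℝ)) ^ (4 / 3 : ℝ)) := by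
          rw [← ENNReal.mul_rpow_of_nonneg _ _ (by norm_num), ← ENNReal.ofReal_mul (by norm_num),
            ENNReal.ofReal_rpow_of_nonneg (by positivity) (by norm_num), ← mul_assoc,
            Real.mul_rpow (by positivity) (by positivity)]
      _ ≤ _ := by
          refine ENNReal.ofReal_le_ofReal ?_
          rw [mul_assoc]
          gcongr
          have hb : 0 ≤ W ^ (3 / 4 : ℝ) := by positivity
          have hWb : (W ^ (3 / 4 : ℝ)) ^ (4 / 3 : ℝ) = W := by rw [← Real.rpow_mul hW]; norm_num
          have h2 : (2 : ℝ) ^ (4 / 3 : ℝ) ≤ 4 :=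
            (Real.rpow_le_rpow_of_exponent_le one_le_two (by norm_num : (4 / 3 : ℝ) ≤ 2)).trans (by norm_num)
          have h3 : (0 : ℝ) ≤ μ.real univ ^ (4 / 3 : ℝ) := by positivity
          rcases le_total (μ.real univ) (W ^ (3 / 4 : ℝ)) with hle | hle
          · calc _ ≤ (2 * W ^ (3 / 4 : ℝ)) ^ (4 / 3 : ℝ) := by gcongr; linarith
              _ = 2 ^ (4 / 3 : ℝ) * W := by rw [Real.mul_rpow (by norm_num) hb, hWb]
              _ ≤ 4 * W := by gcongr
              _ ≤ _ := by linarith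
          · calc _ ≤ (2 * μ.real univ) ^ (4 / 3 : ℝ) := by gcongr; linarith
              _ = 2 ^ (4 / 3 : ℝ) * μ.real univ ^ (4 / 3 : ℝ) := by rw [Real.mul_rpow (by norm_num) hm0]
              _ ≤ 4 * μ.real univ ^ (4 / 3 : ℝ) := by gcongr
              _ ≤ _ := by linarith
  exact ac_of_averages hr0 hrt ENNReal.ofReal_ne_top key

lemma exists_tree_measure (Λ : Finset ℝ) {q : ℝ} (hq : 0 < q) (N : ℕ)
    (hinj : ∀ u ∈ Λ, ∀ u' ∈ Λ, cap N u = cap N u' → u = u') (d : ℕ) :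
    ∀ i, i + d = N → ∀ l, ∃ (ν : ℝ → ℝ) (F : Finset (ℕ × ℕ)), (∀ u, 0 ≤ ν u) ∧ (∀ u, cap i u ≠ l → ν u = 0) ∧
      (∀ i' ≤ N, i ≤ i' → ∀ l', ∑ u ∈ Λ.filter (fun u => cap i' u = l'), ν u ≤ q ^ i') ∧
      (∀ u ∈ Λ, cap i u = l → ∃ p ∈ F, p.1 ≤ N ∧ cap p.1 u = p.2) ∧
      ∑ p ∈ F, q ^ p.1 ≤ ∑ u ∈ Λ, ν u := by
  induction d with
  | zero =>
    rintro i hi l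
    obtain rfl : i = N := by omega
    refine ⟨fun u => if cap i u = l then q ^ i else 0, if ∃ u ∈ Λ, cap i u = l then {(i, l)} else ∅,
      fun u => by dsimp only; split_ifs <;> positivity, fun u hu => if_neg hu, fun i' h1 h2 l' => ?_,
      fun u hu hul => ⟨(i, l), by rw [if_pos ⟨u, hu, hul⟩]; simp, le_rfl, hul⟩, ?_⟩
    · obtain rfl : i' = i := by omega
      have hc : (Λ.filter (fun u => cap i' u = l')).card ≤ 1 := Finset.card_le_one.2 fun u hu u' hu' => by
        rw [Finset.mem_filter] at hu hu'
        exact hinj u hu.1 u' hu'.1 (hu.2.trans hu'.2.symm)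
      calc _ ≤ ∑ u ∈ Λ.filter (fun u => cap i' u = l'), q ^ i' :=
            Finset.sum_le_sum fun u _ => by split_ifs <;> first | exact le_rfl | positivity
        _ ≤ 1 * q ^ i' := by
            rw [Finset.sum_const, nsmul_eq_mul]; gcongr; exact_mod_cast hc
        _ = _ := one_mul _
    · split_ifs with h
      · obtain ⟨u, hu, hul⟩ := h
        rw [Finset.sum_singleton]
        refine le_trans (by rw [if_pos hul]) (Finset.single_le_sum
          (f := fun u => if cap i u = l then q ^ i else 0) (fun u _ => ?_) hu)
        split_ifs <;> positivity
      · rw [Finset.sum_empty]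
        exact Finset.sum_nonneg fun u _ => by split_ifs <;> positivity
  | succ d ih =>
    intro i hi l
    obtain ⟨ν1, F1, p1, z1, m1, c1, s1⟩ := ih (i + 1) (by omega) (2 * l)
    obtain ⟨ν2, F2, p2, z2, m2, c2, s2⟩ := ih (i + 1) (by omega) (2 * l + 1)
    have hcap : ∀ u, cap (i + 1) u / 2 = cap i u := fun u => by
      have := cap_div (Nat.le_succ i) u
      simpa using this
    set ν := fun u => ν1 u + ν2 u with hν
    have hν0 : ∀ u, 0 ≤ ν u := fun u => add_nonneg (p1 u) (p2 u)
    have hz : ∀ u, cap i u ≠ l → ν u = 0 := fun u hu => by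
      have := hcap u
      simp only [hν, z1 u (by omega), z2 u (by omega), add_zero]
    have hm : ∀ i' ≤ N, i + 1 ≤ i' → ∀ l', ∑ u ∈ Λ.filter (fun u => cap i' u = l'), ν u ≤ q ^ i' := by
      intro i' h1 h2 l'
      by_cases hl : l' / 2 ^ (i' - (i + 1)) = 2 * l
      · refine le_trans (Finset.sum_le_sum fun u hu => ?_) (m1 i' h1 h2 l')
        have := cap_div h2 u
        rw [(Finset.mem_filter.1 hu).2, hl] at this
        simp only [hν, z2 u (by omega), add_zero, le_refl]
      · refine le_trans (Finset.sum_le_sum fun u hu => ?_) (m2 i' h1 h2 l')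
        have := cap_div h2 u
        rw [(Finset.mem_filter.1 hu).2] at this
        simp only [hν, z1 u (by omega), zero_add, le_refl]
    by_cases htot : ∑ u ∈ Λ, ν u ≤ q ^ i
    · refine ⟨ν, F1 ∪ F2, hν0, hz, fun i' h1 h2 l' => ?_, fun u hu hul => ?_, ?_⟩
      · rcases h2.eq_or_lt with rfl | h3
        · exact le_trans (Finset.sum_le_sum_of_subset_of_nonneg (Finset.filter_subset _ _) fun u _ _ => hν0 u) htot
        · exact hm i' h1 h3 l'
      · have := hcap u
        rcases (by omega : cap (i + 1) u = 2 * l ∨ cap (i + 1) u = 2 * l + 1) with h | h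
        · obtain ⟨p, hp, h'⟩ := c1 u hu h
          exact ⟨p, Finset.mem_union_left _ hp, h'⟩
        · obtain ⟨p, hp, h'⟩ := c2 u hu h
          exact ⟨p, Finset.mem_union_right _ hp, h'⟩
      · have := Finset.sum_union_inter (s₁ := F1) (s₂ := F2) (f := fun p => q ^ p.1)
        have h0 : 0 ≤ ∑ p ∈ F1 ∩ F2, q ^ p.1 := Finset.sum_nonneg fun _ _ => by positivity
        rw [Finset.sum_add_distrib]
        linarith
    · push Not at htot
      have hS : 0 < ∑ u ∈ Λ, ν u := lt_trans (by positivity) htot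
      set a := q ^ i / ∑ u ∈ Λ, ν u with ha
      have ha0 : 0 ≤ a := by positivity
      have ha1 : a ≤ 1 := (div_le_one hS).2 htot.le
      have haS : ∑ u ∈ Λ, a * ν u = q ^ i := by rw [← Finset.mul_sum, ha]; field_simp
      refine ⟨fun u => a * ν u, {(i, l)}, fun u => mul_nonneg ha0 (hν0 u), fun u hu => by simp [hz u hu],
        fun i' h1 h2 l' => ?_, fun u hu hul => ⟨(i, l), by simp, by dsimp only; omega, hul⟩, ?_⟩
      · rcases h2.eq_or_lt with rfl | h3
        · exact le_trans (Finset.sum_le_sum_of_subset_of_nonneg (Finset.filter_subset _ _)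
            fun u _ _ => mul_nonneg ha0 (hν0 u)) haS.le
        · exact le_trans (Finset.sum_le_sum fun u _ => mul_le_of_le_one_left (hν0 u) ha1) (hm i' h1 h3 l')
      · rw [haS, Finset.sum_singleton]

/-- Discrete Frostman lemma: a set admits either a large measure or a cheap dyadic cover. -/
theorem exists_frostman_cover {K : ℝ} {φ ψ : ℝ → ℝ} {E : Set ℝ} (hE : Convx K φ ψ E) {q : ℝ} (hq : 0 < q) (n : ℕ) :
    ∃ (Λ : Finset ℝ) (ν : ℝ → ℝ) (F : Finset (ℕ × ℕ)), ↑Λ ⊆ E ∧ ParamMeas n K φ ψ Λ ν q ∧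
      (∀ u ∈ E, ∃ p ∈ F, cap p.1 u = p.2) ∧ ∑ p ∈ F, q ^ p.1 ≤ ∑ u ∈ Λ, ν u := by
  classical
  choose! rep hrep using fun (l : ℕ) (h : ∃ u ∈ E, cap (2 * n) u = l) => h
  set Λ : Finset ℝ := (((Finset.range (2 ^ (2 * n))).filter (fun l => ∃ u ∈ E, cap (2 * n) u = l)).image rep) with hΛ
  have hΛE : ∀ u ∈ Λ, u ∈ E ∧ ∃ l, cap (2 * n) u = l ∧ u = rep l := by
    intro u hu
    obtain ⟨l, hl, rfl⟩ := Finset.mem_image.1 hu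
    have := hrep l (Finset.mem_filter.1 hl).2
    exact ⟨this.1, l, this.2, rfl⟩
  obtain ⟨ν, F, h0, -, hm, hc, hs⟩ := exists_tree_measure Λ hq (2 * n) (fun u hu u' hu' h => by
    obtain ⟨-, l, e1, e2⟩ := hΛE u hu
    obtain ⟨-, l', e1', e2'⟩ := hΛE u' hu'
    rw [e2, e2', ← e1, ← e1', h]) (2 * n) 0 (by omega) 0
  have hsub : (Λ : Set ℝ) ⊆ E := fun u hu => (hΛE u hu).1
  refine ⟨Λ, ν, F, hsub, ⟨⟨hE.one_le, fun u hu v hv => hE.lower u (hsub hu) v (hsub hv),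
    fun u hu v hv => hE.upper u (hsub hu) v (hsub hv), fun u hu => hE.phi_le u (hsub hu),
    fun u hu => hE.psi_le u (hsub hu), fun u hu => hE.mem u (hsub hu)⟩, fun u _ => h0 u, hq,
    fun i hi l => hm i hi (by omega) l⟩, fun u hu => ?_, hs⟩
  have hex : ∃ u' ∈ E, cap (2 * n) u' = cap (2 * n) u := ⟨u, hu, rfl⟩
  have hr := hrep _ hex
  have hmem : rep (cap (2 * n) u) ∈ Λ := Finset.mem_image_of_mem _
    (Finset.mem_filter.2 ⟨Finset.mem_range.2 (cap_lt (hE.mem u hu) _), hex⟩)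
  have hc0 : cap 0 (rep (cap (2 * n) u)) = 0 := by
    have := cap_lt (hE.mem _ hr.1) 0
    simpa using this
  obtain ⟨p, hp, hpN, hpc⟩ := hc _ hmem hc0
  refine ⟨p, hp, ?_⟩
  rw [← hpc, ← cap_div hpN u, ← cap_div hpN, hr.2]

/-- Borel–Cantelli for Hausdorff measures, in terms of dyadic covers. -/
theorem hausdorffMeasure_limsup_eq_zero {ι : Type*} [Countable ι] {s : ℝ} (hs : 0 < s) {E : ι → Set ℝ}
    (hE0 : ∀ k, ∀ u ∈ E k, 0 ≤ u) {F : ι → Finset (ℕ × ℕ)} (hF : ∀ k, ∀ u ∈ E k, ∃ p ∈ F k, cap p.1 u = p.2)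
    (hsum : ∑' k, ∑ p ∈ F k, ENNReal.ofReal (((2 : ℝ) ^ (-s)) ^ p.1) ≠ ∞) :
    μH[s] {u : ℝ | {k | u ∈ E k}.Infinite} = 0 := by
  set c : ι → ℝ≥0∞ := fun k => ∑ p ∈ F k, ENNReal.ofReal (((2 : ℝ) ^ (-s)) ^ p.1) with hc
  have ht := ENNReal.tendsto_tsum_compl_atTop_zero hsum
  set tail : Finset ι → ℝ≥0∞ := fun T => ∑' k : {k // k ∉ T}, c k with htail
  have hr : Filter.Tendsto (fun T => tail T ^ (1 / s)) Filter.atTop (nhds 0) := by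
    have := ht.ennrpow_const (1 / s)
    rwa [ENNReal.zero_rpow_of_pos (by positivity)] at this
  have hdiam : ∀ p : ℕ × ℕ, ediam {u : ℝ | 0 ≤ u ∧ cap p.1 u = p.2} ^ s ≤ ENNReal.ofReal (((2 : ℝ) ^ (-s)) ^ p.1) := by
    intro p
    have h1 : ediam {u : ℝ | 0 ≤ u ∧ cap p.1 u = p.2} ≤ ENNReal.ofReal (((2 : ℝ) ^ p.1)⁻¹) := by
      refine ediam_le fun x hx y hy => ?_
      rw [edist_dist, Real.dist_eq]
      exact ENNReal.ofReal_le_ofReal (abs_sub_le_of_cap_eq hx.1 hy.1 (hx.2.trans hy.2.symm))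
    refine (ENNReal.rpow_le_rpow h1 hs.le).trans (le_of_eq ?_)
    rw [ENNReal.ofReal_rpow_of_nonneg (by positivity) hs.le, ← Real.rpow_natCast, ← Real.rpow_natCast,
      ← Real.rpow_neg (by norm_num), ← Real.rpow_mul (by norm_num), ← Real.rpow_mul (by norm_num)]
    ring_nf
  have key := Measure.hausdorffMeasure_le_liminf_tsum s {u : ℝ | {k | u ∈ E k}.Infinite} _ hr
    (ι := fun T : Finset ι => Σ k : {k // k ∉ T}, {p // p ∈ F k})
    (fun T k => {u : ℝ | 0 ≤ u ∧ cap k.2.1.1 u = k.2.1.2})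
    (Filter.Eventually.of_forall fun T k => by
      rw [one_div, ENNReal.le_rpow_inv_iff hs]
      refine (hdiam _).trans (le_trans ?_ (ENNReal.le_tsum k.1))
      exact Finset.single_le_sum (f := fun p : ℕ × ℕ => ENNReal.ofReal (((2 : ℝ) ^ (-s)) ^ p.1))
        (fun _ _ => zero_le) k.2.2)
    (Filter.Eventually.of_forall fun T u hu => by
      obtain ⟨k, hk, hkT⟩ := hu.exists_notMem_finset T
      obtain ⟨p, hp, hpc⟩ := hF k u hk
      exact mem_iUnion.2 ⟨⟨⟨k, hkT⟩, ⟨p, hp⟩⟩, hE0 k u hk, hpc⟩)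
  refine le_antisymm (key.trans ?_) zero_le
  have h2 : ∀ T : Finset ι, ∑' k : (Σ k : {k // k ∉ T}, {p // p ∈ F k}),
      ediam {u : ℝ | 0 ≤ u ∧ cap k.2.1.1 u = k.2.1.2} ^ s ≤ tail T := fun T => by
    rw [ENNReal.tsum_sigma']
    refine ENNReal.tsum_le_tsum fun k => ?_
    rw [tsum_fintype]
    simp only [hc]
    rw [← Finset.sum_coe_sort (F k)]
    exact Finset.sum_le_sum fun p _ => hdiam p.1
  refine (Filter.liminf_le_liminf (Filter.Eventually.of_forall h2)).trans ?_
  rw [ht.liminf_eq]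

/-- The index of the dyadic cube of side `2 ^ (-j)` containing a point. -/
def cubeIdx (j : ℕ) (x : Pt) : ℤ × ℤ × ℤ := (⌊2 ^ j * x.1⌋, ⌊2 ^ j * x.2.1⌋, ⌊2 ^ j * x.2.2⌋)

/-- A dyadic cube of side `2 ^ (-j)`. -/
def cube (j : ℕ) (z : ℤ × ℤ × ℤ) : Set Pt := cubeIdx j ⁻¹' {z}

lemma measurable_cubeIdx (j : ℕ) : Measurable (cubeIdx j) := by
  unfold cubeIdx
  fun_prop

lemma measurableSet_cube (j : ℕ) (z : ℤ × ℤ × ℤ) : MeasurableSet (cube j z) :=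
  measurable_cubeIdx j (measurableSet_singleton z)

/-- The indices of the cubes meeting the unit box. -/
def boxIdx (j : ℕ) : Finset (ℤ × ℤ × ℤ) :=
  Finset.Icc (-2 ^ j) (2 ^ j) ×ˢ Finset.Icc (-2 ^ j) (2 ^ j) ×ˢ Finset.Icc (-2 ^ j) (2 ^ j)

lemma cubeIdx_mem_boxIdx {x : Pt} (h : |x.1| ≤ 1 / 2 ∧ |x.2.1| ≤ 1 / 2 ∧ |x.2.2| ≤ 1 / 2) (j : ℕ) :
    cubeIdx j x ∈ boxIdx j := by
  have key : ∀ a : ℝ, |a| ≤ 1 / 2 → ⌊2 ^ j * a⌋ ∈ Finset.Icc (-2 ^ j : ℤ) (2 ^ j) := by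
    intro a ha
    have h1 := abs_le.1 ha
    have hp : (0 : ℝ) < 2 ^ j := by positivity
    rw [Finset.mem_Icc]
    refine ⟨Int.le_floor.2 ?_, ?_⟩
    · push_cast; nlinarith [h1.1]
    · have : (⌊(2 : ℝ) ^ j * a⌋ : ℝ) ≤ ((2 ^ j : ℤ) : ℝ) := (Int.floor_le _).trans (by push_cast; nlinarith [h1.2])
      exact_mod_cast this
  simp only [cubeIdx, boxIdx, Finset.mem_product]
  exact ⟨key _ h.1, key _ h.2.1, key _ h.2.2⟩

/-- The affine map carrying a dyadic cube into the unit box. -/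
def resc (c : ℝ) (j : ℕ) (z : ℤ × ℤ × ℤ) (x : Pt) : Pt :=
  (7 / 16 + c * (2 ^ j * x.1 - z.1), c * (2 ^ j * x.2.1 - z.2.1), c * (2 ^ j * x.2.2 - z.2.2))

lemma measurable_resc (c : ℝ) (j : ℕ) (z : ℤ × ℤ × ℤ) : Measurable (resc c j z) := by
  unfold resc
  fun_prop

/-- The rescaled piece of a measure in a dyadic cube. -/
def cubeMeas (μ : Measure Pt) (c : ℝ) (j : ℕ) (z : ℤ × ℤ × ℤ) : Measure Pt :=
  (μ.restrict (cube j z)).map (resc c j z)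

lemma resc_mem {c : ℝ} {j : ℕ} {z : ℤ × ℤ × ℤ} {x : Pt} (hc : 0 ≤ c) (h : x ∈ cube j z) :
    (resc c j z x).1 ∈ Icc (7 / 16) (7 / 16 + c) ∧ (resc c j z x).2.1 ∈ Icc 0 c ∧ (resc c j z x).2.2 ∈ Icc 0 c := by
  obtain rfl : cubeIdx j x = z := h
  have key : ∀ a : ℝ, 0 ≤ c * (a - ⌊a⌋) ∧ c * (a - ⌊a⌋) ≤ c := fun a => by
    have h1 := Int.fract_nonneg a
    have h2 := (Int.fract_lt_one a).le
    rw [Int.self_sub_floor]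
    exact ⟨by positivity, mul_le_of_le_one_right hc h2⟩
  have h1 := key (2 ^ j * x.1)
  exact ⟨⟨by simp only [resc, cubeIdx]; linarith, by simp only [resc, cubeIdx]; linarith⟩,
    key (2 ^ j * x.2.1), key (2 ^ j * x.2.2)⟩

lemma dirProj_resc (u v c : ℝ) (j : ℕ) (z : ℤ × ℤ × ℤ) (x : Pt) :
    dirProj u v (resc c j z x) = c * 2 ^ j * dirProj u v x + (7 / 16 - c * (z.1 + u * z.2.1 + v * z.2.2)) := by
  simp only [dirProj, resc]; ring

lemma cubeMeas_real_univ (μ : Measure Pt) (c : ℝ) (j : ℕ) (z : ℤ × ℤ × ℤ) :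
    (cubeMeas μ c j z).real univ = μ.real (cube j z) := by
  rw [cubeMeas, measureReal_def, Measure.map_apply (measurable_resc c j z) MeasurableSet.univ, preimage_univ,
    Measure.restrict_apply_univ, measureReal_def]

section
variable {μ : Measure Pt} {t CF c : ℝ}

lemma BoxMeas.cubeMeas (h : BoxMeas μ t CF) (hc : 0 < c) (hc1 : c ≤ 1 / 16) (j : ℕ) (z : ℤ × ℤ × ℤ) :
    BoxMeas (cubeMeas μ c j z) t (CF * (c * 2 ^ j) ^ (-t)) where
  fin := by
    have := h.fin
    exact Measure.isFiniteMeasure_map _ _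
  CF_nonneg := mul_nonneg h.CF_nonneg (by positivity)
  box := by
    rw [_root_.cubeMeas, ae_map_iff (measurable_resc c j z).aemeasurable (by measurability)]
    filter_upwards [ae_restrict_mem (measurableSet_cube j z)] with x hx
    obtain ⟨h1, h2, h3⟩ := resc_mem hc.le hx
    simp only [abs_le]
    exact ⟨⟨by linarith [h1.1], by linarith [h1.2]⟩, ⟨by linarith [h2.1], by linarith [h2.2]⟩,
      ⟨by linarith [h3.1], by linarith [h3.2]⟩⟩
  frost := by
    intro x ρ hρ
    have := h.fin
    have ha : 0 < c * 2 ^ j := by positivity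
    set w : Pt := ((x.1 - 7 / 16 + c * z.1) / (c * 2 ^ j), (x.2.1 + c * z.2.1) / (c * 2 ^ j),
      (x.2.2 + c * z.2.2) / (c * 2 ^ j)) with hw
    have h1 : resc c j z ⁻¹' closedBall x ρ ⊆ closedBall w (ρ / (c * 2 ^ j)) := by
      intro y hy
      have aux : ∀ a b d : ℝ, a - b = (c * 2 ^ j) * d → |a - b| ≤ ρ → |d| ≤ ρ / (c * 2 ^ j) := by
        intro a b d e hab
        rw [e, abs_mul, abs_of_pos ha] at hab
        rwa [le_div_iff₀ ha, mul_comm]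
      simp only [mem_preimage, mem_closedBall, Prod.dist_eq, max_le_iff, Real.dist_eq] at hy ⊢
      refine ⟨aux _ _ _ ?_ hy.1, aux _ _ _ ?_ hy.2.1, aux _ _ _ ?_ hy.2.2⟩ <;>
      · simp only [resc, hw]; field_simp; ring
    calc (_root_.cubeMeas μ c j z).real (closedBall x ρ)
        ≤ μ.real (closedBall w (ρ / (c * 2 ^ j))) := by
          rw [_root_.cubeMeas, measureReal_def, measureReal_def,
            Measure.map_apply (measurable_resc c j z) measurableSet_closedBall]
          exact ENNReal.toReal_mono (measure_ne_top _ _) ((Measure.restrict_apply_le _ _).trans (measure_mono h1))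
      _ ≤ CF * (ρ / (c * 2 ^ j)) ^ t := h.frost _ _ (by positivity)
      _ = _ := by rw [Real.div_rpow hρ.le ha.le, Real.rpow_neg ha.le]; ring

lemma BoxMeas.cube_le (h : BoxMeas μ t CF) (j : ℕ) (z : ℤ × ℤ × ℤ) : μ.real (cube j z) ≤ CF * (2 ^ j) ^ (-t) := by
  have := h.fin
  have hp : (0 : ℝ) < 2 ^ j := by positivity
  have h1 : cube j z ⊆ closedBall ((z.1 / 2 ^ j, z.2.1 / 2 ^ j, z.2.2 / 2 ^ j) : Pt) (1 / 2 ^ j) := by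
    rintro x rfl
    have aux : ∀ a : ℝ, |a - ⌊2 ^ j * a⌋ / 2 ^ j| ≤ 1 / 2 ^ j := fun a => by
      have e : a - ⌊2 ^ j * a⌋ / 2 ^ j = Int.fract (2 ^ j * a) / 2 ^ j := by rw [Int.fract]; field_simp
      rw [e, abs_of_nonneg (div_nonneg (Int.fract_nonneg _) hp.le)]
      gcongr
      exact (Int.fract_lt_one _).le
    simp only [mem_closedBall, Prod.dist_eq, max_le_iff, Real.dist_eq]
    exact ⟨aux _, aux _, aux _⟩
  calc μ.real (cube j z) ≤ _ := measureReal_mono h1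
    _ ≤ CF * (1 / 2 ^ j) ^ t := h.frost _ _ (by positivity)
    _ = _ := by rw [one_div, Real.inv_rpow hp.le, Real.rpow_neg hp.le]

lemma sum_cube_le (μ : Measure Pt) [IsFiniteMeasure μ] (j : ℕ) : ∑ z ∈ boxIdx j, μ.real (cube j z) ≤ μ.real univ := by
  simp only [cube]
  rw [sum_measureReal_preimage_singleton _ fun z _ => measurableSet_cube j z]
  exact measureReal_mono (subset_univ _)

lemma cubeMeas_dirProj_mem {K u v : ℝ} (hK : 0 ≤ K) (hu : 0 ≤ u ∧ u < 1) (hv : |v| ≤ K) (μ : Measure Pt) (j : ℕ)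
    (z : ℤ × ℤ × ℤ) :
    ∀ᵐ x ∂(cubeMeas μ (1 / (16 * (2 + K))) j z), dirProj u v x ∈ Icc (1 / 4 : ℝ) (3 / 4) := by
  rw [cubeMeas, ae_map_iff (measurable_resc _ j z).aemeasurable
    ((continuous_dirProj u v).measurable measurableSet_Icc)]
  filter_upwards [ae_restrict_mem (measurableSet_cube j z)] with x hx
  set c := 1 / (16 * (2 + K)) with hc
  have hc0 : 0 < c := by positivity
  have hcK : c * (2 + K) = 1 / 16 := by rw [hc]; field_simp
  obtain ⟨h1, h2, h3⟩ := resc_mem hc0.le hx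
  have e1 : |u * (resc c j z x).2.1| ≤ 1 * c := by
    rw [abs_mul, abs_of_nonneg hu.1, abs_of_nonneg h2.1]
    exact mul_le_mul hu.2.le h2.2 h2.1 zero_le_one
  have e2 : |v * (resc c j z x).2.2| ≤ K * c := by
    rw [abs_mul, abs_of_nonneg h3.1]
    exact mul_le_mul hv h3.2 h3.1 hK
  have e1' := abs_le.1 e1
  have e2' := abs_le.1 e2
  simp only [dirProj, mem_Icc]
  constructor <;> linarith [h1.1, h1.2]

lemma map_cubeMeas (μ : Measure Pt) (c : ℝ) (j : ℕ) (z : ℤ × ℤ × ℤ) (u v : ℝ) :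
    (cubeMeas μ c j z).map (dirProj u v) = ((μ.restrict (cube j z)).map (dirProj u v)).map
      (fun y => c * 2 ^ j * y + (7 / 16 - c * (z.1 + u * z.2.1 + v * z.2.2))) := by
  have hd := (continuous_dirProj u v).measurable
  rw [cubeMeas, Measure.map_map hd (measurable_resc c j z), Measure.map_map (by fun_prop) hd]
  congr 1
  ext x
  exact dirProj_resc u v c j z x

end

lemma lintegral_affine {α : ℝ} (hα : 0 < α) (β : ℝ) {f : ℝ → ℝ≥0∞} (hf : Measurable f) :
    ENNReal.ofReal α * ∫⁻ y, f (α * y + β) = ∫⁻ y, f y := by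
  have h1 : ∫⁻ y, f (α * y + β) = ENNReal.ofReal α⁻¹ * ∫⁻ y, f y := by
    have h2 := lintegral_map (μ := (volume : Measure ℝ)) (f := fun y => f (y + β)) (g := fun y => α * y)
      (hf.comp (measurable_add_const β)) (measurable_const_mul α)
    rw [Real.map_volume_mul_left hα.ne', lintegral_smul_measure, lintegral_add_right_eq_self f β,
      abs_of_pos (inv_pos.2 hα)] at h2
    exact h2.symm
  rw [h1, ← mul_assoc, ← ENNReal.ofReal_mul hα.le, mul_inv_cancel₀ hα.ne', ENNReal.ofReal_one, one_mul]

lemma ac_of_map_affine {m : Measure ℝ} [IsFiniteMeasure m] {α : ℝ} (hα : 0 < α) (β : ℝ)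
    (h : m.map (fun y => α * y + β) ≪ volume) : m ≪ volume ∧ ∫⁻ y, (m.rnDeriv volume y) ^ (4 / 3 : ℝ) =
      ENNReal.ofReal (α ^ (1 / 3 : ℝ)) * ∫⁻ y, ((m.map (fun y => α * y + β)).rnDeriv volume y) ^ (4 / 3 : ℝ) := by
  set T : ℝ → ℝ := fun y => α * y + β with hT
  have hTm : Measurable T := by fun_prop
  set g := (m.map T).rnDeriv volume with hg
  have hgm : Measurable g := Measure.measurable_rnDeriv _ _
  have hgT : Measurable fun y => g (T y) := hgm.comp hTm
  have hm : m = volume.withDensity fun y => ENNReal.ofReal α * g (T y) := by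
    ext s hs
    set s' := (fun y => (y - β) / α) ⁻¹' s with hs'
    have hs'm : MeasurableSet s' := (by fun_prop : Measurable fun y : ℝ => (y - β) / α) hs
    have hpre : T ⁻¹' s' = s := by
      ext y
      simp only [hs', hT, mem_preimage]
      rw [show (α * y + β - β) / α = y by field_simp; ring]
    have h1 : m s = m.map T s' := by rw [Measure.map_apply hTm hs'm, hpre]
    rw [h1, ← Measure.withDensity_rnDeriv_eq _ _ h, withDensity_apply _ hs'm, withDensity_apply _ hs,
      ← lintegral_indicator hs'm, ← lintegral_affine hα β (hgm.indicator hs'm),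
      lintegral_const_mul _ hgT, ← lintegral_indicator hs]
    congr 1
    refine lintegral_congr fun y => ?_
    change s'.indicator g (T y) = s.indicator (g ∘ T) y
    rw [← hpre, indicator_comp_right]
  refine ⟨hm ▸ withDensity_absolutelyContinuous _ _, ?_⟩
  have h2 : m.rnDeriv volume =ᵐ[volume] fun y => ENNReal.ofReal α * g (T y) := by
    conv_lhs => rw [hm]
    exact Measure.rnDeriv_withDensity _ (hgT.const_mul _)
  calc ∫⁻ y, (m.rnDeriv volume y) ^ (4 / 3 : ℝ) = ∫⁻ y, ENNReal.ofReal (α ^ (1 / 3 : ℝ)) *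
        (ENNReal.ofReal α * g (T y) ^ (4 / 3 : ℝ)) := by
        refine lintegral_congr_ae ?_
        filter_upwards [h2] with y hy
        rw [hy, ENNReal.mul_rpow_of_nonneg _ _ (by norm_num), ENNReal.ofReal_rpow_of_pos hα, ← mul_assoc,
          ← ENNReal.ofReal_mul (by positivity), ← Real.rpow_add_one hα.ne']
        norm_num
    _ = _ := by
        have hgp : Measurable fun y => g y ^ (4 / 3 : ℝ) := hgm.pow_const _
        have hgTp : Measurable fun y => g (T y) ^ (4 / 3 : ℝ) := hgT.pow_const _
        rw [lintegral_const_mul _ (hgTp.const_mul _), lintegral_const_mul _ hgTp,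
          ← lintegral_affine hα β hgp]

lemma exists_cheap_cover {K t s ε κ C c : ℝ} (hC : 0 < C) (hc : 0 < c) (hc1 : c ≤ 1 / 16) (ht : 0 ≤ t) {n : ℕ}
    (H : ∀ (μ : Measure Pt) (CF : ℝ), BoxMeas μ t CF → μ.real univ ≤ CF →
      ∀ (φ ψ : ℝ → ℝ) (Λ : Finset ℝ) (ν : ℝ → ℝ), ParamMeas n K φ ψ Λ ν ((2 : ℝ) ^ (-s)) →
      ∑ u ∈ Λ, ν u * Xn μ u (φ u) n ⌈κ * n⌉₊ ≤ C * 2 ^ (-(ε * n)) * CF ^ (1 / 3 : ℝ) * μ.real univ)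
    {η : ℝ} {μ : Measure Pt} {CF : ℝ} (hμ : BoxMeas μ t CF) {φ ψ : ℝ → ℝ} {Λ0 : Set ℝ} (hΛ : Convx K φ ψ Λ0) (j : ℕ) :
    ∃ F : Finset (ℕ × ℕ), (∀ u ∈ Λ0, (2 : ℝ) ^ (η * j - t / 3 * j) * 2 ^ (-(ε / 2 * n)) <
        ∑ z ∈ boxIdx j, Xn (cubeMeas μ c j z) u (φ u) n ⌈κ * n⌉₊ → ∃ p ∈ F, cap p.1 u = p.2) ∧
      ∑ p ∈ F, ((2 : ℝ) ^ (-s)) ^ p.1 ≤ C * (CF * c ^ (-t)) ^ (1 / 3 : ℝ) * μ.real univ *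
        ((2 : ℝ) ^ (-η)) ^ j * ((2 : ℝ) ^ (-(ε / 2))) ^ n := by
  have := hμ.fin
  have hCF := hμ.CF_nonneg
  set thr := (2 : ℝ) ^ (η * j - t / 3 * j) * 2 ^ (-(ε / 2 * n)) with hthr
  have hthr0 : 0 < thr := by positivity
  set E := {u ∈ Λ0 | thr < ∑ z ∈ boxIdx j, Xn (cubeMeas μ c j z) u (φ u) n ⌈κ * n⌉₊} with hE
  have hEc : Convx K φ ψ E := ⟨hΛ.one_le, fun u hu v hv => hΛ.lower u hu.1 v hv.1,
    fun u hu v hv => hΛ.upper u hu.1 v hv.1, fun u hu => hΛ.phi_le u hu.1, fun u hu => hΛ.psi_le u hu.1,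
    fun u hu => hΛ.mem u hu.1⟩
  obtain ⟨Λ, ν, F, hΛE, hP, hcov, hF⟩ := exists_frostman_cover hEc (by positivity : (0 : ℝ) < 2 ^ (-s)) n
  refine ⟨F, fun u hu hgt => hcov u ⟨hu, hgt⟩, hF.trans ?_⟩
  have h1 : (∑ u ∈ Λ, ν u) * thr ≤ C * 2 ^ (-(ε * n)) * (CF * (c * 2 ^ j) ^ (-t)) ^ (1 / 3 : ℝ) * μ.real univ := by
    calc (∑ u ∈ Λ, ν u) * thr ≤ ∑ u ∈ Λ, ν u * ∑ z ∈ boxIdx j, Xn (cubeMeas μ c j z) u (φ u) n ⌈κ * n⌉₊ := by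
          rw [Finset.sum_mul]
          exact Finset.sum_le_sum fun u hu => mul_le_mul_of_nonneg_left (hΛE hu).2.le (hP.ν_nonneg u hu)
      _ = ∑ z ∈ boxIdx j, ∑ u ∈ Λ, ν u * Xn (cubeMeas μ c j z) u (φ u) n ⌈κ * n⌉₊ := by
          simp_rw [Finset.mul_sum]; exact Finset.sum_comm
      _ ≤ ∑ z ∈ boxIdx j, C * 2 ^ (-(ε * n)) * (CF * (c * 2 ^ j) ^ (-t)) ^ (1 / 3 : ℝ) * μ.real (cube j z) := by
          refine Finset.sum_le_sum fun z _ => ?_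
          have := H _ _ (hμ.cubeMeas hc hc1 j z) ?_ φ ψ Λ ν hP
          · rwa [cubeMeas_real_univ] at this
          · rw [cubeMeas_real_univ]
            refine (hμ.cube_le j z).trans ?_
            have hle : c * 2 ^ j ≤ 2 ^ j := mul_le_of_le_one_left (by positivity) (by linarith)
            exact mul_le_mul_of_nonneg_left (Real.rpow_le_rpow_of_nonpos (by positivity) hle (by linarith)) hCF
      _ ≤ _ := by
          rw [← Finset.mul_sum]
          gcongr
          exact sum_cube_le μ j
  rw [← le_div_iff₀ hthr0] at h1
  refine h1.trans (le_of_eq ?_)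
  have e1 : (CF * (c * 2 ^ j) ^ (-t)) ^ (1 / 3 : ℝ) = (CF * c ^ (-t)) ^ (1 / 3 : ℝ) * 2 ^ (-(t / 3 * j)) := by
    rw [Real.mul_rpow hc.le (by positivity), ← mul_assoc, Real.mul_rpow (by positivity) (by positivity),
      ← Real.rpow_natCast, ← Real.rpow_mul (by norm_num), ← Real.rpow_mul (by norm_num)]
    ring_nf
  have e2 : (2 : ℝ) ^ (-(ε * n)) * 2 ^ (-(t / 3 * j)) =
      ((2 : ℝ) ^ (-η)) ^ j * ((2 : ℝ) ^ (-(ε / 2))) ^ n * thr := by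
    rw [hthr, ← Real.rpow_natCast, ← Real.rpow_natCast, ← Real.rpow_mul (by norm_num), ← Real.rpow_mul (by norm_num),
      ← Real.rpow_add two_pos, ← Real.rpow_add two_pos, ← Real.rpow_add two_pos, ← Real.rpow_add two_pos]
    ring_nf
  rw [e1, div_eq_iff hthr0.ne']
  linear_combination C * (CF * c ^ (-t)) ^ (1 / 3 : ℝ) * μ.real univ * e2

/-- Outside a set of zero `s`-dimensional measure, all scales are eventually good. -/
theorem exists_exceptional (K : ℝ) {t s η : ℝ} (ht : 0 ≤ t) (hs : (3 - t) / 2 < s) (hs0 : 0 < s) (hη : 0 < η) :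
    ∃ ε κ : ℝ, ∃ n0 : ℕ, 0 < ε ∧ 0 < κ ∧ κ ≤ 1 ∧ κ ≤ ε / 4 ∧ ∀ (c : ℝ), 0 < c → c ≤ 1 / 16 →
      ∀ (μ : Measure Pt) (CF : ℝ), BoxMeas μ t CF → ∀ (φ ψ : ℝ → ℝ) (Λ0 : Set ℝ), Convx K φ ψ Λ0 →
      ∃ N : Set ℝ, μH[s] N = 0 ∧ ∀ u ∈ Λ0, u ∉ N → ∃ j0 : ℕ, ∀ j ≥ j0, ∀ n ≥ n0,
        ∑ z ∈ boxIdx j, Xn (cubeMeas μ c j z) u (φ u) n ⌈κ * n⌉₊ ≤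
          (2 : ℝ) ^ (η * j - t / 3 * j) * 2 ^ (-(ε / 2 * n)) := by
  obtain ⟨ε, κ, C, hε, hκ, hκ1, hκ2, hC, n0, H⟩ := sum_Xn_le K t hs
  refine ⟨ε, κ, n0, hε, hκ, hκ1, hκ2, fun c hc hc1 μ CF hμ φ ψ Λ0 hΛ => ?_⟩
  have := hμ.fin
  have hCF := hμ.CF_nonneg
  set D := C * (CF * c ^ (-t)) ^ (1 / 3 : ℝ) * μ.real univ with hD
  have hD0 : 0 ≤ D := by positivity
  set E : ℕ × ℕ → Set ℝ := fun k => {u ∈ Λ0 | n0 ≤ k.2 ∧ (2 : ℝ) ^ (η * k.1 - t / 3 * k.1) * 2 ^ (-(ε / 2 * k.2)) <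
        ∑ z ∈ boxIdx k.1, Xn (cubeMeas μ c k.1 z) u (φ u) k.2 ⌈κ * k.2⌉₊} with hE
  have hex : ∀ k : ℕ × ℕ, ∃ F : Finset (ℕ × ℕ), (∀ u ∈ E k, ∃ p ∈ F, cap p.1 u = p.2) ∧
      ∑ p ∈ F, ((2 : ℝ) ^ (-s)) ^ p.1 ≤ D * (((2 : ℝ) ^ (-η)) ^ k.1 * ((2 : ℝ) ^ (-(ε / 2))) ^ k.2) := by
    intro k
    by_cases hk : n0 ≤ k.2
    · obtain ⟨F, h1, h2⟩ := exists_cheap_cover (η := η) hC hc hc1 ht (H k.2 hk) hμ hΛ k.1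
      exact ⟨F, fun u hu => h1 u hu.1 hu.2.2, h2.trans (le_of_eq (by ring))⟩
    · exact ⟨∅, fun u hu => absurd hu.2.1 hk, by rw [Finset.sum_empty]; positivity⟩
  choose F hF1 hF2 using hex
  have hlt : ∀ a : ℝ, 0 < a → (2 : ℝ) ^ (-a) < 1 := fun a ha => Real.rpow_lt_one_of_one_lt_of_neg one_lt_two (by linarith)
  have hsum : Summable fun k : ℕ × ℕ => D * (((2 : ℝ) ^ (-η)) ^ k.1 * ((2 : ℝ) ^ (-(ε / 2))) ^ k.2) :=
    ((summable_geometric_of_lt_one (by positivity) (hlt η hη)).mul_of_nonneg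
      (summable_geometric_of_lt_one (by positivity) (hlt (ε / 2) (by positivity)))
      (fun j => by positivity) (fun n => by positivity)).mul_left D
  refine ⟨{u : ℝ | {k | u ∈ E k}.Infinite}, hausdorffMeasure_limsup_eq_zero hs0 (fun k u hu => (hΛ.mem u hu.1).1)
    hF1 (ne_top_of_le_ne_top hsum.tsum_ofReal_ne_top (ENNReal.tsum_le_tsum fun k => ?_)), fun u hu hN => ?_⟩
  · rw [← ENNReal.ofReal_sum_of_nonneg fun p _ => by positivity]
    exact ENNReal.ofReal_le_ofReal (hF2 k)
  · have hfin : {k | u ∈ E k}.Finite := not_infinite.1 hN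
    obtain ⟨b, hb⟩ := (hfin.image Prod.fst).bddAbove
    refine ⟨b + 1, fun j hj n hn => ?_⟩
    by_contra hcon
    have := hb ⟨(j, n), ⟨hu, hn, not_le.1 hcon⟩, rfl⟩
    dsimp only at this
    omega

/-- The `L^{4/3}` bounds at a good scale. -/
theorem exists_level_bound {ε κ K : ℝ} (hε : 0 < ε) (hκ : 0 ≤ κ) (hκ1 : κ ≤ 1) (hκ2 : κ ≤ ε / 4) (hK : 0 ≤ K) (n0 : ℕ) :
    ∃ C2 : ℝ, 0 < C2 ∧ ∀ (μ : Measure Pt) (t CF : ℝ), BoxMeas μ t CF → ∀ (u v : ℝ), 0 ≤ u ∧ u < 1 → |v| ≤ K →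
      ∀ (j : ℕ) (Θ : ℝ), 0 ≤ Θ → (∀ n ≥ n0, ∑ z ∈ boxIdx j, Xn (cubeMeas μ (1 / (16 * (2 + K))) j z) u v n ⌈κ * n⌉₊ ≤
        Θ * 2 ^ (-(ε / 2 * n))) →
      (∀ z ∈ boxIdx j, (μ.restrict (cube j z)).map (dirProj u v) ≪ volume) ∧
      ∑ z ∈ boxIdx j, ∫⁻ y, (((μ.restrict (cube j z)).map (dirProj u v)).rnDeriv volume y) ^ (4 / 3 : ℝ) ≤
        ENNReal.ofReal (C2 * (2 ^ j) ^ (1 / 3 : ℝ) * (∑ z ∈ boxIdx j, μ.real (cube j z) ^ (4 / 3 : ℝ) + Θ)) := by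
  obtain ⟨C1, hC1, H⟩ := lintegral_rnDeriv_map_le hε n0
  set c := 1 / (16 * (2 + K)) with hc
  have hc0 : 0 < c := by positivity
  have hc1 : c ≤ 1 / 16 := one_div_le_one_div_of_le (by norm_num) (by linarith)
  set b := (2 : ℝ) ^ (-(ε / 4)) with hb
  have hb0 : 0 < b := by positivity
  have hb1 : b < 1 := Real.rpow_lt_one_of_one_lt_of_neg one_lt_two (by linarith)
  have hbs := summable_geometric_of_lt_one hb0.le hb1
  have h1b : 0 < 1 - b := by linarith
  refine ⟨C1 * (1 + (1 - b)⁻¹), by positivity, fun μ t CF hμ u v hu hv j Θ hΘ hX => ?_⟩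
  have := hμ.fin
  set w : ℤ × ℤ × ℤ → ℕ → ℝ := fun z n =>
    if n0 ≤ n then (2 : ℝ) ^ (ε / 4 * n) * Xn (cubeMeas μ c j z) u v n ⌈κ * n⌉₊ else 0 with hw
  have hw0 : ∀ z n, 0 ≤ w z n := fun z n => by
    simp only [hw]; split_ifs
    · exact mul_nonneg (by positivity) (Xn_nonneg _ _ _ _ _)
    · exact le_rfl
  have hwsum : ∀ n, ∑ z ∈ boxIdx j, w z n ≤ Θ * b ^ n := by
    intro n
    by_cases hn : n0 ≤ n
    · simp only [hw, if_pos hn]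
      rw [← Finset.mul_sum]
      calc _ ≤ (2 : ℝ) ^ (ε / 4 * n) * (Θ * 2 ^ (-(ε / 2 * n))) := by gcongr; exact hX n hn
        _ = Θ * ((2 : ℝ) ^ (ε / 4 * n) * 2 ^ (-(ε / 2 * n))) := by ring
        _ = Θ * b ^ n := by
          rw [hb, ← Real.rpow_add two_pos, ← Real.rpow_natCast, ← Real.rpow_mul (by norm_num)]; ring_nf
    · simp only [hw, if_neg hn, Finset.sum_const_zero]; positivity
  have hsz : ∀ z ∈ boxIdx j, Summable (w z) := fun z hz => (hbs.mul_left Θ).of_nonneg_of_le (hw0 z) fun n =>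
    (Finset.single_le_sum (fun z _ => hw0 z n) hz).trans (hwsum n)
  have hWtot : ∑ z ∈ boxIdx j, ∑' n, w z n ≤ Θ * (1 - b)⁻¹ := by
    rw [← Summable.tsum_finsetSum hsz, ← tsum_geometric_of_lt_one hb0.le hb1, ← tsum_mul_left]
    exact Summable.tsum_le_tsum hwsum (summable_sum hsz) (hbs.mul_left Θ)
  have hz : ∀ z ∈ boxIdx j, (μ.restrict (cube j z)).map (dirProj u v) ≪ volume ∧
      ∫⁻ y, (((μ.restrict (cube j z)).map (dirProj u v)).rnDeriv volume y) ^ (4 / 3 : ℝ) ≤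
        ENNReal.ofReal ((2 ^ j) ^ (1 / 3 : ℝ) * (C1 * (μ.real (cube j z) ^ (4 / 3 : ℝ) + ∑' n, w z n))) := by
    intro z hz
    have h1 := H _ t _ (hμ.cubeMeas hc0 hc1 j z) u v κ (∑' n, w z n) (cubeMeas_dirProj_mem hK hu hv μ j z) hκ hκ2 hκ1
      (tsum_nonneg (hw0 z)) fun n hn => by
        have h2 := (hsz z hz).le_tsum n fun i _ => hw0 z i
        simpa only [hw, if_pos hn] using h2
    have hf := Measure.isFiniteMeasure_map (μ.restrict (cube j z)) (dirProj u v)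
    rw [map_cubeMeas] at h1
    obtain ⟨h3, h4⟩ := ac_of_map_affine (by positivity) _ h1.1
    refine ⟨h3, h4.le.trans ?_⟩
    rw [ENNReal.ofReal_mul (by positivity)]
    refine mul_le_mul' (ENNReal.ofReal_le_ofReal ?_) (by rw [← cubeMeas_real_univ μ c]; exact h1.2)
    gcongr
    exact mul_le_of_le_one_left (by positivity) (by linarith)
  refine ⟨fun z h => (hz z h).1, (Finset.sum_le_sum fun z h => (hz z h).2).trans ?_⟩
  rw [← ENNReal.ofReal_sum_of_nonneg fun z _ => by
    have : 0 ≤ ∑' n, w z n := tsum_nonneg (hw0 z)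
    positivity]
  refine ENNReal.ofReal_le_ofReal ?_
  rw [← Finset.mul_sum, ← Finset.mul_sum, Finset.sum_add_distrib]
  have hM : 0 ≤ ∑ z ∈ boxIdx j, μ.real (cube j z) ^ (4 / 3 : ℝ) := Finset.sum_nonneg fun z _ => by positivity
  have hi : 0 ≤ (1 - b)⁻¹ := by positivity
  have : ∑ z ∈ boxIdx j, μ.real (cube j z) ^ (4 / 3 : ℝ) + ∑ z ∈ boxIdx j, ∑' n, w z n ≤
      (1 + (1 - b)⁻¹) * (∑ z ∈ boxIdx j, μ.real (cube j z) ^ (4 / 3 : ℝ) + Θ) := by nlinarith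
  calc _ ≤ (2 ^ j) ^ (1 / 3 : ℝ) * (C1 * ((1 + (1 - b)⁻¹) *
        (∑ z ∈ boxIdx j, μ.real (cube j z) ^ (4 / 3 : ℝ) + Θ))) := by gcongr
    _ = _ := by ring

lemma measure_inter_le_of_cubes {ν : Measure Pt} {G s : Set Pt} {a : ℝ≥0∞} {j : ℕ}
    (hG : ∀ x ∈ G, ν (cube j (cubeIdx j x)) ≤ a) (hs : ediam s ≤ ENNReal.ofReal ((1 / 2) ^ j)) :
    ν (s ∩ G) ≤ 27 * a := by
  rcases (s ∩ G).eq_empty_or_nonempty with he | ⟨x0, hx0, -⟩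
  · rw [he, measure_empty]; exact zero_le
  set z0 := cubeIdx j x0 with hz0
  set Nb : Finset (ℤ × ℤ × ℤ) := Finset.Icc (z0.1 - 1) (z0.1 + 1) ×ˢ Finset.Icc (z0.2.1 - 1) (z0.2.1 + 1) ×ˢ
    Finset.Icc (z0.2.2 - 1) (z0.2.2 + 1) with hNb
  have hcard : Nb.card = 27 := by
    have : ∀ a : ℤ, (a + 1 + 1 - (a - 1)).toNat = 3 := fun a => by omega
    simp only [hNb, Finset.card_product, Int.card_Icc, this]
  have hsub : s ∩ G ⊆ ⋃ z ∈ Nb, (s ∩ G) ∩ cube j z := by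
    intro x hx
    refine mem_biUnion (x := cubeIdx j x) ?_ ⟨hx, rfl⟩
    have hd : edist x x0 ≤ ENNReal.ofReal ((1 / 2) ^ j) := (edist_le_ediam_of_mem hx.1 hx0).trans hs
    rw [edist_dist, ENNReal.ofReal_le_ofReal_iff (by positivity), Prod.dist_eq, Prod.dist_eq, max_le_iff,
      max_le_iff] at hd
    have key : ∀ a b : ℝ, dist a b ≤ (1 / 2) ^ j → ⌊2 ^ j * a⌋ ∈ Finset.Icc (⌊2 ^ j * b⌋ - 1) (⌊2 ^ j * b⌋ + 1) := by
      intro a b hab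
      rw [Real.dist_eq] at hab
      have h1 : |2 ^ j * a - 2 ^ j * b| ≤ 1 := by
        rw [← mul_sub, abs_mul, abs_of_pos (by positivity)]
        calc _ ≤ (2 : ℝ) ^ j * (1 / 2) ^ j := by gcongr
          _ = 1 := by rw [← mul_pow]; norm_num
      have h2 := abs_le.1 h1
      rw [Finset.mem_Icc, ← Int.floor_sub_one, ← Int.floor_add_one]
      exact ⟨Int.floor_mono (by linarith), Int.floor_mono (by linarith)⟩
    simp only [hNb, SetLike.mem_coe, Finset.mem_product]
    exact ⟨key _ _ hd.1, key _ _ hd.2.1, key _ _ hd.2.2⟩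
  calc ν (s ∩ G) ≤ ∑ z ∈ Nb, ν ((s ∩ G) ∩ cube j z) := (measure_mono hsub).trans (measure_biUnion_finset_le _ _)
    _ ≤ ∑ z ∈ Nb, a := by
        refine Finset.sum_le_sum fun z _ => ?_
        rcases ((s ∩ G) ∩ cube j z).eq_empty_or_nonempty with he | ⟨x, hx, hxz⟩
        · rw [he, measure_empty]; exact zero_le
        · obtain rfl : cubeIdx j x = z := hxz
          exact (measure_mono inter_subset_right).trans (hG x hx.2)
    _ = 27 * a := by rw [Finset.sum_const, hcard, nsmul_eq_mul]; norm_num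

lemma hausdorffMeasure_pos_of_cubes {ν : Measure Pt} {G : Set Pt} (hGm : MeasurableSet G) {σ : ℝ} (hσ : 0 < σ) {J : ℕ}
    (hG : ∀ x ∈ G, ∀ j ≥ J, ν (cube j (cubeIdx j x)) ≤ ENNReal.ofReal (((1 / 2) ^ j) ^ σ)) {S : Set Pt}
    (hS : ν (S ∩ G) ≠ 0) : μH[σ] S ≠ 0 := by
  set B : ℝ≥0∞ := 27 * ENNReal.ofReal (2 ^ σ) with hB
  have hB0 : B ≠ 0 := mul_ne_zero (by norm_num) (by rw [Ne, ENNReal.ofReal_eq_zero, not_le]; positivity)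
  have hBt : B ≠ ∞ := ENNReal.mul_ne_top (by norm_num) ENNReal.ofReal_ne_top
  have key : B⁻¹ • ν.restrict G ≤ μH[σ] := by
    refine Measure.le_hausdorffMeasure σ _ (ENNReal.ofReal ((1 / 2) ^ J)) (by rw [ENNReal.ofReal_pos]; positivity)
      fun s hs => ?_
    rw [Measure.smul_apply, Measure.restrict_apply' hGm, smul_eq_mul, ← ENNReal.div_eq_inv_mul,
      ENNReal.div_le_iff hB0 hBt]
    have hj : ∀ j ≥ J, ediam s ≤ ENNReal.ofReal ((1 / 2) ^ j) → ν (s ∩ G) ≤ 27 * ENNReal.ofReal (((1 / 2) ^ j) ^ σ) :=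
      fun j hj hd => measure_inter_le_of_cubes (fun x hx => hG x hx j hj) hd
    rcases eq_or_ne (ediam s) 0 with h0 | h0
    · rw [h0, ENNReal.zero_rpow_of_pos hσ, zero_mul]
      have t1 : Filter.Tendsto (fun j : ℕ => ((1 / 2 : ℝ) ^ j) ^ σ) Filter.atTop (nhds (0 ^ σ)) :=
        (tendsto_pow_atTop_nhds_zero_of_lt_one (by norm_num) (by norm_num)).rpow_const (Or.inr hσ.le)
      rw [Real.zero_rpow hσ.ne'] at t1
      have t2 := ENNReal.Tendsto.const_mul (a := 27) (ENNReal.tendsto_ofReal t1) (Or.inr (by norm_num))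
      rw [ENNReal.ofReal_zero, mul_zero] at t2
      refine ge_of_tendsto t2 ?_
      filter_upwards [Filter.eventually_ge_atTop J] with j h
      exact hj j h (by rw [h0]; exact zero_le)
    · have hdt : ediam s ≠ ∞ := ne_top_of_le_ne_top ENNReal.ofReal_ne_top hs
      have hd0 : 0 < (ediam s).toReal := ENNReal.toReal_pos h0 hdt
      have hdJ : (ediam s).toReal ≤ (1 / 2) ^ J := ENNReal.toReal_le_of_le_ofReal (by positivity) hs
      obtain ⟨j, h1, h2⟩ := exists_nat_pow_near_of_lt_one hd0 (hdJ.trans (pow_le_one₀ (by norm_num) (by norm_num)))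
        (by norm_num : (0 : ℝ) < 1 / 2) (by norm_num)
      have hjJ : J ≤ j := by
        have := (pow_lt_pow_iff_right_of_lt_one₀ (by norm_num : (0 : ℝ) < 1 / 2) (by norm_num)).1 (h1.trans_le hdJ)
        omega
      refine (hj j hjJ ((ENNReal.le_ofReal_iff_toReal_le hdt (by positivity)).2 h2)).trans ?_
      rw [hB, mul_left_comm]
      refine mul_le_mul' le_rfl ?_
      conv_rhs => rw [← ENNReal.ofReal_toReal hdt]
      rw [ENNReal.ofReal_rpow_of_pos hd0, ← ENNReal.ofReal_mul (by positivity), ← Real.mul_rpow hd0.le (by norm_num)]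
      refine ENNReal.ofReal_le_ofReal (Real.rpow_le_rpow (by positivity) ?_ hσ.le)
      rw [pow_succ] at h1
      linarith
  intro h0
  have h1 := key S
  rw [h0, Measure.smul_apply, Measure.restrict_apply' hGm, smul_eq_mul, nonpos_iff_eq_zero, mul_eq_zero] at h1
  exact h1.elim (ENNReal.inv_ne_zero.2 hBt) hS

/-- A measure with summable cube energies lives on sets of large dimension. -/
lemma le_dimH_of_cube_energy {ν : Measure Pt} [IsFiniteMeasure ν] (hν : ν ≠ 0)
    (hbox : ∀ᵐ x ∂ν, |x.1| ≤ 1 / 2 ∧ |x.2.1| ≤ 1 / 2 ∧ |x.2.2| ≤ 1 / 2) {S : Set Pt} (hS : ∀ᵐ x ∂ν, x ∈ S)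
    {σ : ℝ} (hσ : 0 < σ) {j0 : ℕ}
    (hsum : ∑' j : ℕ, ENNReal.ofReal ((2 ^ (j0 + j)) ^ (σ / 3)) * ∑ z ∈ boxIdx (j0 + j), ν (cube (j0 + j) z) ^ (4 / 3 : ℝ) ≠ ∞) :
    ENNReal.ofReal σ ≤ dimH S := by
  set g : ℕ → Pt → ℝ≥0∞ := fun j x => ENNReal.ofReal ((2 ^ (j0 + j)) ^ (σ / 3)) *
    ν (cube (j0 + j) (cubeIdx (j0 + j) x)) ^ (1 / 3 : ℝ) with hg
  have hgm : ∀ j, Measurable fun x => ν (cube j (cubeIdx j x)) := fun j =>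
    (measurable_of_countable fun z => ν (cube j z)).comp (measurable_cubeIdx j)
  have hgm' : ∀ j, Measurable (g j) := fun j => ((hgm _).pow_const _).const_mul _
  have hinteg : ∀ j, ∫⁻ x, g j x ∂ν =
      ENNReal.ofReal ((2 ^ (j0 + j)) ^ (σ / 3)) * ∑ z ∈ boxIdx (j0 + j), ν (cube (j0 + j) z) ^ (4 / 3 : ℝ) := by
    intro j
    simp only [hg]
    rw [lintegral_const_mul _ ((hgm _).pow_const _)]
    congr 1
    have hm : Measurable fun z => ν (cube (j0 + j) z) ^ (1 / 3 : ℝ) := measurable_of_countable _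
    rw [← lintegral_map hm (measurable_cubeIdx (j0 + j)), lintegral_countable']
    rw [tsum_eq_sum (s := boxIdx (j0 + j))]
    · refine Finset.sum_congr rfl fun z _ => ?_
      rw [Measure.map_apply (measurable_cubeIdx _) (measurableSet_singleton z)]
      change ν (cube (j0 + j) z) ^ (1 / 3 : ℝ) * ν (cube (j0 + j) z) = _
      conv_lhs => rw [← ENNReal.rpow_one (ν (cube (j0 + j) z)), ← ENNReal.rpow_mul]
      rw [← ENNReal.rpow_add_of_nonneg _ _ (by norm_num) (by norm_num)]
      norm_num
    · intro z hz
      rw [Measure.map_apply (measurable_cubeIdx _) (measurableSet_singleton z)]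
      have : ν (cubeIdx (j0 + j) ⁻¹' {z}) = 0 := by
        have h0 := ae_iff.1 hbox
        have hsub : cubeIdx (j0 + j) ⁻¹' {z} ⊆
            {a | ¬(|a.1| ≤ 1 / 2 ∧ |a.2.1| ≤ 1 / 2 ∧ |a.2.2| ≤ 1 / 2)} := by
          intro x hx hc
          obtain rfl : cubeIdx (j0 + j) x = z := hx
          exact hz (cubeIdx_mem_boxIdx hc _)
        exact measure_mono_null hsub h0
      rw [this, mul_zero]
  have hfin : ∀ᵐ x ∂ν, ∑' j, g j x ≠ ∞ := by
    have h1 : ∫⁻ x, ∑' j, g j x ∂ν ≠ ∞ := by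
      rw [lintegral_tsum fun j => (hgm' j).aemeasurable]
      simp_rw [hinteg]
      exact hsum
    filter_upwards [ae_lt_top (Measurable.tsum hgm') h1] with x hx using hx.ne
  set G : ℕ → Set Pt := fun J => {x | ∀ j ≥ J, ν (cube j (cubeIdx j x)) ≤ ENNReal.ofReal (((1 / 2) ^ j) ^ σ)} with hGdef
  have hGm : ∀ J, MeasurableSet (G J) := fun J => by
    have : G J = ⋂ j, ⋂ (_ : j ≥ J), {x | ν (cube j (cubeIdx j x)) ≤ ENNReal.ofReal (((1 / 2) ^ j) ^ σ)} := by
      ext x; simp [hGdef]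
    rw [this]
    exact MeasurableSet.iInter fun j => MeasurableSet.iInter fun _ => measurableSet_le (hgm j) measurable_const
  have hex : ∀ᵐ x ∂ν, ∃ J, x ∈ G J := by
    filter_upwards [hfin] with x hx
    have ht := ENNReal.tendsto_atTop_zero_of_tsum_ne_top hx
    obtain ⟨J, hJ⟩ := Filter.eventually_atTop.1 (ht.eventually (ge_mem_nhds zero_lt_one))
    refine ⟨j0 + J, fun j hj => ?_⟩
    obtain ⟨i, rfl⟩ := Nat.exists_eq_add_of_le (le_trans (Nat.le_add_right j0 J) hj)
    have h1 := hJ i (by omega)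
    simp only [hg] at h1
    have h2 := ENNReal.rpow_le_rpow h1 (by norm_num : (0 : ℝ) ≤ 3)
    rw [ENNReal.mul_rpow_of_nonneg _ _ (by norm_num), ENNReal.one_rpow, ← ENNReal.rpow_mul,
      ENNReal.ofReal_rpow_of_pos (by positivity), ← Real.rpow_mul (by positivity)] at h2
    norm_num at h2
    have hp : (0 : ℝ) < (2 ^ (j0 + i)) ^ σ := by positivity
    rw [mul_comm, ← ENNReal.le_div_iff_mul_le (Or.inl (by rw [Ne, ENNReal.ofReal_eq_zero, not_le]; exact hp))
      (Or.inl ENNReal.ofReal_ne_top), one_div, ← ENNReal.ofReal_inv_of_pos hp, ← Real.inv_rpow (by positivity)] at h2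
    rwa [one_div, inv_pow]
  obtain ⟨J, hJ⟩ : ∃ J, ν (S ∩ G J) ≠ 0 := by
    by_contra hcon
    push Not at hcon
    refine hν (Measure.measure_univ_eq_zero.1 ?_)
    have : (univ : Set Pt) ⊆ {x | ¬(x ∈ S ∧ ∃ J, x ∈ G J)} ∪ ⋃ J, S ∩ G J := by
      intro x _
      by_cases h : x ∈ S ∧ ∃ J, x ∈ G J
      · exact Or.inr (mem_iUnion.2 ⟨h.2.choose, h.1, h.2.choose_spec⟩)
      · exact Or.inl h
    exact measure_mono_null this (measure_union_null (ae_iff.1 (hS.and hex)) (measure_iUnion_null hcon))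
  have hpos := hausdorffMeasure_pos_of_cubes (hGm J) hσ (fun x hx => hx) hJ
  exact le_dimH_of_hausdorffMeasure_ne_zero (d := σ.toNNReal) (by rwa [Real.coe_toNNReal _ hσ.le])

open ProbabilityTheory in
/-- Fibres of a projection with square-function control have large dimension. -/
theorem ae_le_dimH_fibre {μ : Measure Pt} {t CF u v : ℝ} (hμ : BoxMeas μ t CF) {A : Set Pt} (hAm : MeasurableSet A)
    (hA : ∀ᵐ x ∂μ, x ∈ A) (hac : μ.map (dirProj u v) ≪ volume) {σ : ℝ} (hσ : 0 < σ) {j0 : ℕ}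
    (hsum : ∑' j : ℕ, ENNReal.ofReal ((2 ^ (j0 + j)) ^ (σ / 3)) * ∑ z ∈ boxIdx (j0 + j),
      ∫⁻ y, (((μ.restrict (cube (j0 + j) z)).map (dirProj u v)).rnDeriv volume y) ^ (4 / 3 : ℝ) ≠ ∞) :
    ∀ᵐ y ∂(μ.map (dirProj u v)), ENNReal.ofReal σ ≤ dimH (A ∩ {x | dirProj u v x = y}) := by
  have := hμ.fin
  have hpc := continuous_dirProj u v
  have hpm : Measurable (dirProj u v) := hpc.measurable
  have hgm : Measurable fun x => (dirProj u v x, x) := hpm.prodMk measurable_id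
  set m := μ.map (dirProj u v) with hm
  have hmf : IsFiniteMeasure m := Measure.isFiniteMeasure_map _ _
  set ρ : Measure (ℝ × Pt) := μ.map fun x => (dirProj u v x, x) with hρ
  have hρf : IsFiniteMeasure ρ := Measure.isFiniteMeasure_map _ _
  have hfst : ρ.fst = m := by
    rw [Measure.fst, hρ, Measure.map_map measurable_fst hgm]; rfl
  set k := ρ.condKernel with hk
  have hdis : m ⊗ₘ k = ρ := by rw [← hfst]; exact ρ.disintegrate _
  have hae : ∀ᵐ y ∂m, ∀ᵐ x ∂(k y), (x ∈ A ∧ dirProj u v x = y) ∧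
      |x.1| ≤ 1 / 2 ∧ |x.2.1| ≤ 1 / 2 ∧ |x.2.2| ≤ 1 / 2 := by
    have h1 : ∀ᵐ q ∂ρ, (q.2 ∈ A ∧ dirProj u v q.2 = q.1) ∧ |q.2.1| ≤ 1 / 2 ∧ |q.2.2.1| ≤ 1 / 2 ∧ |q.2.2.2| ≤ 1 / 2 := by
      rw [hρ, ae_map_iff hgm.aemeasurable]
      · filter_upwards [hA, hμ.box] with x h1 h2 using ⟨⟨h1, rfl⟩, h2⟩
      · refine MeasurableSet.inter ((measurable_snd hAm).inter
          (isClosed_eq (hpc.comp continuous_snd) continuous_fst).measurableSet) ?_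
        have hb : IsClosed {x : Pt | |x.1| ≤ 1 / 2 ∧ |x.2.1| ≤ 1 / 2 ∧ |x.2.2| ≤ 1 / 2} := by
          simp only [ofPred_and]
          exact (isClosed_le (by fun_prop) (by fun_prop)).inter
            ((isClosed_le (by fun_prop) (by fun_prop)).inter (isClosed_le (by fun_prop) (by fun_prop)))
        exact measurable_snd hb.measurableSet
    rw [← hdis] at h1
    exact Measure.ae_ae_of_ae_compProd h1
  set p := m.rnDeriv volume with hp
  have hpmeas : Measurable p := Measure.measurable_rnDeriv _ _
  have hkm : ∀ j z, Measurable fun y => k y (cube j z) := fun j z => k.measurable_coe (measurableSet_cube j z)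
  have hdens : ∀ j z, ((μ.restrict (cube j z)).map (dirProj u v)).rnDeriv volume =ᵐ[volume]
      fun y => p y * k y (cube j z) := by
    intro j z
    have h1 : (μ.restrict (cube j z)).map (dirProj u v) = volume.withDensity (p * fun y => k y (cube j z)) := by
      rw [withDensity_mul _ hpmeas (hkm j z), Measure.withDensity_rnDeriv_eq _ _ hac]
      ext s hs
      rw [withDensity_apply _ hs, ← Measure.compProd_apply_prod hs (measurableSet_cube j z), hdis, hρ,
        Measure.map_apply hgm (hs.prod (measurableSet_cube j z)), Measure.map_apply hpm hs,
        Measure.restrict_apply (hpm hs)]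
      rfl
    rw [h1]
    exact Measure.rnDeriv_withDensity _ (hpmeas.mul (hkm j z))
  have hJm : ∀ j : ℕ, Measurable fun y => ENNReal.ofReal ((2 ^ (j0 + j)) ^ (σ / 3)) *
      ∑ z ∈ boxIdx (j0 + j), (p y * k y (cube (j0 + j) z)) ^ (4 / 3 : ℝ) := fun j =>
    (Finset.measurable_sum _ fun z _ => (hpmeas.mul (hkm _ z)).pow_const _).const_mul _
  have hfin : ∀ᵐ y ∂(volume : Measure ℝ), ∑' j : ℕ, ENNReal.ofReal ((2 ^ (j0 + j)) ^ (σ / 3)) *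
      ∑ z ∈ boxIdx (j0 + j), (p y * k y (cube (j0 + j) z)) ^ (4 / 3 : ℝ) ≠ ∞ := by
    have h1 : ∫⁻ y, ∑' j : ℕ, ENNReal.ofReal ((2 ^ (j0 + j)) ^ (σ / 3)) *
        ∑ z ∈ boxIdx (j0 + j), (p y * k y (cube (j0 + j) z)) ^ (4 / 3 : ℝ) ≠ ∞ := by
      rw [lintegral_tsum fun j => (hJm j).aemeasurable]
      convert hsum using 3 with j
      have hzm : ∀ z, Measurable fun y => (p y * k y (cube (j0 + j) z)) ^ (4 / 3 : ℝ) :=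
        fun z => (hpmeas.mul (hkm _ z)).pow_const _
      rw [lintegral_const_mul _ (Finset.measurable_sum _ fun z _ => hzm z), lintegral_finsetSum _ fun z _ => hzm z]
      congr 1
      refine Finset.sum_congr rfl fun z _ => lintegral_congr_ae ?_
      filter_upwards [hdens (j0 + j) z] with y hy
      rw [hy]
    filter_upwards [ae_lt_top (Measurable.tsum hJm) h1] with y hy using hy.ne
  filter_upwards [hae, hac.ae_le hfin, Measure.rnDeriv_pos hac] with y h1 h2 h3
  refine le_dimH_of_cube_energy (ν := k y) (IsProbabilityMeasure.ne_zero _) (h1.mono fun x hx => hx.2)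
    (h1.mono fun x hx => hx.1) hσ (j0 := j0) fun htop => h2 ?_
  have hp0 : p y ^ (4 / 3 : ℝ) ≠ 0 := by
    rw [Ne, ENNReal.rpow_eq_zero_iff_of_pos (by norm_num)]; exact h3.ne'
  simp_rw [ENNReal.mul_rpow_of_nonneg _ _ (by norm_num : (0 : ℝ) ≤ 4 / 3), ← Finset.mul_sum,
    mul_left_comm _ (p y ^ (4 / 3 : ℝ))]
  rw [ENNReal.tsum_mul_left, htop, ENNReal.mul_top hp0]

/-- The conclusion at dimension `t - 1 - 6 η` outside a set of zero `s`-dimensional measure. -/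
theorem exists_null_fibres {K t s η : ℝ} (ht : 0 ≤ t) (hs : (3 - t) / 2 < s) (hs0 : 0 < s) (hη : 0 < η)
    (hσ : 0 < t - 1 - 6 * η) {μ : Measure Pt} {CF : ℝ} (hμ : BoxMeas μ t CF) {φ ψ : ℝ → ℝ} {Λ0 : Set ℝ}
    (hΛ : Convx K φ ψ Λ0) {A : Set Pt} (hAm : MeasurableSet A) (hA : ∀ᵐ x ∂μ, x ∈ A) :
    ∃ N : Set ℝ, μH[s] N = 0 ∧ ∀ u ∈ Λ0, u ∉ N → μ.map (dirProj u (φ u)) ≪ volume ∧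
      ∀ᵐ y ∂(μ.map (dirProj u (φ u))), ENNReal.ofReal (t - 1 - 6 * η) ≤ dimH (A ∩ {x | dirProj u (φ u) x = y}) := by
  obtain ⟨ε, κ, n0, hε, hκ, hκ1, hκ2, H⟩ := exists_exceptional K ht hs hs0 hη
  have hK : 0 ≤ K := hΛ.pos.le
  obtain ⟨C2, hC2, H2⟩ := exists_level_bound hε hκ.le hκ1 hκ2 hK n0
  obtain ⟨N, hN, hgood⟩ := H (1 / (16 * (2 + K))) (by positivity)
    (one_div_le_one_div_of_le (by norm_num) (by linarith)) μ CF hμ φ ψ Λ0 hΛ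
  refine ⟨N, hN, fun u hu huN => ?_⟩
  have := hμ.fin
  have hCF := hμ.CF_nonneg
  obtain ⟨j0, hj0⟩ := hgood u hu huN
  have hL := fun j hj => H2 μ t CF hμ u (φ u) (hΛ.mem u hu) (hΛ.phi_le u hu) j ((2 : ℝ) ^ (η * j - t / 3 * j))
    (by positivity) (hj0 j hj)
  have hpm : Measurable (dirProj u (φ u)) := (continuous_dirProj u (φ u)).measurable
  have hac : μ.map (dirProj u (φ u)) ≪ volume := by
    refine Measure.AbsolutelyContinuous.mk fun s hsm h0 => ?_
    rw [Measure.map_apply hpm hsm]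
    have hb := ae_iff.1 hμ.box
    have hsub : dirProj u (φ u) ⁻¹' s ⊆ {x | ¬(|x.1| ≤ 1 / 2 ∧ |x.2.1| ≤ 1 / 2 ∧ |x.2.2| ≤ 1 / 2)} ∪
        ⋃ z ∈ boxIdx j0, dirProj u (φ u) ⁻¹' s ∩ cube j0 z := by
      intro x hx
      by_cases h : |x.1| ≤ 1 / 2 ∧ |x.2.1| ≤ 1 / 2 ∧ |x.2.2| ≤ 1 / 2
      · exact Or.inr (mem_biUnion (cubeIdx_mem_boxIdx h j0) ⟨hx, rfl⟩)
      · exact Or.inl h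
    refine measure_mono_null hsub (measure_union_null hb ((measure_biUnion_null_iff (boxIdx j0).countable_toSet).2
      fun z hz => ?_))
    have h1 := (hL j0 le_rfl).1 z hz h0
    rwa [Measure.map_apply hpm hsm, Measure.restrict_apply (hpm hsm)] at h1
  refine ⟨hac, ae_le_dimH_fibre hμ hAm hA hac hσ (j0 := j0) ?_⟩
  set D := C2 * (CF ^ (1 / 3 : ℝ) * μ.real univ + 1) with hD
  have hD0 : 0 ≤ D := by positivity
  have hsumm : Summable fun j : ℕ => D * ((2 : ℝ) ^ (-η)) ^ (j0 + j) := by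
    have h1 := summable_geometric_of_lt_one (r := (2 : ℝ) ^ (-η)) (by positivity)
      (Real.rpow_lt_one_of_one_lt_of_neg one_lt_two (by linarith))
    refine ((h1.mul_left (((2 : ℝ) ^ (-η)) ^ j0)).mul_left D).congr fun j => ?_
    rw [pow_add]
  refine ne_top_of_le_ne_top hsumm.tsum_ofReal_ne_top (ENNReal.tsum_le_tsum fun i => ?_)
  set j := j0 + i with hj
  refine (mul_le_mul' le_rfl (hL j (by omega)).2).trans ?_
  rw [← ENNReal.ofReal_mul (by positivity)]
  refine ENNReal.ofReal_le_ofReal ?_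
  have hcubes : ∑ z ∈ boxIdx j, μ.real (cube j z) ^ (4 / 3 : ℝ) ≤
      CF ^ (1 / 3 : ℝ) * μ.real univ * 2 ^ (η * j - t / 3 * j) := by
    calc _ ≤ ∑ z ∈ boxIdx j, (CF * (2 ^ j) ^ (-t)) ^ (1 / 3 : ℝ) * μ.real (cube j z) := by
          refine Finset.sum_le_sum fun z _ => ?_
          have h0 : 0 ≤ μ.real (cube j z) := measureReal_nonneg
          rw [show (4 / 3 : ℝ) = 1 / 3 + 1 by norm_num, Real.rpow_add_one' h0 (by norm_num)]
          gcongr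
          exact hμ.cube_le j z
      _ ≤ (CF * (2 ^ j) ^ (-t)) ^ (1 / 3 : ℝ) * μ.real univ := by
          rw [← Finset.mul_sum]
          gcongr
          exact sum_cube_le μ j
      _ = CF ^ (1 / 3 : ℝ) * μ.real univ * 2 ^ (0 - t / 3 * j) := by
          rw [Real.mul_rpow hCF (by positivity), ← Real.rpow_natCast, ← Real.rpow_mul (by norm_num),
            ← Real.rpow_mul (by norm_num)]
          ring_nf
      _ ≤ _ := by
          gcongr
          · norm_num
          · positivity
  calc ((2 : ℝ) ^ j) ^ ((t - 1 - 6 * η) / 3) * (C2 * (2 ^ j) ^ (1 / 3 : ℝ) *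
        (∑ z ∈ boxIdx j, μ.real (cube j z) ^ (4 / 3 : ℝ) + 2 ^ (η * j - t / 3 * j)))
      ≤ ((2 : ℝ) ^ j) ^ ((t - 1 - 6 * η) / 3) * (C2 * (2 ^ j) ^ (1 / 3 : ℝ) *
        (CF ^ (1 / 3 : ℝ) * μ.real univ * 2 ^ (η * j - t / 3 * j) + 2 ^ (η * j - t / 3 * j))) := by gcongr
    _ = D * (((2 : ℝ) ^ j) ^ ((t - 1 - 6 * η) / 3) * (2 ^ j) ^ (1 / 3 : ℝ) * 2 ^ (η * j - t / 3 * j)) := by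
        rw [hD]; ring
    _ = _ := by
        rw [← Real.rpow_natCast, ← Real.rpow_natCast, ← Real.rpow_mul (by norm_num), ← Real.rpow_mul (by norm_num),
          ← Real.rpow_mul (by norm_num), ← Real.rpow_add two_pos, ← Real.rpow_add two_pos]
        ring_nf

/-- The model theorem: directions with small fibres form a set of small dimension. -/
theorem dimH_exceptional_le {K t : ℝ} (ht : 1 < t) {μ : Measure Pt} {CF : ℝ} (hμ : BoxMeas μ t CF) {φ ψ : ℝ → ℝ}
    {Λ0 : Set ℝ} (hΛ : Convx K φ ψ Λ0) {A : Set Pt} (hAm : MeasurableSet A) (hA : ∀ᵐ x ∂μ, x ∈ A) :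
    dimH {u ∈ Λ0 | ¬(μ.map (dirProj u (φ u)) ≪ volume ∧
      ∀ᵐ y ∂(μ.map (dirProj u (φ u))), ENNReal.ofReal (t - 1) ≤ dimH (A ∩ {x | dirProj u (φ u) x = y}))} ≤
      ENNReal.ofReal ((3 - t) / 2) := by
  refine ENNReal.le_of_forall_pos_le_add fun e he _ => ?_
  set s : ℝ := max ((3 - t) / 2) 0 + e with hs
  have he' : (0 : ℝ) < e := he
  have hs0 : 0 < s := by rw [hs]; positivity
  have hs1 : (3 - t) / 2 < s := by rw [hs]; linarith [le_max_left ((3 - t) / 2) (0 : ℝ)]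
  have hse : ENNReal.ofReal ((3 - t) / 2) + e = ((s.toNNReal : NNReal) : ℝ≥0∞) := by
    change _ = ENNReal.ofReal s
    rw [hs, ENNReal.ofReal_add (le_max_right _ _) he'.le, ENNReal.ofReal_max, ENNReal.ofReal_zero,
      max_eq_left zero_le, ENNReal.ofReal_coe_nnreal]
  set η : ℕ → ℝ := fun k => (t - 1) / 12 * (1 / (k + 1)) with hη
  have hη0 : ∀ k, 0 < η k := fun k => by
    have : 0 < t - 1 := by linarith
    simp only [hη]; positivity
  have hη1 : ∀ k, 0 < t - 1 - 6 * η k := fun k => by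
    have h1 : (1 : ℝ) / (k + 1) ≤ 1 := (div_le_one (by positivity)).2 (by linarith [(Nat.cast_nonneg k : (0 : ℝ) ≤ k)])
    simp only [hη]; nlinarith
  choose N hN hgood using fun k => exists_null_fibres (by linarith) hs1 hs0 (hη0 k) (hη1 k) hμ hΛ hAm hA
  rw [hse]
  refine dimH_le_of_hausdorffMeasure_ne_top ?_
  rw [Real.coe_toNNReal _ hs0.le]
  have hnull : μH[s] (⋃ k, N k) = 0 := measure_iUnion_null hN
  rw [measure_mono_null _ hnull]
  · exact ENNReal.zero_ne_top
  rintro u ⟨hu, hbad⟩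
  by_contra hcon
  rw [mem_iUnion, not_exists] at hcon
  refine hbad ⟨(hgood 0 u hu (hcon 0)).1, ?_⟩
  filter_upwards [ae_all_iff.2 fun k => (hgood k u hu (hcon k)).2] with y hy
  have t1 : Filter.Tendsto (fun k => t - 1 - 6 * η k) Filter.atTop (nhds (t - 1)) := by
    have := ((tendsto_one_div_add_atTop_nhds_zero_nat (𝕜 := ℝ)).const_mul ((t - 1) / 12)).const_mul 6
    simpa [hη] using this.const_sub (t - 1)
  exact le_of_tendsto' (ENNReal.tendsto_ofReal t1) hy

/-- A set all of whose points have large upper density with respect to `ν` has small Hausdorff measure. -/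
theorem hausdorffMeasure_le_of_dense {X : Type*} [MetricSpace X] [MeasurableSpace X] [BorelSpace X]
    [SecondCountableTopology X] (ν : Measure X) {t : ℝ} (ht : 0 < t) (k : ℝ≥0∞) {F : Set X}
    (h : ∀ x ∈ F, ∀ ε > 0, ∃ r, 0 < r ∧ r < ε ∧ ENNReal.ofReal (10 * r) ^ t ≤ k * ν (closedBall x r)) :
    μH[t] F ≤ k * ν univ := by
  have hdiam : ∀ (x : X) (r : ℝ), ediam (closedBall x (5 * r)) ≤ ENNReal.ofReal (10 * r) := fun x r =>
    ediam_le fun y hy z hz => by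
      rw [edist_dist]
      refine ENNReal.ofReal_le_ofReal ?_
      have := dist_triangle_right y z x
      rw [mem_closedBall] at hy hz
      linarith
  have key : ∀ n : ℕ, ∃ u : Set (X × ℝ), u.Countable ∧ (∀ a ∈ u, a.2 ≤ 1 / ((n : ℝ) + 1)) ∧
      F ⊆ (⋃ a : u, closedBall a.1.1 (5 * a.1.2)) ∧
      ∑' a : u, ENNReal.ofReal (10 * a.1.2) ^ t ≤ k * ν univ := by
    intro n
    obtain ⟨u, hut, hdisj, hcov⟩ := Vitali.exists_disjoint_subfamily_covering_enlargement_closedBall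
      {a : X × ℝ | a.1 ∈ F ∧ 0 < a.2 ∧ a.2 ≤ 1 / ((n : ℝ) + 1) ∧
        ENNReal.ofReal (10 * a.2) ^ t ≤ k * ν (closedBall a.1 a.2)}
      Prod.fst Prod.snd (1 / ((n : ℝ) + 1)) (fun a ha => ha.2.2.1) 5 (by norm_num)
    have hc : u.Countable := hdisj.countable_of_nonempty_interior fun a ha =>
      ⟨a.1, ball_subset_interior_closedBall (mem_ball_self (hut ha).2.1)⟩
    refine ⟨u, hc, fun a ha => (hut ha).2.2.1, fun x hx => ?_, ?_⟩
    · obtain ⟨r, h0, h1, h2⟩ := h x hx (1 / ((n : ℝ) + 1)) (by positivity)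
      obtain ⟨b, hb, hs⟩ := hcov (x, r) ⟨hx, h0, h1.le, h2⟩
      exact mem_iUnion.2 ⟨⟨b, hb⟩, hs (mem_closedBall_self h0.le)⟩
    · calc _ ≤ ∑' a : u, k * ν (closedBall a.1.1 a.1.2) := ENNReal.tsum_le_tsum fun a => (hut a.2).2.2.2
        _ = k * ν (⋃ a ∈ u, closedBall a.1 a.2) := by
          rw [ENNReal.tsum_mul_left, measure_biUnion hc hdisj fun b _ => isClosed_closedBall.measurableSet]
        _ ≤ k * ν univ := by gcongr; exact subset_univ _
  choose u hc hr hcov hsum using key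
  have := fun n => (hc n).to_subtype
  have hlim : Filter.Tendsto (fun n : ℕ => ENNReal.ofReal (10 * (1 / ((n : ℝ) + 1)))) Filter.atTop (nhds 0) := by
    rw [← ENNReal.ofReal_zero]
    refine ENNReal.tendsto_ofReal ?_
    simpa using tendsto_one_div_add_atTop_nhds_zero_nat.const_mul (10 : ℝ)
  refine (Measure.hausdorffMeasure_le_liminf_tsum t F _ hlim
    (fun n (a : u n) => closedBall a.1.1 (5 * a.1.2)) (.of_forall fun n a => (hdiam _ _).trans ?_)
    (.of_forall hcov)).trans ?_
  · gcongr; exact hr n a a.2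
  · refine Filter.liminf_le_of_le (by isBoundedDefault) fun b hb => ?_
    obtain ⟨n, hn⟩ := hb.exists
    exact hn.trans ((ENNReal.tsum_le_tsum fun a => ENNReal.rpow_le_rpow (hdiam _ _) ht.le).trans (hsum n))

/-- A set of positive finite Hausdorff measure has a bounded Borel subset of positive measure on which
the Hausdorff measure satisfies a Frostman condition. -/
theorem exists_frostman_subset {X : Type*} [MetricSpace X] [MeasurableSpace X] [BorelSpace X]
    [SecondCountableTopology X] (o : X) {t : ℝ} (ht : 0 < t) {A : Set X} (hAm : NullMeasurableSet A μH[t])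
    (hA0 : 0 < μH[t] A) (hAfin : μH[t] A < ∞) :
    ∃ B ⊆ A, MeasurableSet B ∧ 0 < μH[t] B ∧ (∃ R, B ⊆ closedBall o R) ∧
      ∃ C : ℝ, 0 ≤ C ∧ ∀ x r, 0 < r → (μH[t].restrict B).real (closedBall x r) ≤ C * r ^ t := by
  obtain ⟨A', hA'A, hA'm, hA'e⟩ := hAm.exists_measurable_subset_ae_eq
  rw [← measure_congr hA'e] at hA0 hAfin
  set ν := μH[t].restrict A' with hν
  have hνf : IsFiniteMeasure ν := ⟨by rw [hν, Measure.restrict_apply_univ]; exact hAfin⟩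
  have hνu : ν univ = μH[t] A' := by rw [hν, Measure.restrict_apply_univ]
  set G : ℕ → Set X := fun n => {x | dist x o ≤ n ∧ ∀ r, 0 < r → r < 1 / ((n : ℝ) + 1) →
    (1 / 2) * ν (closedBall x r) ≤ ENNReal.ofReal (10 * r) ^ t} with hG
  have hex : ∃ n, 0 < μH[t] (A' ∩ closure (G n)) := by
    by_contra! hcon
    have hF := hausdorffMeasure_le_of_dense ν ht (1 / 2) (F := A' \ ⋃ n, G n) fun x hx ε hε => by
      obtain ⟨n, hn⟩ := exists_nat_gt (max (1 / ε) (dist x o))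
      by_contra! hc
      refine hx.2 (mem_iUnion.2 ⟨n, ((le_max_right _ _).trans_lt hn).le, fun r h0 h1 => (hc r h0 ?_).le⟩)
      refine h1.trans ((one_div_lt (by positivity) hε).2 ?_)
      linarith [(le_max_left (1 / ε) (dist x o)).trans_lt hn]
    have h2 : μH[t] A' ≤ 0 + 1 / 2 * ν univ := by
      refine (measure_mono (t := (⋃ n, A' ∩ closure (G n)) ∪ (A' \ ⋃ n, G n)) fun x hx => ?_).trans
        ((measure_union_le _ _).trans (add_le_add (measure_iUnion_null fun n => le_antisymm (hcon n) zero_le).le hF))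
      by_cases hxG : x ∈ ⋃ n, G n
      · obtain ⟨n, hn⟩ := mem_iUnion.1 hxG
        exact Or.inl (mem_iUnion.2 ⟨n, hx, subset_closure hn⟩)
      · exact Or.inr ⟨hx, hxG⟩
    rw [hνu, zero_add, one_div, ← ENNReal.div_eq_inv_mul] at h2
    exact (ENNReal.half_lt_self hA0.ne' hAfin.ne).not_ge h2
  obtain ⟨n, hn⟩ := hex
  refine ⟨A' ∩ closure (G n), inter_subset_left.trans hA'A, hA'm.inter isClosed_closure.measurableSet, hn,
    ⟨n, inter_subset_right.trans (closure_minimal (fun x hx => hx.1) isClosed_closedBall)⟩,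
    2 * 30 ^ t + ν.real univ * (3 * ((n : ℝ) + 1)) ^ t, by positivity, fun x r hr => ?_⟩
  have hle : (μH[t].restrict (A' ∩ closure (G n))).real (closedBall x r) ≤ ν.real (closedBall x r) := by
    refine ENNReal.toReal_mono (measure_ne_top _ _) (Measure.restrict_mono inter_subset_left le_rfl _)
  have hA2 : 0 ≤ ν.real univ * (3 * ((n : ℝ) + 1)) ^ t := by positivity
  rw [add_mul]
  by_cases hr1 : 3 * r < 1 / ((n : ℝ) + 1)
  · refine le_trans ?_ (le_add_of_nonneg_right (by positivity))
    rcases (A' ∩ closure (G n) ∩ closedBall x r).eq_empty_or_nonempty with he | ⟨y, ⟨-, hy⟩, hyx⟩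
    · rw [measureReal_restrict_apply isClosed_closedBall.measurableSet, inter_comm, he, measureReal_empty]
      positivity
    · obtain ⟨z, hz, hzy⟩ := Metric.mem_closure_iff.1 hy r hr
      have hsub : closedBall x r ⊆ closedBall z (3 * r) := closedBall_subset_closedBall' (by
        have := dist_triangle x y z
        rw [mem_closedBall, dist_comm] at hyx
        linarith)
      refine hle.trans ((measureReal_mono hsub).trans ?_)
      have h1 := hz.2 (3 * r) (by positivity) hr1
      rw [ENNReal.ofReal_rpow_of_pos (by positivity)] at h1
      have h2 := ENNReal.toReal_mono ENNReal.ofReal_ne_top h1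
      rw [ENNReal.toReal_mul, ENNReal.toReal_ofReal (by positivity), show 10 * (3 * r) = 30 * r by ring,
        Real.mul_rpow (by norm_num) hr.le] at h2
      norm_num at h2
      change 1 / 2 * ν.real (closedBall z (3 * r)) ≤ _ at h2
      linarith
  · refine le_trans ?_ (le_add_of_nonneg_left (by positivity))
    refine hle.trans ((measureReal_mono (subset_univ _)).trans ?_)
    rw [mul_assoc, ← Real.mul_rpow (by positivity) hr.le]
    refine le_mul_of_one_le_right measureReal_nonneg (Real.one_le_rpow ?_ ht.le)
    push Not at hr1
    rw [div_le_iff₀ (by positivity)] at hr1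
    linarith

/-- Almost every fibre of a `1`-Lipschitz function on a set of finite `t`-dimensional measure has
dimension at most `t - 1`. -/
theorem ae_dimH_fibre_le {X : Type*} [MetricSpace X] [MeasurableSpace X] [BorelSpace X] {t : ℝ} (ht : 1 < t)
    {A : Set X} (hA : μH[t] A < ∞) {f : X → ℝ} (hf : LipschitzWith 1 f) :
    ∀ᵐ y ∂(volume : Measure ℝ), dimH ({x | f x = y} ∩ A) ≤ ENNReal.ofReal (t - 1) := by
  have key : ∀ n : ℕ, ∃ U : ℕ → Set X, A ⊆ (⋃ i, U i) ∧ (∀ i, ediam (U i) ≤ ((n : ℝ≥0∞) + 1)⁻¹) ∧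
      ∑' i, ediam (U i) ^ t < μH[t] A + 1 := by
    intro n
    have h1 := ENNReal.lt_add_right hA.ne one_ne_zero
    have h2 : (⨅ (U : ℕ → Set X) (_ : A ⊆ ⋃ i, U i) (_ : ∀ i, ediam (U i) ≤ ((n : ℝ≥0∞) + 1)⁻¹),
        ∑' i, ⨆ (_ : (U i).Nonempty), ediam (U i) ^ t) < μH[t] A + 1 := by
      refine lt_of_le_of_lt ?_ h1
      rw [Measure.hausdorffMeasure_apply t A]
      exact le_iSup₂_of_le ((n : ℝ≥0∞) + 1)⁻¹ (ENNReal.inv_pos.2 (by finiteness)) le_rfl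
    simp only [iInf_lt_iff] at h2
    obtain ⟨U, h3, h4, h5⟩ := h2
    refine ⟨U, h3, h4, lt_of_le_of_lt (ENNReal.tsum_le_tsum fun i => ?_) h5⟩
    rcases (U i).eq_empty_or_nonempty with he | he
    · simp [he, ENNReal.zero_rpow_of_pos (zero_lt_one.trans ht)]
    · exact le_iSup (fun _ : (U i).Nonempty => ediam (U i) ^ t) he
  choose U hcov hdiam hsum using key
  have ht1 : 0 < t - 1 := by linarith
  set g : ℕ → ℝ → ℝ≥0∞ := fun n y => ∑' i, (closure (f '' U n i)).indicator (fun _ => ediam (U n i) ^ (t - 1)) y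
    with hg
  have hgi : ∀ n i, Measurable ((closure (f '' U n i)).indicator fun _ => ediam (U n i) ^ (t - 1)) :=
    fun n i => measurable_const.indicator isClosed_closure.measurableSet
  have hgm : ∀ n, Measurable (g n) := fun n => Measurable.tsum (hgi n)
  have hinteg : ∫⁻ y, Filter.liminf (fun n => g n y) Filter.atTop ≠ ∞ := by
    refine ne_top_of_le_ne_top (ENNReal.add_ne_top.2 ⟨hA.ne, ENNReal.one_ne_top⟩) ((lintegral_liminf_le hgm).trans
      (Filter.liminf_le_of_le (by isBoundedDefault) fun b hb => ?_))
    obtain ⟨n, hn⟩ := hb.exists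
    refine hn.trans (le_trans ?_ (hsum n).le)
    rw [lintegral_tsum fun i => (hgi n i).aemeasurable]
    refine ENNReal.tsum_le_tsum fun i => ?_
    rw [lintegral_indicator_const isClosed_closure.measurableSet]
    have h1 : volume (closure (f '' U n i)) ≤ ediam (U n i) := by
      refine (Real.volume_le_diam _).trans ?_
      rw [ediam_closure]
      simpa using hf.ediam_image_le (U n i)
    calc _ ≤ ediam (U n i) ^ (t - 1) * ediam (U n i) := by gcongr
      _ = ediam (U n i) ^ (t - 1) * ediam (U n i) ^ (1 : ℝ) := by rw [ENNReal.rpow_one]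
      _ = _ := by rw [← ENNReal.rpow_add_of_nonneg _ _ ht1.le zero_le_one]; ring_nf
  filter_upwards [ae_lt_top (Measurable.liminf hgm) hinteg] with y hy
  refine dimH_le_of_hausdorffMeasure_ne_top (ne_top_of_le_ne_top hy.ne ?_)
  rw [Real.coe_toNNReal _ ht1.le]
  classical
  refine (Measure.hausdorffMeasure_le_liminf_tsum (t - 1) _ (l := Filter.atTop) (fun n : ℕ => ((n : ℝ≥0∞) + 1)⁻¹) ?_
    (fun n i => if y ∈ closure (f '' U n i) then U n i else ∅) (.of_forall fun n i => ?_)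
    (.of_forall fun n x hx => ?_)).trans (le_of_eq ?_)
  · have := (Filter.tendsto_add_atTop_iff_nat 1).2 ENNReal.tendsto_inv_nat_nhds_zero
    simpa using this
  · split_ifs
    · exact hdiam n i
    · simp
  · obtain ⟨i, hi⟩ := mem_iUnion.1 (hcov n hx.2)
    refine mem_iUnion.2 ⟨i, ?_⟩
    rw [if_pos (subset_closure (hx.1 ▸ mem_image_of_mem f hi))]
    exact hi
  · congr 1
    ext n
    refine tsum_congr fun i => ?_
    by_cases h : y ∈ closure (f '' U n i)
    · rw [if_pos h, indicator_of_mem h]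
    · rw [if_neg h, indicator_of_notMem h, ediam_empty, ENNReal.zero_rpow_of_pos ht1]

theorem exists_mem_uIcc_sub_eq {f f' : ℝ → ℝ} {x y : ℝ} (hf : ∀ z ∈ uIcc x y, HasDerivAt f (f' z) z) :
    ∃ ξ ∈ uIcc x y, f x - f y = f' ξ * (x - y) := by
  rcases lt_trichotomy x y with h | rfl | h
  · rw [uIcc_of_le h.le] at hf ⊢
    obtain ⟨ξ, hξ, he⟩ := exists_hasDerivAt_eq_slope f f' h (fun z hz => (hf z hz).continuousAt.continuousWithinAt)
      fun z hz => hf z (Ioo_subset_Icc_self hz)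
    refine ⟨ξ, Ioo_subset_Icc_self hξ, ?_⟩
    rw [he]; field_simp [sub_ne_zero.2 h.ne']; ring
  · exact ⟨x, left_mem_uIcc, by simp⟩
  · rw [uIcc_of_ge h.le] at hf ⊢
    obtain ⟨ξ, hξ, he⟩ := exists_hasDerivAt_eq_slope f f' h (fun z hz => (hf z hz).continuousAt.continuousWithinAt)
      fun z hz => hf z (Ioo_subset_Icc_self hz)
    refine ⟨ξ, Ioo_subset_Icc_self hξ, ?_⟩
    rw [he]; field_simp [sub_ne_zero.2 h.ne']

theorem nonneg_of_deriv_deriv_nonneg {f f' f'' : ℝ → ℝ} {x y : ℝ} (hf : ∀ z ∈ uIcc x y, HasDerivAt f (f' z) z)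
    (hf' : ∀ z ∈ uIcc x y, HasDerivAt f' (f'' z) z) (h : ∀ z ∈ uIcc x y, 0 ≤ f'' z) (h0 : f y = 0) (h1 : f' y = 0) :
    0 ≤ f x := by
  obtain ⟨ξ, hξ, e1⟩ := exists_mem_uIcc_sub_eq hf
  have hsub : uIcc ξ y ⊆ uIcc x y := uIcc_subset_uIcc hξ right_mem_uIcc
  obtain ⟨η, hη, e2⟩ := exists_mem_uIcc_sub_eq fun z hz => hf' z (hsub hz)
  rw [h0, sub_zero] at e1
  rw [h1, sub_zero] at e2
  rw [e1, e2, mul_assoc]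
  refine mul_nonneg (h η (hsub hη)) ?_
  rcases le_total x y with hxy | hxy
  · rw [uIcc_of_le hxy] at hξ
    exact mul_nonneg_of_nonpos_of_nonpos (by linarith [hξ.2]) (by linarith)
  · rw [uIcc_of_ge hxy] at hξ
    exact mul_nonneg (by linarith [hξ.1]) (by linarith)

/-- A planar curve `(u, v)` tangent to the first axis at `θ₀` with non-zero curvature is locally the
graph of a convex function. -/
theorem exists_convx {u u1 u2 v v1 v2 : ℝ → ℝ} {θ₀ : ℝ}
    (hd : ∀ᶠ θ in nhds θ₀, (HasDerivAt u (u1 θ) θ ∧ HasDerivAt u1 (u2 θ) θ) ∧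
      HasDerivAt v (v1 θ) θ ∧ HasDerivAt v1 (v2 θ) θ)
    (hu2 : ContinuousAt u2 θ₀) (hv2 : ContinuousAt v2 θ₀) (hu : u θ₀ = 0) (hv : v θ₀ = 0) (hu1 : u1 θ₀ = 1)
    (hv1 : v1 θ₀ = 0) (hv2' : v2 θ₀ = 1) :
    ∃ δ > 0, ∃ φ ψ : ℝ → ℝ, Convx 16 φ ψ ((fun θ => u θ + 1 / 2) '' ball θ₀ δ) ∧
      (∀ θ ∈ ball θ₀ δ, φ (u θ + 1 / 2) = v θ) ∧
      ∀ θ ∈ ball θ₀ δ, ∀ θ₁ ∈ ball θ₀ δ, |θ - θ₁| ≤ 2 * |u θ - u θ₁| := by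
  obtain ⟨⟨h1, h2⟩, h3, h4⟩ := hd.self_of_nhds
  set M := |u2 θ₀| + 1 with hM
  have hM0 : 1 ≤ M := by rw [hM]; linarith [abs_nonneg (u2 θ₀)]
  have e1 : ∀ᶠ θ in nhds θ₀, |u θ| < 1 / 2 := h1.continuousAt.abs.eventually_lt_const (by simp [hu])
  have e2 : ∀ᶠ θ in nhds θ₀, |v θ| < 1 := h3.continuousAt.abs.eventually_lt_const (by simp [hv])
  have e3 : ∀ᶠ θ in nhds θ₀, 1 / 2 < u1 θ := h2.continuousAt.eventually_const_lt (by rw [hu1]; norm_num)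
  have e4 : ∀ᶠ θ in nhds θ₀, u1 θ < 2 := h2.continuousAt.eventually_lt_const (by rw [hu1]; norm_num)
  have e5 : ∀ᶠ θ in nhds θ₀, |v1 θ| < 1 / (8 * M) :=
    h4.continuousAt.abs.eventually_lt_const (by dsimp only; rw [hv1, abs_zero]; positivity)
  have e6 : ∀ᶠ θ in nhds θ₀, |u2 θ| < M := hu2.abs.eventually_lt_const (by linarith)
  have e7 : ∀ᶠ θ in nhds θ₀, 3 / 4 < v2 θ := hv2.eventually_const_lt (by rw [hv2']; norm_num)
  have e8 : ∀ᶠ θ in nhds θ₀, v2 θ < 5 / 4 := hv2.eventually_lt_const (by rw [hv2']; norm_num)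
  obtain ⟨δ, hδ, H⟩ := Metric.eventually_nhds_iff_ball.1
    (hd.and (e1.and (e2.and (e3.and (e4.and (e5.and (e6.and (e7.and e8))))))))
  have hsub : ∀ {x y}, x ∈ ball θ₀ δ → y ∈ ball θ₀ δ → uIcc x y ⊆ ball θ₀ δ := fun hx hy => by
    rw [← segment_eq_uIcc]; exact (convex_ball θ₀ δ).segment_subset hx hy
  have hlip : ∀ θ ∈ ball θ₀ δ, ∀ θ₁ ∈ ball θ₀ δ, |θ - θ₁| ≤ 2 * |u θ - u θ₁| ∧ |u θ - u θ₁| ≤ 2 * |θ - θ₁| := by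
    intro θ hθ θ₁ hθ₁
    obtain ⟨ξ, hξ, he⟩ := exists_mem_uIcc_sub_eq fun z hz => (H z (hsub hθ hθ₁ hz)).1.1.1
    obtain ⟨-, -, -, g1, g2, -⟩ := H ξ (hsub hθ hθ₁ hξ)
    rw [he, abs_mul, abs_of_pos (by linarith : 0 < u1 ξ)]
    constructor <;> nlinarith [abs_nonneg (θ - θ₁)]
  have hinj : InjOn (fun θ => u θ + 1 / 2) (ball θ₀ δ) := fun x hx y hy hxy => by
    have h : u x = u y := add_right_cancel hxy
    have := (hlip x hx y hy).1
    rw [h, sub_self, abs_zero, mul_zero] at this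
    exact sub_eq_zero.1 (abs_nonpos_iff.1 this)
  set g := Function.invFunOn (fun θ => u θ + 1 / 2) (ball θ₀ δ) with hg
  have hgl : ∀ θ ∈ ball θ₀ δ, g (u θ + 1 / 2) = θ := fun θ hθ => hinj.leftInvOn_invFunOn hθ
  have hψ : ∀ θ ∈ ball θ₀ δ, |v1 θ / u1 θ| ≤ 1 / (4 * M) := fun θ hθ => by
    obtain ⟨-, -, -, g1, g2, g3, -⟩ := H θ hθ
    rw [abs_div, abs_of_pos (by linarith : 0 < u1 θ), div_le_iff₀ (by linarith)]
    have : 1 / (8 * M) = 1 / (4 * M) * (1 / 2) := by field_simp; norm_num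
    have h0 : 0 < 1 / (4 * M) := by positivity
    nlinarith
  have hW2 : ∀ θ ∈ ball θ₀ δ, ∀ θ₁ ∈ ball θ₀ δ,
      1 / 2 ≤ v2 θ - v1 θ₁ / u1 θ₁ * u2 θ ∧ v2 θ - v1 θ₁ / u1 θ₁ * u2 θ ≤ 2 := fun θ hθ θ₁ hθ₁ => by
    obtain ⟨-, -, -, -, -, -, g3, g4, g5⟩ := H θ hθ
    have : |v1 θ₁ / u1 θ₁ * u2 θ| ≤ 1 / 4 := by
      rw [abs_mul]
      calc _ ≤ 1 / (4 * M) * M := by gcongr; exact hψ θ₁ hθ₁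
        _ = 1 / 4 := by field_simp
    rw [abs_le] at this
    constructor <;> linarith
  have hW : ∀ θ ∈ ball θ₀ δ, ∀ θ₁ ∈ ball θ₀ δ,
      1 / 4 * (θ - θ₁) ^ 2 ≤ v θ - v θ₁ - v1 θ₁ / u1 θ₁ * (u θ - u θ₁) ∧
      v θ - v θ₁ - v1 θ₁ / u1 θ₁ * (u θ - u θ₁) ≤ (θ - θ₁) ^ 2 := by
    intro θ hθ θ₁ hθ₁
    have hs := hsub hθ hθ₁
    set p := v1 θ₁ / u1 θ₁ with hp
    have hp0 : v1 θ₁ - p * u1 θ₁ = 0 := by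
      rw [hp, div_mul_cancel₀ _ (by linarith [(H θ₁ hθ₁).2.2.2.1] : u1 θ₁ ≠ 0), sub_self]
    have hq : ∀ z, HasDerivAt (fun z => (z - θ₁) ^ 2) (2 * (z - θ₁)) z := fun z => by
      have := ((hasDerivAt_id z).sub_const θ₁).pow 2
      simp only [id, Nat.cast_ofNat, Nat.add_one_sub_one, pow_one, mul_one] at this
      exact this
    have hq' : ∀ z, HasDerivAt (fun z => 2 * (z - θ₁)) 2 z := fun z => by
      simpa using ((hasDerivAt_id z).sub_const θ₁).const_mul 2
    have hV : ∀ z ∈ uIcc θ θ₁, HasDerivAt (fun z => v z - v θ₁ - p * (u z - u θ₁)) (v1 z - p * u1 z) z :=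
      fun z hz => ((H z (hs hz)).1.2.1.sub_const _).sub (((H z (hs hz)).1.1.1.sub_const _).const_mul p)
    have hV' : ∀ z ∈ uIcc θ θ₁, HasDerivAt (fun z => v1 z - p * u1 z) (v2 z - p * u2 z) z :=
      fun z hz => (H z (hs hz)).1.2.2.sub ((H z (hs hz)).1.1.2.const_mul p)
    constructor
    · have := nonneg_of_deriv_deriv_nonneg (fun z hz => (hV z hz).sub ((hq z).const_mul (1 / 4)))
        (fun z hz => (hV' z hz).sub ((hq' z).const_mul (1 / 4)))
        (fun z hz => by linarith [(hW2 z (hs hz) θ₁ hθ₁).1]) (by simp) (by simp [hp0])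
      simp only [Pi.sub_apply] at this
      linarith
    · have := nonneg_of_deriv_deriv_nonneg (fun z hz => (hq z).sub (hV z hz))
        (fun z hz => (hq' z).sub (hV' z hz))
        (fun z hz => by linarith [(hW2 z (hs hz) θ₁ hθ₁).2]) (by simp) (by simp [hp0])
      simp only [Pi.sub_apply] at this
      linarith
  refine ⟨δ, hδ, v ∘ g, (fun θ => v1 θ / u1 θ) ∘ g, ⟨by norm_num, ?_, ?_, ?_, ?_, ?_⟩,
    fun θ hθ => by rw [Function.comp_apply, hgl θ hθ], fun θ hθ θ₁ hθ₁ => (hlip θ hθ θ₁ hθ₁).1⟩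
  · rintro _ ⟨θ, hθ, rfl⟩ _ ⟨θ₁, hθ₁, rfl⟩
    simp only [Function.comp_apply, hgl θ hθ, hgl θ₁ hθ₁, add_sub_add_right_eq_sub]
    have h1 := (hW θ hθ θ₁ hθ₁).1
    have h2 := sq_le_sq' (by linarith [abs_nonneg (u θ - u θ₁), abs_nonneg (θ - θ₁)]) (hlip θ hθ θ₁ hθ₁).2
    rw [mul_pow, sq_abs, sq_abs] at h2
    linarith
  · rintro _ ⟨θ, hθ, rfl⟩ _ ⟨θ₁, hθ₁, rfl⟩
    simp only [Function.comp_apply, hgl θ hθ, hgl θ₁ hθ₁, add_sub_add_right_eq_sub]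
    have h1 := (hW θ hθ θ₁ hθ₁).2
    have h2 := sq_le_sq' (by linarith [abs_nonneg (u θ - u θ₁), abs_nonneg (θ - θ₁)]) (hlip θ hθ θ₁ hθ₁).1
    rw [mul_pow, sq_abs, sq_abs] at h2
    nlinarith [sq_nonneg (u θ - u θ₁)]
  · rintro _ ⟨θ, hθ, rfl⟩
    simp only [Function.comp_apply, hgl θ hθ]
    linarith [(H θ hθ).2.2.1]
  · rintro _ ⟨θ, hθ, rfl⟩
    simp only [Function.comp_apply, hgl θ hθ]
    refine (hψ θ hθ).trans ((div_le_one (by positivity)).2 (by linarith) |>.trans (by norm_num))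
  · rintro _ ⟨θ, hθ, rfl⟩
    have := abs_lt.1 (H θ hθ).2.1
    constructor <;> dsimp only <;> linarith

/-- The first two derivatives of a quotient. -/
theorem hasDerivAt_div_div {f f1 f2 g g1 g2 : ℝ → ℝ} {θ : ℝ} (hf : HasDerivAt f (f1 θ) θ)
    (hf1 : HasDerivAt f1 (f2 θ) θ) (hg : HasDerivAt g (g1 θ) θ) (hg1 : HasDerivAt g1 (g2 θ) θ) (h : g θ ≠ 0) :
    HasDerivAt (fun θ => f θ / g θ) ((f1 θ * g θ - f θ * g1 θ) / g θ ^ 2) θ ∧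
    HasDerivAt (fun θ => (f1 θ * g θ - f θ * g1 θ) / g θ ^ 2)
      (((f2 θ * g θ - f θ * g2 θ) * g θ - 2 * (f1 θ * g θ - f θ * g1 θ) * g1 θ) / g θ ^ 3) θ := by
  refine ⟨hf.div hg h, ?_⟩
  refine (((hf1.mul hg).sub (hf.mul hg1)).div (hg.pow 2) (pow_ne_zero 2 h)).congr_deriv ?_
  simp only [Pi.mul_apply, Pi.sub_apply, Pi.pow_apply]
  field_simp
  ring

/-- In suitable linear coordinates the directions of a non-degenerate curve are locally those of the
graph of a convex function. -/
theorem exists_frame {γ : ℝ → E3} (hγ : ContDiff ℝ 2 γ) {θ₀ : ℝ}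
    (hli : LinearIndependent ℝ ![γ θ₀, deriv γ θ₀, deriv (deriv γ) θ₀]) :
    ∃ T : E3 →ₗ[ℝ] Pt, T.ker = ⊥ ∧ ∃ δ > 0, ∃ φ ψ U α : ℝ → ℝ, Convx 16 φ ψ (U '' ball θ₀ δ) ∧
      (∀ θ ∈ ball θ₀ δ, ∀ θ₁ ∈ ball θ₀ δ, |θ - θ₁| ≤ 2 * |U θ - U θ₁|) ∧
      ∀ θ ∈ ball θ₀ δ, α θ ≠ 0 ∧ ∀ x, ⟪x, γ θ⟫ = α θ * dirProj (U θ) (φ (U θ)) (T x) := by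
  have hγ1 : ContDiff ℝ 1 (deriv γ) := ((contDiff_succ_iff_deriv (n := 1)).1 hγ).2.2
  have hγ2 : Continuous (deriv (deriv γ)) := (contDiff_one_iff_deriv.1 hγ1).2
  have d0 : ∀ θ, HasDerivAt γ (deriv γ θ) θ := fun θ => (hγ.differentiable (by norm_num) θ).hasDerivAt
  have d1 : ∀ θ, HasDerivAt (deriv γ) (deriv (deriv γ) θ) θ := fun θ => (hγ1.differentiable (by norm_num) θ).hasDerivAt
  set e := basisOfLinearIndependentOfCardEqFinrank hli (by simp) with he
  have heb : ∀ i, e i = ![γ θ₀, deriv γ θ₀, deriv (deriv γ) θ₀] i := fun i => by simp [he]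
  set L : Fin 3 → E3 →L[ℝ] ℝ := fun i => LinearMap.toContinuousLinearMap (e.coord i) with hL
  have hLe : ∀ i j, L i (e j) = if j = i then 1 else 0 := fun i j => by
    simp [hL, Finsupp.single_apply]
  have hL0 : ∀ i, L i (γ θ₀) = if 0 = i then 1 else 0 := fun i => by rw [← hLe i 0, heb]; rfl
  have hL1 : ∀ i, L i (deriv γ θ₀) = if 1 = i then 1 else 0 := fun i => by rw [← hLe i 1, heb]; rfl
  have hL2 : ∀ i, L i (deriv (deriv γ) θ₀) = if 2 = i then 1 else 0 := fun i => by rw [← hLe i 2, heb]; rfl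
  obtain ⟨p, p1, p2, hp, D0, D1, c2, v0, v1, v2⟩ : ∃ p p1 p2 : Fin 3 → ℝ → ℝ, (∀ i θ, p i θ = L i (γ θ)) ∧
      (∀ i θ, HasDerivAt (p i) (p1 i θ) θ) ∧ (∀ i θ, HasDerivAt (p1 i) (p2 i θ) θ) ∧ (∀ i, Continuous (p2 i)) ∧
      (∀ i, p i θ₀ = if 0 = i then 1 else 0) ∧ (∀ i, p1 i θ₀ = if 1 = i then 1 else 0) ∧
      (∀ i, p2 i θ₀ = if 2 = i then 1 else 0) :=
    ⟨fun i θ => L i (γ θ), fun i θ => L i (deriv γ θ), fun i θ => L i (deriv (deriv γ) θ), fun _ _ => rfl,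
      fun i θ => (L i).hasFDerivAt.comp_hasDerivAt θ (d0 θ), fun i θ => (L i).hasFDerivAt.comp_hasDerivAt θ (d1 θ),
      fun i => (L i).continuous.comp hγ2, hL0, hL1, hL2⟩
  have c0 : ∀ i, Continuous (p i) := fun i => continuous_iff_continuousAt.2 fun θ => (D0 i θ).continuousAt
  have c1 : ∀ i, Continuous (p1 i) := fun i => continuous_iff_continuousAt.2 fun θ => (D1 i θ).continuousAt
  have hα : ∀ᶠ θ in nhds θ₀, p 0 θ ≠ 0 := (c0 0).continuousAt.eventually_ne (by simp [v0])
  set q : Fin 3 → ℝ → ℝ := fun i θ => p i θ / p 0 θ with hq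
  set q1 : Fin 3 → ℝ → ℝ := fun i θ => (p1 i θ * p 0 θ - p i θ * p1 0 θ) / p 0 θ ^ 2 with hq1
  set q2 : Fin 3 → ℝ → ℝ := fun i θ => ((p2 i θ * p 0 θ - p i θ * p2 0 θ) * p 0 θ -
    2 * (p1 i θ * p 0 θ - p i θ * p1 0 θ) * p1 0 θ) / p 0 θ ^ 3 with hq2
  have hqc : ∀ i, ContinuousAt (q2 i) θ₀ := fun i => ContinuousAt.div (by fun_prop) (by fun_prop) (by simp [v0])
  have hqd : ∀ i θ, p 0 θ ≠ 0 → HasDerivAt (q i) (q1 i θ) θ ∧ HasDerivAt (q1 i) (q2 i θ) θ := fun i θ h =>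
    hasDerivAt_div_div (D0 i θ) (D1 i θ) (D0 0 θ) (D1 0 θ) h
  obtain ⟨δ, hδ, φ, ψ, hC, hφ, hlip⟩ := exists_convx (hα.mono fun θ hθ => ⟨hqd 1 θ hθ, hqd 2 θ hθ⟩)
    (hqc 1) (hqc 2) (by simp [hq, v0]) (by simp [hq, v0]) (by simp [hq1, v0, v1]) (by simp [hq1, v0, v1])
    (by simp [hq2, v0, v1, v2])
  obtain ⟨δ', hδ', hα'⟩ := Metric.eventually_nhds_iff_ball.1 hα
  set T : E3 →ₗ[ℝ] Pt := ((innerₗ E3 (e 0)) - (1 / 2 : ℝ) • innerₗ E3 (e 1)).prod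
    ((innerₗ E3 (e 1)).prod (innerₗ E3 (e 2))) with hT
  have hTx : ∀ x, T x = (⟪e 0, x⟫ - 1 / 2 * ⟪e 1, x⟫, ⟪e 1, x⟫, ⟪e 2, x⟫) := fun x => by simp [hT]
  have hs := ball_subset_ball (x := θ₀) (min_le_left δ δ')
  refine ⟨T, LinearMap.ker_eq_bot'.2 fun x hx => ?_, min δ δ', lt_min hδ hδ', φ, ψ,
    fun θ => q 1 θ + 1 / 2, p 0, ?_, fun θ hθ θ₁ hθ₁ => ?_, fun θ hθ => ?_⟩
  · rw [hTx, Prod.mk_eq_zero, Prod.mk_eq_zero] at hx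
    obtain ⟨h0, h1, h2⟩ := hx
    rw [h1, mul_zero, sub_zero] at h0
    refine InnerProductSpace.ext_inner_left_basis e fun i => ?_
    rw [inner_zero_right]
    fin_cases i <;> assumption
  · exact ⟨hC.one_le, fun u hu v hv => hC.lower u (image_mono hs hu) v (image_mono hs hv),
      fun u hu v hv => hC.upper u (image_mono hs hu) v (image_mono hs hv),
      fun u hu => hC.phi_le u (image_mono hs hu), fun u hu => hC.psi_le u (image_mono hs hu),
      fun u hu => hC.mem u (image_mono hs hu)⟩
  · dsimp only
    rw [add_sub_add_right_eq_sub]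
    exact hlip θ (hs hθ) θ₁ (hs hθ₁)
  · have h0 := hα' θ (ball_subset_ball (min_le_right δ δ') hθ)
    refine ⟨h0, fun x => ?_⟩
    dsimp only
    rw [hφ θ (hs hθ), hTx, dirProj]
    have hsum : γ θ = p 0 θ • e 0 + p 1 θ • e 1 + p 2 θ • e 2 := by
      have := e.sum_repr (γ θ)
      rw [Fin.sum_univ_three] at this
      simp only [hp]
      exact this.symm
    conv_lhs => rw [hsum]
    simp only [inner_add_right, inner_smul_right, hq, fun i => real_inner_comm x (e i)]
    field_simp
    ring

theorem dirProj_smul (u v c : ℝ) (x : Pt) : dirProj u v (c • x) = c * dirProj u v x := by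
  change c * x.1 + u * (c * x.2.1) + v * (c * x.2.2) = c * (x.1 + u * x.2.1 + v * x.2.2)
  ring

/-- The image of a bounded Frostman measure under a bilipschitz map into the box is admissible. -/
theorem BoxMeas.of_map {ν : Measure E3} [IsFiniteMeasure ν] {t C : ℝ} (hC : 0 ≤ C)
    (hfr : ∀ x r, 0 < r → ν.real (closedBall x r) ≤ C * r ^ t) {S : E3 → Pt} (hS : Measurable S) {k : NNReal}
    (hk : 0 < k) (hanti : AntilipschitzWith k S) (hemb : MeasurableEmbedding S) (hbox : ∀ᵐ x ∂ν, ‖S x‖ ≤ 1 / 2) :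
    BoxMeas (ν.map S) t (C * (k * 2) ^ t) := by
  refine ⟨inferInstance, by positivity, hemb.ae_map_iff.2 (hbox.mono fun x hx => ?_), fun y ρ hρ => ?_⟩
  · exact ⟨(norm_fst_le _).trans hx, (norm_fst_le _).trans ((norm_snd_le _).trans hx),
      (norm_snd_le _).trans ((norm_snd_le _).trans hx)⟩
  · rw [map_measureReal_apply hS isClosed_closedBall.measurableSet, mul_assoc, ← Real.mul_rpow (by positivity) hρ.le]
    rcases (S ⁻¹' closedBall y ρ).eq_empty_or_nonempty with he | ⟨x, hx⟩
    · rw [he, measureReal_empty]; positivity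
    · refine (measureReal_mono fun z hz => ?_).trans (hfr x _ (by positivity))
      refine (hanti.le_mul_dist z x).trans ?_
      rw [mul_assoc]
      gcongr
      have := dist_triangle_right (S z) (S x) y
      rw [mem_preimage, mem_closedBall] at hx hz
      linarith

/-- The set of bad directions near `θ₀`. -/
theorem exists_dimH_bad_le {γ : ℝ → E3} (hγ : ContDiff ℝ 2 γ) {θ₀ : ℝ}
    (hli : LinearIndependent ℝ ![γ θ₀, deriv γ θ₀, deriv (deriv γ) θ₀]) {I : Set ℝ} (hI : ∀ θ ∈ I, ‖γ θ‖ = 1)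
    {t : ℝ} (ht : 1 < t) {A : Set E3} (hAm : NullMeasurableSet A μH[t]) (hA0 : 0 < μH[t] A) (hAfin : μH[t] A < ∞) :
    ∃ δ > 0, dimH {θ ∈ I ∩ ball θ₀ δ | volume {c : ℝ | dimH ({x | ⟪x, γ θ⟫ = c} ∩ A) = ENNReal.ofReal (t - 1)} = 0} ≤
      ENNReal.ofReal ((3 - t) / 2) := by
  obtain ⟨B, hBA, hBm, hB0, ⟨R, hR⟩, C, hC, hfr⟩ := exists_frostman_subset 0 (zero_lt_one.trans ht) hAm hA0 hAfin
  obtain ⟨T, hT, δ, hδ, φ, ψ, U, α, hcx, hlip, hin⟩ := exists_frame hγ hli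
  set T' := LinearMap.toContinuousLinearMap T with hT'
  set c : ℝ := 1 / (2 * (‖T'‖ * |R| + 1)) with hc
  have hc0 : 0 < c := by positivity
  set S : E3 →ₗ[ℝ] Pt := c • T with hSdef
  obtain ⟨k, hk, hanti⟩ := S.exists_antilipschitzWith (by rw [hSdef, LinearMap.ker_smul _ _ hc0.ne', hT])
  have hSlip := (LinearMap.toContinuousLinearMap S).lipschitz
  have hemb := (hanti.isClosedEmbedding hSlip.uniformContinuous).measurableEmbedding
  set ν := μH[t].restrict B with hν
  have : IsFiniteMeasure ν := ⟨by rw [hν, Measure.restrict_apply_univ]; exact (measure_mono hBA).trans_lt hAfin⟩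
  have hνB : ∀ᵐ x ∂ν, x ∈ B := ae_restrict_mem hBm
  have hμ := BoxMeas.of_map hC hfr hemb.measurable hk hanti hemb (hνB.mono fun x hx => by
    have h1 : ‖x‖ ≤ |R| := (mem_closedBall_zero_iff.1 (hR hx)).trans (le_abs_self R)
    have h2 : ‖T x‖ ≤ ‖T'‖ * |R| := (T'.le_opNorm x).trans (by gcongr)
    rw [hSdef, LinearMap.smul_apply, norm_smul, Real.norm_of_nonneg hc0.le, hc, one_div_mul_eq_div,
      div_le_iff₀ (by positivity)]
    linarith)
  have hex := dimH_exceptional_le ht hμ hcx (hemb.measurableSet_image.2 hBm)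
    (hemb.ae_map_iff.2 (hνB.mono fun x hx => mem_image_of_mem S hx))
  refine ⟨δ, hδ, ?_⟩
  set bad := {θ ∈ I ∩ ball θ₀ δ | volume {c : ℝ | dimH ({x | ⟪x, γ θ⟫ = c} ∩ A) = ENNReal.ofReal (t - 1)} = 0} with hbad
  have hUb : dimH (U '' bad) ≤ ENNReal.ofReal ((3 - t) / 2) := by
    refine (dimH_mono ?_).trans hex
    rintro _ ⟨θ, ⟨⟨hθI, hθ⟩, hvol⟩, rfl⟩
    refine ⟨mem_image_of_mem U hθ, fun ⟨hac, hlow⟩ => ?_⟩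
    obtain ⟨hα, hinner⟩ := hin θ hθ
    have hinner' : ∀ x, ⟪x, γ θ⟫ = α θ / c * dirProj (U θ) (φ (U θ)) (S x) := fun x => by
      rw [hSdef, LinearMap.smul_apply, dirProj_smul, hinner x]; field_simp
    have hup := ae_dimH_fibre_le ht hAfin (f := fun x => ⟪x, γ θ⟫) (LipschitzWith.of_dist_le_mul fun x y => by
      rw [Real.dist_eq, ← inner_sub_left, dist_eq_norm, NNReal.coe_one, one_mul]
      simpa [hI θ hθI] using abs_real_inner_le_norm (x - y) (γ θ))
    have hno : ∀ᵐ z ∂(volume : Measure ℝ), ¬ ENNReal.ofReal (t - 1) ≤ dimH ({x | ⟪x, γ θ⟫ = z} ∩ A) := by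
      filter_upwards [hup, measure_eq_zero_iff_ae_notMem.1 hvol] with z h1 h2 h3
      exact h2 (le_antisymm h1 h3)
    have hno' : ∀ᵐ y ∂(volume : Measure ℝ),
        ¬ ENNReal.ofReal (t - 1) ≤ dimH ({x | ⟪x, γ θ⟫ = α θ / c * y} ∩ A) := by
      have h := Measure.addHaar_preimage_smul (volume : Measure ℝ) (div_ne_zero hα hc0.ne')
        {z | ¬¬ENNReal.ofReal (t - 1) ≤ dimH ({x | ⟪x, γ θ⟫ = z} ∩ A)}
      rw [ae_iff.1 hno, mul_zero] at h
      exact ae_iff.2 h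
    have hm0 : (ν.map S).map (dirProj (U θ) (φ (U θ))) ≠ 0 := by
      rw [Ne, Measure.map_eq_zero_iff (continuous_dirProj _ _).aemeasurable,
        Measure.map_eq_zero_iff hemb.measurable.aemeasurable, hν, Measure.restrict_eq_zero]
      exact hB0.ne'
    have := ae_neBot.2 hm0
    obtain ⟨y, h1, h2⟩ := (Filter.Eventually.and (hac.ae_le hno') hlow).exists
    refine h1 (h2.trans ((dimH_mono ?_).trans (hSlip.dimH_image_le _)))
    rintro _ ⟨⟨x, hx, rfl⟩, hxy⟩
    exact ⟨x, ⟨by rw [mem_ofPred_eq, hinner' x, ← hxy], hBA hx⟩, rfl⟩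
  have hinj : InjOn U (ball θ₀ δ) := fun x hx y hy h => by
    have := hlip x hx y hy
    rw [h, sub_self, abs_zero, mul_zero] at this
    exact sub_eq_zero.1 (abs_nonpos_iff.1 this)
  set g := Function.invFunOn U (ball θ₀ δ) with hg
  have hgl : ∀ θ ∈ ball θ₀ δ, g (U θ) = θ := fun θ hθ => hinj.leftInvOn_invFunOn hθ
  have hgLip : LipschitzOnWith 2 g (U '' bad) := by
    refine LipschitzOnWith.of_dist_le_mul ?_
    rintro _ ⟨x, hx, rfl⟩ _ ⟨y, hy, rfl⟩
    rw [hgl x hx.1.2, hgl y hy.1.2]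
    exact hlip x hx.1.2 y hy.1.2
  refine le_trans (dimH_mono fun θ hθ => ?_) (hgLip.dimH_image_le.trans hUb)
  exact ⟨U θ, mem_image_of_mem U hθ, hgl θ hθ.1.2⟩

/-!
STATEMENT 2 (Corollary 1.3): if `t > 1` and `A ⊆ ℝ³` is `H^t`-measurable with
`0 < H^t(A) < ∞`, then there is `E ⊆ I` with `dim E ≤ (3-t)/2` such that for
every `θ ∈ I \ E`, the set of `y` in the line spanned by `γ θ` whose fibre
`ρ_θ⁻¹(y) ∩ A` has Hausdorff dimension exactly `t - 1` has positive `H¹` measure.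
(`H^t`-measurability is rendered as null-measurability for the Hausdorff measure
`μH[t]`, i.e. Carathéodory measurability for a Borel regular measure.)
-/

theorem fibres_of_dimension_t_sub_one_outside_small_exceptional_set
    -- the compact interval `I = [a, b]`
    (a b : ℝ) (hab : a ≤ b)
    -- `γ : I → S²` is a `C²` curve with `det(γ, γ', γ'') ≠ 0` on `I`
    (γ : ℝ → E3) (hγC2 : ContDiff ℝ 2 γ)
    (hsphere : ∀ θ ∈ Icc a b, ‖γ θ‖ = 1)
    (hnondeg : ∀ θ ∈ Icc a b,
      LinearIndependent ℝ ![γ θ, deriv γ θ, deriv (deriv γ) θ])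
    (t : ℝ) (ht : 1 < t)
    (A : Set E3) (hAmeas : NullMeasurableSet A μH[t])
    (hA0 : 0 < μH[t] A) (hAfin : μH[t] A < ∞) :
    ∃ E : Set ℝ, E ⊆ Icc a b ∧ dimH E ≤ ENNReal.ofReal ((3 - t) / 2) ∧
      ∀ θ ∈ Icc a b \ E,
        0 < μH[1] {y : E3 | y ∈ (Submodule.span ℝ {γ θ} : Submodule ℝ E3) ∧
          dimH ({x : E3 | lineProj γ θ x = y} ∩ A) = ENNReal.ofReal (t - 1)} := by
  refine ⟨{θ ∈ Icc a b | volume {c : ℝ | dimH ({x | ⟪x, γ θ⟫ = c} ∩ A) = ENNReal.ofReal (t - 1)} = 0},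
    fun θ hθ => hθ.1, ?_, fun θ hθ => ?_⟩
  · by_contra! hlt
    obtain ⟨θ₀, hθ₀, h⟩ := exists_mem_nhdsWithin_lt_dimH_of_lt_dimH hlt
    obtain ⟨δ, hδ, hle⟩ := exists_dimH_bad_le hγC2 (hnondeg θ₀ hθ₀.1) hsphere ht hAmeas hA0 hAfin
    refine (h _ (inter_mem_nhdsWithin _ (ball_mem_nhds θ₀ hδ))).not_ge ((dimH_mono ?_).trans hle)
    exact fun θ hθ => ⟨⟨hθ.1.1, hθ.2⟩, hθ.1.2⟩
  · have hθ1 := hsphere θ hθ.1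
    have hpos : 0 < volume {c : ℝ | dimH ({x | ⟪x, γ θ⟫ = c} ∩ A) = ENNReal.ofReal (t - 1)} :=
      pos_iff_ne_zero.2 fun h0 => hθ.2 ⟨hθ.1, h0⟩
    have hiso : Isometry fun c : ℝ => c • γ θ := Isometry.of_dist_eq fun x y => by
      rw [dist_eq_norm, ← sub_smul, norm_smul, hθ1, mul_one, dist_eq_norm]
    rw [← hausdorffMeasure_real, ← hiso.hausdorffMeasure_image (Or.inl zero_le_one)] at hpos
    refine hpos.trans_le (measure_mono ?_)
    rintro _ ⟨c, hc, rfl⟩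
    refine ⟨Submodule.mem_span_singleton.2 ⟨c, rfl⟩, ?_⟩
    have hset : {x : E3 | lineProj γ θ x = c • γ θ} = {x | ⟪x, γ θ⟫ = c} := by
      ext x
      exact (smul_left_injective ℝ (norm_ne_zero_iff.1 (hθ1 ▸ one_ne_zero))).eq_iff
    rw [hset]
    exact hc
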